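/- (Polynomial threshold window, Theorem 2.) For every axis-parallel rectangle R = [a,b] × [c,d] ⊆ S with a < b and c < d, there exists γ > 0 such that lim_{n→∞} P_{n, 1/2 − n^{−γ}}[f_R = 1] = 0 and lim_{n→∞} P_{n, 1/2 + n^{−γ}}[f_R = 1] = 1. -/

import Mathlib

open MeasureTheory ProbabilityTheory Set Filter
open scoped ENNReal

noncomputable section

abbrev Plane : Type := EuclideanSpace ℝ (Fin 2)
abbrev Pt : Type := Plane × Bool
abbrev Config : Type := Set Pt

/-- The unit square `S = [0,1]²`. -/
def Sq : Set Plane := {x | x 0 ∈ Icc (0:ℝ) 1 ∧ x 1 ∈ Icc (0:ℝ) 1}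

/-- The law of the mark of a point: `1` (blue) with probability `p`, `0` (red) otherwise. -/
def markLaw (p : ℝ) : Measure Bool :=
  p.toNNReal • Measure.dirac true + (1 - p).toNNReal • Measure.dirac false

/-- The law of a single point of the process: uniform location in `S`, independent mark. -/
def ptLaw (p : ℝ) : Measure Pt := (volume.restrict Sq).prod (markLaw p)

/-- Poisson probability mass function with parameter `r`. -/
def pois (r : ℝ) (N : ℕ) : ℝ := Real.exp (-r) * r ^ N / N.factorial

/-- The configuration determined by a finite list of marked points. -/
def cfgOf {N : ℕ} (x : Fin N → Pt) : Config := Set.range x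

/-- Expectation of `g` under the Poisson Voronoi law `P_{n,p}`. -/
def PE (n p : ℝ) (g : Config → ℝ) : ℝ :=
  ∑' N : ℕ, pois n N * ∫ x : Fin N → Pt, g (cfgOf x) ∂(Measure.pi fun _ => ptLaw p)

/-- `y ∈ S` is blue if it belongs to the Voronoi cell of a blue point of `η`. -/
def isBlue (η : Config) (y : Plane) : Prop :=
  ∃ q ∈ η, q.2 = true ∧ ∀ r ∈ η, dist y q.1 ≤ dist y r.1

/-- The rectangle `[a,b] × [c,d]`. -/
def rect (a b c d : ℝ) : Set Plane := {x | x 0 ∈ Icc a b ∧ x 1 ∈ Icc c d}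

/-- The horizontal blue crossing event `H_R` for `R = [a,b] × [c,d]`. -/
def Crossing (a b c d : ℝ) (η : Config) : Prop :=
  ∃ K : Set Plane, K ⊆ {y | y ∈ rect a b c d ∧ isBlue η y} ∧ IsConnected K ∧
    (∃ y ∈ K, y 0 = a) ∧ (∃ y ∈ K, y 0 = b)

open Classical in
/-- The indicator `f_R` of the crossing event. -/
def fR (a b c d : ℝ) (η : Config) : ℝ := if Crossing a b c d η then 1 else 0

/-- Uniform measure on `[0,1]`. -/
def unif01 : Measure ℝ := volume.restrict (Icc (0:ℝ) 1)

/-- Joint expectation of `g (η, η(ε))` where `η ~ P_{n,p}` and `η(ε)` is the `ε`-perturbation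
of `η`: each point of `η` is deleted independently with probability `ε` and an independent
process of law `P_{εn,p}` is added. -/
def PE2pert (n p ε : ℝ) (g : Config → Config → ℝ) : ℝ :=
  ∑' N : ℕ, ∑' M : ℕ, pois n N * pois (ε * n) M *
    ∫ x : Fin N → Pt, ∫ y : Fin M → Pt, ∫ u : Fin N → ℝ,
      g (cfgOf x) ({q | ∃ i, x i = q ∧ ε ≤ u i} ∪ cfgOf y)
      ∂(Measure.pi fun _ => unif01) ∂(Measure.pi fun _ => ptLaw p)
      ∂(Measure.pi fun _ => ptLaw p)

set_option linter.unusedSectionVars false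
set_option linter.unusedSimpArgs false

namespace VP

/-! ### Lifting `ZMod 4` labels on a grid -/

/-- The small integer representative of a label difference. -/
def lab4 (x : ZMod 4) : ℤ := if x = 1 then 1 else if x = 3 then -1 else 0

lemma lab4_abs (x : ZMod 4) : |lab4 x| ≤ 1 := by
  unfold lab4; split_ifs <;> simp

lemma lab4_cast : ∀ x : ZMod 4, x ≠ 2 → ((lab4 x : ℤ) : ZMod 4) = x := by
  unfold lab4; decide

lemma lab4_face : ∀ w x y z : ZMod 4, x - w ≠ 2 → y - x ≠ 2 → z - w ≠ 2 → y - z ≠ 2 →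
    ¬ (y - w = 2 ∧ z - x = 2) → lab4 (x - w) + lab4 (y - x) = lab4 (z - w) + lab4 (y - z) := by
  unfold lab4; decide

lemma exists_lift (c : ℕ → ℕ → ZMod 4) (k l : ℕ)
    (h1 : ∀ i < k, ∀ j ≤ l, c (i+1) j - c i j ≠ 2)
    (h2 : ∀ i ≤ k, ∀ j < l, c i (j+1) - c i j ≠ 2)
    (h3 : ∀ i < k, ∀ j < l, ¬ (c (i+1) (j+1) - c i j = 2 ∧ c i (j+1) - c (i+1) j = 2)) :
    ∃ h : ℕ → ℕ → ℤ, (∀ i ≤ k, ∀ j ≤ l, ((h i j : ℤ) : ZMod 4) = c i j) ∧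
      (∀ i < k, ∀ j ≤ l, |h (i+1) j - h i j| ≤ 1) ∧
      (∀ i ≤ k, ∀ j < l, |h i (j+1) - h i j| ≤ 1) := by
  let h : ℕ → ℕ → ℤ := fun i j => ((c 0 0).val : ℤ) + ∑ a ∈ Finset.range i, lab4 (c (a+1) 0 - c a 0)
    + ∑ b ∈ Finset.range j, lab4 (c i (b+1) - c i b)
  have hv : ∀ i j, h i (j+1) - h i j = lab4 (c i (j+1) - c i j) := by
    intro i j; simp [h, Finset.sum_range_succ]
  have hh : ∀ i < k, ∀ j ≤ l, h (i+1) j - h i j = lab4 (c (i+1) j - c i j) := by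
    intro i hi j
    induction j with
    | zero => intro _; simp [h, Finset.sum_range_succ]
    | succ j ih =>
      intro hj
      have e := ih (by omega)
      have e1 := hv i j
      have e2 := hv (i+1) j
      have := lab4_face (c i j) (c (i+1) j) (c (i+1) (j+1)) (c i (j+1)) (h1 i hi j (by omega))
        (h2 (i+1) (by omega) j (by omega)) (h2 i (by omega) j (by omega)) (h1 i hi (j+1) hj)
        (h3 i hi j (by omega))
      linarith
  refine ⟨h, ?_, fun i hi j hj => by rw [hh i hi j hj]; exact lab4_abs _,
    fun i hi j hj => by rw [hv]; exact lab4_abs _⟩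
  have h0 : ∀ i ≤ k, ((h i 0 : ℤ) : ZMod 4) = c i 0 := by
    intro i
    induction i with
    | zero => intro _; simp [h]
    | succ i ih =>
      intro hi
      have e : h (i+1) 0 = h i 0 + lab4 (c (i+1) 0 - c i 0) := by
        linarith [hh i (by omega) 0 (by omega)]
      rw [e, Int.cast_add, ih (by omega), lab4_cast _ (h1 i (by omega) 0 (by omega))]; ring
  intro i hi j
  induction j with
  | zero => intro _; exact h0 i hi
  | succ j ih =>
    intro hj
    have e : h i (j+1) = h i j + lab4 (c i (j+1) - c i j) := by linarith [hv i j]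
    rw [e, Int.cast_add, ih (by omega), lab4_cast _ (h2 i hi j (by omega))]; ring

/-- An integer walk with unit steps that avoids a residue class modulo `4` stays in its gap. -/
lemma stay (f : ℕ → ℤ) (k : ℕ) (w : ℤ) (hs : ∀ i < k, |f (i+1) - f i| ≤ 1)
    (hw : ∀ i ≤ k, ((f i : ℤ) : ZMod 4) ≠ (w : ℤ)) :
    ∃ a : ℤ, ∀ i ≤ k, 4 * a + w < f i ∧ f i < 4 * a + w + 4 := by
  have hw' : ∀ i ≤ k, (f i - w) % 4 ≠ 0 := by
    intro i hi h
    apply hw i hi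
    have := (ZMod.intCast_eq_intCast_iff_dvd_sub w (f i) 4).2 (by push_cast; omega)
    exact this.symm
  refine ⟨(f 0 - w) / 4, fun i => ?_⟩
  induction i with
  | zero => intro hi; have := hw' 0 hi; omega
  | succ i ih =>
    intro hi
    have a1 := ih (by omega)
    have a2 := hs i (by omega)
    have a3 := hw' _ hi
    rw [abs_le] at a2
    omega

lemma zmod_eq {a w : ℤ} (h : ((a : ℤ) : ZMod 4) = (w : ℤ)) : (a - w) % 4 = 0 := by
  have := ((ZMod.intCast_eq_intCast_iff_dvd_sub w a 4).1 h.symm)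
  push_cast at this; omega

section grid
variable {c : ℕ → ℕ → ZMod 4} {k l : ℕ}

/-- Label constraints on a grid. -/
def GoodLab (c : ℕ → ℕ → ZMod 4) (k l : ℕ) : Prop :=
    (∀ i < k, ∀ j ≤ l, c (i+1) j - c i j ≠ 2) ∧
    (∀ i ≤ k, ∀ j < l, c i (j+1) - c i j ≠ 2) ∧
    (∀ i < k, ∀ j < l, ¬ (c (i+1) (j+1) - c i j = 2 ∧ c i (j+1) - c (i+1) j = 2))

lemma GoodLab.sides (hc : GoodLab c k l) (w1 w2 w3 w4 : ℤ)
    (s1 : ∀ j ≤ l, c 0 j ≠ (w1 : ℤ)) (s2 : ∀ j ≤ l, c k j ≠ (w2 : ℤ))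
    (s3 : ∀ i ≤ k, c i 0 ≠ (w3 : ℤ)) (s4 : ∀ i ≤ k, c i l ≠ (w4 : ℤ)) :
    ∃ h00 h10 h11 h01 a1 a2 a3 a4 : ℤ,
      (h00 : ZMod 4) = c 0 0 ∧ (h10 : ZMod 4) = c k 0 ∧ (h11 : ZMod 4) = c k l ∧
      (h01 : ZMod 4) = c 0 l ∧
      (4 * a1 + w1 < h00 ∧ h00 < 4 * a1 + w1 + 4 ∧ 4 * a1 + w1 < h01 ∧ h01 < 4 * a1 + w1 + 4) ∧
      (4 * a2 + w2 < h10 ∧ h10 < 4 * a2 + w2 + 4 ∧ 4 * a2 + w2 < h11 ∧ h11 < 4 * a2 + w2 + 4) ∧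
      (4 * a3 + w3 < h00 ∧ h00 < 4 * a3 + w3 + 4 ∧ 4 * a3 + w3 < h10 ∧ h10 < 4 * a3 + w3 + 4) ∧
      (4 * a4 + w4 < h01 ∧ h01 < 4 * a4 + w4 + 4 ∧ 4 * a4 + w4 < h11 ∧ h11 < 4 * a4 + w4 + 4) := by
  obtain ⟨h, e, e1, e2⟩ := exists_lift c k l hc.1 hc.2.1 hc.2.2
  obtain ⟨a1, b1⟩ := stay (fun j => h 0 j) l w1 (e2 0 (by omega))
    (fun j hj => by rw [e 0 (by omega) j hj]; exact s1 j hj)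
  obtain ⟨a2, b2⟩ := stay (fun j => h k j) l w2 (e2 k le_rfl)
    (fun j hj => by rw [e k le_rfl j hj]; exact s2 j hj)
  obtain ⟨a3, b3⟩ := stay (fun i => h i 0) k w3 (fun i hi => e1 i hi 0 (by omega))
    (fun i hi => by rw [e i hi 0 (by omega)]; exact s3 i hi)
  obtain ⟨a4, b4⟩ := stay (fun i => h i l) k w4 (fun i hi => e1 i hi l le_rfl)
    (fun i hi => by rw [e i hi l le_rfl]; exact s4 i hi)
  have c1 := b1 0 (by omega)
  have c1' := b1 l le_rfl
  have c2 := b2 0 (by omega)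
  have c2' := b2 l le_rfl
  have c3 := b3 0 (by omega)
  have c3' := b3 k le_rfl
  have c4 := b4 0 (by omega)
  have c4' := b4 k le_rfl
  exact ⟨h 0 0, h k 0, h k l, h 0 l, a1, a2, a3, a4, e 0 (by omega) 0 (by omega),
    e k le_rfl 0 (by omega), e k le_rfl l le_rfl, e 0 (by omega) l le_rfl,
    ⟨c1.1, c1.2, c1'.1, c1'.2⟩, ⟨c2.1, c2.2, c2'.1, c2'.2⟩, ⟨c3.1, c3.2, c3'.1, c3'.2⟩,
    ⟨c4.1, c4.2, c4'.1, c4'.2⟩⟩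

lemma GoodLab.span (hc : GoodLab c k l)
    (s1 : ∀ j ≤ l, c 0 j ≠ 2) (s2 : ∀ j ≤ l, c k j ≠ 0)
    (s3 : ∀ i ≤ k, c i 0 ≠ 3) (s4 : ∀ i ≤ k, c i l ≠ 1) : False := by
  obtain ⟨h00, h10, h11, h01, a1, a2, a3, a4, e00, e10, e11, e01, p1, p2, p3, p4⟩ :=
    hc.sides 2 0 3 1 (by simpa using s1) (by simpa using s2) (by simpa using s3) (by simpa using s4)
  omega

lemma GoodLab.interlace (hc : GoodLab c k l)
    (s1 : ∀ j ≤ l, c 0 j ≠ 0) (s2 : ∀ j ≤ l, c k j ≠ 0)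
    (s3 : ∀ i ≤ k, c i 0 ≠ 2) (s4 : ∀ i ≤ k, c i l ≠ 2)
    (t1 : c 0 0 = 3) (t2 : c k 0 = 1) (t3 : c k l = 3) (t4 : c 0 l = 3) : False := by
  obtain ⟨h00, h10, h11, h01, a1, a2, a3, a4, e00, e10, e11, e01, p1, p2, p3, p4⟩ :=
    hc.sides 0 0 2 2 (by simpa using s1) (by simpa using s2) (by simpa using s3) (by simpa using s4)
  rw [t1] at e00; rw [t2] at e10; rw [t3] at e11; rw [t4] at e01
  have := zmod_eq (a := h00) (w := 3) (by rw [e00]; rfl)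
  have := zmod_eq (a := h10) (w := 1) (by rw [e10]; rfl)
  have := zmod_eq (a := h11) (w := 3) (by rw [e11]; rfl)
  have := zmod_eq (a := h01) (w := 3) (by rw [e01]; rfl)
  omega

lemma GoodLab.gap (hc : GoodLab c k l)
    (s1 : ∀ j ≤ l, c 0 j ≠ 0) (s2 : ∀ j ≤ l, c k j ≠ 0)
    (s3 : ∀ i ≤ k, c i 0 ≠ 0) (s4 : ∀ i ≤ k, c i l ≠ 2)
    (t3 : c k l = 1) (t4 : c 0 l = 3) : False := by
  obtain ⟨h00, h10, h11, h01, a1, a2, a3, a4, e00, e10, e11, e01, p1, p2, p3, p4⟩ :=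
    hc.sides 0 0 0 2 (by simpa using s1) (by simpa using s2) (by simpa using s3) (by simpa using s4)
  rw [t3] at e11; rw [t4] at e01
  have := zmod_eq (a := h11) (w := 1) (by rw [e11]; rfl)
  have := zmod_eq (a := h01) (w := 3) (by rw [e01]; rfl)
  omega

end grid

/-! ### Sector labels -/

/-- The sector of a displacement: `0` left, `1` up, `2` right, `3` down. -/
def sec (x y : ℝ) : ZMod 4 :=
  if x < 0 ∧ |y| ≤ -x then 0 else if 0 < y ∧ |x| < y then 1 else if 0 < x ∧ |y| ≤ x then 2 else 3

lemma sec_cases (x y : ℝ) (h : x ≠ 0 ∨ y ≠ 0) :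
    (sec x y = 0 ∧ x < 0 ∧ |y| ≤ -x) ∨ (sec x y = 1 ∧ 0 < y ∧ |x| < y) ∨
    (sec x y = 2 ∧ 0 < x ∧ |y| ≤ x) ∨ (sec x y = 3 ∧ y < 0 ∧ |x| < -y) := by
  unfold sec
  split_ifs with h1 h2 h3
  · simp_all
  · simp_all
  · simp_all
  · right; right; right
    refine ⟨rfl, ?_⟩
    rcases lt_trichotomy x 0 with hx | hx | hx <;> rcases lt_trichotomy y 0 with hy | hy | hy <;>
    simp_all [abs_of_neg, abs_of_pos] <;> linarith

lemma sec_ne0 {x y : ℝ} (h : x ≠ 0 ∨ y ≠ 0) (hx : 0 ≤ x) : sec x y ≠ 0 := by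
  intro e
  rcases sec_cases x y h with h | h | h | h <;> rw [e] at h <;>
  first | linarith [h.2.1] | exact absurd h.1 (by decide)

lemma sec_ne1 {x y : ℝ} (h : x ≠ 0 ∨ y ≠ 0) (hx : y ≤ 0) : sec x y ≠ 1 := by
  intro e
  rcases sec_cases x y h with h | h | h | h <;> rw [e] at h <;>
  first | linarith [h.2.1] | exact absurd h.1 (by decide)

lemma sec_ne2 {x y : ℝ} (h : x ≠ 0 ∨ y ≠ 0) (hx : x ≤ 0) : sec x y ≠ 2 := by
  intro e
  rcases sec_cases x y h with h | h | h | h <;> rw [e] at h <;>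
  first | linarith [h.2.1] | exact absurd h.1 (by decide)

lemma sec_ne3 {x y : ℝ} (h : x ≠ 0 ∨ y ≠ 0) (hx : 0 ≤ y) : sec x y ≠ 3 := by
  intro e
  rcases sec_cases x y h with h | h | h | h <;> rw [e] at h <;>
  first | linarith [h.2.1] | exact absurd h.1 (by decide)

lemma sec_up {x y : ℝ} (h : x ≠ 0 ∨ y ≠ 0) (hx : x = 0) (hy : 0 ≤ y) : sec x y = 1 := by
  subst hx
  rcases sec_cases 0 y h with h | h | h | h
  · linarith [h.2.1]
  · exact h.1
  · linarith [h.2.1]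
  · linarith [h.2.1]

lemma sec_down {x y : ℝ} (h : x ≠ 0 ∨ y ≠ 0) (hx : x = 0) (hy : y ≤ 0) : sec x y = 3 := by
  subst hx
  rcases sec_cases 0 y h with h | h | h | h
  · linarith [h.2.1]
  · linarith [h.2.1]
  · linarith [h.2.1]
  · exact h.1

/-- Opposite sectors. -/
lemma sec_opp {x y x' y' : ℝ} (h : x ≠ 0 ∨ y ≠ 0) (h' : x' ≠ 0 ∨ y' ≠ 0)
    (e : sec x' y' - sec x y = 2) :
    (x < 0 ∧ |y| ≤ -x ∧ 0 < x' ∧ |y'| ≤ x') ∨ (x' < 0 ∧ |y'| ≤ -x' ∧ 0 < x ∧ |y| ≤ x) ∨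
    (y < 0 ∧ |x| < -y ∧ 0 < y' ∧ |x'| < y') ∨ (y' < 0 ∧ |x'| < -y' ∧ 0 < y ∧ |x| < y) := by
  rcases sec_cases x y h with h | h | h | h <;> rcases sec_cases x' y' h' with h' | h' | h' | h' <;>
  rw [h.1, h'.1] at e <;>
  first | exact absurd e (by decide) | simp [h.2, h'.2]

lemma far_of_opp {x y x' y' ε : ℝ} (hε : 0 < ε) (h : 2 * ε ≤ |x| ∨ 2 * ε ≤ |y|)
    (h' : 2 * ε ≤ |x'| ∨ 2 * ε ≤ |y'|)
    (e : sec x' y' - sec x y = 2) : 4 * ε ≤ |x' - x| ∨ 4 * ε ≤ |y' - y| := by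
  have n1 : x ≠ 0 ∨ y ≠ 0 := by
    rcases h with h | h
    · left; rintro rfl; simp at h; linarith
    · right; rintro rfl; simp at h; linarith
  have n2 : x' ≠ 0 ∨ y' ≠ 0 := by
    rcases h' with h | h
    · left; rintro rfl; simp at h; linarith
    · right; rintro rfl; simp at h; linarith
  rcases sec_opp n1 n2 e with ⟨a, b, c, d⟩ | ⟨a, b, c, d⟩ | ⟨a, b, c, d⟩ | ⟨a, b, c, d⟩
  · left
    rw [abs_of_neg a] at h; rw [abs_of_pos c] at h'
    have : 2 * ε ≤ -x := by rcases h with h | h <;> linarith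
    have : 2 * ε ≤ x' := by rcases h' with h | h <;> linarith
    rw [le_abs]; left; linarith
  · left
    rw [abs_of_neg a] at h'; rw [abs_of_pos c] at h
    have : 2 * ε ≤ x := by rcases h with h | h <;> linarith
    have : 2 * ε ≤ -x' := by rcases h' with h | h <;> linarith
    rw [le_abs]; right; linarith
  · right
    rw [abs_of_neg a] at h; rw [abs_of_pos c] at h'
    have : 2 * ε ≤ -y := by rcases h with h | h <;> linarith
    have : 2 * ε ≤ y' := by rcases h' with h | h <;> linarith
    rw [le_abs]; left; linarith
  · right
    rw [abs_of_neg a] at h'; rw [abs_of_pos c] at h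
    have : 2 * ε ≤ y := by rcases h with h | h <;> linarith
    have : 2 * ε ≤ -y' := by rcases h' with h | h <;> linarith
    rw [le_abs]; right; linarith

section far
variable {Ax Ay Bx By : ℕ → ℝ} {k l : ℕ} {ε : ℝ}

/-- Two `ε`-chains at sup-distance at least `2 ε`: their displacement labels are good. -/
lemma goodLab_of_far (hε : 0 < ε)
    (hA : ∀ i < k, |Ax (i+1) - Ax i| ≤ ε ∧ |Ay (i+1) - Ay i| ≤ ε)
    (hB : ∀ j < l, |Bx (j+1) - Bx j| ≤ ε ∧ |By (j+1) - By j| ≤ ε)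
    (hf : ∀ i ≤ k, ∀ j ≤ l, 2 * ε ≤ |Ax i - Bx j| ∨ 2 * ε ≤ |Ay i - By j|) :
    GoodLab (fun i j => sec (Ax i - Bx j) (Ay i - By j)) k l := by
  refine ⟨fun i hi j hj e => ?_, fun i hi j hj e => ?_, fun i hi j hj e => ?_⟩
  · have := far_of_opp hε (hf i (by omega) j hj) (hf (i+1) (by omega) j hj) e
    have h := hA i hi
    simp only [sub_sub_sub_cancel_right] at this
    rcases this with h' | h' <;> linarith [h.1, h.2]
  · have := far_of_opp hε (hf i (by omega) j (by omega)) (hf i (by omega) (j+1) (by omega)) e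
    have h := hB j hj
    simp only [sub_sub_sub_cancel_left] at this
    rw [abs_sub_comm, abs_sub_comm (By j)] at this
    rcases this with h' | h' <;> linarith [h.1, h.2]
  · have := far_of_opp hε (hf i (by omega) j (by omega)) (hf (i+1) (by omega) (j+1) (by omega)) e.1
    have h := hB j hj
    have h1 := hA i hi
    simp only [abs_le, le_abs] at this h h1
    rcases this with (h' | h') | (h' | h') <;> linarith [h.1.1, h.1.2, h.2.1, h.2.2, h1.1.1, h1.1.2, h1.2.1, h1.2.2]

lemma far_ne (hε : 0 < ε) {x y : ℝ} (h : 2 * ε ≤ |x| ∨ 2 * ε ≤ |y|) : x ≠ 0 ∨ y ≠ 0 := by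
  rcases h with h | h
  · left; rintro rfl; simp at h; linarith
  · right; rintro rfl; simp at h; linarith

/-- Real `ε`-chains, one spanning horizontally and the other vertically, come close. -/
lemma real_span (hε : 0 < ε)
    (hA : ∀ i < k, |Ax (i+1) - Ax i| ≤ ε ∧ |Ay (i+1) - Ay i| ≤ ε)
    (hB : ∀ j < l, |Bx (j+1) - Bx j| ≤ ε ∧ |By (j+1) - By j| ≤ ε)
    (hf : ∀ i ≤ k, ∀ j ≤ l, 2 * ε ≤ |Ax i - Bx j| ∨ 2 * ε ≤ |Ay i - By j|)
    (s1 : ∀ j ≤ l, Ax 0 ≤ Bx j) (s2 : ∀ j ≤ l, Bx j ≤ Ax k)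
    (s3 : ∀ i ≤ k, By 0 ≤ Ay i) (s4 : ∀ i ≤ k, Ay i ≤ By l) : False := by
  refine (goodLab_of_far hε hA hB hf).span (fun j hj => ?_) (fun j hj => ?_) (fun j hj => ?_)
    (fun j hj => ?_)
  · exact sec_ne2 (far_ne hε (hf 0 (by omega) j hj)) (by linarith [s1 j hj])
  · exact sec_ne0 (far_ne hε (hf k (by omega) j hj)) (by linarith [s2 j hj])
  · exact sec_ne3 (far_ne hε (hf j hj 0 (by omega))) (by linarith [s3 j hj])
  · exact sec_ne1 (far_ne hε (hf j hj l (by omega))) (by linarith [s4 j hj])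

end far

/-! ### Discrete connectivity -/

abbrev Z2 : Type := ℤ × ℤ

/-- King adjacency (reflexive). -/
def king (p q : Z2) : Prop := |p.1 - q.1| ≤ 1 ∧ |p.2 - q.2| ≤ 1
/-- Rook adjacency (reflexive). -/
def rook (p q : Z2) : Prop := |p.1 - q.1| + |p.2 - q.2| ≤ 1

lemma rook.king {p q : Z2} (h : rook p q) : king p q :=
  ⟨by unfold rook at h; linarith [abs_nonneg (p.2 - q.2)],
   by unfold rook at h; linarith [abs_nonneg (p.1 - q.1)]⟩

lemma king.symm {p q : Z2} (h : king p q) : king q p := by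
  unfold VP.king at *; rwa [abs_sub_comm, abs_sub_comm q.2]

lemma rook.symm {p q : Z2} (h : rook p q) : rook q p := by
  unfold rook at *; rwa [abs_sub_comm, abs_sub_comm q.2]

/-- `a` and `b` are joined by an `R`-path inside `U`. -/
def Conn (R : Z2 → Z2 → Prop) (U : Set Z2) (a b : Z2) : Prop :=
  a ∈ U ∧ Relation.ReflTransGen (fun p q => R p q ∧ q ∈ U) a b

namespace Conn
variable {R R' : Z2 → Z2 → Prop} {U V : Set Z2} {a b c : Z2}

lemma refl (h : a ∈ U) : Conn R U a a := ⟨h, .refl⟩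
lemma left_mem (h : Conn R U a b) : a ∈ U := h.1
lemma right_mem (h : Conn R U a b) : b ∈ U := by
  rcases h.2.cases_tail with e | ⟨c, _, hc⟩
  · exact e ▸ h.1
  · exact hc.2
lemma trans (h : Conn R U a b) (h' : Conn R U b c) : Conn R U a c := ⟨h.1, h.2.trans h'.2⟩
lemma tail (h : Conn R U a b) (h' : R b c) (hc : c ∈ U) : Conn R U a c := ⟨h.1, h.2.tail ⟨h', hc⟩⟩
lemma mono (h : Conn R U a b) (hU : U ⊆ V) : Conn R V a b :=
  ⟨hU h.1, Relation.ReflTransGen.mono (fun _ _ h => ⟨h.1, hU h.2⟩) _ _ h.2⟩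
lemma mono_rel (h : Conn R U a b) (hR : ∀ p q, R p q → R' p q) : Conn R' U a b :=
  ⟨h.1, Relation.ReflTransGen.mono (fun _ _ h => ⟨hR _ _ h.1, h.2⟩) _ _ h.2⟩
lemma single (ha : a ∈ U) (hb : b ∈ U) (h : R a b) : Conn R U a b := (refl ha).tail h hb

lemma induct {P : Z2 → Prop} (h : Conn R U a b) (h0 : P a)
    (hs : ∀ x y, Conn R U a x → P x → R x y → y ∈ U → P y) : P b := by
  obtain ⟨ha, h⟩ := h
  induction h with
  | refl => exact h0
  | tail h1 h2 ih => exact hs _ _ ⟨ha, h1⟩ ih h2.1 h2.2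

lemma symm (hR : ∀ p q, R p q → R q p) (h : Conn R U a b) : Conn R U b a := by
  refine h.induct (P := fun b => Conn R U b a) (refl h.1) fun x y hx ih hxy hy => ?_
  exact (single hy hx.right_mem (hR _ _ hxy)).trans ih

lemma symmK (h : Conn king U a b) : Conn king U b a := h.symm fun _ _ h => h.symm
lemma symmR (h : Conn rook U a b) : Conn rook U b a := h.symm fun _ _ h => h.symm

/-- The part of `U` joined to `a` carries the same path. -/
lemma restrict (h : Conn R U a b) : Conn R {x | Conn R U a x} a b := by
  refine h.induct (refl (refl h.1)) fun x y hx ih hxy hy => ih.tail hxy (hx.tail hxy hy)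

lemma map {f : Z2 → Z2} (hf : ∀ p q, R p q → R' (f p) (f q)) (h : Conn R U a b)
    (hU : ∀ p ∈ U, f p ∈ V) : Conn R' V (f a) (f b) := by
  refine h.induct (P := fun b => Conn R' V (f a) (f b)) (refl (hU _ h.1))
    fun x y hx ih hxy hy => ih.tail (hf _ _ hxy) (hU _ hy)

lemma exists_seq (h : Conn R U a b) :
    ∃ (k : ℕ) (f : ℕ → Z2), f 0 = a ∧ f k = b ∧ (∀ i ≤ k, f i ∈ U) ∧ ∀ i < k, R (f i) (f (i+1)) := by
  refine h.induct (P := fun b => ∃ (k : ℕ) (f : ℕ → Z2), f 0 = a ∧ f k = b ∧ (∀ i ≤ k, f i ∈ U) ∧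
    ∀ i < k, R (f i) (f (i+1))) ⟨0, fun _ => a, rfl, rfl, fun _ _ => h.1, by simp⟩ ?_
  rintro x y - ⟨k, f, h0, hk, hU, hR⟩ hxy hy
  refine ⟨k+1, fun i => if i ≤ k then f i else y, by simpa, by simp, fun i hi => ?_, fun i hi => ?_⟩
  · by_cases hik : i ≤ k <;> simp [hik, hU, hy]
  · rcases Nat.lt_or_ge i k with h | h
    · simp [h.le, Nat.succ_le_of_lt h, hR i h]
    · have : i = k := by omega
      subst this; simp [hk, hxy]

lemma of_seq {k : ℕ} {f : ℕ → Z2} (hU : ∀ i ≤ k, f i ∈ U) (hR : ∀ i < k, R (f i) (f (i+1))) :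
    ∀ i ≤ k, Conn R U (f 0) (f i) := by
  intro i
  induction i with
  | zero => intro h; exact refl (hU _ h)
  | succ i ih => intro h; exact (ih (by omega)).tail (hR i (by omega)) (hU _ h)

/-- A path on which a unit-step functional climbs from `≤ α` to `≥ β` contains a crossing of
the level strip. -/
lemma cross (G : Z2 → ℤ) (hG : ∀ p q, R p q → |G p - G q| ≤ 1) (h : Conn R U a b) {α β : ℤ}
    (hαβ : α < β) (ha : G a ≤ α) (hb : β ≤ G b) :
    ∃ a' b', G a' = α ∧ G b' = β ∧ Conn R (U ∩ {p | α ≤ G p ∧ G p ≤ β}) a' b' := by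
  set C := ∃ a' b', G a' = α ∧ G b' = β ∧ Conn R (U ∩ {p | α ≤ G p ∧ G p ≤ β}) a' b' with hC
  have key : C ∨ G b ≤ α ∨ ∃ a', G a' = α ∧ Conn R (U ∩ {p | α ≤ G p ∧ G p ≤ β}) a' b := by
    refine h.induct (P := fun b => C ∨ G b ≤ α ∨ ∃ a', G a' = α ∧
      Conn R (U ∩ {p | α ≤ G p ∧ G p ≤ β}) a' b) (Or.inr (Or.inl ha)) ?_
    rintro x y hx (ih | ih | ⟨a', e, ih⟩) hxy hy
    · exact Or.inl ih
    · have := hG _ _ hxy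
      rw [abs_le] at this
      by_cases hy' : G y ≤ α
      · exact Or.inr (Or.inl hy')
      · refine Or.inr (Or.inr ⟨x, by omega, single ⟨hx.right_mem, ?_⟩ ⟨hy, ?_⟩ hxy⟩) <;>
        simp only [mem_ofPred_eq] <;> omega
    · have := hG _ _ hxy
      rw [abs_le] at this
      by_cases hy1 : G y < α
      · exact Or.inr (Or.inl hy1.le)
      by_cases hy2 : G y ≤ β
      · exact Or.inr (Or.inr ⟨a', e, ih.tail hxy ⟨hy, by simp only [mem_ofPred_eq]; omega⟩⟩)
      · have := ih.right_mem.2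
        simp only [mem_ofPred_eq] at this
        exact Or.inl ⟨a', x, e, by omega, ih⟩
  rcases key with h | h | ⟨a', e, h⟩
  · exact h
  · omega
  · have := h.right_mem.2
    simp only [mem_ofPred_eq] at this
    exact ⟨a', b, e, by omega, h⟩

end Conn

/-! ### Gluing paths -/

section glue
variable {U V : Set Z2} {a a' b b' : Z2}

lemma seq_far {k l : ℕ} {f g : ℕ → Z2} (hn : ∀ i ≤ k, ∀ j ≤ l, ¬ king (f i) (g j)) :
    ∀ i ≤ k, ∀ j ≤ l, 2 * (1:ℝ) ≤ |((f i).1 : ℝ) - (g j).1| ∨ 2 * (1:ℝ) ≤ |((f i).2 : ℝ) - (g j).2| := by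
  intro i hi j hj
  have := hn i hi j hj
  unfold king at this
  rw [not_and_or, not_le, not_le] at this
  rcases this with h | h
  · left; have : (2:ℤ) ≤ |(f i).1 - (g j).1| := by omega
    exact_mod_cast (by simpa using this)
  · right; have : (2:ℤ) ≤ |(f i).2 - (g j).2| := by omega
    exact_mod_cast (by simpa using this)

lemma king_step {p q : Z2} (h : king p q) : |(q.1:ℝ) - p.1| ≤ 1 ∧ |(q.2:ℝ) - p.2| ≤ 1 := by
  have h := h.symm
  exact ⟨by exact_mod_cast h.1, by exact_mod_cast h.2⟩

lemma conn_of_adj {k l : ℕ} {f g : ℕ → Z2} (hfU : ∀ i ≤ k, f i ∈ U) (hgV : ∀ i ≤ l, g i ∈ V)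
    (hf : ∀ i < k, king (f i) (f (i+1))) (hg : ∀ i < l, king (g i) (g (i+1)))
    {i j : ℕ} (hi : i ≤ k) (hj : j ≤ l) (h : king (f i) (g j)) : Conn king (U ∪ V) (f 0) (g 0) := by
  have h1 := (Conn.of_seq hfU hf i hi).mono (subset_union_left (t := V))
  have h2 := (Conn.of_seq hgV hg j hj).mono (subset_union_right (s := U))
  exact (h1.trans (Conn.single h1.right_mem h2.right_mem h)).trans h2.symmK

lemma glue_span (hU : Conn king U a a') (hV : Conn king V b b')
    (h1 : ∀ q ∈ V, a.1 ≤ q.1 ∧ q.1 ≤ a'.1) (h2 : ∀ p ∈ U, b.2 ≤ p.2 ∧ p.2 ≤ b'.2) :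
    Conn king (U ∪ V) a b := by
  obtain ⟨k, f, rfl, rfl, hfU, hf⟩ := hU.exists_seq
  obtain ⟨l, g, rfl, rfl, hgV, hg⟩ := hV.exists_seq
  by_contra hcon
  have hn : ∀ i ≤ k, ∀ j ≤ l, ¬ king (f i) (g j) := fun i hi j hj h =>
    hcon (conn_of_adj hfU hgV hf hg hi hj h)
  refine real_span (Ax := fun i => (f i).1) (Ay := fun i => (f i).2) (Bx := fun i => (g i).1)
    (By := fun i => (g i).2) one_pos (fun i hi => king_step (hf i hi))
    (fun i hi => king_step (hg i hi)) (seq_far hn) (fun j hj => ?_) (fun j hj => ?_)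
    (fun j hj => ?_) (fun j hj => ?_)
  · exact_mod_cast (h1 _ (hgV j hj)).1
  · exact_mod_cast (h1 _ (hgV j hj)).2
  · exact_mod_cast (h2 _ (hfU j hj)).1
  · exact_mod_cast (h2 _ (hfU j hj)).2

lemma glue_interlace {X : ℤ} (hU : Conn king U a a') (hV : Conn king V b b')
    (hUX : ∀ p ∈ U, p.1 ≤ X) (hVX : ∀ p ∈ V, p.1 ≤ X) (ea : a.1 = X) (ea' : a'.1 = X)
    (eb : b.1 = X) (eb' : b'.1 = X) (h1 : a.2 ≤ b.2) (h2 : b.2 ≤ a'.2) (h3 : a'.2 ≤ b'.2) :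
    Conn king (U ∪ V) a b := by
  obtain ⟨k, f, rfl, rfl, hfU, hf⟩ := hU.exists_seq
  obtain ⟨l, g, rfl, rfl, hgV, hg⟩ := hV.exists_seq
  by_contra hcon
  have hn : ∀ i ≤ k, ∀ j ≤ l, ¬ king (f i) (g j) := fun i hi j hj h =>
    hcon (conn_of_adj hfU hgV hf hg hi hj h)
  have hfar := seq_far hn
  have nz : ∀ i ≤ k, ∀ j ≤ l, ((f i).1 : ℝ) - (g j).1 ≠ 0 ∨ ((f i).2 : ℝ) - (g j).2 ≠ 0 :=
    fun i hi j hj => far_ne one_pos (hfar i hi j hj)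
  have l1 : ∀ {x y : ℤ}, x ≤ y → (x:ℝ) - y ≤ 0 := fun h => by
    have := (Int.cast_le (R := ℝ)).2 h; linarith
  have l2 : ∀ {x y : ℤ}, y ≤ x → (0:ℝ) ≤ (x:ℝ) - y := fun h => by
    have := (Int.cast_le (R := ℝ)).2 h; linarith
  have l3 : ∀ {x y : ℤ}, y = x → (x:ℝ) - y = 0 := fun h => by rw [h]; ring
  have z : (0:ℕ) ≤ k := by omega
  have z' : (0:ℕ) ≤ l := by omega
  refine (goodLab_of_far (Ax := fun i => (f i).1) (Ay := fun i => (f i).2) (Bx := fun i => (g i).1)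
    (By := fun i => (g i).2) one_pos (fun i hi => king_step (hf i hi))
    (fun i hi => king_step (hg i hi)) hfar).interlace (fun j hj => ?_) (fun j hj => ?_)
    (fun j hj => ?_) (fun j hj => ?_) ?_ ?_ ?_ ?_
  · exact sec_ne0 (nz 0 z j hj) (l2 (by rw [ea]; exact hVX _ (hgV j hj)))
  · exact sec_ne0 (nz k le_rfl j hj) (l2 (by rw [ea']; exact hVX _ (hgV j hj)))
  · exact sec_ne2 (nz j hj 0 z') (l1 (by rw [eb]; exact hUX _ (hfU j hj)))
  · exact sec_ne2 (nz j hj l le_rfl) (l1 (by rw [eb']; exact hUX _ (hfU j hj)))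
  · exact sec_down (nz 0 z 0 z') (l3 (by rw [ea, eb])) (l1 h1)
  · exact sec_up (nz k le_rfl 0 z') (l3 (by rw [ea', eb])) (l2 h2)
  · exact sec_down (nz k le_rfl l le_rfl) (l3 (by rw [ea', eb'])) (l1 h3)
  · exact sec_down (nz 0 z l le_rfl) (l3 (by rw [ea, eb'])) (l1 (h1.trans (h2.trans h3)))

lemma glue_gap {X : ℤ} (hU : Conn king U a a') (hV : Conn king V b b')
    (hUX : ∀ p ∈ U, p.1 ≤ X) (hVX : ∀ p ∈ V, p.1 ≤ X) (ea : a.1 = X) (ea' : a'.1 = X)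
    (hb : ∀ p ∈ U, b.1 ≤ p.1) (eb' : b'.1 = X) (h1 : a.2 ≤ b'.2) (h2 : b'.2 ≤ a'.2) :
    Conn king (U ∪ V) a b := by
  obtain ⟨k, f, rfl, rfl, hfU, hf⟩ := hU.exists_seq
  obtain ⟨l, g, rfl, rfl, hgV, hg⟩ := hV.exists_seq
  by_contra hcon
  have hn : ∀ i ≤ k, ∀ j ≤ l, ¬ king (f i) (g j) := fun i hi j hj h =>
    hcon (conn_of_adj hfU hgV hf hg hi hj h)
  have hfar := seq_far hn
  have nz : ∀ i ≤ k, ∀ j ≤ l, ((f i).1 : ℝ) - (g j).1 ≠ 0 ∨ ((f i).2 : ℝ) - (g j).2 ≠ 0 :=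
    fun i hi j hj => far_ne one_pos (hfar i hi j hj)
  have l1 : ∀ {x y : ℤ}, x ≤ y → (x:ℝ) - y ≤ 0 := fun h => by
    have := (Int.cast_le (R := ℝ)).2 h; linarith
  have l2 : ∀ {x y : ℤ}, y ≤ x → (0:ℝ) ≤ (x:ℝ) - y := fun h => by
    have := (Int.cast_le (R := ℝ)).2 h; linarith
  have l3 : ∀ {x y : ℤ}, y = x → (x:ℝ) - y = 0 := fun h => by rw [h]; ring
  have z : (0:ℕ) ≤ k := by omega
  have z' : (0:ℕ) ≤ l := by omega
  refine (goodLab_of_far (Ax := fun i => (f i).1) (Ay := fun i => (f i).2) (Bx := fun i => (g i).1)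
    (By := fun i => (g i).2) one_pos (fun i hi => king_step (hf i hi))
    (fun i hi => king_step (hg i hi)) hfar).gap (fun j hj => ?_) (fun j hj => ?_)
    (fun j hj => ?_) (fun j hj => ?_) ?_ ?_
  · exact sec_ne0 (nz 0 z j hj) (l2 (by rw [ea]; exact hVX _ (hgV j hj)))
  · exact sec_ne0 (nz k le_rfl j hj) (l2 (by rw [ea']; exact hVX _ (hgV j hj)))
  · exact sec_ne0 (nz j hj 0 z') (l2 (hb _ (hfU j hj)))
  · exact sec_ne2 (nz j hj l le_rfl) (l1 (by rw [eb']; exact hUX _ (hfU j hj)))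
  · exact sec_up (nz k le_rfl l le_rfl) (l3 (by rw [ea', eb'])) (l2 h2)
  · exact sec_down (nz 0 z l le_rfl) (l3 (by rw [ea, eb'])) (l1 h1)

/-- A king path spanning horizontally and a rook path spanning vertically share a site. -/
lemma cross_span (hU : Conn king U a a') (hV : Conn rook V b b')
    (h1 : ∀ q ∈ V, a.1 ≤ q.1 ∧ q.1 ≤ a'.1) (h2 : ∀ p ∈ U, b.2 ≤ p.2 ∧ p.2 ≤ b'.2) :
    ∃ p, p ∈ U ∧ p ∈ V := by
  obtain ⟨k, f, rfl, rfl, hfU, hf⟩ := hU.exists_seq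
  obtain ⟨l, g, rfl, rfl, hgV, hg⟩ := hV.exists_seq
  by_contra! hcon
  have nz' : ∀ i ≤ k, ∀ j ≤ l, (f i).1 - (g j).1 ≠ 0 ∨ (f i).2 - (g j).2 ≠ 0 := by
    intro i hi j hj
    by_contra! h
    have : f i = g j := Prod.ext (by omega) (by omega)
    exact hcon _ (hfU i hi) (this ▸ hgV j hj)
  have nz : ∀ i ≤ k, ∀ j ≤ l, (((f i).1 - (g j).1 : ℤ) : ℝ) ≠ 0 ∨ (((f i).2 - (g j).2 : ℤ) : ℝ) ≠ 0 :=
    fun i hi j hj => by simpa only [ne_eq, Int.cast_eq_zero] using nz' i hi j hj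
  have opp : ∀ {x y x' y' : ℤ}, (x ≠ 0 ∨ y ≠ 0) → (x' ≠ 0 ∨ y' ≠ 0) →
      sec (x':ℝ) y' - sec (x:ℝ) y = 2 → (x < 0 ∧ |y| ≤ -x ∧ 0 < x' ∧ |y'| ≤ x') ∨
      (x' < 0 ∧ |y'| ≤ -x' ∧ 0 < x ∧ |y| ≤ x) ∨
      (y < 0 ∧ |x| < -y ∧ 0 < y' ∧ |x'| < y') ∨ (y' < 0 ∧ |x'| < -y' ∧ 0 < y ∧ |x| < y) := by
    intro x y x' y' hx hx' e
    have := sec_opp (x := x) (y := y) (x' := x') (y' := y') (by simpa using hx) (by simpa using hx') e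
    exact_mod_cast this
  have hgood : GoodLab (fun i j => sec (((f i).1 - (g j).1 : ℤ) : ℝ) (((f i).2 - (g j).2 : ℤ) : ℝ)) k l := by
    refine ⟨fun i hi j hj e => ?_, fun i hi j hj e => ?_, fun i hi j hj e => ?_⟩
    · have o := opp (nz' i (by omega) j hj) (nz' (i+1) (by omega) j hj) e
      have s := hf i hi
      unfold king at s
      rw [abs_le, abs_le] at s
      simp only [abs_le, abs_lt] at o
      omega
    · have o := opp (nz' i (by omega) j (by omega)) (nz' i (by omega) (j+1) (by omega)) e
      have s := (hg j hj).king
      unfold king at s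
      rw [abs_le, abs_le] at s
      simp only [abs_le, abs_lt] at o
      omega
    · have o1 := opp (nz' i (by omega) j (by omega)) (nz' (i+1) (by omega) (j+1) (by omega)) e.1
      have o2 := opp (nz' (i+1) (by omega) j (by omega)) (nz' i (by omega) (j+1) (by omega)) e.2
      have s := hf i hi
      have t := hg j hj
      unfold king at s
      unfold rook at t
      rw [abs_le, abs_le] at s
      have t1 := neg_abs_le ((g j).1 - (g (j+1)).1)
      have t2 := neg_abs_le ((g j).2 - (g (j+1)).2)
      have t3 := le_abs_self ((g j).1 - (g (j+1)).1)
      have t4 := le_abs_self ((g j).2 - (g (j+1)).2)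
      simp only [abs_le, abs_lt] at o1 o2
      generalize |(g j).1 - (g (j+1)).1| = w1 at *
      generalize |(g j).2 - (g (j+1)).2| = w2 at *
      omega
  have c1 : ∀ {x : ℤ}, x ≤ 0 → (x:ℝ) ≤ 0 := fun h => by exact_mod_cast h
  have c2 : ∀ {x : ℤ}, 0 ≤ x → (0:ℝ) ≤ x := fun h => by exact_mod_cast h
  refine hgood.span (fun j hj => ?_) (fun j hj => ?_) (fun j hj => ?_) (fun j hj => ?_)
  · exact sec_ne2 (nz 0 (by omega) j hj) (c1 (by have := h1 _ (hgV j hj); omega))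
  · exact sec_ne0 (nz k le_rfl j hj) (c2 (by have := h1 _ (hgV j hj); omega))
  · exact sec_ne3 (nz j hj 0 (by omega)) (c2 (by have := h2 _ (hfU j hj); omega))
  · exact sec_ne1 (nz j hj l le_rfl) (c1 (by have := h2 _ (hfU j hj); omega))

end glue

/-! ### Duality in a box -/

/-- The lattice box `[x0,x1] × [y0,y1]`. -/
def Box (x0 x1 y0 y1 : ℤ) : Set Z2 := {p | x0 ≤ p.1 ∧ p.1 ≤ x1 ∧ y0 ≤ p.2 ∧ p.2 ≤ y1}

lemma mem_box {x0 x1 y0 y1 : ℤ} {p : Z2} :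
    p ∈ Box x0 x1 y0 y1 ↔ x0 ≤ p.1 ∧ p.1 ≤ x1 ∧ y0 ≤ p.2 ∧ p.2 ≤ y1 := Iff.rfl

/-- Left-right crossing of a box inside `U`. -/
def HC (R : Z2 → Z2 → Prop) (U : Set Z2) (x0 x1 y0 y1 : ℤ) : Prop :=
  ∃ a b : Z2, a.1 = x0 ∧ b.1 = x1 ∧ Conn R (U ∩ Box x0 x1 y0 y1) a b

/-- Bottom-top crossing of a box inside `U`. -/
def VC (R : Z2 → Z2 → Prop) (U : Set Z2) (x0 x1 y0 y1 : ℤ) : Prop :=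
  ∃ a b : Z2, a.2 = y0 ∧ b.2 = y1 ∧ Conn R (U ∩ Box x0 x1 y0 y1) a b

open Classical in
lemma hc_or_vc (U : Set Z2) (x0 x1 y0 y1 : ℤ) (hx : x0 ≤ x1) (hy : y0 ≤ y1) :
    HC king U x0 x1 y0 y1 ∨ VC rook Uᶜ x0 x1 y0 y1 := by
  by_contra! hcon
  obtain ⟨hH, hV⟩ := hcon
  obtain ⟨k, rfl⟩ := Int.le.dest hx
  obtain ⟨l, rfl⟩ := Int.le.dest hy
  set B := Box x0 (x0 + k) y0 (y0 + l)
  let P : ℕ → ℕ → Z2 := fun i j => (x0 + i, y0 + j)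
  let c : ℕ → ℕ → ZMod 4 := fun i j =>
    if P i j ∈ U then (if ∃ a : Z2, a.1 = x0 ∧ Conn king (U ∩ B) a (P i j) then 0 else 2)
    else (if ∃ a : Z2, a.2 = y0 ∧ Conn rook (Uᶜ ∩ B) a (P i j) then 1 else 3)
  have hB : ∀ i ≤ k, ∀ j ≤ l, P i j ∈ B := fun i hi j hj => by
    simp only [P, B, mem_box]; omega
  have pair : ∀ i ≤ k, ∀ j ≤ l, ∀ i' ≤ k, ∀ j' ≤ l, king (P i j) (P i' j') →
      (P i j ∈ U → P i' j' ∈ U → c i' j' = c i j) ∧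
      (P i j ∉ U → P i' j' ∉ U → rook (P i j) (P i' j') → c i' j' = c i j) := by
    intro i hi j hj i' hi' j' hj' hk
    refine ⟨fun h h' => ?_, fun h h' hr => ?_⟩
    · have : (∃ a : Z2, a.1 = x0 ∧ Conn king (U ∩ B) a (P i j)) ↔
          ∃ a : Z2, a.1 = x0 ∧ Conn king (U ∩ B) a (P i' j') :=
        ⟨fun ⟨a, e, ha⟩ => ⟨a, e, ha.tail hk ⟨h', hB _ hi' _ hj'⟩⟩,
         fun ⟨a, e, ha⟩ => ⟨a, e, ha.tail hk.symm ⟨h, hB _ hi _ hj⟩⟩⟩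
      simp only [c, h, h', this, if_true]
    · have : (∃ a : Z2, a.2 = y0 ∧ Conn rook (Uᶜ ∩ B) a (P i j)) ↔
          ∃ a : Z2, a.2 = y0 ∧ Conn rook (Uᶜ ∩ B) a (P i' j') :=
        ⟨fun ⟨a, e, ha⟩ => ⟨a, e, ha.tail hr ⟨h', hB _ hi' _ hj'⟩⟩,
         fun ⟨a, e, ha⟩ => ⟨a, e, ha.tail hr.symm ⟨h, hB _ hi _ hj⟩⟩⟩
      simp only [c, h, h', this, if_false]
  have val : ∀ i j, (P i j ∈ U ∧ (c i j = 0 ∨ c i j = 2)) ∨ (P i j ∉ U ∧ (c i j = 1 ∨ c i j = 3)) := by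
    intro i j
    by_cases h : P i j ∈ U
    · left; refine ⟨h, ?_⟩; simp only [c, h, if_true]; split_ifs <;> simp
    · right; refine ⟨h, ?_⟩; simp only [c, h, if_false]; split_ifs <;> simp
  have par : ∀ i j i' j', c i' j' - c i j = 2 → (P i j ∈ U ↔ P i' j' ∈ U) := by
    intro i j i' j' e
    rcases val i j with ⟨h, h1 | h1⟩ | ⟨h, h1 | h1⟩ <;> rcases val i' j' with ⟨h', h2 | h2⟩ | ⟨h', h2 | h2⟩ <;>
    simp only [h, h'] <;> rw [h1, h2] at e <;> exact absurd e (by decide)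
  have ne2 : ∀ i j i' j', c i' j' - c i j = 2 → c i' j' ≠ c i j := by
    intro i j i' j' e h; rw [h, sub_self] at e; exact absurd e (by decide)
  have adj : ∀ i ≤ k, ∀ j ≤ l, ∀ i' ≤ k, ∀ j' ≤ l, rook (P i j) (P i' j') → c i' j' - c i j ≠ 2 := by
    intro i hi j hj i' hi' j' hj' hr e
    have hp := pair i hi j hj i' hi' j' hj' hr.king
    by_cases h : P i j ∈ U
    · exact ne2 _ _ _ _ e (hp.1 h ((par _ _ _ _ e).1 h))
    · exact ne2 _ _ _ _ e (hp.2 h (fun h' => h ((par _ _ _ _ e).2 h')) hr)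
  have hgood : GoodLab c k l := by
    refine ⟨fun i hi j hj => ?_, fun i hi j hj => ?_, fun i hi j hj e => ?_⟩
    · exact adj _ (by omega) _ hj _ (by omega) _ hj (by simp [rook, P])
    · exact adj _ hi _ (by omega) _ hi _ (by omega) (by simp [rook, P])
    · have d1 := pair i (by omega) j (by omega) (i+1) (by omega) (j+1) (by omega) (by simp [king, P])
      have d2 := pair (i+1) (by omega) j (by omega) i (by omega) (j+1) (by omega) (by simp [king, P])
      by_cases h : P i j ∈ U
      · exact ne2 _ _ _ _ e.1 (d1.1 h ((par _ _ _ _ e.1).1 h))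
      · by_cases h' : P (i+1) j ∈ U
        · exact ne2 _ _ _ _ e.2 (d2.1 h' ((par _ _ _ _ e.2).1 h'))
        · have a1 := (pair i (by omega) j (by omega) (i+1) (by omega) j (by omega) (by simp [king, P])).2
            h h' (by simp [rook, P])
          have a2 := (pair (i+1) (by omega) j (by omega) (i+1) (by omega) (j+1) (by omega)
            (by simp [king, P])).2 h' (fun h'' => h ((par _ _ _ _ e.1).2 h'')) (by simp [rook, P])
          exact ne2 _ _ _ _ e.1 (a2.trans a1)
  refine hgood.span (fun j hj => ?_) (fun j hj => ?_) (fun i hi => ?_) (fun i hi => ?_)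
  · by_cases h : P 0 j ∈ U
    · have : ∃ a : Z2, a.1 = x0 ∧ Conn king (U ∩ B) a (P 0 j) :=
        ⟨P 0 j, by simp [P], Conn.refl ⟨h, hB 0 (by omega) j hj⟩⟩
      simp only [c, h, if_true, this]; decide
    · simp only [c, h, if_false]; split_ifs <;> decide
  · by_cases h : P k j ∈ U
    · have : ¬ ∃ a : Z2, a.1 = x0 ∧ Conn king (U ∩ B) a (P k j) :=
        fun ⟨a, e, ha⟩ => hH ⟨a, P k j, e, rfl, ha⟩
      simp only [c, h, if_true, this, if_false]; decide
    · simp only [c, h, if_false]; split_ifs <;> decide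
  · by_cases h : P i 0 ∈ U
    · simp only [c, h, if_true]; split_ifs <;> decide
    · have : ∃ a : Z2, a.2 = y0 ∧ Conn rook (Uᶜ ∩ B) a (P i 0) :=
        ⟨P i 0, by simp [P], Conn.refl ⟨h, hB i hi 0 (by omega)⟩⟩
      simp only [c, h, if_true, this, if_false]; decide
  · by_cases h : P i l ∈ U
    · simp only [c, h, if_true]; split_ifs <;> decide
    · have : ¬ ∃ a : Z2, a.2 = y0 ∧ Conn rook (Uᶜ ∩ B) a (P i l) :=
        fun ⟨a, e, ha⟩ => hV ⟨a, P i l, e, rfl, ha⟩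
      simp only [c, h, this, if_false]; decide

/-! ### Finite product probability spaces -/

section prod
variable {ι : Type*} [Fintype ι] [DecidableEq ι]

/-- Bernoulli weight of one coordinate. -/
def w1 (x : ℝ) (b : Bool) : ℝ := if b then x else 1 - x
/-- Product Bernoulli weight. -/
def wt (q : ι → ℝ) (ω : ι → Bool) : ℝ := ∏ i, w1 (q i) (ω i)
/-- Expectation under the product Bernoulli law. -/
def Ex (q : ι → ℝ) (f : (ι → Bool) → ℝ) : ℝ := ∑ ω, wt q ω * f ω

/-- Admissible parameters. -/
def Adm (q : ι → ℝ) : Prop := ∀ i, 0 ≤ q i ∧ q i ≤ 1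

lemma w1_nonneg {x : ℝ} (h : 0 ≤ x ∧ x ≤ 1) (b : Bool) : 0 ≤ w1 x b := by
  unfold w1; split_ifs <;> linarith [h.1, h.2]

lemma w1_sum (x : ℝ) : ∑ b, w1 x b = 1 := by simp [w1]

lemma wt_nonneg {q : ι → ℝ} (hq : Adm q) (ω) : 0 ≤ wt q ω :=
  Finset.prod_nonneg fun i _ => w1_nonneg (hq i) _

lemma wt_sum (q : ι → ℝ) : ∑ ω, wt q ω = 1 := by
  have := Finset.prod_univ_sum (fun _ : ι => (Finset.univ : Finset Bool)) (fun i b => w1 (q i) b)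
  simp only [w1_sum, Finset.prod_const_one, Fintype.piFinset_univ] at this
  exact this.symm

lemma Ex_add (q : ι → ℝ) (f g) : Ex q (fun ω => f ω + g ω) = Ex q f + Ex q g := by
  simp [Ex, mul_add, Finset.sum_add_distrib]
lemma Ex_sub (q : ι → ℝ) (f g) : Ex q (fun ω => f ω - g ω) = Ex q f - Ex q g := by
  simp [Ex, mul_sub, Finset.sum_sub_distrib]
lemma Ex_smul (q : ι → ℝ) (c : ℝ) (f) : Ex q (fun ω => c * f ω) = c * Ex q f := by
  simp only [Ex, Finset.mul_sum]; exact Finset.sum_congr rfl fun _ _ => by ring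
lemma Ex_const (q : ι → ℝ) (c : ℝ) : Ex q (fun _ => c) = c := by
  simp [Ex, ← Finset.sum_mul, wt_sum]
lemma Ex_sum {κ : Type*} (q : ι → ℝ) (s : Finset κ) (f : κ → (ι → Bool) → ℝ) :
    Ex q (fun ω => ∑ k ∈ s, f k ω) = ∑ k ∈ s, Ex q (f k) := by
  simp only [Ex, Finset.mul_sum]; exact Finset.sum_comm
lemma Ex_mono {q : ι → ℝ} (hq : Adm q) {f g : (ι → Bool) → ℝ} (h : ∀ ω, f ω ≤ g ω) : Ex q f ≤ Ex q g :=
  Finset.sum_le_sum fun ω _ => mul_le_mul_of_nonneg_left (h ω) (wt_nonneg hq ω)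
lemma Ex_nonneg {q : ι → ℝ} (hq : Adm q) {f : (ι → Bool) → ℝ} (h : ∀ ω, 0 ≤ f ω) : 0 ≤ Ex q f :=
  Finset.sum_nonneg fun ω _ => mul_nonneg (wt_nonneg hq ω) (h ω)
lemma Ex_abs {q : ι → ℝ} (hq : Adm q) (f) : |Ex q f| ≤ Ex q (fun ω => |f ω|) := by
  refine (Finset.abs_sum_le_sum_abs _ _).trans (Finset.sum_le_sum fun ω _ => ?_)
  rw [abs_mul, abs_of_nonneg (wt_nonneg hq ω)]

/-- Integrating out one coordinate with arbitrary weights on it. -/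
lemma sum_split (q : ι → ℝ) (i : ι) (h : Bool → ℝ) (g : (ι → Bool) → ℝ) :
    ∑ ω, (∏ j ∈ Finset.univ.erase i, w1 (q j) (ω j)) * h (ω i) * g ω =
      ∑ b, h b * Ex q (fun ω => g (Function.update ω i b)) := by
  let e := (Equiv.funSplitAt i Bool).symm
  have ei : ∀ b η, e (b, η) i = b := fun b η => by simp [e]
  have ej : ∀ b η, ∀ j (hj : j ≠ i), e (b, η) j = η ⟨j, hj⟩ := fun b η j hj => by simp [e, hj]
  have eu : ∀ b b' η, Function.update (e (b', η)) i b = e (b, η) := by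
    intro b b' η; ext j
    by_cases hj : j = i
    · subst hj; simp [ei]
    · simp [hj, ej _ _ _ hj]
  have eW : ∀ b b' η, ∏ j ∈ Finset.univ.erase i, w1 (q j) (e (b, η) j) =
      ∏ j ∈ Finset.univ.erase i, w1 (q j) (e (b', η) j) := by
    intro b b' η
    refine Finset.prod_congr rfl fun j hj => ?_
    have hj := (Finset.mem_erase.1 hj).1
    rw [ej _ _ _ hj, ej _ _ _ hj]
  have ewt : ∀ b η, wt q (e (b, η)) = w1 (q i) b * ∏ j ∈ Finset.univ.erase i, w1 (q j) (e (true, η) j) := by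
    intro b η
    unfold wt
    rw [← Finset.mul_prod_erase _ _ (Finset.mem_univ i), ei, eW b true]
  unfold Ex
  rw [← e.sum_comp, Fintype.sum_prod_type]
  refine Finset.sum_congr rfl fun b _ => ?_
  rw [← e.sum_comp, Fintype.sum_prod_type_right, Finset.mul_sum]
  refine Finset.sum_congr rfl fun η _ => ?_
  simp only [eu, ewt, ei]
  rw [eW b true, ← Finset.sum_mul, ← Finset.sum_mul, w1_sum]
  ring

lemma Ex_split (q : ι → ℝ) (i : ι) (g : (ι → Bool) → ℝ) :
    Ex q g = ∑ b, w1 (q i) b * Ex q (fun ω => g (Function.update ω i b)) := by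
  rw [← sum_split]
  unfold Ex wt
  refine Finset.sum_congr rfl fun ω _ => ?_
  rw [← Finset.mul_prod_erase _ _ (Finset.mem_univ i)]; ring

lemma Ex_update (q : ι → ℝ) (i : ι) (x : ℝ) (g : (ι → Bool) → ℝ) :
    Ex (Function.update q i x) g = x * Ex q (fun ω => g (Function.update ω i true)) +
      (1 - x) * Ex q (fun ω => g (Function.update ω i false)) := by
  have := sum_split q i (w1 x) g
  simp only [Fintype.sum_bool, w1, if_true, Bool.false_eq_true, if_false] at this
  rw [← this]
  unfold Ex wt
  refine Finset.sum_congr rfl fun ω _ => ?_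
  rw [← Finset.mul_prod_erase _ _ (Finset.mem_univ i)]
  have : ∏ j ∈ Finset.univ.erase i, w1 (Function.update q i x j) (ω j) =
      ∏ j ∈ Finset.univ.erase i, w1 (q j) (ω j) :=
    Finset.prod_congr rfl fun j hj => by rw [Function.update_of_ne (Finset.mem_erase.1 hj).1]
  rw [this]; simp [w1]; ring_nf

lemma Ex_congr_symm (q : ι → ℝ) (σ : (ι → Bool) ≃ (ι → Bool)) (hσ : ∀ ω, wt q (σ ω) = wt q ω)
    (f : (ι → Bool) → ℝ) : Ex q (fun ω => f (σ ω)) = Ex q f := by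
  unfold Ex
  rw [← σ.sum_comp (fun ω => wt q ω * f ω)]
  exact Finset.sum_congr rfl fun ω _ => by rw [hσ]

/-- Independence. -/
lemma Ex_mul_indep (q : ι → ℝ) (S : Finset ι) {f g : (ι → Bool) → ℝ}
    (hf : DependsOn f (S : Set ι)) (hg : DependsOn g ((S : Set ι)ᶜ)) :
    Ex q (fun ω => f ω * g ω) = Ex q f * Ex q g := by
  induction S using Finset.induction_on generalizing f with
  | empty =>
    have : ∀ ω, f ω = f (fun _ => true) := fun ω => hf (by simp)
    simp only [this, Ex_smul, Ex_const]
    rw [show f = fun _ => f (fun _ => true) from funext this, Ex_const]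
  | insert i S hi ih =>
    have hg1 : ∀ ω b, g (Function.update ω i b) = g ω := fun ω b => hg (by
      intro j hj
      have : j ≠ i := by rintro rfl; simp at hj
      simp [this])
    have hf' : DependsOn (fun ω => ∑ b, w1 (q i) b * f (Function.update ω i b)) (S : Set ι) := by
      intro x y hxy
      refine Finset.sum_congr rfl fun b _ => ?_
      congr 1
      refine hf fun j hj => ?_
      by_cases h : j = i
      · subst h; simp
      · simp [h]; exact hxy j (by simpa [h] using hj)
    have hg' : DependsOn g ((S : Set ι)ᶜ) := hg.mono (by
      intro j hj; simp at hj ⊢; tauto)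
    have e1 : Ex q (fun ω => f ω * g ω) =
        Ex q (fun ω => (∑ b, w1 (q i) b * f (Function.update ω i b)) * g ω) := by
      rw [Ex_split q i]
      simp only [hg1, Finset.sum_mul]
      rw [Ex_sum]
      refine Finset.sum_congr rfl fun b _ => ?_
      rw [← Ex_smul]; congr 1; ext ω; ring
    have e2 : Ex q f = Ex q (fun ω => ∑ b, w1 (q i) b * f (Function.update ω i b)) := by
      rw [Ex_split q i, Ex_sum]
      exact Finset.sum_congr rfl fun b _ => by rw [← Ex_smul]
    rw [e1, e2, ih hf' hg']

lemma Ex_fkg {q : ι → ℝ} (hq : Adm q) {f g : (ι → Bool) → ℝ} (hf0 : 0 ≤ f) (hg0 : 0 ≤ g)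
    (hf : Monotone f) (hg : Monotone g) : Ex q f * Ex q g ≤ Ex q (fun ω => f ω * g ω) := by
  have := fkg (μ := wt q) f g (fun ω => wt_nonneg hq ω) hf0 hg0 hf hg (by
    intro a b
    apply le_of_eq
    unfold wt
    rw [← Finset.prod_mul_distrib, ← Finset.prod_mul_distrib]
    refine Finset.prod_congr rfl fun i _ => ?_
    simp only [Pi.inf_apply, Pi.sup_apply]
    cases a i <;> cases b i <;> simp [mul_comm])
  rw [wt_sum, one_mul] at this
  exact this

lemma mono_update {g : (ι → Bool) → ℝ} (hg : Monotone g) (i : ι) (ω : ι → Bool) :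
    g (Function.update ω i false) ≤ g (Function.update ω i true) :=
  hg (by
    intro j
    by_cases h : j = i
    · subst h; simp
    · simp [h])

lemma Ex_mono_param {q q' : ι → ℝ} (hq : Adm q) (hq' : Adm q') (h : ∀ i, q i ≤ q' i)
    {g : (ι → Bool) → ℝ} (hg : Monotone g) : Ex q g ≤ Ex q' g := by
  have key : ∀ S : Finset ι, Ex q g ≤ Ex (S.piecewise q' q) g := by
    intro S
    induction S using Finset.induction_on with
    | empty => simp
    | insert i S hi ih =>
      refine ih.trans ?_
      have hA : Adm (S.piecewise q' q) := fun j => by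
        by_cases hj : j ∈ S <;> simp [hj, hq j, hq' j]
      rw [Finset.piecewise_insert, Ex_update]
      have e := Ex_update (S.piecewise q' q) i (q i) g
      rw [show Function.update (S.piecewise q' q) i (q i) = S.piecewise q' q by
        rw [Function.update_eq_self_iff]; simp [hi]] at e
      rw [e]
      have := Ex_mono hA (fun ω => mono_update hg i ω)
      nlinarith [h i]
  simpa using key Finset.univ

/-- Russo's formula. -/
lemma Ex_hasDerivAt (q : ℝ → ι → ℝ) (q' : ι → ℝ) (p : ℝ)
    (hq : ∀ i, HasDerivAt (fun t => q t i) (q' i) p) (g : (ι → Bool) → ℝ) :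
    HasDerivAt (fun t => Ex (q t) g)
      (∑ i, q' i * (Ex (q p) (fun ω => g (Function.update ω i true)) -
        Ex (q p) (fun ω => g (Function.update ω i false)))) p := by
  have h1 : ∀ ω : ι → Bool, ∀ i, HasDerivAt (fun t => w1 (q t i) (ω i))
      (if ω i then q' i else - q' i) p := by
    intro ω i
    unfold w1
    split_ifs
    · exact hq i
    · exact (hq i).const_sub 1
  have h2 : ∀ ω : ι → Bool, HasDerivAt (fun t => wt (q t) ω)
      (∑ i, (∏ j ∈ Finset.univ.erase i, w1 (q p j) (ω j)) * (if ω i then q' i else - q' i)) p := by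
    intro ω
    have := HasDerivAt.fun_finsetProd (u := Finset.univ) (fun i _ => h1 ω i)
    simpa [wt, smul_eq_mul] using this
  have h3 : HasDerivAt (fun t => Ex (q t) g) (∑ ω : ι → Bool,
      (∑ i, (∏ j ∈ Finset.univ.erase i, w1 (q p j) (ω j)) * (if ω i then q' i else - q' i)) * g ω) p := by
    unfold Ex
    exact HasDerivAt.fun_sum fun ω _ => (h2 ω).mul_const _
  convert h3 using 1
  simp only [Finset.sum_mul]
  rw [Finset.sum_comm]
  refine Finset.sum_congr rfl fun i _ => ?_
  have := sum_split (q p) i (fun b => if b then q' i else - q' i) g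
  rw [this]; simp; ring

/-! ### The OSSS inequality -/

/-- Influence with resampling. -/
def Infl (q : ι → ℝ) (i : ι) (F : (ι → Bool) → ℝ) : ℝ :=
  ∑ b, w1 (q i) b * Ex q (fun ω => |F (Function.update ω i b) - F ω|)

lemma Infl_nonneg {q : ι → ℝ} (hq : Adm q) (i F) : 0 ≤ Infl q i F :=
  Finset.sum_nonneg fun b _ => mul_nonneg (w1_nonneg (hq i) b) (Ex_nonneg hq fun _ => abs_nonneg _)

lemma Infl_mono {q : ι → ℝ} (i : ι) {F : (ι → Bool) → ℝ} (hF : Monotone F) :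
    Infl q i F = 2 * (q i * (1 - q i)) * (Ex q (fun ω => F (Function.update ω i true)) -
      Ex q (fun ω => F (Function.update ω i false))) := by
  have hm := fun ω => mono_update hF i ω
  have e : ∀ ω, |F (Function.update ω i false) - F (Function.update ω i true)| =
      F (Function.update ω i true) - F (Function.update ω i false) := fun ω => by
    rw [abs_sub_comm, abs_of_nonneg (by linarith [hm ω])]
  have e' : ∀ ω, |F (Function.update ω i true) - F (Function.update ω i false)| =
      F (Function.update ω i true) - F (Function.update ω i false) := fun ω => by
    rw [abs_of_nonneg (by linarith [hm ω])]
  have : ∀ b, Ex q (fun ω => |F (Function.update ω i b) - F ω|) = ∑ b', w1 (q i) b' *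
      Ex q (fun ω => |F (Function.update ω i b) - F (Function.update ω i b')|) := by
    intro b
    rw [Ex_split q i]
    simp
  unfold Infl
  simp only [this, Fintype.sum_bool, w1, if_true, Bool.false_eq_true, if_false, e, e', sub_self, abs_zero,
    Ex_const, Ex_sub]
  ring

open Classical in
/-- The hybrid configuration along an exploration `nxt`. -/
def hyb (nxt : Finset ι → (ι → Bool) → Option ι) :
    ℕ → Finset ι → (ι → Bool) → (ι → Bool) → (ι → Bool)
  | 0, _, _, Y => Y
  | t+1, S, X, Y => match nxt S X with
    | none => Y
    | some i => Function.update (hyb nxt t (insert i S) X Y) i (X i)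

variable {nxt : Finset ι → (ι → Bool) → Option ι}

/-- Restrict a function to a prescribed next query. -/
def onNext (nxt : Finset ι → (ι → Bool) → Option ι) (S : Finset ι) (o : Option ι)
    (a : (ι → Bool) → ℝ) (X : ι → Bool) : ℝ := if nxt S X = o then a X else 0

lemma onNext_sum (S : Finset ι) (a : (ι → Bool) → ℝ) (X) : ∑ o, onNext nxt S o a X = a X := by
  simp [onNext]

lemma onNext_dep (h1 : ∀ S, DependsOn (nxt S) (S : Set ι)) {S : Finset ι} {o : Option ι}
    {a : (ι → Bool) → ℝ} (ha : DependsOn a (S : Set ι)) : DependsOn (onNext nxt S o a) (S : Set ι) := by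
  intro x y hxy
  simp only [onNext]
  rw [h1 S hxy, ha hxy]

lemma hyb_law (q : ι → ℝ) (h1 : ∀ S, DependsOn (nxt S) (S : Set ι))
    (h2 : ∀ S X i, nxt S X = some i → i ∉ S) (t : ℕ) (S : Finset ι) (a F : (ι → Bool) → ℝ)
    (ha : DependsOn a (S : Set ι)) :
    Ex q (fun X => Ex q (fun Y => a X * F (hyb nxt t S X Y))) = Ex q a * Ex q F := by
  induction t generalizing S a F with
  | zero => 
    simp only [hyb, Ex_smul]
    simp only [mul_comm _ (Ex q F), Ex_smul]
  | succ t ih =>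
    have e0 : Ex q (fun X => Ex q (fun Y => a X * F (hyb nxt (t+1) S X Y))) =
        ∑ o, Ex q (fun X => Ex q (fun Y => onNext nxt S o a X * F (hyb nxt (t+1) S X Y))) := by
      rw [← Ex_sum]; congr 1; ext X
      rw [← Ex_sum]; congr 1; ext Y
      rw [← Finset.sum_mul, onNext_sum]
    have e1 : Ex q a = ∑ o, Ex q (onNext nxt S o a) := by
      rw [← Ex_sum]; congr 1; ext X; rw [onNext_sum]
    rw [e0, e1, Finset.sum_mul]
    refine Finset.sum_congr rfl fun o _ => ?_
    have hao := onNext_dep (o := o) h1 ha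
    cases o with
    | none =>
      have : ∀ X Y, onNext nxt S none a X * F (hyb nxt (t+1) S X Y) = onNext nxt S none a X * F Y := by
        intro X Y
        unfold onNext
        split_ifs with h
        · simp [hyb, h]
        · simp
      simp only [this, Ex_smul]
      simp only [mul_comm _ (Ex q F), Ex_smul]
    | some i =>
      by_cases hi : i ∈ S
      · have : onNext nxt S (some i) a = fun _ => 0 := by
          ext X; unfold onNext; rw [if_neg]; exact fun h => h2 S X i h hi
        simp [this, Ex_const]
      set a' := onNext nxt S (some i) a with ha'
      have e2 : ∀ X Y, a' X * F (hyb nxt (t+1) S X Y) = ∑ b, (a' X * (if X i = b then 1 else 0)) *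
          F (Function.update (hyb nxt t (insert i S) X Y) i b) := by
        intro X Y
        rw [ha']; unfold onNext
        split_ifs with h
        · simp [hyb, h]
        · simp
      have dep : ∀ b, DependsOn (fun X => a' X * (if X i = b then (1:ℝ) else 0)) ((insert i S : Finset ι) : Set ι) := by
        intro b x y hxy
        simp only
        rw [hxy i (by simp), hao (fun j hj => hxy j (by simp; right; exact hj))]
      simp only [e2]
      have : ∀ b, Ex q (fun X => a' X * (if X i = b then (1:ℝ) else 0)) = Ex q a' * w1 (q i) b := by
        intro b
        rw [Ex_mul_indep q S hao]
        · congr 1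
          rw [Ex_split q i]
          cases b <;> simp [Ex_const]
        · intro x y hxy
          simp only
          rw [hxy i (by simpa using hi)]
      rw [show (fun X => Ex q fun Y => ∑ b, (a' X * (if X i = b then (1:ℝ) else 0)) *
          F (Function.update (hyb nxt t (insert i S) X Y) i b)) = fun X => ∑ b, Ex q fun Y =>
          (a' X * (if X i = b then (1:ℝ) else 0)) *
          F (Function.update (hyb nxt t (insert i S) X Y) i b) from funext fun X => Ex_sum _ _ _]
      rw [Ex_sum]
      have e3 := fun b => ih (insert i S) _ (fun Z => F (Function.update Z i b)) (dep b)
      simp only [e3, this]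
      rw [Ex_split q i F, Finset.mul_sum]
      exact Finset.sum_congr rfl fun b _ => by ring

lemma hyb_diff {q : ι → ℝ} (hq : Adm q) (h1 : ∀ S, DependsOn (nxt S) (S : Set ι))
    (h2 : ∀ S X i, nxt S X = some i → i ∉ S) (D : ι → (ι → Bool) → ℝ) (hD0 : ∀ i X, 0 ≤ D i X)
    (hD : ∀ S X i, nxt S X = some i → D i X = 1)
    (f F : (ι → Bool) → ℝ) (hf : ∀ X, |f X| ≤ 1) (t : ℕ) (S : Finset ι) (a : (ι → Bool) → ℝ)
    (ha : DependsOn a (S : Set ι)) (ha0 : ∀ X, 0 ≤ a X) :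
    |Ex q (fun X => Ex q (fun Y => a X * f X * (F (hyb nxt t S X Y) - F Y)))| ≤
      ∑ i ∈ Sᶜ, Ex q (fun X => a X * D i X) * Infl q i F := by
  induction t generalizing S a with
  | zero =>
    simp only [hyb, sub_self, mul_zero, Ex_const, abs_zero]
    exact Finset.sum_nonneg fun i _ => mul_nonneg (Ex_nonneg hq fun X => mul_nonneg (ha0 X) (hD0 i X))
      (Infl_nonneg hq _ _)
  | succ t ih =>
    have e0 : Ex q (fun X => Ex q (fun Y => a X * f X * (F (hyb nxt (t+1) S X Y) - F Y))) =
        ∑ o, Ex q (fun X => Ex q (fun Y => onNext nxt S o a X * f X * (F (hyb nxt (t+1) S X Y) - F Y))) := by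
      rw [← Ex_sum]; congr 1; ext X
      rw [← Ex_sum]; congr 1; ext Y
      rw [← Finset.sum_mul, ← Finset.sum_mul, onNext_sum]
    have e1 : ∑ i ∈ Sᶜ, Ex q (fun X => a X * D i X) * Infl q i F =
        ∑ o, ∑ i ∈ Sᶜ, Ex q (fun X => onNext nxt S o a X * D i X) * Infl q i F := by
      rw [Finset.sum_comm]
      refine Finset.sum_congr rfl fun i _ => ?_
      rw [← Finset.sum_mul, ← Ex_sum]; congr 2; ext X
      rw [← Finset.sum_mul, onNext_sum]
    rw [e0, e1]
    refine (Finset.abs_sum_le_sum_abs _ _).trans (Finset.sum_le_sum fun o _ => ?_)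
    have hao := onNext_dep (o := o) h1 ha
    have hao0 : ∀ X, 0 ≤ onNext nxt S o a X := fun X => by
      unfold onNext; split_ifs <;> simp [ha0]
    cases o with
    | none =>
      have : ∀ X Y, onNext nxt S none a X * f X * (F (hyb nxt (t+1) S X Y) - F Y) = 0 := by
        intro X Y
        unfold onNext
        split_ifs with h
        · simp [hyb, h]
        · simp
      simp only [this, Ex_const, abs_zero]
      exact Finset.sum_nonneg fun i _ => mul_nonneg (Ex_nonneg hq fun X => mul_nonneg (hao0 X) (hD0 i X))
        (Infl_nonneg hq _ _)
    | some i =>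
      by_cases hi : i ∈ S
      · have : onNext nxt S (some i) a = fun _ => 0 := by
          ext X; unfold onNext; rw [if_neg]; exact fun h => h2 S X i h hi
        simp [this, Ex_const]
      set a' := onNext nxt S (some i) a with ha'
      have hsub : (↑S : Set ι) ⊆ ((insert i S : Finset ι) : Set ι) := by simp
      have e2 : ∀ X Y, a' X * f X * (F (hyb nxt (t+1) S X Y) - F Y) =
          a' X * f X * (F (Function.update (hyb nxt t (insert i S) X Y) i (X i)) - F (hyb nxt t (insert i S) X Y))
          + a' X * f X * (F (hyb nxt t (insert i S) X Y) - F Y) := by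
        intro X Y
        rw [ha']; unfold onNext
        split_ifs with h
        · simp only [hyb, h]; ring
        · simp
      simp only [e2, Ex_add]
      have b2 := ih (insert i S) a' (hao.mono hsub) hao0
      have b1 : |Ex q (fun X => Ex q (fun Y => a' X * f X *
          (F (Function.update (hyb nxt t (insert i S) X Y) i (X i)) - F (hyb nxt t (insert i S) X Y))))| ≤
          Ex q a' * Infl q i F := by
        refine (Ex_abs hq _).trans ((Ex_mono hq fun X => Ex_abs hq _).trans ?_)
        have e3 : ∀ X Y, |a' X * f X *
          (F (Function.update (hyb nxt t (insert i S) X Y) i (X i)) - F (hyb nxt t (insert i S) X Y))| ≤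
          ∑ b, (a' X * (if X i = b then 1 else 0)) *
            |F (Function.update (hyb nxt t (insert i S) X Y) i b) - F (hyb nxt t (insert i S) X Y)| := by
          intro X Y
          have : ∑ b, (a' X * (if X i = b then 1 else 0)) *
            |F (Function.update (hyb nxt t (insert i S) X Y) i b) - F (hyb nxt t (insert i S) X Y)| =
            a' X * |F (Function.update (hyb nxt t (insert i S) X Y) i (X i)) - F (hyb nxt t (insert i S) X Y)| := by
            simp only [mul_ite, mul_one, mul_zero, ite_mul, zero_mul, Finset.sum_ite_eq, Finset.mem_univ, if_true]
          rw [this, abs_mul, abs_mul, abs_of_nonneg (hao0 X)]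
          have := hf X
          have h0 := hao0 X
          have := abs_nonneg (F (Function.update (hyb nxt t (insert i S) X Y) i (X i)) - F (hyb nxt t (insert i S) X Y))
          gcongr
          nlinarith
        refine (Ex_mono hq fun X => Ex_mono hq fun Y => e3 X Y).trans (le_of_eq ?_)
        have dep : ∀ b, DependsOn (fun X => a' X * (if X i = b then (1:ℝ) else 0)) ((insert i S : Finset ι) : Set ι) := by
          intro b x y hxy
          simp only
          rw [hxy i (by simp), hao (fun j hj => hxy j (by simp; right; exact hj))]
        have this : ∀ b, Ex q (fun X => a' X * (if X i = b then (1:ℝ) else 0)) = Ex q a' * w1 (q i) b := by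
          intro b
          rw [Ex_mul_indep q S hao]
          · congr 1
            rw [Ex_split q i]
            cases b <;> simp [Ex_const]
          · intro x y hxy
            simp only
            rw [hxy i (by simpa using hi)]
        simp only [Ex_sum]
        have e3 := fun b => hyb_law q h1 h2 t (insert i S) _
          (fun Z => |F (Function.update Z i b) - F Z|) (dep b)
        simp only [e3, this]
        unfold Infl
        rw [Finset.mul_sum]
        exact Finset.sum_congr rfl fun b _ => by ring
      refine (abs_add_le _ _).trans ((add_le_add b1 b2).trans ?_)
      have hc : Sᶜ = insert i (insert i S)ᶜ := by
        ext j; simp; by_cases h : j = i <;> simp [h, hi]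
      rw [hc, Finset.sum_insert (by simp)]
      have : Ex q (fun X => a' X * D i X) = Ex q a' := by
        congr 1; ext X
        rw [ha']; unfold onNext
        split_ifs with h
        · rw [hD S X i h, mul_one]
        · simp
      rw [this]

lemma hyb_agree (h2 : ∀ S X i, nxt S X = some i → i ∉ S) (X Y : ι → Bool) (t : ℕ) (S : Finset ι)
    (ht : Sᶜ.card ≤ t) : ∃ S' : Finset ι, nxt S' X = none ∧ ∀ j ∈ S', j ∉ S → hyb nxt t S X Y j = X j := by
  induction t generalizing S with
  | zero =>
    refine ⟨S, ?_, fun j h1 h2 => absurd h1 h2⟩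
    have : S = Finset.univ := by simpa using ht
    cases h : nxt S X with
    | none => rfl
    | some i => exact absurd (this ▸ Finset.mem_univ i) (h2 S X i h)
  | succ t ih =>
    cases h : nxt S X with
    | none => exact ⟨S, h, fun j h1 h2 => absurd h1 h2⟩
    | some i =>
      have hi := h2 S X i h
      have hc : Sᶜ = insert i (insert i S)ᶜ := by
        ext j; simp; by_cases h : j = i <;> simp [h, hi]
      have hcard : (insert i S)ᶜ.card ≤ t := by
        rw [hc, Finset.card_insert_of_notMem (by simp)] at ht; omega
      obtain ⟨S', hS', hag⟩ := ih (insert i S) hcard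
      refine ⟨S', hS', fun j hj hjS => ?_⟩
      simp only [hyb, h]
      by_cases hji : j = i
      · subst hji; simp
      · rw [Function.update_of_ne hji]
        exact hag j hj (by simp [hji, hjS])

/-- The OSSS inequality for an exploration revealing only coordinates in `D`. -/
lemma osss {q : ι → ℝ} (hq : Adm q) (h1 : ∀ S, DependsOn (nxt S) (S : Set ι))
    (h2 : ∀ S X i, nxt S X = some i → i ∉ S) (D : ι → (ι → Bool) → ℝ) (hD0 : ∀ i X, 0 ≤ D i X)
    (hD : ∀ S X i, nxt S X = some i → D i X = 1) (g : (ι → Bool) → ℝ) (hg : ∀ X, |g X| ≤ 1)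
    (hdet : ∀ S X, nxt S X = none → ∀ Z, (∀ j ∈ S, Z j = X j) → g Z = g X) :
    Ex q (fun X => g X * g X) - Ex q g * Ex q g ≤ ∑ i, Ex q (D i) * Infl q i g := by
  have := hyb_diff hq h1 h2 D hD0 hD g g hg (Finset.univ : Finset ι).card ∅ (fun _ => 1)
    (fun _ _ _ => rfl) (fun _ => zero_le_one)
  simp only [one_mul, Finset.compl_empty] at this
  refine le_trans (le_of_eq ?_) ((le_abs_self _).trans this)
  have e : ∀ X Y, g (hyb nxt (Finset.univ : Finset ι).card ∅ X Y) = g X := by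
    intro X Y
    obtain ⟨S', hS', hag⟩ := hyb_agree h2 X Y (Finset.univ : Finset ι).card ∅ (by simp)
    exact hdet S' X hS' _ (fun j hj => hag j hj (by simp))
  simp only [e, mul_sub, Ex_sub, Ex_const, Ex_smul]
  congr 1
  simp only [mul_comm _ (Ex q g), Ex_smul]

end prod

section prob
variable {ι : Type*} [Fintype ι] [DecidableEq ι]

/-- Probability of an event under the product Bernoulli law. -/
def Pr (q : ι → ℝ) (E : Set (ι → Bool)) : ℝ := Ex q (E.indicator fun _ => 1)

/-- The event is determined by the coordinates in `S`. -/
def EvDep (E : Set (ι → Bool)) (S : Set ι) : Prop := ∀ x y : ι → Bool, (∀ i ∈ S, x i = y i) → (x ∈ E ↔ y ∈ E)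

variable {q : ι → ℝ} {E F : Set (ι → Bool)}

lemma Pr_nonneg (hq : Adm q) (E : Set (ι → Bool)) : 0 ≤ Pr q E :=
  Ex_nonneg hq fun _ => indicator_nonneg (fun _ _ => zero_le_one) _
lemma Pr_mono (hq : Adm q) (h : E ⊆ F) : Pr q E ≤ Pr q F :=
  Ex_mono hq fun _ => indicator_le_indicator_of_subset h (fun _ => zero_le_one) _
lemma Pr_univ : Pr q univ = 1 := by rw [Pr, indicator_univ, Ex_const]
lemma Pr_le_one (hq : Adm q) (E : Set (ι → Bool)) : Pr q E ≤ 1 := (Pr_mono hq (subset_univ E)).trans_eq Pr_univ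
lemma Pr_compl : Pr q Eᶜ = 1 - Pr q E := by
  unfold Pr
  rw [← Ex_const q 1, ← Ex_sub]
  congr 1; ext ω; by_cases h : ω ∈ E <;> simp [h, Ex_const]
lemma Pr_union_le (hq : Adm q) : Pr q (E ∪ F) ≤ Pr q E + Pr q F := by
  unfold Pr
  rw [← Ex_add]
  refine Ex_mono hq fun ω => ?_
  by_cases h : ω ∈ E <;> by_cases h' : ω ∈ F <;> simp [h, h']
lemma Pr_mul (q : ι → ℝ) (E F) : Pr q (E ∩ F) =
    Ex q (fun ω => E.indicator (fun _ => 1) ω * F.indicator (fun _ => 1) ω) := by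
  unfold Pr; congr 1; ext ω
  by_cases h : ω ∈ E <;> by_cases h' : ω ∈ F <;> simp [h, h']
lemma indicator_monotone (hE : IsUpperSet E) : Monotone (E.indicator fun _ => (1:ℝ)) := by
  intro a b hab
  by_cases h : a ∈ E
  · simp [h, hE hab h]
  · simp only [h, not_false_iff, indicator_of_notMem]; exact indicator_nonneg (by simp) _
lemma Pr_fkg (hq : Adm q) (hE : IsUpperSet E) (hF : IsUpperSet F) : Pr q E * Pr q F ≤ Pr q (E ∩ F) := by
  rw [Pr_mul]
  exact Ex_fkg hq (fun _ => indicator_nonneg (by simp) _) (fun _ => indicator_nonneg (by simp) _)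
    (indicator_monotone hE) (indicator_monotone hF)
lemma EvDep.indicator {S : Set ι} (h : EvDep E S) : DependsOn (E.indicator fun _ => (1:ℝ)) S := by
  intro x y hxy
  have := h x y hxy
  by_cases hx : x ∈ E
  · simp [hx, this.1 hx]
  · rw [indicator_of_notMem hx, indicator_of_notMem fun hy => hx (this.2 hy)]
lemma EvDep.mono {S T : Set ι} (h : EvDep E S) (hST : S ⊆ T) : EvDep E T :=
  fun x y hxy => h x y fun i hi => hxy i (hST hi)
lemma Pr_indep {S T : Set ι} (hE : EvDep E S) (hF : EvDep F T) (hST : Disjoint S T) :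
    Pr q (E ∩ F) = Pr q E * Pr q F := by
  classical
  rw [Pr_mul]
  refine Ex_mul_indep q S.toFinset (by simpa using hE.indicator) ?_
  have : T ⊆ ((S.toFinset : Finset ι) : Set ι)ᶜ := by
    intro i hi h; simp at h; exact hST.le_bot ⟨h, hi⟩
  exact (hF.mono this).indicator

lemma Pr_mono_param {q q' : ι → ℝ} (hq : Adm q) (hq' : Adm q') (h : ∀ i, q i ≤ q' i)
    (hE : IsUpperSet E) : Pr q E ≤ Pr q' E := Ex_mono_param hq hq' h (indicator_monotone hE)

lemma Pr_congr_symm (q : ι → ℝ) (σ : (ι → Bool) ≃ (ι → Bool)) (hσ : ∀ ω, wt q (σ ω) = wt q ω)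
    (E : Set (ι → Bool)) : Pr q (σ ⁻¹' E) = Pr q E :=
  Ex_congr_symm q σ hσ (E.indicator fun _ => 1)

/-- An exploration with the properties needed for the OSSS inequality. -/
structure Explore (E : Set (ι → Bool)) (D : ι → Set (ι → Bool)) where
  nxt : Finset ι → (ι → Bool) → Option ι
  dep : ∀ S, DependsOn (nxt S) (S : Set ι)
  fresh : ∀ S X i, nxt S X = some i → i ∉ S
  rev : ∀ S X i, nxt S X = some i → X ∈ D i
  det : ∀ S X, nxt S X = none → ∀ Z, (∀ j ∈ S, Z j = X j) → (Z ∈ E ↔ X ∈ E)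

lemma osss_avg (hq : Adm q) (hE : IsUpperSet E) {N : ℕ} (hN : 0 < N) (D : ℕ → ι → Set (ι → Bool))
    (ex : ∀ k < N, Nonempty (Explore E (D k))) {Δ : ℝ}
    (hΔ : ∀ i, ∑ k ∈ Finset.range N, Pr q (D k i) ≤ N * Δ) :
    Pr q E * (1 - Pr q E) ≤ Δ * ∑ i, 2 * (q i * (1 - q i)) *
      (Ex q (fun ω => E.indicator (fun _ => 1) (Function.update ω i true)) -
       Ex q (fun ω => E.indicator (fun _ => 1) (Function.update ω i false))) := by
  set g : (ι → Bool) → ℝ := E.indicator fun _ => 1 with hg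
  have h1 : ∀ k < N, Pr q E * (1 - Pr q E) ≤ ∑ i, Pr q (D k i) * Infl q i g := by
    intro k hk
    obtain ⟨e⟩ := ex k hk
    have := osss hq e.dep e.fresh (fun i => (D k i).indicator fun _ => 1)
      (fun i X => indicator_nonneg (by simp) _) (fun S X i h => by simp [e.rev S X i h]) g
      (fun X => by by_cases h : X ∈ E <;> simp [hg, h])
      (fun S X h Z hZ => by
        have := e.det S X h Z hZ
        by_cases hx : X ∈ E
        · simp [hg, hx, this.2 hx]
        · rw [hg, indicator_of_notMem hx, indicator_of_notMem fun hy => hx (this.1 hy)])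
    refine le_trans (le_of_eq ?_) this
    have e : (fun X => g X * g X) = g := by
      ext X; by_cases h : X ∈ E <;> simp [hg, h]
    rw [e]; simp only [Pr, ← hg]; ring
  have h2 : (N:ℝ) * (Pr q E * (1 - Pr q E)) ≤ N * (Δ * ∑ i, Infl q i g) := by
    calc (N:ℝ) * (Pr q E * (1 - Pr q E)) = ∑ k ∈ Finset.range N, Pr q E * (1 - Pr q E) := by simp
      _ ≤ ∑ k ∈ Finset.range N, ∑ i, Pr q (D k i) * Infl q i g :=
        Finset.sum_le_sum fun k hk => h1 k (Finset.mem_range.1 hk)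
      _ = ∑ i, (∑ k ∈ Finset.range N, Pr q (D k i)) * Infl q i g := by
        rw [Finset.sum_comm]; simp only [Finset.sum_mul]
      _ ≤ ∑ i, (N * Δ) * Infl q i g :=
        Finset.sum_le_sum fun i _ => mul_le_mul_of_nonneg_right (hΔ i) (Infl_nonneg hq i g)
      _ = _ := by rw [← Finset.mul_sum]; ring
  have h3 := le_of_mul_le_mul_left h2 (by exact_mod_cast hN)
  refine h3.trans_eq ?_
  congr 1
  exact Finset.sum_congr rfl fun i _ => Infl_mono i (indicator_monotone hE)

/-- Sharp threshold from small average revealment. -/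
lemma sharp_threshold (Q : ℝ → ι → ℝ) (Q' : ℝ → ι → ℝ) {p0 p1 Δ : ℝ} (hp : p0 ≤ p1) (hΔ0 : 0 < Δ)
    (hQ : ∀ p ∈ Icc p0 p1, Adm (Q p))
    (hd : ∀ p ∈ Icc p0 p1, ∀ i, HasDerivAt (fun t => Q t i) (Q' p i) p)
    (hv : ∀ p ∈ Icc p0 p1, ∀ i, Q p i * (1 - Q p i) ≤ Q' p i)
    (hm : ∀ p ∈ Icc p0 p1, ∀ i, Q p0 i ≤ Q p i)
    (hE : IsUpperSet E) {N : ℕ} (hN : 0 < N) (D : ℕ → ι → Set (ι → Bool))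
    (ex : ∀ k < N, Nonempty (Explore E (D k)))
    (hΔ : ∀ p ∈ Icc p0 p1, ∀ i, ∑ k ∈ Finset.range N, Pr (Q p) (D k i) ≤ N * Δ) :
    1 - Pr (Q p1) E ≤ Real.exp (-(Pr (Q p0) E * (p1 - p0) / (2 * Δ))) := by
  set g : (ι → Bool) → ℝ := E.indicator fun _ => 1 with hg
  set F' : ℝ → ℝ := fun p => ∑ i, Q' p i * (Ex (Q p) (fun ω => g (Function.update ω i true)) -
        Ex (Q p) (fun ω => g (Function.update ω i false)))
  have hF : ∀ p ∈ Icc p0 p1, HasDerivAt (fun t => Pr (Q t) E) (F' p) p := fun p h =>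
    Ex_hasDerivAt Q (Q' p) p (hd p h) g
  have hF' : ∀ p ∈ Icc p0 p1, Pr (Q p0) E * (1 - Pr (Q p) E) ≤ 2 * Δ * F' p := by
    intro p h
    have a1 := osss_avg (hQ p h) hE hN D ex (hΔ p h)
    have a2 := Pr_mono_param (hQ p0 ⟨le_rfl, hp⟩) (hQ p h) (hm p h) hE
    have a3 := Pr_le_one (hQ p h) E
    calc _ ≤ Pr (Q p) E * (1 - Pr (Q p) E) := mul_le_mul_of_nonneg_right a2 (by linarith)
      _ ≤ _ := a1
      _ ≤ Δ * ∑ i, 2 * Q' p i * (Ex (Q p) (fun ω => g (Function.update ω i true)) -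
        Ex (Q p) (fun ω => g (Function.update ω i false))) := by
          refine mul_le_mul_of_nonneg_left (Finset.sum_le_sum fun i _ => ?_) hΔ0.le
          refine mul_le_mul_of_nonneg_right (by linarith [hv p h i]) ?_
          exact sub_nonneg.2 (Ex_mono (hQ p h) fun ω => mono_update (indicator_monotone hE) i ω)
      _ = 2 * Δ * F' p := by
          simp only [F']; rw [Finset.mul_sum, Finset.mul_sum]
          exact Finset.sum_congr rfl fun i _ => by ring
  set c := Pr (Q p0) E / (2 * Δ) with hc
  set G : ℝ → ℝ := fun p => (1 - Pr (Q p) E) * Real.exp (c * (p - p0))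
  have hG : ∀ p ∈ Icc p0 p1, HasDerivAt G (-F' p * Real.exp (c * (p - p0)) +
      (1 - Pr (Q p) E) * (Real.exp (c * (p - p0)) * c)) p := by
    intro p h
    have e1 : HasDerivAt (fun t => c * (t - p0)) c p := by
      simpa using ((hasDerivAt_id p).sub_const p0).const_mul c
    exact ((hF p h).const_sub 1).mul e1.exp
  have hanti : AntitoneOn G (Icc p0 p1) := by
    refine antitoneOn_of_deriv_nonpos (convex_Icc _ _)
      (fun p h => (hG p h).continuousAt.continuousWithinAt)
      (fun p h => (hG p (interior_subset h)).differentiableAt.differentiableWithinAt) fun p h => ?_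
    have h := interior_subset h
    rw [(hG p h).deriv]
    have a := hF' p h
    have : (1 - Pr (Q p) E) * c ≤ F' p := by
      rw [hc, mul_div_assoc', div_le_iff₀ (by positivity)]; linarith
    nlinarith [Real.exp_pos (c * (p - p0))]
  have := hanti ⟨le_rfl, hp⟩ ⟨hp, le_rfl⟩ hp
  simp only [G, sub_self, mul_zero, Real.exp_zero, mul_one] at this
  have h0 := Pr_nonneg (hQ p0 ⟨le_rfl, hp⟩) E
  have e : c * (p1 - p0) = Pr (Q p0) E * (p1 - p0) / (2 * Δ) := by rw [hc]; ring
  rw [e] at this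
  rw [Real.exp_neg, ← one_div, le_div_iff₀ (Real.exp_pos _)]
  linarith

end prob

/-! ### Abstract percolation laws -/

/-- An event is determined by the sites of `U`. -/
def SetDep (A : Set (Set Z2)) (U : Set Z2) : Prop :=
  ∀ B B' : Set Z2, (∀ v ∈ U, v ∈ B ↔ v ∈ B') → (B ∈ A ↔ B' ∈ A)

/-- The sup-ball window. -/
def Win (o : Z2) (N : ℤ) : Set Z2 := Box (o.1 - N) (o.1 + N) (o.2 - N) (o.2 + N)

/-- The event that some site of `S` is joined to some site of `T` inside `W`. -/
def Ev (W S T : Set Z2) : Set (Set Z2) := {B | ∃ a b, a ∈ S ∧ b ∈ T ∧ Conn king (B ∩ W) a b}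

lemma Ev_upper (W S T) : IsUpperSet (Ev W S T) := by
  rintro B B' h ⟨a, b, ha, hb, hc⟩
  exact ⟨a, b, ha, hb, hc.mono (inter_subset_inter_left _ h)⟩

lemma Ev_mono {W S T W' S' T'} (hW : W ⊆ W') (hS : S ⊆ S') (hT : T ⊆ T') : Ev W S T ⊆ Ev W' S' T' := by
  rintro B ⟨a, b, ha, hb, hc⟩
  exact ⟨a, b, hS ha, hT hb, hc.mono (inter_subset_inter_right _ hW)⟩

lemma Ev_dep (W S T) : SetDep (Ev W S T) W := by
  have : ∀ B B' : Set Z2, (∀ v ∈ W, v ∈ B ↔ v ∈ B') → B ∈ Ev W S T → B' ∈ Ev W S T := by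
    rintro B B' h ⟨a, b, ha, hb, hc⟩
    exact ⟨a, b, ha, hb, hc.mono fun p hp => ⟨(h p hp.2).1 hp.1, hp.2⟩⟩
  exact fun B B' h => ⟨this B B' h, this B' B fun v hv => (h v hv).symm⟩

lemma SetDep.mono {A U V} (h : SetDep A U) (hUV : U ⊆ V) : SetDep A V :=
  fun B B' hB => h B B' fun v hv => hB v (hUV hv)
lemma SetDep.inter {A A' U} (h : SetDep A U) (h' : SetDep A' U) : SetDep (A ∩ A') U :=
  fun B B' hB => and_congr (h B B' hB) (h' B B' hB)
lemma SetDep.compl {A U} (h : SetDep A U) : SetDep Aᶜ U :=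
  fun B B' hB => not_congr (h B B' hB)

/-- Left-right crossing event. -/
def EH (x0 x1 y0 y1 : ℤ) : Set (Set Z2) := Ev (Box x0 x1 y0 y1) {p | p.1 = x0} {p | p.1 = x1}
/-- Bottom-top crossing event. -/
def EV (x0 x1 y0 y1 : ℤ) : Set (Set Z2) := Ev (Box x0 x1 y0 y1) {p | p.2 = y0} {p | p.2 = y1}

/-- A translation invariant, symmetric, positively associated law on subsets of the lattice with
finite range `r`, independence inside windows of radius `N`, and square crossings. -/
structure Perc where
  P : Set (Set Z2) → ℝ
  r : ℤ
  N : ℤ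
  nonneg : ∀ A, 0 ≤ P A
  univ : P univ = 1
  mono : ∀ A A', A ⊆ A' → P A ≤ P A'
  compl : ∀ A, P Aᶜ = 1 - P A
  union : ∀ A A', P (A ∪ A') ≤ P A + P A'
  fkg : ∀ A A', IsUpperSet A → IsUpperSet A' → P A * P A' ≤ P (A ∩ A')
  shift : ∀ (o : Z2) (A), P {B | (fun p => p + o) ⁻¹' B ∈ A} = P A
  swap : ∀ A, P {B | (fun p : Z2 => (p.2, p.1)) ⁻¹' B ∈ A} = P A
  refl : ∀ A, P {B | (fun p : Z2 => (-p.1, p.2)) ⁻¹' B ∈ A} = P A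
  indep : ∀ (A A') (U V : Set Z2) (o : Z2), SetDep A U → SetDep A' V → U ⊆ Win o N → V ⊆ Win o N →
    (∀ u ∈ U, ∀ v ∈ V, 2 * r < |u.1 - v.1| ∨ 2 * r < |u.2 - v.2|) → P (A ∩ A') = P A * P A'
  sq : ∀ x y k : ℤ, 0 ≤ k → 1 / 2 ≤ P (EH x (x + k) y (y + k))

namespace Perc
variable (μ : Perc)

lemma le_one (A) : μ.P A ≤ 1 := (μ.mono _ _ (subset_univ A)).trans_eq μ.univ

lemma fkg' {A A' : Set (Set Z2)} (h : IsUpperSet A) (h' : IsUpperSet A') {x y : ℝ} (hx : 0 ≤ x) (hy : 0 ≤ y)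
    (hA : x ≤ μ.P A) (hA' : y ≤ μ.P A') : x * y ≤ μ.P (A ∩ A') :=
  (mul_le_mul hA hA' hy (hx.trans hA)).trans (μ.fkg _ _ h h')

/-- Lattice symmetries preserving the law. -/
def Sym (f : Z2 → Z2) : Prop :=
  (∀ A, μ.P {B | f ⁻¹' B ∈ A} = μ.P A) ∧ ∀ p q, king p q → king (f p) (f q)

lemma Sym.comp {f g : Z2 → Z2} (hf : μ.Sym f) (hg : μ.Sym g) : μ.Sym (fun p => f (g p)) := by
  refine ⟨fun A => ?_, fun p q h => hf.2 _ _ (hg.2 _ _ h)⟩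
  rw [← hg.1 A, ← hf.1 {B | g ⁻¹' B ∈ A}]
  rfl

lemma sym_shift (o : Z2) : μ.Sym (fun p => p + o) :=
  ⟨μ.shift o, fun _ _ h => by simpa [king] using h⟩
lemma sym_swap : μ.Sym (fun p => (p.2, p.1)) := ⟨μ.swap, fun _ _ h => ⟨h.2, h.1⟩⟩
lemma sym_refl : μ.Sym (fun p => (-p.1, p.2)) := by
  refine ⟨μ.refl, fun p q h => ⟨?_, h.2⟩⟩
  have := h.1
  simp only [abs_le] at this ⊢
  omega
lemma sym_mirror (a : ℤ) : μ.Sym (fun p => (2 * a - p.1, p.2)) := by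
  have := (μ.sym_shift (2 * a, 0)).comp μ μ.sym_refl
  convert this using 2 with p
  ext <;> simp; ring
lemma sym_vmirror (a : ℤ) : μ.Sym (fun p => (p.1, 2 * a - p.2)) :=
  (μ.sym_swap.comp μ (μ.sym_mirror a)).comp μ μ.sym_swap

lemma le_of_sym {f : Z2 → Z2} (hf : μ.Sym f) {W S T W' S' T' : Set Z2} (hW : ∀ p ∈ W, f p ∈ W')
    (hS : ∀ p ∈ W, p ∈ S → f p ∈ S') (hT : ∀ p ∈ W, p ∈ T → f p ∈ T') :
    μ.P (Ev W S T) ≤ μ.P (Ev W' S' T') := by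
  rw [← hf.1]
  refine μ.mono _ _ ?_
  rintro B ⟨a, b, ha, hb, hc⟩
  exact ⟨f a, f b, hS _ hc.left_mem.2 ha, hT _ hc.right_mem.2 hb, hc.map hf.2 fun p hp => ⟨hp.1, hW _ hp.2⟩⟩

/-- Horizontal crossing probability of a `w × h` rectangle. -/
def hcr (w h : ℤ) : ℝ := μ.P (EH 0 w 0 h)

lemma hcr_EH {x0 x1 y0 y1 w h : ℤ} (hw : x1 - x0 = w) (hh : y1 - y0 = h) : μ.hcr w h ≤ μ.P (EH x0 x1 y0 y1) := by
  refine μ.le_of_sym (μ.sym_shift (x0, y0)) ?_ ?_ ?_ <;> rintro ⟨x, y⟩ <;>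
  simp only [mem_box, mem_ofPred_eq, Prod.mk_add_mk] <;> omega

lemma EH_hcr {x0 x1 y0 y1 w h : ℤ} (hw : x1 - x0 = w) (hh : y1 - y0 = h) : μ.P (EH x0 x1 y0 y1) ≤ μ.hcr w h := by
  refine μ.le_of_sym (μ.sym_shift (-x0, -y0)) ?_ ?_ ?_ <;> rintro ⟨x, y⟩ <;>
  simp only [mem_box, mem_ofPred_eq, Prod.mk_add_mk] <;> omega

lemma hcr_EV {x0 x1 y0 y1 w h : ℤ} (hw : y1 - y0 = w) (hh : x1 - x0 = h) : μ.hcr w h ≤ μ.P (EV x0 x1 y0 y1) := by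
  refine μ.le_of_sym ((μ.sym_shift (x0, y0)).comp μ μ.sym_swap) ?_ ?_ ?_ <;> rintro ⟨x, y⟩ <;>
  simp only [mem_box, mem_ofPred_eq, Prod.mk_add_mk] <;> omega

lemma EV_hcr {x0 x1 y0 y1 w h : ℤ} (hw : y1 - y0 = w) (hh : x1 - x0 = h) : μ.P (EV x0 x1 y0 y1) ≤ μ.hcr w h := by
  refine μ.le_of_sym (μ.sym_swap.comp μ (μ.sym_shift (-x0, -y0))) ?_ ?_ ?_ <;> rintro ⟨x, y⟩ <;>
  simp only [mem_box, mem_ofPred_eq, Prod.mk_add_mk] <;> omega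

lemma hcr_sq {k : ℤ} (hk : 0 ≤ k) : 1 / 2 ≤ μ.hcr k k := by
  have := μ.sq 0 0 k hk
  simpa [hcr] using this

end Perc

/-- Cut a path crossing a wide range down to a narrower strip, horizontally. -/
lemma cut_h {B W : Set Z2} {a b : Z2} (h : Conn king (B ∩ W) a b) {x0 x1 : ℤ} (hx : x0 < x1)
    (ha : a.1 ≤ x0) (hb : x1 ≤ b.1) {W' : Set Z2} (hW : ∀ p ∈ W, x0 ≤ p.1 → p.1 ≤ x1 → p ∈ W') :
    ∃ a' b', a'.1 = x0 ∧ b'.1 = x1 ∧ Conn king (B ∩ W') a' b' := by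
  obtain ⟨a', b', e, e', hc⟩ := h.cross (fun p => p.1) (fun p q h => h.1) hx ha hb
  exact ⟨a', b', e, e', hc.mono fun p hp => ⟨hp.1.1, hW p hp.1.2 hp.2.1 hp.2.2⟩⟩

lemma cut_v {B W : Set Z2} {a b : Z2} (h : Conn king (B ∩ W) a b) {x0 x1 : ℤ} (hx : x0 < x1)
    (ha : a.2 ≤ x0) (hb : x1 ≤ b.2) {W' : Set Z2} (hW : ∀ p ∈ W, x0 ≤ p.2 → p.2 ≤ x1 → p ∈ W') :
    ∃ a' b', a'.2 = x0 ∧ b'.2 = x1 ∧ Conn king (B ∩ W') a' b' := by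
  obtain ⟨a', b', e, e', hc⟩ := h.cross (fun p => p.2) (fun p q h => h.2) hx ha hb
  exact ⟨a', b', e, e', hc.mono fun p hp => ⟨hp.1.1, hW p hp.1.2 hp.2.1 hp.2.2⟩⟩

/-- Membership-friendly form of `glue_span`. -/
lemma span_boxes {B U V W : Set Z2} {a a' b b' : Z2} (hU : Conn king (B ∩ U) a a')
    (hV : Conn king (B ∩ V) b b') (h1 : ∀ q ∈ V, a.1 ≤ q.1 ∧ q.1 ≤ a'.1)
    (h2 : ∀ p ∈ U, b.2 ≤ p.2 ∧ p.2 ≤ b'.2) (hUW : U ⊆ W) (hVW : V ⊆ W) : Conn king (B ∩ W) a b :=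
  (glue_span hU hV (fun q hq => h1 q hq.2) fun p hp => h2 p hp.2).mono
    (union_subset (inter_subset_inter_right _ hUW) (inter_subset_inter_right _ hVW))

/-- A path from the box of radius `s` to distance `2s` crosses one of the four rectangles of the
annulus in the short direction. -/
lemma cut_annulus {R : Z2 → Z2 → Prop} (hR : ∀ p q, R p q → king p q) {U : Set Z2} {a b : Z2}
    (h : Conn R U a b) (o : Z2) {s : ℤ} (hs : 0 < s) (ha : a ∈ Win o s)
    (hb : 2 * s ≤ |b.1 - o.1| ∨ 2 * s ≤ |b.2 - o.2|) :
    (∃ a' b', a'.1 = o.1 + s ∧ b'.1 = o.1 + 2*s ∧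
      Conn R (U ∩ Box (o.1 + s) (o.1 + 2*s) (o.2 - 2*s) (o.2 + 2*s)) a' b') ∨
    (∃ a' b', a'.1 = o.1 - s ∧ b'.1 = o.1 - 2*s ∧
      Conn R (U ∩ Box (o.1 - 2*s) (o.1 - s) (o.2 - 2*s) (o.2 + 2*s)) a' b') ∨
    (∃ a' b', a'.2 = o.2 + s ∧ b'.2 = o.2 + 2*s ∧
      Conn R (U ∩ Box (o.1 - 2*s) (o.1 + 2*s) (o.2 + s) (o.2 + 2*s)) a' b') ∨
    (∃ a' b', a'.2 = o.2 - s ∧ b'.2 = o.2 - 2*s ∧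
      Conn R (U ∩ Box (o.1 - 2*s) (o.1 + 2*s) (o.2 - 2*s) (o.2 - s)) a' b') := by
  obtain ⟨x, y⟩ := o
  simp only [Win, mem_box] at *
  obtain ⟨a1, b1, e1, e2, h1⟩ := h.cross (fun p => max |p.1 - x| |p.2 - y|)
    (fun p q hpq => by
      have := hR p q hpq
      unfold king at this
      simp only [abs_le] at this
      rw [abs_le]
      constructor <;> simp only [abs, max_def] <;> split_ifs <;> omega)
    (show s < 2*s by omega) (by rw [max_le_iff, abs_le, abs_le]; omega) (by rw [le_max_iff]; exact hb)
  have hm : ∀ p ∈ U ∩ {p : Z2 | s ≤ max |p.1 - x| |p.2 - y| ∧ max |p.1 - x| |p.2 - y| ≤ 2*s},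
      p ∈ U ∧ x - 2*s ≤ p.1 ∧ p.1 ≤ x + 2*s ∧ y - 2*s ≤ p.2 ∧ p.2 ≤ y + 2*s := by
    rintro p ⟨hp, -, h2⟩
    rw [max_le_iff, abs_le, abs_le] at h2
    exact ⟨hp, by omega⟩
  have h1 := h1.mono hm
  have ea : x - s ≤ a1.1 ∧ a1.1 ≤ x + s ∧ y - s ≤ a1.2 ∧ a1.2 ≤ y + s := by
    have := e1.le; rw [max_le_iff, abs_le, abs_le] at this; omega
  have eb : b1.1 = x + 2*s ∨ b1.1 = x - 2*s ∨ b1.2 = y + 2*s ∨ b1.2 = y - 2*s := by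
    rcases le_total |b1.1 - x| |b1.2 - y| with h | h
    · rw [max_eq_right h] at e2
      rcases abs_choice (b1.2 - y) with h' | h' <;> omega
    · rw [max_eq_left h] at e2
      rcases abs_choice (b1.1 - x) with h' | h' <;> omega
  have step1 : ∀ p q, R p q → |(fun p : Z2 => p.1) p - (fun p : Z2 => p.1) q| ≤ 1 := fun p q h => (hR p q h).1
  have step2 : ∀ p q, R p q → |(fun p : Z2 => p.2) p - (fun p : Z2 => p.2) q| ≤ 1 := fun p q h => (hR p q h).2
  have step3 : ∀ p q, R p q → |(fun p : Z2 => -p.1) p - (fun p : Z2 => -p.1) q| ≤ 1 := fun p q h => by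
    have := (hR p q h).1; simp only [abs_le] at this ⊢; omega
  have step4 : ∀ p q, R p q → |(fun p : Z2 => -p.2) p - (fun p : Z2 => -p.2) q| ≤ 1 := fun p q h => by
    have := (hR p q h).2; simp only [abs_le] at this ⊢; omega
  rcases eb with eb | eb | eb | eb
  · obtain ⟨a', b', f1, f2, hc⟩ := h1.cross _ step1 (show x + s < x + 2*s by omega) (by omega) (by omega)
    refine Or.inl ⟨a', b', f1, f2, hc.mono ?_⟩
    rintro p ⟨hp, hp'⟩
    simp only [mem_ofPred_eq] at hp'
    exact ⟨hp.1, by rw [mem_box]; have := hp.2; omega⟩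
  · obtain ⟨a', b', f1, f2, hc⟩ := h1.cross _ step3 (show -x + s < -x + 2*s by omega) (by omega) (by omega)
    refine Or.inr (Or.inl ⟨a', b', by omega, by omega, hc.mono ?_⟩)
    rintro p ⟨hp, hp'⟩
    simp only [mem_ofPred_eq] at hp'
    exact ⟨hp.1, by rw [mem_box]; have := hp.2; omega⟩
  · obtain ⟨a', b', f1, f2, hc⟩ := h1.cross _ step2 (show y + s < y + 2*s by omega) (by omega) (by omega)
    refine Or.inr (Or.inr (Or.inl ⟨a', b', f1, f2, hc.mono ?_⟩))
    rintro p ⟨hp, hp'⟩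
    simp only [mem_ofPred_eq] at hp'
    exact ⟨hp.1, by rw [mem_box]; have := hp.2; omega⟩
  · obtain ⟨a', b', f1, f2, hc⟩ := h1.cross _ step4 (show -y + s < -y + 2*s by omega) (by omega) (by omega)
    refine Or.inr (Or.inr (Or.inr ⟨a', b', by omega, by omega, hc.mono ?_⟩))
    rintro p ⟨hp, hp'⟩
    simp only [mem_ofPred_eq] at hp'
    exact ⟨hp.1, by rw [mem_box]; have := hp.2; omega⟩

/-! ### Russo-Seymour-Welsh theory -/

lemma box_subset {x0 x1 y0 y1 x0' x1' y0' y1' : ℤ} (h1 : x0' ≤ x0) (h2 : x1 ≤ x1') (h3 : y0' ≤ y0) (h4 : y1 ≤ y1') :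
    Box x0 x1 y0 y1 ⊆ Box x0' x1' y0' y1' := fun p hp => by
  rw [mem_box] at *; omega

/-- Mirrored form of `glue_gap`. -/
lemma glue_gap' {U V : Set Z2} {a a' b b' : Z2} {X : ℤ} (hU : Conn king U a a') (hV : Conn king V b b')
    (hUX : ∀ p ∈ U, X ≤ p.1) (hVX : ∀ p ∈ V, X ≤ p.1) (ea : a.1 = X) (ea' : a'.1 = X)
    (hb : ∀ p ∈ U, p.1 ≤ b.1) (eb' : b'.1 = X) (h1 : a.2 ≤ b'.2) (h2 : b'.2 ≤ a'.2) :
    Conn king (U ∪ V) a b := by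
  have hm : ∀ p q : Z2, king p q → king (-p.1, p.2) (-q.1, q.2) := by
    intro p q h
    have := h.1
    refine ⟨?_, h.2⟩
    simp only [abs_le] at this ⊢
    omega
  have hU' := hU.map (V := (fun p : Z2 => (-p.1, p.2)) ⁻¹' U) (f := fun p : Z2 => (-p.1, p.2)) hm (by simp)
  have hV' := hV.map (V := (fun p : Z2 => (-p.1, p.2)) ⁻¹' V) (f := fun p : Z2 => (-p.1, p.2)) hm (by simp)
  have := glue_gap (X := -X) hU' hV' (fun p hp => by have := hUX _ hp; simp at this; omega)
    (fun p hp => by have := hVX _ hp; simp at this; omega) (by simpa) (by simpa)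
    (fun p hp => by have := hb _ hp; simp at this; simp; omega) (by simpa) h1 h2
  have := this.map (f := fun p : Z2 => (-p.1, p.2)) (R' := king) (V := U ∪ V) hm (by
    rintro p (hp | hp)
    · exact Or.inl hp
    · exact Or.inr hp)
  simpa using this

/-- The event of a crossing of the box of radius `s` ending at height in `[α, β]`. -/
def Hs (s α β : ℤ) : Set (Set Z2) :=
  Ev (Box (-s) s (-s) s) {p | p.1 = -s} {p | p.1 = s ∧ α ≤ p.2 ∧ p.2 ≤ β}

lemma Hs_upper (s α β) : IsUpperSet (Hs s α β) := Ev_upper _ _ _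

lemma Hs_mono {s α β α' β' : ℤ} (h : α' ≤ α) (h' : β ≤ β') : Hs s α β ⊆ Hs s α' β' := by
  refine Ev_mono subset_rfl subset_rfl fun p hp => ?_
  simp only [mem_ofPred_eq] at *
  omega

lemma Hs_union (s α : ℤ) : Hs s 0 s ⊆ Hs s 0 α ∪ Hs s α s := by
  rintro B ⟨a, b, ha, ⟨hb, hb1, hb2⟩, hc⟩
  rcases le_total b.2 α with h | h
  · exact Or.inl ⟨a, b, ha, ⟨hb, hb1, h⟩, hc⟩
  · exact Or.inr ⟨a, b, ha, ⟨hb, h, hb2⟩, hc⟩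

/-- A component of the box of radius `s` touching both vertical sides at heights beyond `±α`. -/
def Xs (s α : ℤ) (o : Z2) : Set (Set Z2) :=
  {B | ∃ a b c d : Z2, a.1 = o.1 + s ∧ a.2 ≤ o.2 - α ∧ b.1 = o.1 + s ∧ o.2 + α ≤ b.2 ∧
    c.1 = o.1 - s ∧ c.2 ≤ o.2 - α ∧ d.1 = o.1 - s ∧ o.2 + α ≤ d.2 ∧
    Conn king (B ∩ Box (o.1 - s) (o.1 + s) (o.2 - s) (o.2 + s)) a b ∧
    Conn king (B ∩ Box (o.1 - s) (o.1 + s) (o.2 - s) (o.2 + s)) a c ∧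
    Conn king (B ∩ Box (o.1 - s) (o.1 + s) (o.2 - s) (o.2 + s)) a d}

lemma Xs_upper (s α o) : IsUpperSet (Xs s α o) := by
  rintro B B' h ⟨a, b, c, d, h1, h2, h3, h4, h5, h6, h7, h8, h9, h10, h11⟩
  have := inter_subset_inter_left (Box (o.1 - s) (o.1 + s) (o.2 - s) (o.2 + s)) h
  exact ⟨a, b, c, d, h1, h2, h3, h4, h5, h6, h7, h8, h9.mono this, h10.mono this, h11.mono this⟩

/-- Site set joined by `F` to any path leaving it. -/
def Hub (F : Set (Set Z2)) (o : Z2) (u : ℤ) : Prop :=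
  ∀ B ∈ F, ∃ z, ∀ W a b, Win o (2*u) ⊆ W → Conn king (B ∩ W) a b → a ∈ Win o u →
    (2*u ≤ |b.1 - o.1| ∨ 2*u ≤ |b.2 - o.2|) → Conn king (B ∩ W) a z

lemma row_conn {U : Set Z2} {y x0 : ℤ} (k : ℕ) (h : ∀ x, x0 ≤ x → x ≤ x0 + k → (x, y) ∈ U) :
    Conn king U (x0, y) (x0 + k, y) := by
  induction k with
  | zero => simpa using Conn.refl (R := king) (h x0 le_rfl (by simp))
  | succ k ih =>
    refine (ih fun x h1 h2 => h x h1 (by push_cast; omega)).tail ⟨?_, by simp⟩ (h _ (by omega) (by push_cast; omega))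
    simp

lemma row_conn' {U : Set Z2} {y x x' x0 x1 : ℤ} (h : ∀ z, x0 ≤ z → z ≤ x1 → (z, y) ∈ U) (hx : x0 ≤ x)
    (hx1 : x ≤ x1) (hx' : x0 ≤ x') (hx1' : x' ≤ x1) : Conn king U (x, y) (x', y) := by
  rcases le_total x x' with hh | hh
  · obtain ⟨k, rfl⟩ := Int.le.dest hh
    exact row_conn k fun z h1 h2 => h z (by omega) (by omega)
  · obtain ⟨k, rfl⟩ := Int.le.dest hh
    exact (row_conn k fun z h1 h2 => h z (by omega) (by omega)).symmK

lemma box_conn {U : Set Z2} {x0 x1 y0 y1 : ℤ} (h : Box x0 x1 y0 y1 ⊆ U) {a b : Z2} (ha : a ∈ Box x0 x1 y0 y1)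
    (hb : b ∈ Box x0 x1 y0 y1) : Conn king U a b := by
  obtain ⟨x, y⟩ := a
  obtain ⟨x', y'⟩ := b
  simp only [mem_box] at ha hb
  have h1 : Conn king U (x, y) (x', y) := row_conn' (x0 := x0) (x1 := x1)
    (fun z h1 h2 => h (by rw [mem_box]; simp only; omega)) ha.1 ha.2.1 hb.1 hb.2.1
  have h2 : Conn king {p : Z2 | (p.2, p.1) ∈ U} (y, x') (y', x') := row_conn' (x0 := y0) (x1 := y1)
    (fun z h1 h2 => h (by rw [mem_box]; simp only; omega)) ha.2.2.1 ha.2.2.2 hb.2.2.1 hb.2.2.2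
  have h3 := h2.map (f := fun p : Z2 => (p.2, p.1)) (R' := king) (V := U) (fun p q h => ⟨h.2, h.1⟩) (by simp)
  exact h1.trans h3

lemma seed_hub (o : Z2) {u : ℤ} (hu : 0 ≤ u) : Hub {B | Win o u ⊆ B} o u := by
  refine fun B hB => ⟨o, fun W a b hW h ha hb => box_conn (subset_inter hB (subset_trans ?_ hW)) ha ?_⟩
  · exact box_subset (by omega) (by omega) (by omega) (by omega)
  · simp only [Win, mem_box]; omega

/-- A circuit in the annulus between radii `s` and `2s`. -/
def Circ (o : Z2) (s : ℤ) : Set (Set Z2) :=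
  (EV (o.1 + s) (o.1 + 2*s) (o.2 - 2*s) (o.2 + 2*s) ∩ EV (o.1 - 2*s) (o.1 - s) (o.2 - 2*s) (o.2 + 2*s)) ∩
  (EH (o.1 - 2*s) (o.1 + 2*s) (o.2 + s) (o.2 + 2*s) ∩ EH (o.1 - 2*s) (o.1 + 2*s) (o.2 - 2*s) (o.2 - s))

lemma Circ_upper (o s) : IsUpperSet (Circ o s) :=
  ((Ev_upper _ _ _).inter (Ev_upper _ _ _)).inter ((Ev_upper _ _ _).inter (Ev_upper _ _ _))

lemma circ_hub (o : Z2) {s : ℤ} (hs : 0 < s) : Hub (Circ o s) o s := by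
  rintro B ⟨⟨⟨r, r', hr, hr', hR⟩, ⟨l, l', hl, hl', hL⟩⟩, ⟨t, t', ht, ht', hT⟩, ⟨b, b', hb, hb', hBo⟩⟩
  refine ⟨r, fun W p q hW hpq hp hq => ?_⟩
  simp only [mem_ofPred_eq] at hr hr' hl hl' ht ht' hb hb'
  have wR : Box (o.1 + s) (o.1 + 2*s) (o.2 - 2*s) (o.2 + 2*s) ⊆ W :=
    (box_subset (by omega) (by omega) (by omega) (by omega)).trans hW
  have wL : Box (o.1 - 2*s) (o.1 - s) (o.2 - 2*s) (o.2 + 2*s) ⊆ W :=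
    (box_subset (by omega) (by omega) (by omega) (by omega)).trans hW
  have wT : Box (o.1 - 2*s) (o.1 + 2*s) (o.2 + s) (o.2 + 2*s) ⊆ W :=
    (box_subset (by omega) (by omega) (by omega) (by omega)).trans hW
  have wB : Box (o.1 - 2*s) (o.1 + 2*s) (o.2 - 2*s) (o.2 - s) ⊆ W :=
    (box_subset (by omega) (by omega) (by omega) (by omega)).trans hW
  have cTR : Conn king (B ∩ W) t r := span_boxes hT hR
    (fun q hq => by rw [mem_box] at hq; omega) (fun q hq => by rw [mem_box] at hq; omega) wT wR
  have cTL : Conn king (B ∩ W) t l := span_boxes hT hL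
    (fun q hq => by rw [mem_box] at hq; omega) (fun q hq => by rw [mem_box] at hq; omega) wT wL
  have cBR : Conn king (B ∩ W) b r := span_boxes hBo hR
    (fun q hq => by rw [mem_box] at hq; omega) (fun q hq => by rw [mem_box] at hq; omega) wB wR
  have sub : {x | Conn king (B ∩ W) p x} ⊆ B := fun x hx => hx.right_mem.1
  rcases cut_annulus (fun _ _ h => h) hpq.restrict o hs hp hq with
    ⟨a1, b1, e1, e2, hc⟩ | ⟨a1, b1, e1, e2, hc⟩ | ⟨a1, b1, e1, e2, hc⟩ | ⟨a1, b1, e1, e2, hc⟩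
  all_goals refine Conn.trans hc.left_mem.1 ?_
  all_goals replace hc := hc.mono (inter_subset_inter_left _ sub)
  · exact span_boxes hc hR (fun q hq => by rw [mem_box] at hq; omega)
      (fun q hq => by rw [mem_box] at hq; omega) wR wR
  · have h1 := span_boxes hc.symmK hL (fun q hq => by rw [mem_box] at hq; omega)
      (fun q hq => by rw [mem_box] at hq; omega) wL wL
    have h2 := hc.mono (inter_subset_inter_right _ wL)
    exact h2.trans (h1.trans (cTL.symmK.trans cTR))
  · have h1 := span_boxes hT hc (fun q hq => by rw [mem_box] at hq; omega)
      (fun q hq => by rw [mem_box] at hq; omega) wT wT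
    exact h1.symmK.trans cTR
  · have h1 := span_boxes hBo hc.symmK (fun q hq => by rw [mem_box] at hq; omega)
      (fun q hq => by rw [mem_box] at hq; omega) wB wB
    have h2 := hc.mono (inter_subset_inter_right _ wB)
    exact h2.trans (h1.symmK.trans cBR)

namespace Perc
variable (μ : Perc)

lemma hs_half {s : ℤ} (hs : 0 ≤ s) : 1 / 4 ≤ μ.P (Hs s 0 s) := by
  have h1 := μ.sq (-s) (-s) (2*s) (by omega)
  have h2 : μ.P (EH (-s) (-s + 2*s) (-s) (-s + 2*s)) ≤ μ.P (Hs s 0 s ∪ Hs s (-s) 0) := by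
    refine μ.mono _ _ ?_
    rintro B ⟨a, b, ha, hb, hc⟩
    have e : -s + 2*s = s := by ring
    rw [e] at hc hb
    have := hc.right_mem.2
    rw [mem_box] at this
    rcases le_total 0 b.2 with h | h
    · exact Or.inl ⟨a, b, ha, ⟨hb, h, by omega⟩, hc⟩
    · exact Or.inr ⟨a, b, ha, ⟨hb, by omega, h⟩, hc⟩
  have h3 : μ.P (Hs s (-s) 0) ≤ μ.P (Hs s 0 s) := by
    refine μ.le_of_sym (μ.sym_vmirror 0) ?_ ?_ ?_ <;> rintro ⟨x, y⟩ <;>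
    simp only [mem_box, mem_ofPred_eq] <;> omega
  have := μ.union (Hs s 0 s) (Hs s (-s) 0)
  linarith

def phi (s α : ℤ) : ℝ := μ.P (Hs s 0 α) - μ.P (Hs s α s)

lemma phi_mono {s α β : ℤ} (h : α ≤ β) : μ.phi s α ≤ μ.phi s β := by
  have h1 := μ.mono _ _ (Hs_mono (s := s) (le_refl 0) h)
  have h2 := μ.mono _ _ (Hs_mono (s := s) h (le_refl s))
  unfold phi
  linarith

open Classical in
/-- Tassion's height parameter. -/
def aa (s : ℤ) : ℤ := (Nat.findGreatest (fun k => μ.phi s (k:ℕ) < 1/8) (s / 2).toNat : ℕ)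

lemma aa_nonneg (s) : 0 ≤ μ.aa s := by unfold aa; omega

lemma aa_le {s : ℤ} (hs : 0 ≤ s) : 2 * μ.aa s ≤ s := by
  classical
  have := Nat.findGreatest_le (P := fun k : ℕ => μ.phi s k < 1/8) (s / 2).toNat
  unfold aa
  omega

lemma phi_aa {s : ℤ} (hs : 0 ≤ s) : μ.phi s (μ.aa s) < 1/8 := by
  classical
  have := Nat.findGreatest_spec (P := fun k : ℕ => μ.phi s k < 1/8) (m := 0) (n := (s / 2).toNat) (by simp) (by
    have := μ.mono _ _ (Hs_mono (s := s) (le_refl 0) hs)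
    simp only [phi, Nat.cast_zero]
    linarith)
  exact this

lemma aa_lt {s α : ℤ} (h : μ.aa s < s / 2) (hα : μ.aa s < α) : 1/8 ≤ μ.phi s α := by
  classical
  have h0 := μ.aa_nonneg s
  have h1 := Nat.findGreatest_is_greatest (P := fun k : ℕ => μ.phi s k < 1/8) (k := (μ.aa s + 1).toNat)
    (n := (s / 2).toNat) (by show _ < _; unfold aa at *; omega) (by omega)
  rw [not_lt] at h1
  refine h1.trans (μ.phi_mono ?_)
  omega

lemma hs_low {s α : ℤ} (hs : 0 ≤ s) (h : α ≤ μ.aa s) : 1/16 ≤ μ.P (Hs s α s) := by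
  have h1 := μ.phi_aa hs
  have h2 := μ.hs_half hs
  have h3 := (μ.mono _ _ (Hs_union s (μ.aa s))).trans (μ.union _ _)
  have h4 := μ.mono _ _ (Hs_mono (s := s) h (le_refl s))
  unfold phi at h1
  linarith

lemma hs_high {s α : ℤ} (h : μ.aa s < s / 2) (hα : μ.aa s < α) :
    1/8 + μ.P (Hs s α s) ≤ μ.P (Hs s 0 α) := by
  have := μ.aa_lt h hα
  unfold phi at this
  linarith

lemma xs_low {s α : ℤ} (hs : 0 ≤ s) (h : α ≤ μ.aa s) (o : Z2) : (1/16)^4 / 2 ≤ μ.P (Xs s α o) := by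
  set W := Box (o.1 - s) (o.1 + s) (o.2 - s) (o.2 + s) with hW
  have h0 := μ.hs_low hs h
  have e1 : 1/16 ≤ μ.P (Ev W {p | p.1 = o.1 - s} {p | p.1 = o.1 + s ∧ o.2 + α ≤ p.2}) := by
    refine h0.trans (μ.le_of_sym (μ.sym_shift o) ?_ ?_ ?_) <;> rintro ⟨x, y⟩ <;>
    simp only [hW, mem_box, mem_ofPred_eq, Prod.fst_add, Prod.snd_add] <;> omega
  have e2 : 1/16 ≤ μ.P (Ev W {p | p.1 = o.1 - s} {p | p.1 = o.1 + s ∧ p.2 ≤ o.2 - α}) := by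
    refine h0.trans (μ.le_of_sym ((μ.sym_shift o).comp μ (μ.sym_vmirror 0)) ?_ ?_ ?_) <;> rintro ⟨x, y⟩ <;>
    simp only [hW, mem_box, mem_ofPred_eq, Prod.fst_add, Prod.snd_add] <;> omega
  have e3 : 1/16 ≤ μ.P (Ev W {p | p.1 = o.1 + s} {p | p.1 = o.1 - s ∧ o.2 + α ≤ p.2}) := by
    refine h0.trans (μ.le_of_sym ((μ.sym_shift o).comp μ μ.sym_refl) ?_ ?_ ?_) <;> rintro ⟨x, y⟩ <;>
    simp only [hW, mem_box, mem_ofPred_eq, Prod.fst_add, Prod.snd_add] <;> omega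
  have e4 : 1/16 ≤ μ.P (Ev W {p | p.1 = o.1 + s} {p | p.1 = o.1 - s ∧ p.2 ≤ o.2 - α}) := by
    refine h0.trans (μ.le_of_sym ((μ.sym_shift o).comp μ ((μ.sym_vmirror 0).comp μ μ.sym_refl)) ?_ ?_ ?_) <;>
    rintro ⟨x, y⟩ <;>
    simp only [hW, mem_box, mem_ofPred_eq, Prod.fst_add, Prod.snd_add] <;> omega
  have e5 : 1/2 ≤ μ.P (EV (o.1 - s) (o.1 + s) (o.2 - s) (o.2 + s)) :=
    (μ.hcr_sq (k := 2*s) (by omega)).trans (μ.hcr_EV (by ring) (by ring))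
  have f1 := μ.fkg' (Ev_upper _ _ _) (Ev_upper _ _ _) (by norm_num) (by norm_num) e1 e2
  have f2 := μ.fkg' (Ev_upper _ _ _) (Ev_upper _ _ _) (by norm_num) (by norm_num) e3 e4
  have f3 := μ.fkg' ((Ev_upper _ _ _).inter (Ev_upper _ _ _)) ((Ev_upper _ _ _).inter (Ev_upper _ _ _))
    (by norm_num) (by norm_num) f1 f2
  have f4 := μ.fkg' (((Ev_upper _ _ _).inter (Ev_upper _ _ _)).inter ((Ev_upper _ _ _).inter (Ev_upper _ _ _)))
    (Ev_upper _ _ _) (by norm_num) (by norm_num) f3 e5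
  refine le_trans (by norm_num) (f4.trans (μ.mono _ _ ?_))
  rintro B ⟨⟨⟨⟨a1, b1, ha1, hb1, h1⟩, ⟨a2, b2, ha2, hb2, h2⟩⟩, ⟨a3, b3, ha3, hb3, h3⟩, ⟨a4, b4, ha4, hb4, h4⟩⟩,
    ⟨v, v', hv, hv', hV⟩⟩
  simp only [mem_ofPred_eq] at *
  have c1 : Conn king (B ∩ W) a1 v := span_boxes h1 hV (fun q hq => by rw [mem_box] at hq; omega)
    (fun q hq => by rw [mem_box] at hq; omega) subset_rfl subset_rfl
  have c2 : Conn king (B ∩ W) a2 v := span_boxes h2 hV (fun q hq => by rw [mem_box] at hq; omega)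
    (fun q hq => by rw [mem_box] at hq; omega) subset_rfl subset_rfl
  have c3 : Conn king (B ∩ W) b3 v := span_boxes h3.symmK hV (fun q hq => by rw [mem_box] at hq; omega)
    (fun q hq => by rw [mem_box] at hq; omega) subset_rfl subset_rfl
  have c4 : Conn king (B ∩ W) b4 v := span_boxes h4.symmK hV (fun q hq => by rw [mem_box] at hq; omega)
    (fun q hq => by rw [mem_box] at hq; omega) subset_rfl subset_rfl
  have d2 := h2.symmK.trans c2
  exact ⟨b2, b1, b4, b3, hb2.1, hb2.2, hb1.1, hb1.2, hb4.1, hb4.2, hb3.1, hb3.2,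
    d2.trans (c1.symmK.trans h1), d2.trans c4.symmK, d2.trans c3.symmK⟩

lemma hcr_anti {w w' h : ℤ} (hw : 0 < w) (hww : w ≤ w') : μ.hcr w' h ≤ μ.hcr w h := by
  refine μ.mono _ _ ?_
  rintro B ⟨a, b, ha, hb, hc⟩
  simp only [mem_ofPred_eq] at ha hb
  obtain ⟨a', b', e, e', hc'⟩ := cut_h (W' := Box 0 w 0 h) hc hw (by omega) (by omega)
    (fun p hp h1 h2 => by rw [mem_box] at *; omega)
  exact ⟨a', b', e, e', hc'⟩

lemma boot {w1 w2 h : ℤ} {x y : ℝ} (hh : 0 ≤ h) (h1 : h ≤ w1) (h2 : h ≤ w2) (hx : 0 ≤ x) (hy : 0 ≤ y)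
    (hx1 : x ≤ μ.hcr w1 h) (hy1 : y ≤ μ.hcr w2 h) : x * y / 2 ≤ μ.hcr (w1 + w2 - h) h := by
  have e2 := hy1.trans (μ.hcr_EH (x0 := w1 - h) (x1 := w1 + w2 - h) (y0 := 0) (y1 := h) (by ring) (by ring))
  have e3 := (μ.hcr_sq hh).trans (μ.hcr_EV (x0 := w1 - h) (x1 := w1) (y0 := 0) (y1 := h) (by ring) (by ring))
  have f1 := μ.fkg' (Ev_upper _ _ _) (Ev_upper _ _ _) hx hy hx1 e2
  have f2 := μ.fkg' ((Ev_upper _ _ _).inter (Ev_upper _ _ _)) (Ev_upper _ _ _) (mul_nonneg hx hy) (by norm_num) f1 e3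
  refine le_trans (by linarith) (f2.trans (μ.mono _ _ ?_))
  rintro B ⟨⟨⟨a1, b1, ha1, hb1, h1⟩, ⟨a2, b2, ha2, hb2, h2⟩⟩, ⟨v, v', hv, hv', hV⟩⟩
  simp only [mem_ofPred_eq] at *
  have c1 : Conn king (B ∩ Box 0 (w1 + w2 - h) 0 h) a1 v := span_boxes h1 hV (fun q hq => by rw [mem_box] at hq; omega)
    (fun q hq => by rw [mem_box] at hq; omega) (box_subset (by omega) (by omega) (by omega) (by omega))
    (box_subset (by omega) (by omega) (by omega) (by omega))
  have c2 : Conn king (B ∩ Box 0 (w1 + w2 - h) 0 h) a2 v := span_boxes h2 hV (fun q hq => by rw [mem_box] at hq; omega)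
    (fun q hq => by rw [mem_box] at hq; omega) (box_subset (by omega) (by omega) (by omega) (by omega))
    (box_subset (by omega) (by omega) (by omega) (by omega))
  exact ⟨a1, b2, ha1, hb2, c1.trans (c2.symmK.trans (h2.mono (inter_subset_inter_right _
    (box_subset (by omega) (by omega) (by omega) (by omega)))))⟩

/-- The bootstrap function. -/
def bs (x : ℝ) : ℝ := x ^ 16 / 2 ^ 15

lemma good_of {w S : ℤ} {x : ℝ} (hS : 0 < S) (hw : 4 * S ≤ 3 * w) (hx : 0 ≤ x) (h : x ≤ μ.hcr w S) :
    bs x ≤ μ.hcr (4 * S) S := by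
  have b1 := μ.boot hS.le (by omega) (by omega) hx hx h h
  have b2 := μ.boot hS.le (by omega) (by omega) (by positivity) (by positivity) b1 b1
  have b3 := μ.boot hS.le (by omega) (by omega) (by positivity) (by positivity) b2 b2
  have b4 := μ.boot hS.le (by omega) (by omega) (by positivity) (by positivity) b3 b3
  have := b4.trans (μ.hcr_anti (w := 4 * S) (by omega) (by omega))
  refine le_trans (le_of_eq ?_) this
  unfold bs
  ring

/-- The universal constants. -/
def cX : ℝ := (1/16)^4 / 2
def cA : ℝ := bs (cX ^ 3)

lemma cX_pos : 0 < cX := by unfold cX; norm_num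
lemma cA_pos : 0 < cA := by unfold cA bs; have := cX_pos; positivity

/-- One step of the multi-scale comparison. -/
lemma scale_step {s s' : ℤ} (hs' : 0 < s') (h1 : 3 * s' ≤ 2 * s) (he : 2 ∣ s) :
    cA ≤ μ.hcr (4 * (2 * s)) (2 * s) ∨ 2 * μ.aa s' ≤ μ.aa s := by
  have hs : 0 < s := by omega
  have hX0 := cX_pos
  have hle := μ.aa_le hs.le
  have hle' := μ.aa_le hs'.le
  have h0' := μ.aa_nonneg s'
  have h0 := μ.aa_nonneg s
  by_cases hfull : 2 * μ.aa s = s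
  · left
    have q : ∀ o, cX ≤ μ.P (Xs s (μ.aa s) o) := fun o => μ.xs_low hs.le le_rfl o
    have f1 := μ.fkg' (Xs_upper _ _ _) (Xs_upper _ _ _) hX0.le hX0.le (q (0, s)) (q (0, 2 * s))
    have f2 := μ.fkg' (Xs_upper _ _ _) ((Xs_upper _ _ _).inter (Xs_upper _ _ _)) hX0.le (by positivity) (q (0, 0)) f1
    have f3 : cX ^ 3 ≤ μ.P (EV (-s) s (-μ.aa s) (2 * s + μ.aa s)) := by
      refine le_trans (le_of_eq (by ring)) (f2.trans (μ.mono _ _ ?_))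
      rintro B ⟨⟨a1, b1, -, -, p1, p2, p3, p4, -, -, -, -, hc1, -⟩, ⟨a2, b2, -, -, q1, q2, q3, q4, -, -, -, -, hc2, -⟩,
        ⟨a3, b3, -, -, r1, r2, r3, r4, -, -, -, -, hc3, -⟩⟩
      simp only at *
      have m1 := hc1.left_mem.2
      have m1' := hc1.right_mem.2
      have m2 := hc2.left_mem.2
      have m2' := hc2.right_mem.2
      have m3 := hc3.left_mem.2
      have m3' := hc3.right_mem.2
      rw [mem_box] at m1 m1' m2 m2' m3 m3'
      have g1 := glue_interlace (X := s) hc1 hc2 (fun p hp => by have := hp.2; rw [mem_box] at this; omega)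
        (fun p hp => by have := hp.2; rw [mem_box] at this; omega) (by omega) (by omega) (by omega) (by omega)
        (by omega) (by omega) (by omega)
      have g2 := glue_interlace (X := s) hc2 hc3 (fun p hp => by have := hp.2; rw [mem_box] at this; omega)
        (fun p hp => by have := hp.2; rw [mem_box] at this; omega) (by omega) (by omega) (by omega) (by omega)
        (by omega) (by omega) (by omega)
      have w : ∀ k : ℤ, 0 ≤ k → k ≤ 2 * s → B ∩ Box (0 - s) (0 + s) (k - s) (k + s) ⊆ B ∩ Box (-s) s (-s) (3 * s) :=
        fun k hk hk' => inter_subset_inter_right _ (box_subset (by omega) (by omega) (by omega) (by omega))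
      have k1 := g1.mono (union_subset (w 0 le_rfl (by omega)) (w s (by omega) (by omega)))
      have k2 := g2.mono (union_subset (w s (by omega) (by omega)) (w (2*s) (by omega) (by omega)))
      have k3 := hc3.mono (w (2*s) (by omega) (by omega))
      obtain ⟨a', b', e, e', hc'⟩ := cut_v (W' := Box (-s) s (-μ.aa s) (2 * s + μ.aa s)) (k1.trans (k2.trans k3))
        (x0 := -μ.aa s) (x1 := 2 * s + μ.aa s) (by omega) (by omega) (by omega)
        (fun p hp h1 h2 => by rw [mem_box] at *; omega)
      exact ⟨a', b', e, e', hc'⟩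
    have f4 := f3.trans (μ.EV_hcr (w := 3 * s) (h := 2 * s) (by omega) (by ring))
    exact μ.good_of (by omega) (by omega) (by positivity) f4
  by_cases hI : 2 * μ.aa s' ≤ μ.aa s
  · exact Or.inr hI
  left
  have hE := μ.hs_high (s := s) (α := μ.aa s + 1) (by omega) (by omega)
  have hE1 : 1/8 ≤ μ.P (Hs s 0 (μ.aa s + 1)) := by linarith [μ.nonneg (Hs s (μ.aa s + 1) s)]
  have hE2 : 1/8 ≤ μ.P (Ev (Box (s - 2*s') (3*s - 2*s') (-s) s) {p | p.1 = 3*s - 2*s'}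
      {p | p.1 = s - 2*s' ∧ 0 ≤ p.2 ∧ p.2 ≤ μ.aa s + 1}) := by
    refine hE1.trans (μ.le_of_sym (μ.sym_mirror (s - s')) ?_ ?_ ?_) <;> rintro ⟨x, y⟩ <;>
    simp only [mem_box, mem_ofPred_eq] <;> omega
  have hX : cX ≤ μ.P (Xs s' (μ.aa s') (s - s', μ.aa s')) := μ.xs_low hs'.le le_rfl _
  have f1 := μ.fkg' (Hs_upper _ _ _) (Ev_upper _ _ _) (by norm_num) (by norm_num) hE1 hE2
  have f2 := μ.fkg' ((Hs_upper _ _ _).inter (Ev_upper _ _ _)) (Xs_upper _ _ _) (by norm_num) hX0.le f1 hX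
  have f3 : cX ^ 3 ≤ μ.P (EH (-s) (3*s - 2*s') (-s) s) := by
    refine le_trans ?_ (f2.trans (μ.mono _ _ ?_))
    · unfold cX; norm_num
    rintro B ⟨⟨⟨a1, b1, p1, ⟨p2, p3, p4⟩, h1⟩, ⟨a2, b2, q1, ⟨q2, q3, q4⟩, h2⟩⟩,
      ⟨a, b, c, d, r1, r2, r3, r4, r5, r6, r7, r8, hab, hac, had⟩⟩
    simp only [mem_ofPred_eq] at *
    have g1 := glue_gap (X := s) hab h1 (fun p hp => by have := hp.2; rw [mem_box] at this; omega)
      (fun p hp => by have := hp.2; rw [mem_box] at this; omega) (by omega) (by omega)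
      (fun p hp => by have := hp.2; rw [mem_box] at this; omega) (by omega) (by omega) (by omega)
    have g2 := glue_gap' (X := s - 2*s') (hac.symmK.trans had) h2
      (fun p hp => by have := hp.2; rw [mem_box] at this; omega)
      (fun p hp => by have := hp.2; rw [mem_box] at this; omega) (by omega) (by omega)
      (fun p hp => by have := hp.2; rw [mem_box] at this; omega) (by omega) (by omega) (by omega)
    have wX : B ∩ Box (s - s' - s') (s - s' + s') (μ.aa s' - s') (μ.aa s' + s') ⊆ B ∩ Box (-s) (3*s - 2*s') (-s) s :=
      inter_subset_inter_right _ (box_subset (by omega) (by omega) (by omega) (by omega))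
    have w1 : B ∩ Box (-s) s (-s) s ⊆ B ∩ Box (-s) (3*s - 2*s') (-s) s :=
      inter_subset_inter_right _ (box_subset (by omega) (by omega) (by omega) (by omega))
    have w2 : B ∩ Box (s - 2*s') (3*s - 2*s') (-s) s ⊆ B ∩ Box (-s) (3*s - 2*s') (-s) s :=
      inter_subset_inter_right _ (box_subset (by omega) (by omega) (by omega) (by omega))
    exact ⟨a1, a2, p1, q1, (g1.mono (union_subset wX w1)).symmK.trans
      ((hac.mono wX).trans (g2.mono (union_subset wX w2)))⟩
  have f4 := f3.trans (μ.EH_hcr (w := 4*s - 2*s') (h := 2 * s) (by ring) (by ring))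
  exact μ.good_of (by omega) (by omega) (by positivity) f4

end Perc

namespace Perc
variable (μ : Perc)

lemma hub_good {F : Set (Set Z2)} {t u : ℤ} {x : ℝ} (hF : IsUpperSet F) (hub : Hub F (t, 0) u) (hu : 0 < u)
    (hut : 4 * u ≤ t) (hx : 0 ≤ x) (hxF : x ≤ μ.P F) (ha : μ.aa t < u) :
    bs (x / 64) ≤ μ.hcr (4 * (2 * t)) (2 * t) := by
  have h0 := μ.aa_nonneg t
  have hE := μ.hs_high (s := t) (α := u) (by omega) ha
  have hE1 : 1/8 ≤ μ.P (Hs t 0 u) := by linarith [μ.nonneg (Hs t u t)]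
  have hE2 : 1/8 ≤ μ.P (Ev (Box t (3*t) (-t) t) {p | p.1 = 3*t} {p | p.1 = t ∧ 0 ≤ p.2 ∧ p.2 ≤ u}) := by
    refine hE1.trans (μ.le_of_sym (μ.sym_mirror t) ?_ ?_ ?_) <;> rintro ⟨x, y⟩ <;>
    simp only [mem_box, mem_ofPred_eq] <;> omega
  have f1 := μ.fkg' (Hs_upper _ _ _) (Ev_upper _ _ _) (by norm_num) (by norm_num) hE1 hE2
  have f2 := μ.fkg' ((Hs_upper _ _ _).inter (Ev_upper _ _ _)) hF (by norm_num) hx f1 hxF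
  have f3 : x / 64 ≤ μ.P (EH (-t) (3*t) (-t) t) := by
    refine le_trans (le_of_eq (by ring)) (f2.trans (μ.mono _ _ ?_))
    rintro B ⟨⟨⟨a1, b1, p1, ⟨p2, p3, p4⟩, h1⟩, ⟨a2, b2, q1, ⟨q2, q3, q4⟩, h2⟩⟩, hB⟩
    simp only [mem_ofPred_eq] at *
    obtain ⟨z, hz⟩ := hub B hB
    have w1 : B ∩ Box (-t) t (-t) t ⊆ B ∩ Box (-t) (3*t) (-t) t :=
      inter_subset_inter_right _ (box_subset (by omega) (by omega) (by omega) (by omega))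
    have w2 : B ∩ Box t (3*t) (-t) t ⊆ B ∩ Box (-t) (3*t) (-t) t :=
      inter_subset_inter_right _ (box_subset (by omega) (by omega) (by omega) (by omega))
    have wW : Win (t, 0) (2*u) ⊆ Box (-t) (3*t) (-t) t := box_subset (by omega) (by omega) (by omega) (by omega)
    have k1 := hz _ _ _ wW (h1.mono w1).symmK (by simp only [Win, mem_box]; omega)
      (Or.inl (by rw [le_abs]; right; omega))
    have k2 := hz _ _ _ wW (h2.mono w2).symmK (by simp only [Win, mem_box]; omega)
      (Or.inl (by rw [le_abs]; left; omega))
    exact ⟨a1, a2, p1, q1, ((h1.mono w1).trans k1).trans (k2.symmK.trans (h2.mono w2).symmK)⟩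
  have f4 := f3.trans (μ.EH_hcr (w := 4*t) (h := 2*t) (by ring) (by ring))
  exact μ.good_of (by omega) (by omega) (by positivity) f4

lemma circ_low {s : ℤ} {c : ℝ} (hc : 0 ≤ c) (h : c ≤ μ.hcr (4 * s) s) (o : Z2) : c ^ 4 ≤ μ.P (Circ o s) := by
  have h1 := h.trans (μ.hcr_EV (x0 := o.1 + s) (x1 := o.1 + 2*s) (y0 := o.2 - 2*s) (y1 := o.2 + 2*s) (by ring) (by ring))
  have h2 := h.trans (μ.hcr_EV (x0 := o.1 - 2*s) (x1 := o.1 - s) (y0 := o.2 - 2*s) (y1 := o.2 + 2*s) (by ring) (by ring))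
  have h3 := h.trans (μ.hcr_EH (x0 := o.1 - 2*s) (x1 := o.1 + 2*s) (y0 := o.2 + s) (y1 := o.2 + 2*s) (by ring) (by ring))
  have h4 := h.trans (μ.hcr_EH (x0 := o.1 - 2*s) (x1 := o.1 + 2*s) (y0 := o.2 - 2*s) (y1 := o.2 - s) (by ring) (by ring))
  have f1 := μ.fkg' (Ev_upper _ _ _) (Ev_upper _ _ _) hc hc h1 h2
  have f2 := μ.fkg' (Ev_upper _ _ _) (Ev_upper _ _ _) hc hc h3 h4
  have f3 := μ.fkg' ((Ev_upper _ _ _).inter (Ev_upper _ _ _)) ((Ev_upper _ _ _).inter (Ev_upper _ _ _))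
    (mul_nonneg hc hc) (mul_nonneg hc hc) f1 f2
  exact le_trans (le_of_eq (by ring)) f3

/-- The left half of an annulus around `(T, 0)`. -/
def Half (T w : ℤ) : Set Z2 := {p | p ∈ Box (T - 2*w) T (-(2*w)) (2*w) ∧ (p.1 ≤ T - w ∨ p.2 ≤ -w ∨ w ≤ p.2)}

/-- A half circuit. -/
def EvU (T w : ℤ) : Set (Set Z2) := Ev (Half T w) {p | p.1 = T ∧ p.2 ≤ 0} {p | p.1 = T ∧ w ≤ p.2}

lemma evU_low {w : ℤ} {c : ℝ} (hw : 0 < w) (hc : 0 ≤ c) (h : c ≤ μ.hcr (4 * w) w) (T : ℤ) : c ^ 3 ≤ μ.P (EvU T w) := by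
  have h1 := h.trans (μ.hcr_EV (x0 := T - 2*w) (x1 := T - w) (y0 := -(2*w)) (y1 := 2*w) (by ring) (by ring))
  have h' := h.trans (μ.hcr_anti (w := 2*w) (by omega) (by omega))
  have h2 := h'.trans (μ.hcr_EH (x0 := T - 2*w) (x1 := T) (y0 := w) (y1 := 2*w) (by ring) (by ring))
  have h3 := h'.trans (μ.hcr_EH (x0 := T - 2*w) (x1 := T) (y0 := -(2*w)) (y1 := -w) (by ring) (by ring))
  have f1 := μ.fkg' (Ev_upper _ _ _) (Ev_upper _ _ _) hc hc h1 h2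
  have f2 := μ.fkg' ((Ev_upper _ _ _).inter (Ev_upper _ _ _)) (Ev_upper _ _ _) (by positivity) hc f1 h3
  refine le_trans (le_of_eq (by ring)) (f2.trans (μ.mono _ _ ?_))
  rintro B ⟨⟨⟨v, v', hv, hv', hV⟩, ⟨t, t', ht, ht', hT⟩⟩, ⟨b, b', hb, hb', hBo⟩⟩
  simp only [mem_ofPred_eq] at *
  have wV : Box (T - 2*w) (T - w) (-(2*w)) (2*w) ⊆ Half T w := fun p hp => by
    simp only [Half, mem_box, mem_ofPred_eq] at *; omega
  have wT : Box (T - 2*w) T w (2*w) ⊆ Half T w := fun p hp => by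
    simp only [Half, mem_box, mem_ofPred_eq] at *; omega
  have wB : Box (T - 2*w) T (-(2*w)) (-w) ⊆ Half T w := fun p hp => by
    simp only [Half, mem_box, mem_ofPred_eq] at *; omega
  have c1 := span_boxes hT hV (fun q hq => by rw [mem_box] at hq; omega) (fun q hq => by rw [mem_box] at hq; omega) wT wV
  have c2 := span_boxes hBo hV (fun q hq => by rw [mem_box] at hq; omega) (fun q hq => by rw [mem_box] at hq; omega) wB wV
  have m1 := hBo.right_mem.2
  have m2 := hT.right_mem.2
  rw [mem_box] at m1 m2
  exact ⟨b', t', ⟨hb', by omega⟩, ⟨ht', by omega⟩, (hBo.mono (inter_subset_inter_right _ wB)).symmK.trans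
    (c2.trans (c1.symmK.trans (hT.mono (inter_subset_inter_right _ wT))))⟩

/-- Existence of a scale with large height parameter. -/
lemma exists_height {s : ℤ} {c : ℝ} (hc : 0 ≤ c) (hs : 0 < s) (hr : μ.r ≤ s) (hgood : c ≤ μ.hcr (4 * s) s) (k : ℕ)
    (hk : (1 - bs (c ^ 4 / 64) ^ 3) ^ k < 1 / 8) (hN : 4 * s * 5 ^ k ≤ μ.N) :
    ∃ i ≤ k, s ≤ μ.aa (4 * s * 5 ^ i) := by
  by_contra! hcon
  set c' := bs (c ^ 4 / 64) with hc'
  have hc'0 : 0 ≤ c' := by rw [hc']; unfold bs; positivity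
  have hp : ∀ i : ℕ, (1:ℤ) ≤ 5 ^ i := fun i => one_le_pow₀ (by norm_num)
  have t0 : ∀ i : ℕ, 4 * s ≤ 4 * s * 5 ^ i := fun i => by nlinarith [hp i]
  have hg : ∀ i ≤ k, c' ≤ μ.hcr (4 * (2 * (4 * s * 5 ^ i))) (2 * (4 * s * 5 ^ i)) := fun i hi =>
    μ.hub_good (Circ_upper _ _) (circ_hub _ hs) hs (t0 i) (by positivity) (μ.circ_low hc hgood _) (hcon i hi)
  set T := 4 * s * 5 ^ k with hT
  have hU : ∀ i ≤ k, c' ^ 3 ≤ μ.P (EvU T (2 * (4 * s * 5 ^ i))) := fun i hi =>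
    μ.evU_low (by linarith [t0 i]) hc'0 (hg i hi) T
  have hone : c' ^ 3 ≤ 1 := (hU 0 (Nat.zero_le _)).trans (μ.le_one _)
  -- independence of the half circuits
  have key : ∀ j ≤ k, μ.P (⋂ i < j, (EvU T (2 * (4 * s * 5 ^ i)))ᶜ) ≤ (1 - c' ^ 3) ^ j ∧
      SetDep (⋂ i < j, (EvU T (2 * (4 * s * 5 ^ i)))ᶜ) (⋃ i < j, Half T (2 * (4 * s * 5 ^ i))) := by
    intro j
    induction j with
    | zero => intro _; simp [μ.univ, SetDep]
    | succ j ih =>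
      intro hj
      obtain ⟨i1, i2⟩ := ih (by omega)
      have e1 : (⋂ i < j + 1, (EvU T (2 * (4 * s * 5 ^ i)))ᶜ) =
          (⋂ i < j, (EvU T (2 * (4 * s * 5 ^ i)))ᶜ) ∩ (EvU T (2 * (4 * s * 5 ^ j)))ᶜ := by
        ext B; simp only [mem_iInter, mem_inter_iff, Nat.lt_succ_iff_lt_or_eq, or_imp, forall_and, forall_eq]
      have e2 : (⋃ i < j + 1, Half T (2 * (4 * s * 5 ^ i))) =
          (⋃ i < j, Half T (2 * (4 * s * 5 ^ i))) ∪ Half T (2 * (4 * s * 5 ^ j)) := by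
        ext B
        simp only [mem_iUnion, mem_union, Nat.lt_succ_iff_lt_or_eq, exists_prop, or_and_right, exists_or, exists_eq_left]
      have d2 : SetDep (EvU T (2 * (4 * s * 5 ^ j)))ᶜ (Half T (2 * (4 * s * 5 ^ j))) := (Ev_dep _ _ _).compl
      have hpow : ∀ i < j, (4 * s * 5 ^ i) * 5 ≤ 4 * s * 5 ^ j := fun i hi => by
        have : (5:ℤ) ^ (i + 1) ≤ 5 ^ j := pow_le_pow_right₀ (by norm_num) hi
        rw [pow_succ] at this
        nlinarith
      have hpowk : (4 * s * 5 ^ j) * 5 ≤ T := by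
        have : (5:ℤ) ^ (j + 1) ≤ 5 ^ k := pow_le_pow_right₀ (by norm_num) hj
        rw [pow_succ] at this
        rw [hT]; nlinarith
      refine ⟨?_, ?_⟩
      · rw [e1, μ.indep _ _ _ _ (T, 0) i2 d2, pow_succ]
        · refine mul_le_mul i1 ?_ (μ.nonneg _) (pow_nonneg (by linarith) _)
          rw [μ.compl]; linarith [hU j (by omega)]
        · refine iUnion₂_subset fun i hi p hp => ?_
          have := hpow i hi
          have := t0 i
          simp only [Half, Win, mem_box, mem_ofPred_eq] at *
          omega
        · intro p hp
          have := t0 j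
          simp only [Half, Win, mem_box, mem_ofPred_eq] at *
          omega
        · intro p hp q hq
          obtain ⟨i, hi, hp⟩ := mem_iUnion₂.1 hp
          have := hpow i hi
          have := t0 i
          simp only [Half, mem_box, mem_ofPred_eq] at hp hq
          simp only [lt_abs]
          omega
      · rw [e1, e2]
        exact (i2.mono subset_union_left).inter (d2.mono subset_union_right)
  obtain ⟨k1, -⟩ := key k le_rfl
  have hTs : 4 * s ≤ T := t0 k
  have haT : μ.aa T < s := hcon k le_rfl
  have hH := μ.hs_high (s := T) (α := s) (by omega) haT
  have hincl : Hs T 0 s ⊆ Hs T s T ∪ ⋂ i < k, (EvU T (2 * (4 * s * 5 ^ i)))ᶜ := by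
    rintro B ⟨a, b, ha, ⟨hb, hb1, hb2⟩, hc⟩
    by_cases hB : B ∈ ⋂ i < k, (EvU T (2 * (4 * s * 5 ^ i)))ᶜ
    · exact Or.inr hB
    left
    simp only [mem_iInter, not_forall, mem_compl_iff, not_not] at hB
    obtain ⟨i, hi, x, y, ⟨hx, hx'⟩, ⟨hy, hy'⟩, hxy⟩ := hB
    have hpowk : (4 * s * 5 ^ i) * 5 ≤ T := by
      have : (5:ℤ) ^ (i + 1) ≤ 5 ^ k := pow_le_pow_right₀ (by norm_num) hi
      rw [pow_succ] at this
      rw [hT]; nlinarith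
    have := t0 i
    simp only [mem_ofPred_eq] at ha
    have wH : Half T (2 * (4 * s * 5 ^ i)) ⊆ Box (-T) T (-T) T := fun p hp => by
      simp only [Half, mem_box, mem_ofPred_eq] at *; omega
    have hxy := hxy.mono (inter_subset_inter_right _ wH)
    have g := glue_gap (X := T) hxy hc (fun p hp => by have := hp.2; rw [mem_box] at this; omega)
      (fun p hp => by have := hp.2; rw [mem_box] at this; omega) hx hy
      (fun p hp => by have := hp.2; rw [mem_box] at this; omega) hb (by omega) (by omega)
    rw [union_self] at g
    have := hxy.right_mem.2
    rw [mem_box] at this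
    exact ⟨a, y, ha, ⟨hy, by omega, by omega⟩, g.symmK.trans hxy⟩
  have := (μ.mono _ _ hincl).trans (μ.union _ _)
  linarith

/-- Doubling of the height parameter must fail within boundedly many steps. -/
lemma doubling {t s : ℤ} {M : ℝ} (hs : 0 < s) (ht : 4 ≤ t) (he : 2 ∣ t) (ha : s ≤ μ.aa t) (hM : (t : ℝ) ≤ M * s) (J : ℕ)
    (hJ : M * (7/4) ^ J < 2 ^ J) :
    ∃ S : ℤ, t ≤ S ∧ (S : ℝ) ≤ 2 * ((7/4) ^ J * t) ∧ cA ≤ μ.hcr (4 * S) S := by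
  by_contra! hcon
  have key : ∀ j ≤ J, ∃ τ : ℤ, t ≤ τ ∧ 2 ∣ τ ∧ (τ : ℝ) ≤ (7/4) ^ j * t ∧ 2 ^ j * s ≤ μ.aa τ := by
    intro j
    induction j with
    | zero => intro _; exact ⟨t, le_rfl, he, by simp, by simpa⟩
    | succ j ih =>
      intro hj
      obtain ⟨τ, h1, h2, h3, h4⟩ := ih (by omega)
      obtain ⟨σ, rfl⟩ := h2
      have hσ : (4:ℤ) * (2 * ((3 * σ + 1) / 2)) ≤ 7 * (2 * σ) := by omega
      have hσ' : (4:ℝ) * ((2 * ((3 * σ + 1) / 2) : ℤ) : ℝ) ≤ 7 * ((2 * σ : ℤ) : ℝ) := by exact_mod_cast hσ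
      have hb : ((2 * ((3 * σ + 1) / 2) : ℤ) : ℝ) ≤ (7/4) ^ (j+1) * t := by
        rw [pow_succ]; nlinarith
      have hJ' : ((7/4 : ℝ)) ^ (j+1) * t ≤ (7/4) ^ J * t := by
        have : (0:ℝ) ≤ t := by exact_mod_cast (by omega : (0:ℤ) ≤ t)
        gcongr
        · norm_num
      refine ⟨2 * ((3 * σ + 1) / 2), by omega, by omega, hb, ?_⟩
      rcases μ.scale_step (s' := 2 * σ) (s := 2 * ((3 * σ + 1) / 2)) (by omega) (by omega) (by omega) with h | h
      · refine absurd h (not_le.2 (hcon _ (by omega) ?_))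
        push_cast at *
        linarith
      · rw [pow_succ]
        linarith
  obtain ⟨τ, h1, h2, h3, h4⟩ := key J le_rfl
  have h5 := μ.aa_le (s := τ) (by omega)
  have h6 : ((2:ℝ) ^ J * s) ≤ (7/4) ^ J * t := by
    have : (2 ^ J * s : ℤ) ≤ τ := by linarith [μ.aa_nonneg τ]
    have : ((2:ℝ) ^ J * s) ≤ τ := by exact_mod_cast this
    linarith
  have hs' : (0:ℝ) < s := by exact_mod_cast hs
  have h7 : (7/4 : ℝ) ^ J * t ≤ (7/4) ^ J * (M * s) := by gcongr
  nlinarith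

/-- From one good scale to the next. -/
lemma next_good {c : ℝ} (hc : 0 < c) : ∃ C : ℤ, 0 < C ∧ ∀ (μ : Perc) (s : ℤ), 0 < s → μ.r ≤ s → C * s ≤ μ.N →
    c ≤ μ.hcr (4 * s) s → ∃ s', 4 * s ≤ s' ∧ s' ≤ C * s ∧ cA ≤ μ.hcr (4 * s') s' := by
  by_cases hc1 : bs (c ^ 4 / 64) ^ 3 ≤ 1
  swap
  · refine ⟨4, by norm_num, fun μ s hs hr hN hgood => absurd ?_ hc1⟩
    have h1 : c ≤ 1 := hgood.trans (μ.le_one _)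
    unfold bs
    have : c ^ 4 / 64 ≤ 1 := by nlinarith [pow_le_one₀ (n := 4) hc.le h1]
    have : (c ^ 4 / 64) ^ 16 ≤ 1 := pow_le_one₀ (by positivity) this
    refine pow_le_one₀ (by positivity) ?_
    linarith
  have hc0 : 0 < bs (c ^ 4 / 64) ^ 3 := by unfold bs; positivity
  obtain ⟨k, hk⟩ := exists_pow_lt_of_lt_one (show (0:ℝ) < 1/8 by norm_num) (show 1 - bs (c ^ 4 / 64) ^ 3 < 1 by linarith)
  obtain ⟨J, hJ⟩ := exists_pow_lt_of_lt_one (show (0:ℝ) < 1 / (4 * 5 ^ k) by positivity) (show (7/8 : ℝ) < 1 by norm_num)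
  have hJ' : (4 * 5 ^ k : ℝ) * (7/4) ^ J < 2 ^ J := by
    rw [lt_div_iff₀ (by positivity)] at hJ
    have : (7/4 : ℝ) ^ J = (7/8) ^ J * 2 ^ J := by rw [← mul_pow]; norm_num
    rw [this]
    have : (0:ℝ) < 2 ^ J := by positivity
    nlinarith
  refine ⟨8 * 5 ^ k * 2 ^ J, by positivity, fun μ s hs hr hN hgood => ?_⟩
  have h5 : ∀ i : ℕ, (1:ℤ) ≤ 5 ^ i := fun i => one_le_pow₀ (by norm_num)
  have h2 : (1:ℤ) ≤ 2 ^ J := one_le_pow₀ (by norm_num)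
  obtain ⟨i, hi, ha⟩ := μ.exists_height hc.le hs hr hgood k hk (by
    have : (0:ℤ) ≤ s * 5 ^ k := by positivity
    nlinarith)
  have hik : (5:ℤ) ^ i ≤ 5 ^ k := pow_le_pow_right₀ (by norm_num) hi
  have hti : 4 * s * 5 ^ i ≤ 4 * s * 5 ^ k := by gcongr
  obtain ⟨S, e1, e2, e3⟩ := μ.doubling (M := 4 * 5 ^ k) hs (by nlinarith [h5 i]) ⟨2 * s * 5 ^ i, by ring⟩ ha (by
    have : ((4 * s * 5 ^ i : ℤ) : ℝ) ≤ ((4 * s * 5 ^ k : ℤ) : ℝ) := by exact_mod_cast hti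
    push_cast at *
    linarith) J hJ'
  refine ⟨S, by nlinarith [h5 i], ?_, e3⟩
  have : ((4 * s * 5 ^ i : ℤ) : ℝ) ≤ ((4 * s * 5 ^ k : ℤ) : ℝ) := by exact_mod_cast hti
  have hs0 : (0:ℝ) < s := by exact_mod_cast hs
  have : (S:ℝ) ≤ ((8 * 5 ^ k * 2 ^ J * s : ℤ) : ℝ) := by
    have h74 : (7/4:ℝ) ^ J ≤ 2 ^ J := pow_le_pow_left₀ (by norm_num) (by norm_num) _
    have h0 : (0:ℝ) ≤ ((4 * s * 5 ^ i : ℤ) : ℝ) := by push_cast; positivity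
    calc (S:ℝ) ≤ 2 * ((7/4) ^ J * ((4 * s * 5 ^ i : ℤ) : ℝ)) := e2
      _ ≤ 2 * (2 ^ J * ((4 * s * 5 ^ k : ℤ) : ℝ)) := by gcongr
      _ = _ := by push_cast; ring
  exact_mod_cast this

/-- The first good scale, from an all-blue seed. -/
lemma first_good {T u : ℤ} {x M : ℝ} (hu : 0 < u) (hT : 4 * u ≤ T) (he : 2 ∣ T) (hx : 0 ≤ x)
    (hseed : x ≤ μ.P {B | Win (T, 0) u ⊆ B}) (hM : (T : ℝ) ≤ M * u) (J : ℕ) (hJ : M * (7/4) ^ J < 2 ^ J) :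
    ∃ S : ℤ, T ≤ S ∧ (S : ℝ) ≤ 2 * ((7/4) ^ J * T) ∧ min cA (bs (x / 64)) ≤ μ.hcr (4 * S) S := by
  by_cases ha : μ.aa T < u
  · refine ⟨2 * T, by omega, ?_, (min_le_right _ _).trans (μ.hub_good ?_ (seed_hub _ hu.le) hu hT hx hseed ha)⟩
    · have : (0:ℝ) ≤ T := by exact_mod_cast (by omega : (0:ℤ) ≤ T)
      have h74 : (1:ℝ) ≤ (7/4:ℝ) ^ J := one_le_pow₀ (by norm_num)
      push_cast
      nlinarith
    · exact fun B B' h hB => Subset.trans hB h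
  · obtain ⟨S, h1, h2, h3⟩ := μ.doubling hu (by omega) he (not_lt.1 ha) hM J hJ
    exact ⟨S, h1, h2, (min_le_left _ _).trans h3⟩

end Perc

/-! ### The discrete torus model -/

/-- Sites of the torus, with a colour. -/
abbrev Idx (m : ℕ) : Type := (ZMod m × ZMod m) × Bool

/-- Bernoulli parameters of the discretised Poisson process: for the colour `true`, presence of a
blue point; for the colour `false`, absence of a red point. -/
def qp (m : ℕ) (lam p : ℝ) : Idx m → ℝ := fun i => if i.2 then 1 - Real.exp (-(lam * p)) else Real.exp (-(lam * (1 - p)))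

def cs (m : ℕ) (z : Z2) : ZMod m × ZMod m := ((z.1 : ZMod m), (z.2 : ZMod m))

def bl {m : ℕ} (ω : Idx m → Bool) (z : Z2) : Prop := ω (cs m z, true) = true
def rd {m : ℕ} (ω : Idx m → Bool) (z : Z2) : Prop := ω (cs m z, false) = false

/-- Squared Euclidean distance. -/
def d2 (z v : Z2) : ℤ := (z.1 - v.1) ^ 2 + (z.2 - v.2) ^ 2

/-- The locally determined blue region; sites far from all points count as blue. -/
def blueL {m : ℕ} (r : ℤ) (ω : Idx m → Bool) : Set Z2 :=
  {v | ∀ z, d2 z v ≤ r ^ 2 → rd ω z → ∃ z', d2 z' v ≤ d2 z v ∧ bl ω z'}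

lemma d2_nonneg (z v) : 0 ≤ d2 z v := by unfold d2; positivity

lemma d2_le_sq {z v : Z2} {r : ℤ} (hr : 0 ≤ r) (h : d2 z v ≤ r ^ 2) : |z.1 - v.1| ≤ r ∧ |z.2 - v.2| ≤ r := by
  unfold d2 at h
  exact ⟨abs_le_of_sq_le_sq (by nlinarith [sq_nonneg (z.2 - v.2)]) hr,
    abs_le_of_sq_le_sq (by nlinarith [sq_nonneg (z.1 - v.1)]) hr⟩

variable {m : ℕ}

lemma qp_adm {lam p : ℝ} (hl : 0 ≤ lam) (hp : 0 ≤ p) (hp1 : p ≤ 1) : Adm (qp m lam p) := by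
  intro i
  unfold qp
  have h1 : Real.exp (-(lam * p)) ≤ 1 := Real.exp_le_one_iff.2 (by nlinarith)
  have h2 : Real.exp (-(lam * (1 - p))) ≤ 1 := Real.exp_le_one_iff.2 (by nlinarith)
  split_ifs
  · exact ⟨by linarith, by linarith [Real.exp_pos (-(lam * p))]⟩
  · exact ⟨(Real.exp_pos _).le, h2⟩

lemma qp_mono {lam p p' : ℝ} (hl : 0 ≤ lam) (h : p ≤ p') (i : Idx m) : qp m lam p i ≤ qp m lam p' i := by
  unfold qp
  split_ifs
  · have : Real.exp (-(lam * p')) ≤ Real.exp (-(lam * p)) := Real.exp_le_exp.2 (by nlinarith)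
    linarith
  · exact Real.exp_le_exp.2 (by nlinarith)

/-- Derivative of the parameters. -/
def qp' (m : ℕ) (lam p : ℝ) : Idx m → ℝ :=
  fun i => if i.2 then lam * Real.exp (-(lam * p)) else lam * Real.exp (-(lam * (1 - p)))

lemma qp_deriv (lam p : ℝ) (i : Idx m) : HasDerivAt (fun t => qp m lam t i) (qp' m lam p i) p := by
  unfold qp qp'
  have e : HasDerivAt (fun t : ℝ => -(lam * t)) (-lam) p := by
    simpa [neg_mul] using (hasDerivAt_id p).const_mul (-lam)
  have e' : HasDerivAt (fun t : ℝ => -(lam * (1 - t))) lam p := by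
    simpa [neg_mul] using ((hasDerivAt_id p).const_sub 1).const_mul (-lam)
  split_ifs
  · exact (e.exp.const_sub 1).congr_deriv (by ring)
  · exact e'.exp.congr_deriv (by ring)

lemma qp_var {lam p : ℝ} (hl : 0 ≤ lam) (hp : 0 ≤ p) (hp1 : p ≤ 1) (i : Idx m) :
    qp m lam p i * (1 - qp m lam p i) ≤ qp' m lam p i := by
  unfold qp qp'
  split_ifs
  · have := Real.add_one_le_exp (-(lam * p))
    have h0 := Real.exp_pos (-(lam * p))
    have : 1 - Real.exp (-(lam * p)) ≤ lam := by nlinarith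
    nlinarith
  · have := Real.add_one_le_exp (-(lam * (1 - p)))
    have h0 := Real.exp_pos (-(lam * (1 - p)))
    have : 1 - Real.exp (-(lam * (1 - p))) ≤ lam := by nlinarith
    nlinarith

lemma bl_mono {ω ω' : Idx m → Bool} (h : ω ≤ ω') {z} (hz : bl ω z) : bl ω' z :=
  h (cs m z, true) hz

lemma rd_mono {ω ω' : Idx m → Bool} (h : ω ≤ ω') {z} (hz : rd ω' z) : rd ω z := by
  refine Bool.eq_false_iff.2 fun e => ?_
  have : ω' (cs m z, false) = true := h (cs m z, false) e
  rw [show ω' (cs m z, false) = false from hz] at this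
  simp at this

lemma blueL_mono {ω ω' : Idx m → Bool} (r : ℤ) (h : ω ≤ ω') : blueL r ω ⊆ blueL r ω' := by
  intro v hv z hz hr
  obtain ⟨z', h1, h2⟩ := hv z hz (rd_mono h hr)
  exact ⟨z', h1, bl_mono h h2⟩

lemma blueL_upper {A : Set (Set Z2)} (hA : IsUpperSet A) (r : ℤ) : IsUpperSet {ω : Idx m → Bool | blueL r ω ∈ A} :=
  fun _ _ h hω => hA (blueL_mono r h) hω

lemma blueL_congr {ω ω' : Idx m → Bool} {r : ℤ} {v : Z2} (h : ∀ z, d2 z v ≤ r ^ 2 → ∀ c, ω (cs m z, c) = ω' (cs m z, c)) :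
    v ∈ blueL r ω ↔ v ∈ blueL r ω' := by
  have key : ∀ ω ω' : Idx m → Bool, (∀ z, d2 z v ≤ r ^ 2 → ∀ c, ω (cs m z, c) = ω' (cs m z, c)) →
      v ∈ blueL r ω → v ∈ blueL r ω' := by
    intro ω ω' h hv z hz hr
    obtain ⟨z', h1, h2⟩ := hv z hz (by unfold rd at *; rw [h z hz]; exact hr)
    exact ⟨z', h1, by unfold bl at *; rw [← h z' (h1.trans hz)]; exact h2⟩
  exact ⟨key _ _ h, key _ _ fun z hz c => (h z hz c).symm⟩

/-- The coordinates within distance `r` of `U`. -/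
def nbhd (m : ℕ) (r : ℤ) (U : Set Z2) : Set (Idx m) := {i | ∃ u ∈ U, ∃ z, d2 z u ≤ r ^ 2 ∧ cs m z = i.1}

lemma blueL_dep {A : Set (Set Z2)} {U : Set Z2} (h : SetDep A U) (r : ℤ) :
    EvDep {ω : Idx m → Bool | blueL r ω ∈ A} (nbhd m r U) := by
  intro x y hxy
  exact h _ _ fun v hv => blueL_congr fun z hz c => hxy _ ⟨v, hv, z, hz, rfl⟩

lemma cs_inj {z z' : Z2} (h : cs m z = cs m z') (h1 : |z.1 - z'.1| < m) (h2 : |z.2 - z'.2| < m) : z = z' := by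
  unfold cs at h
  rw [Prod.mk.injEq] at h
  obtain ⟨e1, e2⟩ := h
  have e1' := (ZMod.intCast_eq_intCast_iff_dvd_sub _ _ _).1 e1
  have e2' := (ZMod.intCast_eq_intCast_iff_dvd_sub _ _ _).1 e2
  ext
  · have := Int.eq_zero_of_abs_lt_dvd e1' (by rw [abs_sub_comm]; exact h1)
    omega
  · have := Int.eq_zero_of_abs_lt_dvd e2' (by rw [abs_sub_comm]; exact h2)
    omega

lemma nbhd_disjoint {U V : Set Z2} {o : Z2} {r N : ℤ} (hr : 0 ≤ r) (hN : 2 * N + 2 * r < m) (hU : U ⊆ Win o N) (hV : V ⊆ Win o N)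
    (h : ∀ u ∈ U, ∀ v ∈ V, 2 * r < |u.1 - v.1| ∨ 2 * r < |u.2 - v.2|) :
    Disjoint (nbhd m r U) (nbhd m r V) := by
  rw [Set.disjoint_left]
  rintro i ⟨u, hu, z, hz, e⟩ ⟨v, hv, z', hz', e'⟩
  have h1 := hU hu
  have h2 := hV hv
  obtain ⟨a1, a2⟩ := d2_le_sq hr hz
  obtain ⟨b1, b2⟩ := d2_le_sq hr hz'
  simp only [Win, mem_box] at h1 h2
  rw [abs_le] at a1 a2 b1 b2
  have := cs_inj (e.trans e'.symm) (by rw [abs_lt]; omega) (by rw [abs_lt]; omega)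
  subst this
  have := h u hu v hv
  rw [lt_abs, lt_abs] at this
  omega

variable [NeZero m]

lemma wt_comp {ι : Type*} [Fintype ι] [DecidableEq ι] (q : ι → ℝ) (e : ι ≃ ι) (he : ∀ i, q (e i) = q i) (ω : ι → Bool) :
    wt q (fun i => ω (e i)) = wt q ω := by
  unfold wt
  rw [← e.prod_comp fun i => w1 (q i) (ω i)]
  simp only [he]

/-- Lattice isometries compatible with the torus preserve the law of the blue region. -/
lemma model_symm (lam p : ℝ) (r : ℤ) (f : Z2 → Z2) (hf : Function.Surjective f) (hd : ∀ z v, d2 (f z) (f v) = d2 z v)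
    (e : ZMod m × ZMod m ≃ ZMod m × ZMod m) (he : ∀ z, cs m (f z) = e (cs m z)) (A : Set (Set Z2)) :
    Pr (qp m lam p) {ω | f ⁻¹' blueL r ω ∈ A} = Pr (qp m lam p) {ω | blueL r ω ∈ A} := by
  let E : Idx m ≃ Idx m := e.prodCongr (Equiv.refl Bool)
  let σ : (Idx m → Bool) ≃ (Idx m → Bool) := E.symm.arrowCongr (Equiv.refl Bool)
  have hσ : ∀ ω i, σ ω i = ω (E i) := fun ω i => by simp [σ, Equiv.arrowCongr]
  rw [← Pr_congr_symm (qp m lam p) σ (fun ω => by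
    have : σ ω = fun i => ω (E i) := funext (hσ ω)
    rw [this]
    exact wt_comp _ E (fun i => rfl) ω) {ω | blueL r ω ∈ A}]
  congr 1
  ext ω
  simp only [mem_ofPred_eq, mem_preimage]
  have : f ⁻¹' blueL r ω = blueL r (σ ω) := by
    have hrd : ∀ z, rd (σ ω) z ↔ rd ω (f z) := fun z => by
      unfold rd; rw [hσ, he]; rfl
    have hbl : ∀ z, bl (σ ω) z ↔ bl ω (f z) := fun z => by
      unfold bl; rw [hσ, he]; rfl
    ext v
    simp only [mem_preimage, blueL, mem_ofPred_eq, hrd, hbl]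
    constructor
    · intro h z hz hr
      obtain ⟨z', h1, h2⟩ := h (f z) (by rwa [hd]) hr
      obtain ⟨w, rfl⟩ := hf z'
      exact ⟨w, by rwa [hd, hd] at h1, h2⟩
    · intro h z hz hr
      obtain ⟨w, rfl⟩ := hf z
      obtain ⟨z', h1, h2⟩ := h w (by rwa [hd] at hz) hr
      exact ⟨f z', by rwa [hd, hd], h2⟩
  rw [this]

lemma model_shift (lam p : ℝ) (r : ℤ) (o : Z2) (A : Set (Set Z2)) :
    Pr (qp m lam p) {ω | (fun z => z + o) ⁻¹' blueL r ω ∈ A} = Pr (qp m lam p) {ω | blueL r ω ∈ A} :=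
  model_symm lam p r _ (fun z => ⟨z - o, by simp⟩) (fun z v => by simp [d2]) (Equiv.addRight (cs m o))
    (fun z => by simp [cs]) A

lemma model_swap (lam p : ℝ) (r : ℤ) (A : Set (Set Z2)) :
    Pr (qp m lam p) {ω | (fun z : Z2 => (z.2, z.1)) ⁻¹' blueL r ω ∈ A} = Pr (qp m lam p) {ω | blueL r ω ∈ A} :=
  model_symm lam p r _ (fun z => ⟨(z.2, z.1), by simp⟩) (fun z v => by simp [d2]; ring) (Equiv.prodComm _ _)
    (fun z => by simp [cs]) A

lemma model_refl (lam p : ℝ) (r : ℤ) (A : Set (Set Z2)) :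
    Pr (qp m lam p) {ω | (fun z : Z2 => (-z.1, z.2)) ⁻¹' blueL r ω ∈ A} = Pr (qp m lam p) {ω | blueL r ω ∈ A} :=
  model_symm lam p r _ (fun z => ⟨(-z.1, z.2), by simp⟩) (fun z v => by simp [d2]; ring)
    ((Equiv.neg _).prodCongr (Equiv.refl _)) (fun z => by simp [cs]) A

/-- Exchange of colours. -/
def flipE (m : ℕ) : (Idx m → Bool) ≃ (Idx m → Bool) where
  toFun ω i := !ω (i.1, !i.2)
  invFun ω i := !ω (i.1, !i.2)
  left_inv ω := by ext i; simp
  right_inv ω := by ext i; simp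

lemma flip_wt (lam : ℝ) (ω : Idx m → Bool) : wt (qp m lam (1/2)) (flipE m ω) = wt (qp m lam (1/2)) ω := by
  unfold wt
  let E : Idx m ≃ Idx m := (Equiv.refl _).prodCongr Equiv.boolNot
  rw [← E.prod_comp fun i => w1 (qp m lam (1/2) i) (ω i)]
  refine Finset.prod_congr rfl fun i _ => ?_
  obtain ⟨g, c⟩ := i
  have e : (1:ℝ) - 1/2 = 1/2 := by norm_num
  simp only [E, flipE, qp, w1, e, Equiv.prodCongr_apply, Equiv.coe_fn_mk, Prod.map, Equiv.refl_apply, Equiv.boolNot_apply]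
  cases c <;> cases ω (g, _) <;> simp

lemma flip_blueL (r : ℤ) (ω : Idx m → Bool) : (blueL r ω)ᶜ ⊆ blueL r (flipE m ω) := by
  intro v hv
  simp only [blueL, mem_compl_iff, mem_ofPred_eq, not_forall, not_exists, not_and] at hv
  obtain ⟨z0, h1, h2, h3⟩ := hv
  intro z hz hr
  refine ⟨z0, ?_, ?_⟩
  · by_contra hlt
    exact h3 z (not_le.1 hlt).le (by simpa [rd, bl, flipE] using hr)
  · simpa [rd, bl, flipE] using h2

lemma model_sq {lam : ℝ} (hl : 0 ≤ lam) (r x y k : ℤ) (hk : 0 ≤ k) :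
    1 / 2 ≤ Pr (qp m lam (1/2)) {ω | blueL r ω ∈ EH x (x + k) y (y + k)} := by
  have hq : Adm (qp m lam (1/2)) := qp_adm hl (by norm_num) (by norm_num)
  have h1 : (univ : Set (Idx m → Bool)) ⊆ {ω | blueL r ω ∈ EH x (x + k) y (y + k)} ∪
      flipE m ⁻¹' {ω | blueL r ω ∈ EV x (x + k) y (y + k)} := by
    intro ω _
    rcases hc_or_vc (blueL r ω) x (x + k) y (y + k) (by omega) (by omega) with ⟨a, b, ha, hb, hc⟩ | ⟨a, b, ha, hb, hc⟩
    · exact Or.inl ⟨a, b, ha, hb, hc⟩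
    · exact Or.inr ⟨a, b, ha, hb, (hc.mono_rel fun _ _ h => h.king).mono
        (inter_subset_inter_left _ (flip_blueL r ω))⟩
  have h2 := (Pr_mono hq h1).trans (Pr_union_le hq)
  rw [Pr_univ, Pr_congr_symm _ _ (flip_wt lam)] at h2
  have h3 : Pr (qp m lam (1/2)) {ω | blueL r ω ∈ EV x (x + k) y (y + k)} ≤
      Pr (qp m lam (1/2)) {ω | blueL r ω ∈ EH x (x + k) y (y + k)} := by
    rw [← model_swap, ← model_shift lam (1/2) r (y - x, x - y)]
    refine Pr_mono hq ?_
    rintro ω ⟨a, b, ha, hb, hc⟩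
    simp only [mem_ofPred_eq] at ha hb
    refine ⟨(a.2 - y + x, a.1 - x + y), (b.2 - y + x, b.1 - x + y), by simp [ha], by simp [hb]; ring, ?_⟩
    refine hc.map (f := fun p : Z2 => (p.2 - y + x, p.1 - x + y)) ?_ ?_
    · intro p q h
      exact ⟨by simpa using h.2, by simpa using h.1⟩
    · rintro p ⟨hp1, hp2⟩
      simp only [mem_preimage, Prod.mk_add_mk] at hp1
      simp only [mem_box] at hp2
      refine ⟨?_, by simp only [mem_box]; omega⟩
      show (p.2 - y + x + (y - x), p.1 - x + y + (x - y)) ∈ blueL r ω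
      convert hp1 using 2 <;> ring
  linarith

/-- The discrete model at or above criticality. -/
def modelPerc (m : ℕ) [NeZero m] {lam p : ℝ} (hl : 0 ≤ lam) {r N : ℤ} (hr : 0 ≤ r) (hN : 2 * N + 2 * r < m)
    (hp : 1 / 2 ≤ p) (hp1 : p ≤ 1) : Perc :=
  have hq : Adm (qp m lam p) := qp_adm hl (by linarith) hp1
  { P := fun A => Pr (qp m lam p) {ω | blueL r ω ∈ A}
    r := r
    N := N
    nonneg := fun A => Pr_nonneg hq _
    univ := Pr_univ
    mono := fun A A' h => Pr_mono hq fun _ hω => h hω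
    compl := fun A => Pr_compl
    union := fun A A' => Pr_union_le hq
    fkg := fun A A' hA hA' => Pr_fkg hq (blueL_upper hA r) (blueL_upper hA' r)
    shift := model_shift lam _ r
    swap := model_swap lam _ r
    refl := model_refl lam _ r
    indep := fun A A' U V o hA hA' hU hV h =>
      Pr_indep (blueL_dep hA r) (blueL_dep hA' r) (nbhd_disjoint hr hN hU hV h)
    sq := fun x y k hk => (model_sq hl r x y k hk).trans (Pr_mono_param (qp_adm hl (by norm_num) (by norm_num)) hq
      (qp_mono hl hp) (blueL_upper (Ev_upper _ _ _) r)) }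

lemma modelPerc_mono {lam p p' : ℝ} (hl : 0 ≤ lam) {r N : ℤ} (hr : 0 ≤ r) (hN : 2 * N + 2 * r < m)
    (hp : 1 / 2 ≤ p) (hpp : p ≤ p') (hp1 : p' ≤ 1) {A : Set (Set Z2)} (hA : IsUpperSet A) :
    (modelPerc m hl hr hN hp (hpp.trans hp1)).P A ≤ (modelPerc m hl hr hN (hp.trans hpp) hp1).P A :=
  Pr_mono_param (qp_adm hl (by linarith) (hpp.trans hp1)) (qp_adm hl (by linarith) hp1)
      (qp_mono hl hpp) (blueL_upper hA r)

/-! ### Arm events -/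

lemma scale_mono {s : ℕ → ℤ} (h0 : 0 < s 0) (h : ∀ j, 4 * s j ≤ s (j + 1)) : ∀ j, 0 < s j := by
  intro j
  induction j with
  | zero => exact h0
  | succ j ih => linarith [h j]

lemma scale_le {s : ℕ → ℤ} (h0 : 0 < s 0) (h : ∀ j, 4 * s j ≤ s (j + 1)) {i j : ℕ} (hij : i ≤ j) : s i ≤ s j := by
  induction j, hij using Nat.le_induction with
  | base => exact le_rfl
  | succ j hj ih => linarith [h j, scale_mono h0 h j]

lemma scale_pow {s : ℕ → ℤ} (h : ∀ j, 4 * s j ≤ s (j + 1)) (i j : ℕ) : 4 ^ j * s i ≤ s (i + j) := by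
  induction j with
  | zero => simp
  | succ j ih => rw [pow_succ, ← add_assoc]; linarith [h (i + j)]

lemma Circ_dep (o : Z2) (s : ℤ) : SetDep (Circ o s) {p | p ∈ Win o (2 * s) ∧ p ∉ Win o (s - 1)} := by
  refine SetDep.inter (SetDep.inter ?_ ?_) (SetDep.inter ?_ ?_) <;>
  · refine (Ev_dep _ _ _).mono fun p hp => ?_
    simp only [mem_box, Win, mem_ofPred_eq] at *
    omega

namespace Perc
variable (μ : Perc)

lemma arm_prob {s : ℕ → ℤ} {c : ℝ} (hc : 0 ≤ c) (hr : μ.r < s 0) (h0 : 0 < s 0) (h4 : ∀ j, 4 * s j ≤ s (j + 1))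
    {k : ℕ} (hN : 2 * s k ≤ μ.N) (hg : ∀ j < k, c ≤ μ.hcr (4 * s j) (s j)) (o : Z2) :
    μ.P (⋂ j < k, (Circ o (s j))ᶜ) ≤ (1 - c ^ 4) ^ k := by
  have hpos := scale_mono h0 h4
  have key : ∀ j ≤ k, μ.P (⋂ i < j, (Circ o (s i))ᶜ) ≤ (1 - c ^ 4) ^ j ∧
      SetDep (⋂ i < j, (Circ o (s i))ᶜ) {p | ∃ i < j, p ∈ Win o (2 * s i)} := by
    intro j
    induction j with
    | zero => intro _; simp [μ.univ, SetDep]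
    | succ j ih =>
      intro hj
      obtain ⟨i1, i2⟩ := ih (by omega)
      have e1 : (⋂ i < j + 1, (Circ o (s i))ᶜ) = (⋂ i < j, (Circ o (s i))ᶜ) ∩ (Circ o (s j))ᶜ := by
        ext B; simp only [mem_iInter, mem_inter_iff, Nat.lt_succ_iff_lt_or_eq, or_imp, forall_and, forall_eq]
      have d2 := (Circ_dep o (s j)).compl
      have hle : ∀ i ≤ k, s i ≤ s k := fun i hi => scale_le h0 h4 hi
      rw [e1]
      refine ⟨?_, SetDep.inter (i2.mono ?_) (d2.mono ?_)⟩
      · rw [μ.indep _ _ _ _ o i2 d2 ?_ ?_ ?_]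
        · rw [pow_succ, μ.compl]
          refine mul_le_mul i1 (by linarith [μ.circ_low hc (hg j (by omega)) o]) ?_ ?_
          · linarith [μ.le_one (Circ o (s j))]
          · exact (μ.nonneg _).trans i1
        · rintro p ⟨i, hi, hp⟩
          have := hle i (by omega)
          simp only [Win, mem_box] at *; omega
        · rintro p ⟨hp, -⟩
          have := hle j (by omega)
          simp only [Win, mem_box] at *; omega
        · rintro u ⟨i, hi, hu⟩ v ⟨-, hv⟩
          have h1 : s (i + 1) ≤ s j := scale_le h0 h4 hi
          have h2 := h4 i
          have h3 : s 0 ≤ s i := scale_le h0 h4 (Nat.zero_le _)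
          simp only [Win, mem_box, not_and_or, not_le] at *
          rw [lt_abs, lt_abs]
          omega
      · rintro p ⟨i, hi, hp⟩; exact ⟨i, by omega, hp⟩
      · rintro p ⟨hp, -⟩; exact ⟨j, by omega, hp⟩
  exact (key k le_rfl).1

end Perc

lemma arm_not_circ {B : Set Z2} {o a b : Z2} {s : ℤ} (hs : 0 < s) (h : Conn rook Bᶜ a b) (ha : a ∈ Win o s)
    (hb : 2 * s ≤ |b.1 - o.1| ∨ 2 * s ≤ |b.2 - o.2|) : B ∉ Circ o s := by
  rintro ⟨⟨⟨r, r', hr, hr', hR⟩, ⟨l, l', hl, hl', hL⟩⟩, ⟨t, t', ht, ht', hT⟩, ⟨d, d', hd, hd', hD⟩⟩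
  simp only [mem_ofPred_eq] at *
  have swapc : ∀ {U : Set Z2} {a b : Z2}, Conn king U a b →
      Conn king {p | (p.2, p.1) ∈ U} (a.2, a.1) (b.2, b.1) := fun h =>
    h.map (f := fun p => (p.2, p.1)) (fun p q h => ⟨h.2, h.1⟩) fun p hp => hp
  have swapr : ∀ {U : Set Z2} {a b : Z2}, Conn rook U a b →
      Conn rook {p | (p.2, p.1) ∈ U} (a.2, a.1) (b.2, b.1) := fun h =>
    h.map (f := fun p => (p.2, p.1)) (fun p q h => by unfold rook at h; show |p.2 - q.2| + |p.1 - q.1| ≤ 1; omega) fun p hp => hp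
  rcases cut_annulus (fun _ _ h => h.king) h o hs ha hb with
    ⟨x, y, hx, hy, hc⟩ | ⟨x, y, hx, hy, hc⟩ | ⟨x, y, hx, hy, hc⟩ | ⟨x, y, hx, hy, hc⟩
  · obtain ⟨p, hp, hq⟩ := cross_span (swapc hR) (swapr hc)
      (fun q hq => by have := hq.2; simp only [mem_box] at this; simp only [hr, hr']; omega)
      (fun q hq => by have := hq.2; simp only [mem_box] at this; simp only [hx, hy]; omega)
    exact hq.1 hp.1
  · obtain ⟨p, hp, hq⟩ := cross_span (swapc hL) (swapr hc.symmR)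
      (fun q hq => by have := hq.2; simp only [mem_box] at this; simp only [hl, hl']; omega)
      (fun q hq => by have := hq.2; simp only [mem_box] at this; simp only [hx, hy]; omega)
    exact hq.1 hp.1
  · obtain ⟨p, hp, hq⟩ := cross_span hT hc
      (fun q hq => by have := hq.2; simp only [mem_box] at this; omega)
      (fun q hq => by have := hq.2; simp only [mem_box] at this; omega)
    exact hq.1 hp.1
  · obtain ⟨p, hp, hq⟩ := cross_span hD hc.symmR
      (fun q hq => by have := hq.2; simp only [mem_box] at this; omega)
      (fun q hq => by have := hq.2; simp only [mem_box] at this; omega)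
    exact hq.1 hp.1

lemma arm_sub {s : ℕ → ℤ} (h0 : 0 < s 0) (h4 : ∀ j, 4 * s j ≤ s (j + 1)) {k : ℕ} {B : Set Z2} {o a b : Z2}
    (h : Conn rook Bᶜ a b) (ha : a ∈ Win o (s 0)) (hb : 2 * s k ≤ |b.1 - o.1| ∨ 2 * s k ≤ |b.2 - o.2|) :
    B ∈ ⋂ j < k, (Circ o (s j))ᶜ := by
  simp only [mem_iInter]
  intro j hj
  have h1 := scale_le h0 h4 hj.le
  have h2 := scale_le h0 h4 (Nat.zero_le j)
  refine arm_not_circ (scale_mono h0 h4 j) h ?_ (by omega)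
  simp only [Win, mem_box] at *; omega

/-! ### Exploration of a row -/

section explore
variable {m : ℕ} [NeZero m]

/-- Sites joined to the row `k` by a path outside `B` in `W`. -/
def RowC (W : Set Z2) (k : ℤ) (B : Set Z2) : Set Z2 := {v | ∃ a, a.2 = k ∧ Conn rook (W ∩ Bᶜ) a v}

/-- Indices possibly queried when exploring the row `k`. -/
def Dq (m : ℕ) (W : Set Z2) (r k : ℤ) (i : Idx m) : Set (Idx m → Bool) :=
  {ω | ∃ v ∈ W, i ∈ nbhd m r {v} ∧ (v.2 = k ∨ ∃ v', rook v' v ∧ v' ∈ RowC W k (blueL r ω))}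

/-- Sites known to be non-blue. -/
def Kn (r : ℤ) (S : Finset (Idx m)) (ω : Idx m → Bool) : Set Z2 := {v | nbhd m r {v} ⊆ S ∧ v ∉ blueL r ω}

lemma blueL_known {r : ℤ} {S : Set (Idx m)} {ω ω' : Idx m → Bool} {v : Z2} (hv : nbhd m r {v} ⊆ S)
    (h : ∀ i ∈ S, ω i = ω' i) : v ∈ blueL r ω ↔ v ∈ blueL r ω' :=
  blueL_congr fun z hz _ => h _ (hv ⟨v, rfl, z, hz, rfl⟩)

lemma Kn_congr {r : ℤ} {S : Finset (Idx m)} {ω ω' : Idx m → Bool} (h : ∀ i ∈ (S : Set (Idx m)), ω i = ω' i) :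
    Kn r S ω = Kn r S ω' := by
  ext v
  simp only [Kn, mem_ofPred_eq, and_congr_right_iff]
  exact fun hv => not_congr (blueL_known hv h)

open Classical in
/-- The exploration from row `k`. -/
def nxtE (W : Set Z2) (r k : ℤ) (S : Finset (Idx m)) (ω : Idx m → Bool) : Option (Idx m) :=
  if h : ∃ i, i ∉ S ∧ ∃ v ∈ W, i ∈ nbhd m r {v} ∧ (v.2 = k ∨ ∃ v', rook v' v ∧ v' ∈ RowC W k (Kn r S ω)ᶜ) then
    some h.choose else none

lemma explore_row {x0 x1 y0 y1 r k : ℤ} (hx : x0 ≤ x1) (hy0 : y0 ≤ k) (hy1 : k ≤ y1) :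
    Nonempty (Explore {ω : Idx m → Bool | blueL r ω ∈ EH x0 x1 y0 y1} (Dq m (Box x0 x1 y0 y1) r k)) := by
  classical
  set W := Box x0 x1 y0 y1 with hW
  refine ⟨⟨nxtE W r k, ?_, ?_, ?_, ?_⟩⟩
  · intro S ω ω' h
    unfold nxtE
    rw [Kn_congr h]
  · intro S ω i h
    unfold nxtE at h
    split_ifs at h with hh
    obtain rfl := Option.some.inj h
    exact hh.choose_spec.1
  · intro S ω i h
    unfold nxtE at h
    split_ifs at h with hh
    obtain rfl := Option.some.inj h
    obtain ⟨-, v, hv, hi, hv'⟩ := hh.choose_spec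
    refine ⟨v, hv, hi, hv'.imp id ?_⟩
    rintro ⟨v', h1, a, ha, h2⟩
    exact ⟨v', h1, a, ha, h2.mono fun p hp => ⟨hp.1, (not_not.1 hp.2).2⟩⟩
  · intro S ω h Z hZ
    unfold nxtE at h
    split_ifs at h with hh
    push Not at hh
    have known : ∀ v ∈ W, (v.2 = k ∨ ∃ v', rook v' v ∧ v' ∈ RowC W k (Kn r S ω)ᶜ) → nbhd m r {v} ⊆ S := by
      intro v hv h1 i hi
      by_contra hiS
      rcases hh i hiS v hv hi with ⟨h2, h3⟩
      rcases h1 with h1 | ⟨v', h4, h5⟩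
      · exact h2 h1
      · exact h3 v' h4 h5
    have main : ∀ ω1 ω2 : Idx m → Bool, (∀ i ∈ (S : Set (Idx m)), ω1 i = ω i) → (∀ i ∈ (S : Set (Idx m)), ω2 i = ω i) →
        blueL r ω1 ∈ EH x0 x1 y0 y1 → blueL r ω2 ∈ EH x0 x1 y0 y1 := by
      intro ω1 ω2 e1 e2 h1
      rcases hc_or_vc (blueL r ω2) x0 x1 y0 y1 hx (hy0.trans hy1) with ⟨a, b, ha, hb, hc⟩ | ⟨a, b, ha, hb, hc⟩
      · exact ⟨a, b, ha, hb, hc⟩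
      exfalso
      obtain ⟨a', b', ha', hb', hc'⟩ := h1
      -- every site joined to the row is known
      have kk : ∀ c v, c.2 = k → Conn rook ((blueL r ω2)ᶜ ∩ W) c v → Conn rook (W ∩ ((Kn r S ω)ᶜ)ᶜ) c v := by
        intro c v hck hcv
        have mem : ∀ v ∈ W, v ∉ blueL r ω2 → nbhd m r {v} ⊆ S → v ∈ W ∩ ((Kn r S ω)ᶜ)ᶜ := fun v h1 h2 h3 =>
          ⟨h1, not_not.2 ⟨h3, fun h4 => h2 ((blueL_known h3 e2).2 h4)⟩⟩
        refine hcv.induct (P := fun v => Conn rook (W ∩ ((Kn r S ω)ᶜ)ᶜ) c v) ?_ ?_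
        · exact Conn.refl (mem c hcv.1.2 hcv.1.1 (known c hcv.1.2 (Or.inl hck)))
        · intro x y _ ih hxy hy
          exact ih.tail hxy (mem y hy.2 hy.1 (known y hy.2 (Or.inr ⟨x, hxy, c, hck, ih⟩)))
      have hex : ∃ c, c.2 = k ∧ Conn rook ((blueL r ω2)ᶜ ∩ W) a c := by
        by_contra! hno
        have : b.2 < k := by
          refine hc.induct (P := fun v => v.2 < k) ?_ ?_
          · have := hno a; by_contra h; exact this (by omega) (Conn.refl hc.1)
          · intro x y hx ih hxy hy
            have h1 := hno y
            have h2 := hxy.king.2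
            rw [abs_le] at h2
            by_contra h
            exact h1 (by omega) (hx.tail hxy hy)
        omega
      obtain ⟨c, hck, hac⟩ := hex
      have p1 := kk c a hck hac.symmR
      have p2 := kk c b hck (hac.symmR.trans hc)
      have p3 := (p1.symmR.trans p2)
      obtain ⟨p, hp, hq⟩ := cross_span hc' p3
        (fun q hq => by have := hq.1; simp only [hW, mem_box, mem_ofPred_eq] at *; omega)
        (fun q hq => by have := hq.2; simp only [hW, mem_box, mem_ofPred_eq] at *; omega)
      have hq' := not_not.1 hq.2
      exact hq'.2 ((blueL_known hq'.1 e1).1 hp.1)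
    exact ⟨main Z ω hZ (fun _ _ => rfl), main ω Z (fun _ _ => rfl) hZ⟩

lemma row_reveal {lam p : ℝ} (hl : 0 ≤ lam) (hp : 1 / 2 ≤ p) (hp1 : p ≤ 1) {r N : ℤ} (hr : 0 ≤ r)
    (hN : 2 * N + 2 * r < m) {s : ℕ → ℤ} {c : ℝ} (hc : 0 ≤ c) (hr0 : r < s 0) (h4 : ∀ j, 4 * s j ≤ s (j + 1))
    {k : ℕ} (hsN : 2 * s k ≤ N) (hg : ∀ j < k, c ≤ (modelPerc m hl hr hN le_rfl (by norm_num)).hcr (4 * s j) (s j))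
    {S : ℕ} (hS : 4 * (S:ℤ) + 2 * r < m) (i : Idx m) :
    ∑ y ∈ Finset.range (S + 1), Pr (qp m lam p) (Dq m (Box 0 (4 * S) 0 S) r y i) ≤
      ((S + 1 : ℕ) : ℝ) * (4 * s k / (S + 1 : ℕ) + (1 - c ^ 4) ^ k) := by
  classical
  have hq : Adm (qp m lam p) := qp_adm hl (by linarith) hp1
  have h0 : 0 < s 0 := by omega
  have hpos := scale_mono h0 h4 k
  set W := Box 0 (4 * (S:ℤ)) 0 S
  have hθ : 0 ≤ (1 - c ^ 4) ^ k := by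
    refine ((modelPerc m hl hr hN hp hp1).nonneg _).trans
      ((modelPerc m hl hr hN hp hp1).arm_prob hc hr0 h0 h4 hsN (fun j hj => (hg j hj).trans ?_) (0, 0))
    exact modelPerc_mono hl hr hN le_rfl hp hp1 (Ev_upper _ _ _)
  have hS1 : (0:ℝ) < ((S + 1 : ℕ) : ℝ) := by positivity
  have e : ((S + 1 : ℕ) : ℝ) * (4 * s k / (S + 1 : ℕ) + (1 - c ^ 4) ^ k) = 4 * s k + (S + 1 : ℕ) * (1 - c ^ 4) ^ k := by
    field_simp
  rw [e]
  by_cases hex : ∃ v0 ∈ W, i ∈ nbhd m r {v0}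
  swap
  · have : ∀ y : ℕ, Dq m W r y i = ∅ := by
      intro y
      rw [Set.eq_empty_iff_forall_notMem]
      rintro ω ⟨v, hv, hi, -⟩
      exact hex ⟨v, hv, hi⟩
    simp only [this]
    have e0 : Pr (qp m lam p) ∅ = 0 := by
      have := Pr_compl (q := qp m lam p) (E := univ)
      rw [compl_univ, Pr_univ] at this; linarith
    rw [e0]
    have : (0:ℝ) < s k := by exact_mod_cast hpos
    simp only [Finset.sum_const_zero]
    positivity
  obtain ⟨v0, hv0, u, rfl, z0, hz0, e0⟩ := hex
  have key : ∀ y : ℕ, 2 * s k ≤ |(y:ℤ) - z0.2| → Pr (qp m lam p) (Dq m W r y i) ≤ (1 - c ^ 4) ^ k := by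
    intro y hy
    refine le_trans (Pr_mono hq ?_) ((modelPerc m hl hr hN hp hp1).arm_prob hc hr0 h0 h4 hsN
      (fun j hj => (hg j hj).trans (modelPerc_mono hl hr hN le_rfl hp hp1 (Ev_upper _ _ _))) z0)
    rintro ω ⟨v, hv, ⟨w, rfl, z, hz, ez⟩, hv'⟩
    have a1 := d2_le_sq hr hz0
    have a2 := d2_le_sq hr hz
    simp only [W, mem_box] at hv hv0
    simp only [abs_le] at a1 a2
    have : z = z0 := cs_inj (ez.trans e0.symm) (by rw [abs_lt]; omega) (by rw [abs_lt]; omega)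
    subst this
    have hs := scale_le h0 h4 (Nat.zero_le k)
    rw [le_abs] at hy
    rcases hv' with hv' | ⟨v', hvv, a, ha, hc⟩
    · omega
    · have h1 := hvv.king
      simp only [king, abs_le] at h1
      refine arm_sub h0 h4 (hc.symmR.mono fun p hp => hp.2) (o := z) ?_ (Or.inr ?_)
      · simp only [Win, mem_box]; omega
      · rw [ha, le_abs]; omega
  calc ∑ y ∈ Finset.range (S + 1), Pr (qp m lam p) (Dq m W r y i)
      ≤ ∑ y ∈ Finset.range (S + 1), ((if |(y:ℤ) - z0.2| < 2 * s k then (1:ℝ) else 0) + (1 - c ^ 4) ^ k) := by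
        refine Finset.sum_le_sum fun y _ => ?_
        split_ifs with h
        · linarith [Pr_le_one hq (Dq m W r y i)]
        · linarith [key y (not_lt.1 h)]
    _ = ((Finset.range (S + 1)).filter fun y : ℕ => |(y:ℤ) - z0.2| < 2 * s k).card + (S + 1 : ℕ) * (1 - c ^ 4) ^ k := by
        rw [Finset.sum_add_distrib, Finset.sum_boole]; simp
    _ ≤ _ := by
        gcongr
        have h1 : ((Finset.range (S + 1)).filter fun y : ℕ => |(y:ℤ) - z0.2| < 2 * s k).card ≤
            (Finset.Ioo (z0.2 - 2 * s k) (z0.2 + 2 * s k)).card := by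
          refine Finset.card_le_card_of_injOn (fun y : ℕ => (y:ℤ)) ?_ fun a _ b _ h => by simpa using h
          intro y hy
          have hy := (Finset.mem_filter.1 hy).2
          rw [abs_lt] at hy
          simp only [Finset.coe_Ioo, Set.mem_Ioo]; omega
        rw [Int.card_Ioo] at h1
        have h2 : (((Finset.range (S + 1)).filter fun y : ℕ => |(y:ℤ) - z0.2| < 2 * s k).card : ℤ) ≤ 4 * s k := by omega
        exact_mod_cast h2

/-- Crossing probabilities above criticality at a scale dominating many good scales. -/
lemma sharp_crossing {lam p : ℝ} (hl : 0 ≤ lam) (hp : 1 / 2 ≤ p) (hp1 : p ≤ 1) {r N : ℤ} (hr : 0 ≤ r)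
    (hN : 2 * N + 2 * r < m) {s : ℕ → ℤ} {c : ℝ} (hc : 0 < c) (hc1 : c ≤ 1) (hr0 : r < s 0) (h4 : ∀ j, 4 * s j ≤ s (j + 1))
    {k : ℕ} (hsN : 4 * s (2 * k) ≤ N)
    (hg : ∀ j ≤ 2 * k, c ≤ (modelPerc m hl hr hN le_rfl (by norm_num)).hcr (4 * s j) (s j)) :
    1 - Pr (qp m lam p) {ω | blueL r ω ∈ EH 0 (4 * s (2 * k)) 0 (s (2 * k))} ≤
      Real.exp (-(c * (p - 1 / 2) / (10 * max (1 / 4) (1 - c ^ 4) ^ k))) := by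
  have h0 : 0 < s 0 := by omega
  obtain ⟨S, hS⟩ := Int.eq_ofNat_of_zero_le (scale_mono h0 h4 (2 * k)).le
  rw [hS] at hsN ⊢
  have hk2 : 2 * s k ≤ N := by
    have := scale_le h0 h4 (show k ≤ 2 * k by omega)
    have := scale_mono h0 h4 k
    omega
  set θ := max (1 / 4 : ℝ) (1 - c ^ 4)
  have hθ : 0 < θ := lt_max_of_lt_left (by norm_num)
  have hc4 : c ^ 4 ≤ 1 := pow_le_one₀ hc.le hc1
  have hΔ : 4 * (s k : ℝ) / (S + 1 : ℕ) + (1 - c ^ 4) ^ k ≤ 5 * θ ^ k := by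
    have h1 : (1 - c ^ 4) ^ k ≤ θ ^ k := pow_le_pow_left₀ (by linarith) (le_max_right _ _) k
    have h2 : (1 / 4 : ℝ) ^ k ≤ θ ^ k := pow_le_pow_left₀ (by norm_num) (le_max_left _ _) k
    have h3 : (s k : ℝ) / (S + 1 : ℕ) ≤ (1 / 4 : ℝ) ^ k := by
      rw [div_le_iff₀ (by positivity), one_div, inv_pow]
      have h5 := scale_pow h4 k k
      rw [← two_mul, hS] at h5
      have h6 : (4:ℝ) ^ k * s k ≤ S := by exact_mod_cast h5
      rw [← div_eq_inv_mul, le_div_iff₀ (by positivity)]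
      push_cast
      linarith
    rw [mul_div_assoc]; linarith
  have hsh := sharp_threshold (fun t => qp m lam t) (fun t => qp' m lam t) (p0 := 1/2) (p1 := p) (Δ := 5 * θ ^ k)
    hp (by positivity) (fun t ht => qp_adm hl (by linarith [ht.1]) (ht.2.trans hp1))
    (fun t _ i => qp_deriv lam t i) (fun t ht i => qp_var hl (by linarith [ht.1]) (ht.2.trans hp1) i)
    (fun t ht i => qp_mono hl ht.1 i) (blueL_upper (Ev_upper _ _ _) r) (N := S + 1) (Nat.succ_pos _)
    (fun y i => Dq m (Box 0 (4 * S) 0 S) r y i)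
    (fun y hy => explore_row (x0 := 0) (x1 := 4 * S) (y0 := 0) (y1 := S) (by positivity) (by positivity) (by omega))
    (fun t ht i => (row_reveal hl ht.1 (ht.2.trans hp1) hr hN hc.le hr0 h4 hk2 (fun j hj => hg j (by omega))
      (by omega) i).trans (mul_le_mul_of_nonneg_left hΔ (by positivity)))
  refine hsh.trans (Real.exp_le_exp.2 (neg_le_neg ?_))
  have := hg (2 * k) le_rfl
  rw [hS] at this
  rw [show 2 * (5 * θ ^ k) = 10 * θ ^ k by ring]
  gcongr
  exact this

end explore

section cyl
variable {ι : Type*} [Fintype ι] [DecidableEq ι] {q : ι → ℝ}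

lemma Pr_cylinder (q : ι → ℝ) (A : Finset ι) (b : ι → Bool) :
    Pr q {ω | ∀ i ∈ A, ω i = b i} = ∏ i ∈ A, w1 (q i) (b i) := by
  classical
  have h1 : Pr q {ω | ∀ i ∈ A, ω i = b i} =
      ∑ ω : ι → Bool, ∏ i, (w1 (q i) (ω i) * if i ∈ A → ω i = b i then 1 else 0) := by
    unfold Pr Ex wt
    refine Finset.sum_congr rfl fun ω _ => ?_
    rw [Finset.prod_mul_distrib]
    congr 1
    by_cases h : ∀ i ∈ A, ω i = b i
    · rw [indicator_of_mem (by exact h), Finset.prod_eq_one]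
      exact fun i _ => if_pos (h i)
    · rw [indicator_of_notMem (by exact h)]
      push Not at h
      obtain ⟨i, hi, hne⟩ := h
      rw [Finset.prod_eq_zero (Finset.mem_univ i)]
      simp [hi, hne]
  rw [h1, ← Fintype.prod_sum (fun i x => w1 (q i) x * if i ∈ A → x = b i then 1 else 0)]
  rw [← Finset.prod_subset (Finset.subset_univ A)]
  · refine Finset.prod_congr rfl fun i hi => ?_
    cases hb : b i <;> simp [hi, hb]
  · intro i _ hi
    simp [hi, w1]

end cyl

section seeds
variable {m : ℕ} [NeZero m]

/-- Finite boxes of sites. -/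
def fbox (m : ℕ) (x0 x1 y0 y1 : ℤ) : Finset (ZMod m × ZMod m) :=
  ((Finset.Icc x0 x1) ×ˢ (Finset.Icc y0 y1)).image (cs m)

lemma fbox_card_le (x0 x1 y0 y1 : ℤ) : (fbox m x0 x1 y0 y1).card ≤ (x1 + 1 - x0).toNat * (y1 + 1 - y0).toNat := by
  refine Finset.card_image_le.trans ?_
  rw [Finset.card_product, Int.card_Icc, Int.card_Icc]

lemma fbox_card {x0 x1 y0 y1 : ℤ} (hx : x1 - x0 < m) (hy : y1 - y0 < m) :
    (fbox m x0 x1 y0 y1).card = (x1 + 1 - x0).toNat * (y1 + 1 - y0).toNat := by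
  unfold fbox
  rw [Finset.card_image_of_injOn, Finset.card_product, Int.card_Icc, Int.card_Icc]
  intro z hz z' hz' e
  simp only [Finset.coe_product, Finset.coe_Icc, Set.mem_prod, Set.mem_Icc] at hz hz'
  exact cs_inj e (by rw [abs_lt]; omega) (by rw [abs_lt]; omega)

lemma mem_fbox {x0 x1 y0 y1 : ℤ} {z : Z2} (hz : z ∈ Box x0 x1 y0 y1) : cs m z ∈ fbox m x0 x1 y0 y1 := by
  rw [mem_box] at hz
  refine Finset.mem_image_of_mem _ ?_
  simp only [Finset.mem_product, Finset.mem_Icc]; omega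

lemma exists_of_fbox {x0 x1 y0 y1 : ℤ} {g : ZMod m × ZMod m} (hg : g ∈ fbox m x0 x1 y0 y1) :
    ∃ z ∈ Box x0 x1 y0 y1, cs m z = g := by
  obtain ⟨z, hz, rfl⟩ := Finset.mem_image.1 hg
  refine ⟨z, ?_, rfl⟩
  simp only [Finset.mem_product, Finset.mem_Icc] at hz
  rw [mem_box]; omega

/-- No red point in the box. -/
def NoRed (m : ℕ) (x0 x1 y0 y1 : ℤ) : Set (Idx m → Bool) := {ω | ∀ z ∈ Box x0 x1 y0 y1, ¬ rd ω z}
/-- No blue point in the box. -/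
def NoBlue (m : ℕ) (x0 x1 y0 y1 : ℤ) : Set (Idx m → Bool) := {ω | ∀ z ∈ Box x0 x1 y0 y1, ¬ bl ω z}

lemma Pr_noRed (lam p : ℝ) (x0 x1 y0 y1 : ℤ) :
    Pr (qp m lam p) (NoRed m x0 x1 y0 y1) = Real.exp (-(lam * (1 - p) * (fbox m x0 x1 y0 y1).card)) := by
  have : NoRed m x0 x1 y0 y1 = {ω | ∀ i ∈ (fbox m x0 x1 y0 y1) ×ˢ ({false} : Finset Bool), ω i = true} := by
    ext ω
    simp only [NoRed, rd, mem_ofPred_eq, Finset.mem_product, Finset.mem_singleton, Bool.not_eq_false]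
    constructor
    · rintro h ⟨g, b⟩ ⟨hg, rfl⟩
      obtain ⟨z, hz, rfl⟩ := exists_of_fbox hg
      exact h z hz
    · exact fun h z hz => h _ ⟨mem_fbox hz, rfl⟩
  rw [this, Pr_cylinder, Finset.prod_product]
  simp only [w1, qp, Finset.prod_singleton, if_true, Finset.prod_const, Bool.false_eq_true, if_false]
  rw [← Real.exp_nat_mul]
  congr 1; ring

lemma Pr_noBlue (lam p : ℝ) (x0 x1 y0 y1 : ℤ) :
    Pr (qp m lam p) (NoBlue m x0 x1 y0 y1) = Real.exp (-(lam * p * (fbox m x0 x1 y0 y1).card)) := by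
  have : NoBlue m x0 x1 y0 y1 = {ω | ∀ i ∈ (fbox m x0 x1 y0 y1) ×ˢ ({true} : Finset Bool), ω i = false} := by
    ext ω
    simp only [NoBlue, bl, mem_ofPred_eq, Finset.mem_product, Finset.mem_singleton, Bool.not_eq_true]
    constructor
    · rintro h ⟨g, b⟩ ⟨hg, rfl⟩
      obtain ⟨z, hz, rfl⟩ := exists_of_fbox hg
      exact h z hz
    · exact fun h z hz => h _ ⟨mem_fbox hz, rfl⟩
  rw [this, Pr_cylinder, Finset.prod_product]
  simp only [w1, qp, Finset.prod_singleton, if_true, Finset.prod_const, Bool.false_eq_true, if_false, sub_sub_cancel]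
  rw [← Real.exp_nat_mul]
  congr 1; ring

/-- A blue box: a blue point near the centre and no red point around. -/
def Seed (m : ℕ) (o : Z2) (u : ℤ) : Set (Idx m → Bool) :=
  (NoBlue m (o.1 - u) (o.1 + u) (o.2 - u) (o.2 + u))ᶜ ∩
    NoRed m (o.1 - 4 * u) (o.1 + 4 * u) (o.2 - 4 * u) (o.2 + 4 * u)

lemma noRed_upper (x0 x1 y0 y1 : ℤ) : IsUpperSet (NoRed m x0 x1 y0 y1) :=
  fun _ _ h hω z hz hr => hω z hz (rd_mono h hr)

lemma noBlue_compl_upper (x0 x1 y0 y1 : ℤ) : IsUpperSet (NoBlue m x0 x1 y0 y1)ᶜ := by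
  intro ω ω' h hω hn
  exact hω fun z hz hb => hn z hz (bl_mono h hb)

lemma seed_upper (o : Z2) (u : ℤ) : IsUpperSet (Seed m o u) :=
  (noBlue_compl_upper _ _ _ _).inter (noRed_upper _ _ _ _)

/-- Lower bound for the probability of a seed. -/
def cS : ℝ := (1 - Real.exp (-(1 / 2))) * Real.exp (-41)

lemma cS_pos : 0 < cS := by
  unfold cS
  have : Real.exp (-(1 / 2)) < 1 := Real.exp_lt_one_iff.2 (by norm_num)
  have := Real.exp_pos (-41)
  nlinarith

lemma cS_lt : cS < 1 := by
  unfold cS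
  have h1 := Real.exp_pos (-(1 / 2))
  have h2 : Real.exp (-41) < 1 := Real.exp_lt_one_iff.2 (by norm_num)
  have := Real.exp_pos (-41)
  nlinarith

lemma seed_prob {lam p : ℝ} (hl : 0 ≤ lam) (hp : 1 / 2 ≤ p) (hp1 : p ≤ 1) {u : ℤ} (hu : 0 < u) (hum : 2 * u < m)
    (h1 : 1 / 4 ≤ lam * u ^ 2) (h2 : lam * u ^ 2 ≤ 1) (o : Z2) : cS ≤ Pr (qp m lam p) (Seed m o u) := by
  have hq : Adm (qp m lam p) := qp_adm hl (by linarith) hp1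
  refine le_trans ?_ (Pr_fkg hq (noBlue_compl_upper _ _ _ _) (noRed_upper _ _ _ _))
  have hu' : (1:ℝ) ≤ u := by exact_mod_cast hu
  unfold cS
  refine mul_le_mul ?_ ?_ (Real.exp_pos _).le (Pr_nonneg hq _)
  · rw [Pr_compl, Pr_noBlue, fbox_card (by omega) (by omega)]
    refine sub_le_sub_left (Real.exp_le_exp.2 (neg_le_neg ?_)) _
    have e : (((o.1 + u + 1 - (o.1 - u)).toNat * (o.2 + u + 1 - (o.2 - u)).toNat : ℕ) : ℝ) = (2 * u + 1) ^ 2 := by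
      have e1 : (o.1 + u + 1 - (o.1 - u)) = 2 * u + 1 := by ring
      have e2 : (o.2 + u + 1 - (o.2 - u)) = 2 * u + 1 := by ring
      have : ((2 * u + 1).toNat : ℤ) = 2 * u + 1 := Int.toNat_of_nonneg (by omega)
      rw [e1, e2]
      have : ((2 * u + 1).toNat : ℝ) = 2 * u + 1 := by exact_mod_cast this
      push_cast; rw [this]; ring
    rw [e]
    have : lam * p * (4 * u ^ 2) ≤ lam * p * (2 * u + 1) ^ 2 := by
      refine mul_le_mul_of_nonneg_left (by nlinarith) (mul_nonneg hl (by linarith))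
    nlinarith
  · rw [Pr_noRed]
    refine Real.exp_le_exp.2 (neg_le_neg ?_)
    have h3 : ((fbox m (o.1 - 4 * u) (o.1 + 4 * u) (o.2 - 4 * u) (o.2 + 4 * u)).card : ℝ) ≤ (9 * u) ^ 2 := by
      have h := fbox_card_le (m := m) (o.1 - 4 * u) (o.1 + 4 * u) (o.2 - 4 * u) (o.2 + 4 * u)
      have e1 : (o.1 + 4 * u + 1 - (o.1 - 4 * u)) = 8 * u + 1 := by ring
      have e2 : (o.2 + 4 * u + 1 - (o.2 - 4 * u)) = 8 * u + 1 := by ring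
      have e3 : ((8 * u + 1).toNat : ℤ) = 8 * u + 1 := Int.toNat_of_nonneg (by omega)
      have e4 : ((8 * u + 1).toNat : ℝ) = 8 * u + 1 := by exact_mod_cast e3
      rw [e1, e2] at h
      have h' : ((fbox m (o.1 - 4 * u) (o.1 + 4 * u) (o.2 - 4 * u) (o.2 + 4 * u)).card : ℝ) ≤ (8 * u + 1) * (8 * u + 1) := by
        rw [← e4]; exact_mod_cast h
      nlinarith
    have h4 : lam * (1 - p) ≤ lam * (1 / 2) := mul_le_mul_of_nonneg_left (by linarith) hl
    have h5 : lam * (1 - p) * (fbox m (o.1 - 4 * u) (o.1 + 4 * u) (o.2 - 4 * u) (o.2 + 4 * u)).card ≤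
        lam * (1 / 2) * (9 * u) ^ 2 :=
      mul_le_mul h4 h3 (by positivity) (by positivity)
    nlinarith

lemma d2_win {o v z : Z2} {u : ℤ} (hv : v ∈ Win o u) (hz : z ∈ Win o u) : d2 z v ≤ 8 * u ^ 2 := by
  simp only [Win, mem_box] at *
  unfold d2
  have h1 : |z.1 - v.1| ≤ 2 * u := by rw [abs_le]; omega
  have h2 : |z.2 - v.2| ≤ 2 * u := by rw [abs_le]; omega
  have := sq_le_sq' (abs_le.1 h1).1 (abs_le.1 h1).2
  have := sq_le_sq' (abs_le.1 h2).1 (abs_le.1 h2).2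
  linarith

lemma d2_far {o v z : Z2} {u : ℤ} (hu : 0 ≤ u) (hv : v ∈ Win o u) (hz : z ∉ Win o (4 * u)) : 9 * u ^ 2 ≤ d2 z v := by
  simp only [Win, mem_box] at *
  unfold d2
  have : 3 * u ≤ |z.1 - v.1| ∨ 3 * u ≤ |z.2 - v.2| := by
    rw [le_abs, le_abs]; omega
  rcases this with h | h
  · have := sq_le_sq' (by linarith [abs_nonneg (z.1 - v.1)]) h
    rw [sq_abs] at this
    nlinarith [sq_nonneg (z.2 - v.2)]
  · have := sq_le_sq' (by linarith [abs_nonneg (z.2 - v.2)]) h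
    rw [sq_abs] at this
    nlinarith [sq_nonneg (z.1 - v.1)]

lemma seed_blue {o v : Z2} {u : ℤ} (hu : 0 ≤ u) {ω : Idx m → Bool} (h : ω ∈ Seed m o u) (hv : v ∈ Win o u) :
    ∃ z ∈ Win o u, bl ω z ∧ ∀ z', rd ω z' → d2 z v ≤ d2 z' v := by
  obtain ⟨h1, h2⟩ := h
  simp only [NoBlue, mem_compl_iff, mem_ofPred_eq, not_forall, not_not] at h1
  obtain ⟨z, hz, hb⟩ := h1
  refine ⟨z, hz, hb, fun z' hr => ?_⟩
  have h3 : z' ∉ Win o (4 * u) := fun h => h2 z' h hr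
  nlinarith [d2_win hv hz, d2_far hu hv h3, sq_nonneg u]

lemma seed_win {o : Z2} {u : ℤ} (hu : 0 ≤ u) {ω : Idx m → Bool} (h : ω ∈ Seed m o u) (r : ℤ) : Win o u ⊆ blueL r ω := by
  intro v hv z _ hr
  obtain ⟨z', -, hb, hz'⟩ := seed_blue hu h hv
  exact ⟨z', hz' z hr, hb⟩

end seeds

/-- Iterating `next_good`. -/
lemma Perc.scales {c : ℝ} (hc : 0 < c) (hcA : c ≤ cA) : ∃ C : ℤ, 4 ≤ C ∧ ∀ (μ : Perc) (S : ℤ), 0 < S → μ.r ≤ S →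
    c ≤ μ.hcr (4 * S) S → ∀ K : ℕ, C ^ K * S ≤ μ.N → ∃ s : ℕ → ℤ, s 0 = S ∧ (∀ j, 4 * s j ≤ s (j + 1)) ∧
      (∀ j, s j ≤ C ^ j * S) ∧ ∀ j ≤ K, c ≤ μ.hcr (4 * s j) (s j) := by
  classical
  obtain ⟨C, hC, h⟩ := Perc.next_good hc
  refine ⟨max C 4, le_max_right _ _, fun μ S hS hr hg K hK => ?_⟩
  set D := max C 4
  have hD : 4 ≤ D := le_max_right _ _
  have hCD : C ≤ D := le_max_left _ _
  let nx : ℤ → ℤ := fun t => if e : ∃ s', 4 * t ≤ s' ∧ s' ≤ C * t ∧ cA ≤ μ.hcr (4 * s') s' then e.choose else 4 * t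
  let s : ℕ → ℤ := fun j => Nat.rec S (fun _ t => nx t) j
  have hs1 : ∀ j, s (j + 1) = nx (s j) := fun _ => rfl
  have h4 : ∀ j, 4 * s j ≤ s (j + 1) := by
    intro j
    rw [hs1]
    simp only [nx]
    split_ifs with e
    · exact e.choose_spec.1
    · exact le_rfl
  have hpos : ∀ j, 0 < s j ∧ S ≤ s j := by
    intro j
    induction j with
    | zero => exact ⟨hS, le_rfl⟩
    | succ j ih => have := h4 j; omega
  have hD0 : ∀ j : ℕ, 0 < D ^ j := fun j => by positivity
  have hup : ∀ j, s j ≤ D ^ j * S := by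
    intro j
    induction j with
    | zero => simp [s]
    | succ j ih =>
      have h1 : s (j + 1) ≤ D * s j := by
        rw [hs1]
        simp only [nx]
        split_ifs with e
        · exact e.choose_spec.2.1.trans (mul_le_mul_of_nonneg_right hCD (hpos j).1.le)
        · exact mul_le_mul_of_nonneg_right hD (hpos j).1.le
      calc _ ≤ D * s j := h1
        _ ≤ D * (D ^ j * S) := by gcongr
        _ = _ := by ring
  refine ⟨s, rfl, h4, hup, fun j => ?_⟩
  induction j with
  | zero => exact fun _ => hg
  | succ j ih =>
    intro hj
    have e : ∃ s', 4 * s j ≤ s' ∧ s' ≤ C * s j ∧ cA ≤ μ.hcr (4 * s') s' := by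
      refine h μ (s j) (hpos j).1 (hr.trans (hpos j).2) ?_ (ih (by omega))
      refine le_trans ?_ hK
      calc C * s j ≤ D * s j := mul_le_mul_of_nonneg_right hCD (hpos j).1.le
        _ ≤ D * (D ^ j * S) := by gcongr; exact hup j
        _ = D ^ (j + 1) * S := by ring
        _ ≤ _ := mul_le_mul_of_nonneg_right (pow_le_pow_right₀ (by omega) hj) hS.le
    refine hcA.trans ?_
    rw [hs1]
    simp only [nx, dif_pos e]
    exact e.choose_spec.2.2

lemma exists_doublings {ℓ : ℤ} (hℓ : 1 ≤ ℓ) :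
    ∃ J : ℕ, (16 * ℓ : ℝ) * (7/4) ^ J < 2 ^ J ∧ ((7/4:ℝ)) ^ J ≤ (19 * ℓ) ^ 5 := by
  have h1 : (1:ℝ) ≤ ℓ := by exact_mod_cast hℓ
  obtain ⟨J, e1, e2⟩ := exists_nat_pow_near (show (1:ℝ) ≤ 16 * ℓ by linarith) (show (1:ℝ) < 8/7 by norm_num)
  refine ⟨J + 1, ?_, ?_⟩
  · have : (2:ℝ) ^ (J+1) = (8/7) ^ (J+1) * (7/4) ^ (J+1) := by rw [← mul_pow]; norm_num
    rw [this]
    exact mul_lt_mul_of_pos_right e2 (by positivity)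
  · calc (7/4:ℝ) ^ (J+1) ≤ ((8/7) ^ 5) ^ (J+1) := pow_le_pow_left₀ (by norm_num) (by norm_num) _
      _ = ((8/7) ^ J * (8/7)) ^ 5 := by rw [← pow_succ, ← pow_mul, ← pow_mul, mul_comm]
      _ ≤ (16 * ℓ * (8/7)) ^ 5 := by gcongr
      _ ≤ _ := by
        apply pow_le_pow_left₀ (by positivity)
        linarith

/-- The rectangle crossing estimate at a scale comparable, up to powers, to the seed size. -/
lemma exists_good_crossing : ∃ (C : ℤ) (c θ : ℝ), 4 ≤ C ∧ 0 < c ∧ 0 < θ ∧ θ < 1 ∧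
    ∀ (m : ℕ) [NeZero m] (lam p : ℝ) (u ℓ : ℤ) (k : ℕ), 0 ≤ lam → 1 / 2 ≤ p → p ≤ 1 → 0 < u → 1 ≤ ℓ →
    1 / 4 ≤ lam * u ^ 2 → lam * u ^ 2 ≤ 1 → 8 * (C ^ (2 * k) * (79235168 * ℓ ^ 6 * u)) + 16 * ℓ * u < m →
    ∃ s : ℤ, 8 * ℓ * u < s ∧ s ≤ C ^ (2 * k) * (79235168 * ℓ ^ 6 * u) ∧
      1 - Pr (qp m lam p) {ω | blueL (8 * ℓ * u) ω ∈ EH 0 (4 * s) 0 s} ≤ Real.exp (-(c * (p - 1 / 2) / θ ^ k)) := by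
  have hb : 0 < Perc.bs (cS / 64) := by have := cS_pos; unfold Perc.bs; positivity
  set c := min (min Perc.cA (Perc.bs (cS / 64))) 1
  have hc : 0 < c := lt_min (lt_min Perc.cA_pos hb) one_pos
  have hc1 : c ≤ 1 := min_le_right _ _
  have hcA : c ≤ Perc.cA := (min_le_left _ _).trans (min_le_left _ _)
  obtain ⟨C, hC, h⟩ := Perc.scales hc hcA
  have hc4 : 0 < c ^ 4 := by positivity
  refine ⟨C, c / 10, max (1/4) (1 - c ^ 4), hC, by positivity, lt_max_of_lt_left (by norm_num),
    max_lt (by norm_num) (by linarith), ?_⟩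
  intro m _ lam p u ℓ k hl hp hp1 hu hℓ hl1 hl2 hm
  set L := C ^ (2 * k) * (79235168 * ℓ ^ 6 * u) with hL
  have hCk : (1:ℤ) ≤ C ^ (2 * k) := one_le_pow₀ (by omega)
  have hℓu : 0 < ℓ * u := by positivity
  have hℓ6 : ℓ * u ≤ ℓ ^ 6 * u := mul_le_mul_of_nonneg_right (le_self_pow₀ hℓ (by norm_num)) hu.le
  have hLu : 79235168 * (ℓ * u) ≤ L := by
    rw [hL]; nlinarith
  have hr : 0 ≤ 8 * ℓ * u := by positivity
  have hN : 2 * (4 * L) + 2 * (8 * ℓ * u) < (m:ℤ) := by linarith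
  set μ := modelPerc m hl hr hN le_rfl (by norm_num : (1/2:ℝ) ≤ 1) with hμ
  obtain ⟨J, hJ, hJ'⟩ := exists_doublings hℓ
  obtain ⟨S, hS1, hS2, hS3⟩ := μ.first_good (T := 16 * ℓ * u) (u := u) (x := cS) (M := 16 * ℓ) hu
    (by nlinarith) ⟨8 * ℓ * u, by ring⟩ cS_pos.le
    ((seed_prob hl le_rfl (by norm_num) hu (by nlinarith) hl1 hl2 (16 * ℓ * u, 0)).trans
      (Pr_mono (qp_adm hl (by norm_num) (by norm_num)) fun ω hω => seed_win hu.le hω _))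
    (by push_cast; exact le_rfl) J hJ
  have hS4 : S ≤ 79235168 * ℓ ^ 6 * u := by
    have hu' : (0:ℝ) ≤ u := by exact_mod_cast hu.le
    have hℓ' : (0:ℝ) ≤ ℓ := by exact_mod_cast (by omega : (0:ℤ) ≤ ℓ)
    have : (S:ℝ) ≤ ((79235168 * ℓ ^ 6 * u : ℤ) : ℝ) := by
      calc (S:ℝ) ≤ 2 * ((7/4) ^ J * ((16 * ℓ * u : ℤ) : ℝ)) := hS2
        _ ≤ 2 * ((19 * ℓ) ^ 5 * ((16 * ℓ * u : ℤ) : ℝ)) := by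
          push_cast
          gcongr
        _ = _ := by push_cast; ring
    exact_mod_cast this
  have hS0 : 0 < S := by nlinarith
  have hCS : C ^ (2 * k) * S ≤ L := by rw [hL]; gcongr
  obtain ⟨s, e0, e4, eup, eg⟩ := h μ S hS0 (show 8 * ℓ * u ≤ S by linarith) ((min_le_left _ _).trans hS3) (2 * k)
    (show C ^ (2 * k) * S ≤ 4 * L by linarith [hLu])
  refine ⟨s (2 * k), ?_, (eup _).trans hCS, ?_⟩
  · have h1 : s 0 ≤ s (2 * k) := by
      have : ∀ j, S ≤ s j := fun j => by
        induction j with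
        | zero => exact e0.ge
        | succ j ih => have := e4 j; omega
      rw [e0]; exact this _
    rw [e0] at h1
    linarith
  · refine (sharp_crossing hl hp hp1 hr hN hc hc1 (by rw [e0]; linarith) e4 ?_ eg).trans (Real.exp_le_exp.2 (le_of_eq ?_))
    · have := (eup (2 * k)).trans hCS
      linarith
    · have : (0:ℝ) < max (1/4) (1 - c ^ 4) := lt_max_of_lt_left (by norm_num)
      field_simp

/-- The number of correlation lengths used for the range of dependence. -/
def ell (n : ℕ) : ℤ := ⌈√(Real.log n)⌉

lemma ell_sq (n : ℕ) : Real.log n ≤ (ell n : ℝ) ^ 2 := by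
  rcases le_or_gt (Real.log n) 0 with h | h
  · exact h.trans (sq_nonneg _)
  · have := Int.le_ceil (√(Real.log n))
    calc Real.log n = √(Real.log n) ^ 2 := (Real.sq_sqrt h.le).symm
      _ ≤ _ := pow_le_pow_left₀ (Real.sqrt_nonneg _) this 2

lemma tendsto_log_nat : Tendsto (fun n : ℕ => Real.log n) atTop atTop :=
  Real.tendsto_log_atTop.comp tendsto_natCast_atTop_atTop

lemma ell_pos : ∀ᶠ n : ℕ in atTop, 1 ≤ ell n := by
  filter_upwards [tendsto_log_nat.eventually_gt_atTop 0] with n hn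
  exact Int.one_le_ceil_iff.2 (Real.sqrt_pos.2 hn)

lemma ell_le : ∀ᶠ n : ℕ in atTop, (ell n : ℝ) ≤ 2 * √(Real.log n) := by
  filter_upwards [tendsto_log_nat.eventually_ge_atTop 1] with n hn
  have h1 := (Int.ceil_lt_add_one (√(Real.log n))).le
  have h2 : 1 ≤ √(Real.log n) := Real.one_le_sqrt.2 hn
  unfold ell
  linarith

/-- Powers of the logarithm are eventually below any power. -/
lemma ell_pow_le {K ε : ℝ} (hK : 0 < K) (hε : 0 < ε) : ∀ᶠ n : ℕ in atTop, K * (ell n : ℝ) ^ 6 ≤ (n : ℝ) ^ ε := by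
  have h := (isLittleO_log_rpow_rpow_atTop 3 hε).def (show 0 < 1 / (64 * K) by positivity)
  have h' := tendsto_natCast_atTop_atTop.eventually h
  filter_upwards [h', ell_le, ell_pos, tendsto_log_nat.eventually_ge_atTop 1] with n h1 h2 h3 h4
  have h3' : (0:ℝ) ≤ ell n := by exact_mod_cast (by omega : 0 ≤ ell n)
  rw [Real.norm_of_nonneg (by positivity), Real.norm_of_nonneg (by positivity)] at h1
  have h5 : (ell n : ℝ) ^ 6 ≤ 64 * Real.log n ^ (3:ℝ) := by
    calc (ell n : ℝ) ^ 6 ≤ (2 * √(Real.log n)) ^ 6 := pow_le_pow_left₀ h3' h2 6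
      _ = 64 * (√(Real.log n) ^ 2) ^ 3 := by ring
      _ = 64 * Real.log n ^ (3:ℕ) := by rw [Real.sq_sqrt (by linarith)]
      _ = _ := by norm_cast
  calc K * (ell n : ℝ) ^ 6 ≤ K * (64 * Real.log n ^ (3:ℝ)) := by gcongr
    _ ≤ K * (64 * (1 / (64 * K) * (n:ℝ) ^ ε)) := by gcongr
    _ = _ := by field_simp

/-- Exponentials of `√log` are subpolynomial. -/
lemma pow_ell_ge {x ε : ℝ} (hx : 0 < x) (hx1 : x < 1) (hε : 0 < ε) (K : ℕ) :
    ∀ᶠ n : ℕ in atTop, (n : ℝ) ^ (-ε) ≤ x ^ (K * (ell n).toNat) := by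
  have hl : 0 < -Real.log x := neg_pos.2 (Real.log_neg hx hx1)
  set M : ℝ := 2 * K * (-Real.log x) / ε
  have hM : 0 ≤ M := by positivity
  filter_upwards [ell_le, ell_pos, tendsto_log_nat.eventually_ge_atTop (max 1 (M ^ 2)), eventually_gt_atTop 0] with n h2 h3 h4 h0
  have hL : 1 ≤ Real.log n := (le_max_left _ _).trans h4
  have hs : M ≤ √(Real.log n) := Real.le_sqrt_of_sq_le ((le_max_right _ _).trans h4)
  have h5 : ((ell n).toNat : ℝ) = ell n := by exact_mod_cast Int.toNat_of_nonneg (by omega : 0 ≤ ell n)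
  have h6 : (0:ℝ) < n := by exact_mod_cast h0
  rw [← Real.log_le_log_iff (by positivity) (by positivity), Real.log_rpow h6, Real.log_pow]
  push_cast
  rw [h5]
  have h7 : M * √(Real.log n) ≤ Real.log n := by
    calc M * √(Real.log n) ≤ √(Real.log n) * √(Real.log n) := by gcongr
      _ = _ := Real.mul_self_sqrt (by linarith)
  have h8 : M * ε = 2 * K * (-Real.log x) := by simp only [M]; field_simp
  have h9 : (K:ℝ) * ell n * (-Real.log x) ≤ K * (2 * √(Real.log n)) * (-Real.log x) := by gcongr
  nlinarith

/-- Choice of the exponent and of the number of scales. -/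
lemma exists_exponent {C θ : ℝ} (hC : 4 ≤ C) (hθ : 0 < θ) (hθ1 : θ < 1) :
    ∃ (γ : ℝ) (k : ℕ → ℕ), 0 < γ ∧ ∀ᶠ n : ℕ in atTop, (n : ℝ) ^ (-γ) ≤ 1 / 2 ∧
      8 * (C ^ (2 * k n) * (79235168 * (ell n : ℝ) ^ 6)) + 16 * ell n + 1 ≤ (n : ℝ) ^ (1 / 6 : ℝ) ∧
      θ * (n : ℝ) ^ γ ≤ (n : ℝ) ^ (-γ) / θ ^ k n := by
  have hlC : 0 < Real.log C := Real.log_pos (by linarith)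
  have hlθ : 0 < -Real.log θ := neg_pos.2 (Real.log_neg hθ hθ1)
  set η := 1 / (24 * Real.log C) with hη
  have hη0 : 0 < η := by positivity
  refine ⟨η * (-Real.log θ) / 2, fun n => ⌊η * Real.log n⌋₊, by positivity, ?_⟩
  set γ := η * (-Real.log θ) / 2 with hγ
  have hγ0 : 0 < γ := by positivity
  have t1 : Tendsto (fun n : ℕ => (n:ℝ) ^ (-γ)) atTop (nhds 0) :=
    (tendsto_rpow_neg_atTop hγ0).comp tendsto_natCast_atTop_atTop
  filter_upwards [t1.eventually_le_const (show (0:ℝ) < 1/2 by norm_num),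
    ell_pow_le (K := 8 * 79235168 + 17) (ε := 1/12) (by norm_num) (by norm_num), ell_pos,
    tendsto_log_nat.eventually_ge_atTop 1, eventually_gt_atTop 0] with n h1 h2 h3 h4 h0
  have hn : (0:ℝ) < n := by exact_mod_cast h0
  have h3' : (1:ℝ) ≤ ell n := by exact_mod_cast h3
  have hk1 : (⌊η * Real.log n⌋₊ : ℝ) ≤ η * Real.log n := Nat.floor_le (by positivity)
  have hk2 : η * Real.log n < ⌊η * Real.log n⌋₊ + 1 := Nat.lt_floor_add_one _
  refine ⟨h1, ?_, ?_⟩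
  · have e1 : C ^ (2 * ⌊η * Real.log n⌋₊) ≤ (n:ℝ) ^ (1/12 : ℝ) := by
      rw [← Real.log_le_log_iff (by positivity) (by positivity), Real.log_rpow hn, Real.log_pow]
      push_cast
      calc 2 * (⌊η * Real.log n⌋₊ : ℝ) * Real.log C ≤ 2 * (η * Real.log n) * Real.log C := by gcongr
        _ = _ := by rw [hη]; field_simp; norm_num
    have e2 : (1:ℝ) ≤ C ^ (2 * ⌊η * Real.log n⌋₊) := one_le_pow₀ (by linarith)
    have e3 : (ell n : ℝ) ≤ (ell n : ℝ) ^ 6 := le_self_pow₀ h3' (by norm_num)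
    calc _ ≤ C ^ (2 * ⌊η * Real.log n⌋₊) * ((8 * 79235168 + 17) * (ell n : ℝ) ^ 6) := by nlinarith
      _ ≤ (n:ℝ) ^ (1/12 : ℝ) * (n:ℝ) ^ (1/12 : ℝ) := by gcongr
      _ = _ := by rw [← Real.rpow_add hn]; norm_num
  · rw [le_div_iff₀ (by positivity)]
    have e1 : θ ^ ⌊η * Real.log n⌋₊ * θ ≤ (n:ℝ) ^ (-(2 * γ)) := by
      rw [← pow_succ, ← Real.log_le_log_iff (by positivity) (by positivity), Real.log_rpow hn, Real.log_pow]
      push_cast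
      have : 2 * γ = η * (-Real.log θ) := by rw [hγ]; ring
      rw [this]
      nlinarith
    calc θ * (n:ℝ) ^ γ * θ ^ ⌊η * Real.log n⌋₊ = (n:ℝ) ^ γ * (θ ^ ⌊η * Real.log n⌋₊ * θ) := by ring
      _ ≤ (n:ℝ) ^ γ * (n:ℝ) ^ (-(2 * γ)) := by gcongr
      _ = _ := by rw [← Real.rpow_add hn]; ring_nf

/-- The seed size. -/
def usz (n m : ℕ) : ℤ := ⌊(m : ℝ) / √n⌋

lemma usz_bounds {n m : ℕ} (hn : 0 < n) (hm : 2 * √n ≤ m) : 0 < usz n m ∧ 1 / 4 ≤ (n:ℝ) / m ^ 2 * (usz n m : ℝ) ^ 2 ∧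
    (n:ℝ) / m ^ 2 * (usz n m : ℝ) ^ 2 ≤ 1 ∧ (usz n m : ℝ) * √n ≤ m ∧ (m:ℝ) ≤ 2 * usz n m * √n := by
  have hs : 0 < √(n:ℝ) := Real.sqrt_pos.2 (by exact_mod_cast hn)
  have hm0 : (0:ℝ) < m := by linarith
  have h2 : 2 ≤ (m:ℝ) / √n := by rwa [le_div_iff₀ hs]
  have h3 := Int.floor_le ((m:ℝ) / √n)
  have h4 := Int.lt_floor_add_one ((m:ℝ) / √n)
  have hu : (0:ℝ) < usz n m := by unfold usz; linarith
  have h5 : (usz n m : ℝ) * √n ≤ m := by rwa [← le_div_iff₀ hs]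
  have h6 : (m:ℝ) ≤ 2 * usz n m * √n := by
    rw [← div_le_iff₀ hs]; unfold usz; linarith
  have e : (n:ℝ) / m ^ 2 * (usz n m : ℝ) ^ 2 = (usz n m * √n / m) ^ 2 := by
    rw [div_pow, mul_pow, Real.sq_sqrt (Nat.cast_nonneg n)]; ring
  refine ⟨by exact_mod_cast hu, ?_, ?_, h5, h6⟩
  · rw [e]
    have : 1/2 ≤ usz n m * √n / m := by rw [le_div_iff₀ hm0]; linarith
    nlinarith
  · rw [e]
    have h7 : usz n m * √n / m ≤ 1 := by rwa [div_le_one hm0]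
    exact pow_le_one₀ (by positivity) h7

/-- Crossing estimates with polynomially small perturbation of the critical parameter. -/
lemma exists_strip_scale : ∃ γ κ : ℝ, 0 < γ ∧ 0 < κ ∧ ∀ᶠ n : ℕ in atTop, (n : ℝ) ^ (-γ) ≤ 1 / 2 ∧ 1 ≤ ell n ∧
    ∀ (m : ℕ) [NeZero m], 2 * √n ≤ m → ∃ s : ℤ, 8 * ell n * usz n m < s ∧ (s : ℝ) ≤ (n : ℝ) ^ (1 / 6 : ℝ) * usz n m ∧
      1 - Pr (qp m (n / m ^ 2) (1 / 2 + (n : ℝ) ^ (-γ))) {ω | blueL (8 * ell n * usz n m) ω ∈ EH 0 (4 * s) 0 s} ≤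
        Real.exp (-(κ * (n : ℝ) ^ γ)) := by
  obtain ⟨C, c, θ, hC, hc, hθ, hθ1, h⟩ := exists_good_crossing
  obtain ⟨γ, k, hγ, hk⟩ := exists_exponent (C := C) (by exact_mod_cast hC) hθ hθ1
  refine ⟨γ, c * θ, hγ, by positivity, ?_⟩
  filter_upwards [hk, ell_pos, eventually_ge_atTop 1] with n ⟨h1, h2, h3⟩ h4 h0
  refine ⟨h1, h4, fun m _ hm => ?_⟩
  obtain ⟨hu, hl1, hl2, hum, hmu⟩ := usz_bounds h0 hm
  have hn1 : (1:ℝ) ≤ n := by exact_mod_cast h0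
  have hu' : (0:ℝ) < usz n m := by exact_mod_cast hu
  have h16 : (n:ℝ) ^ (1/6:ℝ) ≤ √n := by
    rw [Real.sqrt_eq_rpow]
    exact Real.rpow_le_rpow_of_exponent_le hn1 (by norm_num)
  have hℓ : (1:ℝ) ≤ ell n := by exact_mod_cast h4
  have hCr : (4:ℝ) ≤ C := by exact_mod_cast hC
  obtain ⟨s, e1, e2, e3⟩ := h m (n / m ^ 2) (1 / 2 + (n : ℝ) ^ (-γ)) (usz n m) (ell n) (k n) (by positivity)
    (by have : (0:ℝ) ≤ (n:ℝ) ^ (-γ) := by positivity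
        linarith) (by linarith) hu h4 hl1 hl2 (by
      have : ((8 * (C ^ (2 * k n) * (79235168 * ell n ^ 6 * usz n m)) + 16 * ell n * usz n m : ℤ) : ℝ) < (m : ℤ) := by
        push_cast
        nlinarith
      exact_mod_cast this)
  refine ⟨s, e1, ?_, e3.trans (Real.exp_le_exp.2 (neg_le_neg ?_))⟩
  · have e2' : (s:ℝ) ≤ ((C ^ (2 * k n) * (79235168 * ell n ^ 6 * usz n m) : ℤ) : ℝ) := by exact_mod_cast e2
    push_cast at e2'
    have : (0:ℝ) ≤ (C:ℝ) ^ (2 * k n) * (79235168 * (ell n:ℝ) ^ 6) := by positivity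
    nlinarith
  · have e4 : c * (1 / 2 + (n:ℝ) ^ (-γ) - 1 / 2) / θ ^ k n = c * ((n:ℝ) ^ (-γ) / θ ^ k n) := by ring
    rw [e4, mul_assoc]
    gcongr

namespace Perc
variable (μ : Perc)

lemma inter_ge (A A' : Set (Set Z2)) : μ.P A + μ.P A' - 1 ≤ μ.P (A ∩ A') := by
  have h1 := μ.compl (A ∩ A')
  have h2 := μ.union Aᶜ A'ᶜ
  rw [← compl_inter, h1, μ.compl, μ.compl] at h2
  linarith

lemma hcr_add {w1 w2 h : ℤ} (h1 : h ≤ w1) (h2 : h ≤ w2) :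
    μ.hcr w1 h + μ.hcr w2 h + μ.hcr h h - 2 ≤ μ.hcr (w1 + w2 - h) h := by
  have e1 := μ.hcr_EH (x0 := 0) (x1 := w1) (y0 := 0) (y1 := h) (w := w1) (h := h) (by ring) (by ring)
  have e2 := μ.hcr_EH (x0 := w1 - h) (x1 := w1 + w2 - h) (y0 := 0) (y1 := h) (w := w2) (h := h) (by ring) (by ring)
  have e3 := μ.hcr_EV (x0 := w1 - h) (x1 := w1) (y0 := 0) (y1 := h) (w := h) (h := h) (by ring) (by ring)
  have f1 := μ.inter_ge (EH 0 w1 0 h) (EH (w1 - h) (w1 + w2 - h) 0 h)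
  have f2 := μ.inter_ge (EH 0 w1 0 h ∩ EH (w1 - h) (w1 + w2 - h) 0 h) (EV (w1 - h) w1 0 h)
  refine le_trans (by linarith) (f2.trans (μ.mono _ _ ?_))
  rintro B ⟨⟨⟨a, a', ha, ha', hA⟩, b, b', hb, hb', hB⟩, c, c', hc, hc', hC⟩
  simp only [mem_ofPred_eq] at ha ha' hb hb' hc hc'
  have hW : ∀ p ∈ Box 0 w1 0 h, p ∈ Box 0 (w1 + w2 - h) 0 h := fun p hp => by rw [mem_box] at *; omega
  have hW2 : ∀ p ∈ Box (w1 - h) (w1 + w2 - h) 0 h, p ∈ Box 0 (w1 + w2 - h) 0 h := fun p hp => by rw [mem_box] at *; omega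
  have hW3 : ∀ p ∈ Box (w1 - h) w1 0 h, p ∈ Box 0 (w1 + w2 - h) 0 h := fun p hp => by rw [mem_box] at *; omega
  have g1 := span_boxes hA hC (fun q hq => by rw [mem_box] at hq; omega) (fun q hq => by rw [mem_box] at hq; omega) hW hW3
  have g2 := span_boxes hB hC (fun q hq => by rw [mem_box] at hq; omega) (fun q hq => by rw [mem_box] at hq; omega) hW2 hW3
  exact ⟨a, b', ha, hb', (g1.trans g2.symmK).trans (hB.mono (inter_subset_inter_right _ hW2))⟩

/-- Long thin strips are crossed, by a union bound. -/
lemma hcr_strip {s : ℤ} (hs : 0 < s) {δ : ℝ} (hδ : 1 - μ.hcr (4 * s) s ≤ δ) (j : ℕ) :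
    1 - (2 * j + 1) * δ ≤ μ.hcr (s + 3 * s * j) s := by
  have h0 : 1 - δ ≤ μ.hcr s s := by
    have := μ.hcr_anti (h := s) hs (show s ≤ 4 * s by omega)
    linarith
  induction j with
  | zero => simpa using h0
  | succ j ih =>
    have hj : 0 ≤ 3 * s * j := by positivity
    have := μ.hcr_add (w1 := s + 3 * s * j) (w2 := 4 * s) (h := s) (by omega) (by omega)
    have e : s + 3 * s * (j:ℤ) + 4 * s - s = s + 3 * s * ((j + 1 : ℕ) : ℤ) := by push_cast; ring
    rw [e] at this
    push_cast at *
    linarith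

end Perc

section smodel
variable {m : ℕ}

/-- The lattice square. -/
def SqZ (m : ℕ) : Set Z2 := Box 0 (m - 1) 0 (m - 1)

/-- The blue region of the lattice Voronoi colouring of the square. -/
def SB (m : ℕ) (ω : Idx m → Bool) : Set Z2 :=
  {v | ∃ z ∈ SqZ m, bl ω z ∧ ∀ z' ∈ SqZ m, rd ω z' → d2 z v ≤ d2 z' v}

/-- No large hole in the configuration. -/
def Full (m : ℕ) (r : ℤ) : Set (Idx m → Bool) :=
  {ω | ∀ v ∈ Box r (m - 1 - r) r (m - 1 - r), ∃ z, d2 z v ≤ r ^ 2 ∧ (bl ω z ∨ rd ω z)}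

lemma full_blue {r : ℤ} (hr : 0 ≤ r) {ω : Idx m → Bool} (hω : ω ∈ Full m r) {v : Z2}
    (hv : v ∈ Box r (m - 1 - r) r (m - 1 - r)) (hb : v ∈ blueL r ω) : v ∈ SB m ω := by
  obtain ⟨z, hz, h⟩ := hω v hv
  have h0 : ∃ z, bl ω z ∧ d2 z v ≤ r ^ 2 := by
    rcases h with h | h
    · exact ⟨z, h, hz⟩
    · obtain ⟨z', h1, h2⟩ := hb z hz h
      exact ⟨z', h2, h1.trans hz⟩
  classical
  have h1 : ∃ k : ℕ, ∃ z, bl ω z ∧ d2 z v = k := by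
    obtain ⟨z, hz, -⟩ := h0
    exact ⟨(d2 z v).toNat, z, hz, (Int.toNat_of_nonneg (d2_nonneg z v)).symm⟩
  obtain ⟨z0, hz0, e0⟩ := Nat.find_spec h1
  have hmin : ∀ z, bl ω z → d2 z0 v ≤ d2 z v := by
    intro z hz
    have := Nat.find_min' h1 ⟨z, hz, (Int.toNat_of_nonneg (d2_nonneg z v)).symm⟩
    have h2 := Int.toNat_of_nonneg (d2_nonneg z v)
    rw [e0]; omega
  have hr0 : d2 z0 v ≤ r ^ 2 := by
    obtain ⟨z, hz, h⟩ := h0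
    exact (hmin z hz).trans h
  obtain ⟨a1, a2⟩ := d2_le_sq hr hr0
  rw [mem_box] at hv
  rw [abs_le] at a1 a2
  refine ⟨z0, by unfold SqZ; rw [mem_box]; omega, hz0, fun z' _ hr' => ?_⟩
  rcases le_or_gt (d2 z' v) (r ^ 2) with h | h
  · obtain ⟨z'', h1, h2⟩ := hb z' h hr'
    exact (hmin _ h2).trans h1
  · linarith

lemma Pr_biUnion_le [NeZero m] {q : Idx m → ℝ} (hq : Adm q) {α : Type*} (s : Finset α) (E : α → Set (Idx m → Bool)) :
    Pr q (⋃ i ∈ s, E i) ≤ ∑ i ∈ s, Pr q (E i) := by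
  classical
  induction s using Finset.induction_on with
  | empty =>
    have : Pr q (∅ : Set (Idx m → Bool)) = 0 := by
      have := Pr_compl (q := q) (E := univ)
      rw [Pr_univ] at this
      simpa using this
    simp [this]
  | insert a s ha ih =>
    rw [Finset.set_biUnion_insert, Finset.sum_insert ha]
    exact (Pr_union_le hq).trans (by linarith)

lemma noPoint_dep_true (x0 x1 y0 y1 : ℤ) : EvDep (NoBlue m x0 x1 y0 y1) {i | i.2 = true} := fun x y h => by
  simp only [NoBlue, bl, mem_ofPred_eq]
  refine forall₂_congr fun z _ => ?_
  rw [h _ rfl]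

lemma noPoint_dep_false (x0 x1 y0 y1 : ℤ) : EvDep (NoRed m x0 x1 y0 y1) {i | i.2 = false} := fun x y h => by
  simp only [NoRed, rd, mem_ofPred_eq]
  refine forall₂_congr fun z _ => ?_
  rw [h _ rfl]

/-- Large holes are unlikely. -/
lemma full_prob [NeZero m] {lam p : ℝ} (hl : 0 ≤ lam) (hp : 0 ≤ p) (hp1 : p ≤ 1) {w : ℤ} (hw : 0 < w) (hwm : w < m)
    {J : ℕ} (hJ : m ≤ w * J) : 1 - J ^ 2 * Real.exp (-(lam * w ^ 2)) ≤ Pr (qp m lam p) (Full m (2 * w)) := by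
  have hq : Adm (qp m lam p) := qp_adm hl hp hp1
  set E : ℕ × ℕ → Set (Idx m → Bool) := fun i =>
    NoBlue m (w * i.1) (w * i.1 + w) (w * i.2) (w * i.2 + w) ∩ NoRed m (w * i.1) (w * i.1 + w) (w * i.2) (w * i.2 + w)
  have h1 : (Full m (2 * w))ᶜ ⊆ ⋃ i ∈ Finset.range J ×ˢ Finset.range J, E i := by
    intro ω hω
    simp only [Full, mem_compl_iff, mem_ofPred_eq, not_forall, not_exists, not_and, not_or] at hω
    obtain ⟨v, hv, hω⟩ := hω
    rw [mem_box] at hv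
    have d1 := Int.emod_add_mul_ediv v.1 w
    have d2' := Int.emod_add_mul_ediv v.2 w
    have m1 := Int.emod_nonneg v.1 hw.ne'
    have m2 := Int.emod_nonneg v.2 hw.ne'
    have l1 := Int.emod_lt_of_pos v.1 hw
    have l2 := Int.emod_lt_of_pos v.2 hw
    have q1 : 0 ≤ v.1 / w := Int.ediv_nonneg (by omega) hw.le
    have q2 : 0 ≤ v.2 / w := Int.ediv_nonneg (by omega) hw.le
    have r1 : v.1 / w < J := Int.ediv_lt_of_lt_mul hw (by linarith)
    have r2 : v.2 / w < J := Int.ediv_lt_of_lt_mul hw (by linarith)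
    obtain ⟨i, hi⟩ := Int.eq_ofNat_of_zero_le q1
    obtain ⟨j, hj⟩ := Int.eq_ofNat_of_zero_le q2
    rw [hi] at d1 r1
    rw [hj] at d2' r2
    simp only [mem_iUnion]
    refine ⟨(i, j), by simp only [Finset.mem_product, Finset.mem_range]; omega, ?_⟩
    have hd : ∀ z ∈ Box (w * i) (w * i + w) (w * j) (w * j + w), d2 z v ≤ (2 * w) ^ 2 := by
      intro z hz
      rw [mem_box] at hz
      unfold d2
      have e1 : |z.1 - v.1| ≤ w := by rw [abs_le]; omega
      have e2 : |z.2 - v.2| ≤ w := by rw [abs_le]; omega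
      have := sq_le_sq' (abs_le.1 e1).1 (abs_le.1 e1).2
      have := sq_le_sq' (abs_le.1 e2).1 (abs_le.1 e2).2
      nlinarith
    exact ⟨fun z hz => (hω z (hd z hz)).1, fun z hz => (hω z (hd z hz)).2⟩
  have h2 : ∀ i, Pr (qp m lam p) (E i) ≤ Real.exp (-(lam * w ^ 2)) := by
    intro i
    simp only [E]
    rw [Pr_indep (noPoint_dep_true _ _ _ _) (noPoint_dep_false _ _ _ _) (by
      rw [Set.disjoint_left]; rintro ⟨_, b⟩ h h'; simp only [mem_ofPred_eq] at h h'; simp [h] at h'),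
      Pr_noBlue, Pr_noRed, ← Real.exp_add]
    refine Real.exp_le_exp.2 ?_
    have hc : (w:ℝ) ^ 2 ≤ (fbox m (w * i.1) (w * i.1 + w) (w * i.2) (w * i.2 + w)).card := by
      rw [fbox_card (by omega) (by omega)]
      have : w ^ 2 ≤ (((w * i.1 + w + 1 - w * i.1).toNat * (w * i.2 + w + 1 - w * i.2).toNat : ℕ) : ℤ) := by
        push_cast
        rw [Int.toNat_of_nonneg (by omega), Int.toNat_of_nonneg (by omega)]
        nlinarith
      exact_mod_cast this
    have := mul_le_mul_of_nonneg_left hc hl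
    linarith
  have h3 := (Pr_mono hq h1).trans (Pr_biUnion_le hq _ _)
  have h4 := h3.trans (Finset.sum_le_sum fun i _ => h2 i)
  rw [Pr_compl, Finset.sum_const, Finset.card_product, Finset.card_range, nsmul_eq_mul] at h4
  push_cast at h4
  have : (J:ℝ) * J * Real.exp (-(lam * w ^ 2)) = J ^ 2 * Real.exp (-(lam * w ^ 2)) := by ring
  linarith

end smodel

section
variable {ι : Type*} [Fintype ι] [DecidableEq ι] {q : ι → ℝ}

lemma EvDep.none {G : ℕ → Set (ι → Bool)} {S : ℕ → Set ι} {M : ℕ} (hG : ∀ i < M, EvDep (G i) (S i)) :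
    EvDep {ω | ∀ i < M, ω ∉ G i} (⋃ i ∈ Iio M, S i) := fun x y h => by
  simp only [mem_ofPred_eq]
  refine forall₂_congr fun i hi => not_congr (hG i hi x y fun k hk => h k ?_)
  simp only [mem_iUnion]
  exact ⟨i, hi, hk⟩

/-- Among many independent events, one is likely to occur. -/
lemma Pr_none (hq : Adm q) {G : ℕ → Set (ι → Bool)} {S : ℕ → Set ι} {π : ℝ} (M : ℕ)
    (hG : ∀ i < M, EvDep (G i) (S i)) (hS : ∀ i < M, ∀ j < i, Disjoint (S j) (S i))
    (hπ : ∀ i < M, π ≤ Pr q (G i)) : Pr q {ω | ∀ i < M, ω ∉ G i} ≤ (1 - π) ^ M := by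
  induction M with
  | zero => simpa using Pr_le_one hq _
  | succ M ih =>
    have e : {ω | ∀ i < M + 1, ω ∉ G i} = {ω | ∀ i < M, ω ∉ G i} ∩ (G M)ᶜ := by
      ext ω
      simp only [mem_inter_iff, mem_ofPred_eq, mem_compl_iff]
      exact ⟨fun h => ⟨fun i hi => h i (by omega), h M (by omega)⟩, fun h i hi => by
        rcases Nat.lt_succ_iff_lt_or_eq.1 hi with h' | rfl
        · exact h.1 i h'
        · exact h.2⟩
    have hc : EvDep (G M)ᶜ (S M) := fun x y h => not_congr (hG M (by omega) x y h)
    rw [e, Pr_indep (EvDep.none fun i hi => hG i (by omega)) hc ?_, pow_succ]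
    · have h1 := ih (fun i hi => hG i (by omega)) (fun i hi j hj => hS i (by omega) j hj) fun i hi => hπ i (by omega)
      have h2 := hπ M (by omega)
      rw [Pr_compl]
      have h3 := Pr_le_one hq (G M)
      have h4 := Pr_nonneg hq {ω | ∀ i < M, ω ∉ G i}
      exact mul_le_mul h1 (by linarith) (by linarith) (h4.trans h1)
    · rw [Set.disjoint_left]
      intro k hk hk'
      simp only [mem_iUnion] at hk
      obtain ⟨j, hj, hk⟩ := hk
      exact Set.disjoint_left.1 (hS M (by omega) j hj) hk hk'

lemma Pr_forall_ge (hq : Adm q) {G : ℕ → Set (ι → Bool)} {π : ℝ} (h0 : 0 ≤ π) (M : ℕ) (hG : ∀ i < M, IsUpperSet (G i))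
    (hπ : ∀ i < M, π ≤ Pr q (G i)) : π ^ M ≤ Pr q {ω | ∀ i < M, ω ∈ G i} := by
  induction M with
  | zero => simp [Pr_univ]
  | succ M ih =>
    have e : {ω | ∀ i < M, ω ∈ G i} ∩ G M ⊆ {ω | ∀ i < M + 1, ω ∈ G i} := by
      intro ω h i hi
      rcases Nat.lt_succ_iff_lt_or_eq.1 hi with h' | rfl
      · exact h.1 i h'
      · exact h.2
    refine le_trans ?_ (Pr_mono hq e)
    refine le_trans ?_ (Pr_fkg hq (fun x y hxy h i hi => hG i (by omega) hxy (h i hi)) (hG M (by omega)))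
    rw [pow_succ]
    exact mul_le_mul (ih (fun i hi => hG i (by omega)) fun i hi => hπ i (by omega)) (hπ M (by omega)) h0 (Pr_nonneg hq _)
end

/-- An arm from a short vertical segment to distance `s`. -/
def Arm (x y u s : ℤ) : Set (Set Z2) :=
  Ev (Box x (x + s) (y - 2 * s) (y + 2 * s)) {p | p.1 = x ∧ |p.2 - y| ≤ u} {p | p.1 = x + s}

lemma Perc.arm_ge (μ : Perc) {u s : ℤ} (hu : 0 < u) (hs : 8 * u ≤ s) (x y : ℤ) : (u / (2 * s) : ℝ) ≤ μ.P (Arm x y u s) := by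
  set J := (s / (2 * u)).toNat + 1
  have hJ : (J : ℤ) = s / (2 * u) + 1 := by
    have := Int.ediv_nonneg (show 0 ≤ s by omega) (show 0 ≤ 2 * u by omega)
    push_cast [J]; omega
  have h1 : EH 0 s 0 s ⊆ ⋃ j ∈ Finset.range J, Ev (Box 0 s 0 s) {p | p.1 = 0 ∧ 2 * u * j ≤ p.2 ∧ p.2 ≤ 2 * u * (j + 1)} {p | p.1 = s} := by
    rintro B ⟨a, b, ha, hb, hc⟩
    have hab := hc.left_mem.2
    rw [mem_box] at hab
    simp only [mem_iUnion]
    have h2 := Int.mul_ediv_add_emod a.2 (2 * u)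
    have h3 := Int.emod_nonneg a.2 (show 2 * u ≠ 0 by omega)
    have h4 := Int.emod_lt_of_pos a.2 (show 0 < 2 * u by omega)
    have h5 := Int.ediv_nonneg (show 0 ≤ a.2 by omega) (show 0 ≤ 2 * u by omega)
    have h6 : a.2 / (2 * u) ≤ s / (2 * u) := Int.ediv_le_ediv (by omega) (by omega)
    have h7 : (((a.2 / (2 * u)).toNat : ℕ) : ℤ) = a.2 / (2 * u) := Int.toNat_of_nonneg h5
    refine ⟨(a.2 / (2 * u)).toNat, ?_, a, b, ⟨ha, ?_⟩, hb, hc⟩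
    · rw [Finset.mem_range]; omega
    · rw [h7]; constructor <;> nlinarith
  have hle : ∀ j ∈ Finset.range J, μ.P (Ev (Box 0 s 0 s) {p | p.1 = 0 ∧ 2 * u * j ≤ p.2 ∧ p.2 ≤ 2 * u * (j + 1)} {p | p.1 = s})
      ≤ μ.P (Arm x y u s) := by
    intro j hj
    rw [Finset.mem_range] at hj
    have hj' : (j : ℤ) ≤ s / (2 * u) := by omega
    have h8 : 2 * u * (j:ℤ) ≤ s := by
      have := Int.mul_ediv_self_le (x := s) (k := 2 * u) (by omega)
      nlinarith
    have hj0 : 0 ≤ 2 * u * (j:ℤ) := by positivity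
    have e : 2 * u * ((j:ℤ) + 1) = 2 * u * j + 2 * u := by ring
    refine μ.le_of_sym (μ.sym_shift (x, y - (2 * u * j + u))) ?_ ?_ ?_
    · rintro ⟨v, w⟩ h
      simp only [mem_box, Prod.mk_add_mk] at *
      omega
    · rintro ⟨v, w⟩ - h
      simp only [mem_ofPred_eq, Prod.mk_add_mk] at *
      rw [e] at h
      rw [abs_le]; omega
    · rintro ⟨v, w⟩ - h
      simp only [mem_ofPred_eq, Prod.mk_add_mk] at *
      omega
  have hun : ∀ s' : Finset ℕ, μ.P (⋃ j ∈ s', Ev (Box 0 s 0 s) {p | p.1 = 0 ∧ 2 * u * j ≤ p.2 ∧ p.2 ≤ 2 * u * (j + 1)} {p | p.1 = s})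
      ≤ ∑ j ∈ s', μ.P (Ev (Box 0 s 0 s) {p | p.1 = 0 ∧ 2 * u * j ≤ p.2 ∧ p.2 ≤ 2 * u * (j + 1)} {p | p.1 = s}) := by
    classical
    intro s'
    induction s' using Finset.induction_on with
    | empty =>
      have := μ.compl Set.univ
      rw [μ.univ, compl_univ] at this
      simp [this]
    | insert a s' ha ih =>
      rw [Finset.set_biUnion_insert, Finset.sum_insert ha]
      exact (μ.union _ _).trans (by linarith)
  have h9 : 1 / 2 ≤ J * μ.P (Arm x y u s) := by
    calc (1:ℝ) / 2 ≤ μ.P (EH 0 s 0 s) := by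
          have := μ.sq 0 0 s (by omega); simpa using this
      _ ≤ _ := (μ.mono _ _ h1).trans (hun _)
      _ ≤ ∑ j ∈ Finset.range J, μ.P (Arm x y u s) := Finset.sum_le_sum hle
      _ = _ := by rw [Finset.sum_const, Finset.card_range, nsmul_eq_mul]
  have hJ2 : (J:ℝ) * u ≤ s := by
    have h10 : (J:ℤ) * u ≤ s := by
      have := Int.mul_ediv_self_le (x := s) (k := 2 * u) (by omega)
      rw [hJ]; nlinarith
    exact_mod_cast h10
  have hs' : (0:ℝ) < s := by exact_mod_cast (by omega : 0 < s)
  have hu' : (0:ℝ) < u := by exact_mod_cast hu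
  have h11 := μ.nonneg (Arm x y u s)
  rw [div_le_iff₀ (by positivity)]
  nlinarith [mul_le_mul_of_nonneg_right h9 hu'.le, mul_le_mul_of_nonneg_right hJ2 h11]

variable {m : ℕ}

lemma seed_dep (o : Z2) {u r : ℤ} (hu : 0 ≤ u) (hr : 8 * u ≤ r) {U : Set Z2} (ho : o ∈ U) :
    EvDep (Seed m o u) (nbhd m r U) := by
  have key : ∀ (u' : ℤ), 0 ≤ u' → u' ≤ 4 * u → ∀ z ∈ Box (o.1 - u') (o.1 + u') (o.2 - u') (o.2 + u'), ∀ c, (cs m z, c) ∈ nbhd m r U := by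
    intro u' h0 h4 z hz c
    refine ⟨o, ho, z, ?_, rfl⟩
    have := d2_win (o := o) (u := u') (v := o) (z := z) (by simp only [Win, mem_box]; omega) hz
    have h1 : u' ^ 2 ≤ (4 * u) ^ 2 := pow_le_pow_left₀ h0 h4 2
    have : d2 z o ≤ 2 * u' ^ 2 := by
      rw [mem_box] at hz
      unfold d2
      have a1 : |z.1 - o.1| ≤ u' := by rw [abs_le]; omega
      have a2 : |z.2 - o.2| ≤ u' := by rw [abs_le]; omega
      have := sq_le_sq' (abs_le.1 a1).1 (abs_le.1 a1).2
      have := sq_le_sq' (abs_le.1 a2).1 (abs_le.1 a2).2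
      linarith
    have h2 : (8 * u) ^ 2 ≤ r ^ 2 := pow_le_pow_left₀ (by omega) hr 2
    nlinarith
  intro x y h
  simp only [Seed, NoBlue, NoRed, bl, rd, mem_inter_iff, mem_compl_iff, mem_ofPred_eq]
  refine and_congr (not_congr (forall₂_congr fun z hz => ?_)) (forall₂_congr fun z hz => ?_)
  · rw [h _ (key u hu (by omega) z hz true)]
  · rw [h _ (key (4 * u) (by omega) le_rfl z hz false)]

/-- A tube of seeds attached to the line `x = A`, continued by an arm. -/
def Spot (m : ℕ) (A y u s : ℤ) (L : ℕ) : Set (Idx m → Bool) :=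
  {ω | ∀ i < L, ω ∈ Seed m (A + u + u * i, y) u} ∩ {ω | blueL (u * L) ω ∈ Arm (A + u * L) y u s}

lemma spot_dep {A y u s : ℤ} {L : ℕ} (hu : 0 < u) (hL : 8 ≤ L) (hs : 0 ≤ s) :
    EvDep (Spot m A y u s L) (nbhd m (u * L) (Box A (A + u * L + s) (y - 2 * s) (y + 2 * s))) := by
  have h8 : 8 * u ≤ u * (L:ℤ) := by
    have : (8:ℤ) ≤ L := by exact_mod_cast hL
    nlinarith
  have h2 := blueL_dep (m := m) ((Ev_dep (Box (A + u * L) (A + u * L + s) (y - 2 * s) (y + 2 * s))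
    {p | p.1 = A + u * L ∧ |p.2 - y| ≤ u} {p | p.1 = A + u * L + s}).mono
    (V := Box A (A + u * L + s) (y - 2 * s) (y + 2 * s)) fun p hp => by rw [mem_box] at *; omega) (u * L)
  intro x y' h
  refine and_congr ?_ (h2 x y' h)
  simp only [mem_ofPred_eq]
  refine forall₂_congr fun i hi => seed_dep _ hu.le h8 ?_ x y' h
  have h3 : u * (i:ℤ) + u ≤ u * L := by
    have : (i:ℤ) + 1 ≤ L := by exact_mod_cast hi
    nlinarith
  have h4 : 0 ≤ u * (i:ℤ) := by positivity
  rw [mem_box]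
  simp only
  omega

lemma spot_prob [NeZero m] {lam p : ℝ} (hl : 0 ≤ lam) (hp : 1 / 2 ≤ p) (hp1 : p ≤ 1) {A y u s : ℤ} {L : ℕ} (hu : 0 < u)
    (h1 : 1 / 4 ≤ lam * u ^ 2) (h2 : lam * u ^ 2 ≤ 1) (hL : 8 ≤ L) (hLm : 2 * (u * L) < m) (hs : 8 * u ≤ s) :
    cS ^ L * (u / (2 * s)) ≤ Pr (qp m lam p) (Spot m A y u s L) := by
  have hq : Adm (qp m lam p) := qp_adm hl (by linarith) hp1
  have h8 : 8 * u ≤ u * (L:ℤ) := by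
    have : (8:ℤ) ≤ L := by exact_mod_cast hL
    nlinarith
  have hu' : (0:ℝ) < u := by exact_mod_cast hu
  have hs' : (0:ℝ) < s := by exact_mod_cast (by omega : 0 < s)
  refine le_trans ?_ (Pr_fkg hq (fun x y hxy h i hi => seed_upper _ _ hxy (h i hi)) (blueL_upper (Ev_upper _ _ _) _))
  refine mul_le_mul (Pr_forall_ge hq cS_pos.le L (fun i _ => seed_upper _ _) fun i _ =>
    seed_prob hl hp hp1 hu (by omega) h1 h2 _) ?_ (by positivity) (Pr_nonneg hq _)
  exact (modelPerc m hl (r := u * L) (N := 0) (by positivity) (by omega) hp hp1).arm_ge hu hs (A + u * L) y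

lemma conn_hline {U : Set Z2} {x x' w : ℤ} (hx : x ≤ x') (h : ∀ t, x ≤ t → t ≤ x' → (t, w) ∈ U) :
    Conn king U (x, w) (x', w) := by
  have := Conn.of_seq (R := king) (U := U) (k := (x' - x).toNat) (f := fun i => (x + i, w))
    (fun i hi => h _ (by omega) (by omega)) (fun i hi => ⟨by simp, by simp⟩) _ le_rfl
  have e : x + ((x' - x).toNat : ℤ) = x' := by omega
  simp only [e, Nat.cast_zero, add_zero] at this
  exact this

lemma spot_path [NeZero m] {A y u s C' D' : ℤ} {L : ℕ} (hu : 0 < u) (hL : 1 ≤ L) (hs : 0 ≤ s) (hus : u ≤ s) (hA : 0 ≤ A)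
    (hAm : A + u * L + s ≤ m - 1 - u * L) (hC : u * L ≤ C') (hD : D' ≤ m - 1 - u * L)
    (hy : C' ≤ y - 2 * s) (hy' : y + 2 * s ≤ D') {ω : Idx m → Bool} (hF : ω ∈ Full m (u * L)) (hω : ω ∈ Spot m A y u s L) :
    SB m ω ∈ Ev (Box A (A + u * L + s) C' D') {p | p.1 = A} {p | p.1 = A + u * L + s} := by
  obtain ⟨hS, a, b, ha, hb, hc⟩ := hω
  simp only [mem_ofPred_eq] at hS ha hb
  have hL' : (1:ℤ) ≤ L := by exact_mod_cast hL
  have hr : u ≤ u * (L:ℤ) := by nlinarith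
  have hseed : ∀ v ∈ Box A (A + u * L) (y - u) (y + u), v ∈ SB m ω := by
    intro v hv
    rw [mem_box] at hv
    obtain ⟨i, hi, h1, h2⟩ : ∃ i < L, A + u * (i:ℤ) ≤ v.1 ∧ v.1 ≤ A + u * i + 2 * u := by
      rcases eq_or_ne v.1 (A + u * L) with e | e
      · refine ⟨L - 1, by omega, ?_⟩
        have : u * ((L - 1 : ℕ) : ℤ) = u * L - u := by push_cast [hL]; ring
        rw [this]; omega
      · have h2 := Int.mul_ediv_add_emod (v.1 - A) u
        have h3 := Int.emod_nonneg (v.1 - A) (show u ≠ 0 by omega)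
        have h4 := Int.emod_lt_of_pos (v.1 - A) hu
        have h5 := Int.ediv_nonneg (show 0 ≤ v.1 - A by omega) hu.le
        have h7 : ((((v.1 - A) / u).toNat : ℕ) : ℤ) = (v.1 - A) / u := Int.toNat_of_nonneg h5
        have h8 : (v.1 - A) / u < L := Int.ediv_lt_of_lt_mul hu (by rw [mul_comm]; omega)
        exact ⟨((v.1 - A) / u).toNat, by omega, by rw [h7]; omega, by rw [h7]; omega⟩
    obtain ⟨z, hz, hb', hz'⟩ := seed_blue (v := v) hu.le (hS i hi) (by simp only [Win, mem_box]; omega)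
    have h3 : u * (i:ℤ) + u ≤ u * L := by
      have : (i:ℤ) + 1 ≤ L := by exact_mod_cast hi
      nlinarith
    have h4 : 0 ≤ u * (i:ℤ) := by positivity
    simp only [Win, mem_box] at hz
    exact ⟨z, by unfold SqZ; rw [mem_box]; omega, hb', fun z' _ h => hz' z' h⟩
  have hab := hc.left_mem.2
  rw [abs_le] at ha
  rw [mem_box] at hab
  have h1 : Conn king (SB m ω ∩ Box A (A + u * L + s) C' D') (A, a.2) (A + u * L, a.2) :=
    conn_hline (by omega) fun t ht ht' => ⟨hseed _ (by rw [mem_box]; simp only; omega), by rw [mem_box]; simp only; omega⟩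
  have e : a = (A + u * L, a.2) := Prod.ext ha.1 rfl
  have h2 := hc.mono (V := SB m ω ∩ Box A (A + u * L + s) C' D') fun p hp => by
    have hp2 := hp.2
    rw [mem_box] at hp2
    exact ⟨full_blue (by omega) hF (by rw [mem_box]; omega) hp.1, by rw [mem_box]; omega⟩
  rw [e] at h2
  exact ⟨_, b, rfl, hb, h1.trans h2⟩

/-- The wall `x = A` is connected to the vertical strip next to it. -/
lemma left_wall [NeZero m] {lam p : ℝ} (hl : 0 ≤ lam) (hp : 1 / 2 ≤ p) (hp1 : p ≤ 1) {A u s C' D' N : ℤ} {L M : ℕ} {δ : ℝ}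
    (hu : 0 < u) (h1 : 1 / 4 ≤ lam * u ^ 2) (h2 : lam * u ^ 2 ≤ 1) (hL : 8 ≤ L) (hs : u * L < s)
    (hA : 0 ≤ A) (hAm : A + u * L + s ≤ m - 1 - u * L) (hC : u * L ≤ C') (hD : D' ≤ m - 1 - u * L)
    (hM : 7 * s * M ≤ D' - C') (hN : 2 * N + 2 * (u * L) < m) (hN1 : u * L + s ≤ 2 * N) (hN2 : D' - C' ≤ 2 * N)
    (hF : 1 - δ ≤ Pr (qp m lam p) (Full m (u * L))) :
    1 - (1 - cS ^ L * (u / (2 * s))) ^ M - δ ≤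
      Pr (qp m lam p) {ω | SB m ω ∈ Ev (Box A (A + u * L + s) C' D') {p | p.1 = A} {p | p.1 = A + u * L + s}} := by
  have hq : Adm (qp m lam p) := qp_adm hl (by linarith) hp1
  have h8 : 8 * u ≤ u * (L:ℤ) := by
    have : (8:ℤ) ≤ L := by exact_mod_cast hL
    nlinarith
  have hyi : ∀ i < M, 0 ≤ 7 * s * (i:ℤ) ∧ 7 * s * (i:ℤ) + 7 * s ≤ 7 * s * M := fun i hi => by
    have : (i:ℤ) + 1 ≤ M := by exact_mod_cast hi
    exact ⟨by have : 0 ≤ s := by omega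
              positivity, by nlinarith⟩
  have hno := Pr_none hq (G := fun i => Spot m A (C' + 3 * s + 7 * s * i) u s L)
    (S := fun i => nbhd m (u * L) (Box A (A + u * L + s) (C' + 3 * s + 7 * s * i - 2 * s) (C' + 3 * s + 7 * s * i + 2 * s)))
    (π := cS ^ L * (u / (2 * s))) M
    (fun i _ => spot_dep hu hL (by omega)) (fun i hi j hj => ?_)
    (fun i _ => spot_prob hl hp hp1 hu h1 h2 hL (by omega) (by omega))
  · have h3 : {ω | SB m ω ∈ Ev (Box A (A + u * L + s) C' D') {p | p.1 = A} {p | p.1 = A + u * L + s}}ᶜ ⊆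
        {ω | ∀ i < M, ω ∉ Spot m A (C' + 3 * s + 7 * s * i) u s L} ∪ (Full m (u * L))ᶜ := by
      intro ω hω
      by_contra hcon
      simp only [mem_union, mem_ofPred_eq, mem_compl_iff, not_or, not_forall, not_not] at hcon
      obtain ⟨⟨i, hi, hsp⟩, hfu⟩ := hcon
      have := hyi i hi
      exact hω (spot_path hu (by omega) (by omega) (by omega) hA hAm hC hD (by omega) (by omega) hfu hsp)
    have h4 := (Pr_mono hq h3).trans (Pr_union_le hq)
    rw [Pr_compl, Pr_compl] at h4
    linarith
  · have a1 := hyi i hi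
    have a2 := hyi j (by omega)
    have a3 : 7 * s * (j:ℤ) + 7 * s ≤ 7 * s * i := by
      have : (j:ℤ) + 1 ≤ i := by exact_mod_cast hj
      nlinarith
    refine nbhd_disjoint (o := (A + N, C' + N)) (N := N) (by omega) hN ?_ ?_ ?_
    · intro p hp
      simp only [Win, mem_box] at *; omega
    · intro p hp
      simp only [Win, mem_box] at *; omega
    · intro p hp p' hp'
      simp only [mem_box] at hp hp'
      right
      rw [abs_sub_comm]
      exact lt_of_lt_of_le (by omega) (le_abs_self _)

/-- The square is symmetric. -/
lemma SB_mirror [NeZero m] (lam p : ℝ) (A : Set (Set Z2)) :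
    Pr (qp m lam p) {ω | (fun z : Z2 => (m - 1 - z.1, z.2)) ⁻¹' SB m ω ∈ A} = Pr (qp m lam p) {ω | SB m ω ∈ A} := by
  let f : Z2 → Z2 := fun z => (m - 1 - z.1, z.2)
  have hff : ∀ z, f (f z) = z := fun z => by simp [f]
  let e : ZMod m × ZMod m ≃ ZMod m × ZMod m := (Equiv.subLeft (-1)).prodCongr (Equiv.refl _)
  have he : ∀ z, cs m (f z) = e (cs m z) := fun z => by simp [cs, f, e]
  have hd : ∀ z v, d2 (f z) (f v) = d2 z v := fun z v => by simp [d2, f]; ring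
  have hS : ∀ z, f z ∈ SqZ m ↔ z ∈ SqZ m := fun z => by simp only [SqZ, mem_box, f]; omega
  let E : Idx m ≃ Idx m := e.prodCongr (Equiv.refl Bool)
  let σ : (Idx m → Bool) ≃ (Idx m → Bool) := E.symm.arrowCongr (Equiv.refl Bool)
  have hσ : ∀ ω i, σ ω i = ω (E i) := fun ω i => by simp [σ, Equiv.arrowCongr]
  rw [← Pr_congr_symm (qp m lam p) σ (fun ω => by
    have : σ ω = fun i => ω (E i) := funext (hσ ω)
    rw [this]
    exact wt_comp _ E (fun i => rfl) ω) {ω | SB m ω ∈ A}]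
  congr 1
  ext ω
  simp only [mem_ofPred_eq, mem_preimage]
  have hrd : ∀ z, rd (σ ω) z ↔ rd ω (f z) := fun z => by
    unfold rd; rw [hσ, he]; rfl
  have hbl : ∀ z, bl (σ ω) z ↔ bl ω (f z) := fun z => by
    unfold bl; rw [hσ, he]; rfl
  have : f ⁻¹' SB m ω = SB m (σ ω) := by
    ext v
    simp only [mem_preimage, SB, mem_ofPred_eq, hrd, hbl]
    constructor
    · rintro ⟨z, hz, hb, h⟩
      refine ⟨f z, (hS z).2 hz, by rwa [hff], fun z' hz' hr => ?_⟩
      have := h (f z') ((hS z').2 hz') hr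
      rwa [← hd (f z) v, hff, ← hd z' v]
    · rintro ⟨z, hz, hb, h⟩
      refine ⟨f z, (hS z).2 hz, hb, fun z' hz' hr => ?_⟩
      have := h (f z') ((hS z').2 hz') (by rwa [hff])
      rwa [hd, ← hff z', hd]
  rw [← this]

lemma right_wall [NeZero m] {lam p : ℝ} (hl : 0 ≤ lam) (hp : 1 / 2 ≤ p) (hp1 : p ≤ 1) {B u s C' D' N : ℤ} {L M : ℕ} {δ : ℝ}
    (hu : 0 < u) (h1 : 1 / 4 ≤ lam * u ^ 2) (h2 : lam * u ^ 2 ≤ 1) (hL : 8 ≤ L) (hs : u * L < s)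
    (hB : B ≤ m - 1) (hBm : u * L ≤ B - u * L - s) (hC : u * L ≤ C') (hD : D' ≤ m - 1 - u * L)
    (hM : 7 * s * M ≤ D' - C') (hN : 2 * N + 2 * (u * L) < m) (hN1 : u * L + s ≤ 2 * N) (hN2 : D' - C' ≤ 2 * N)
    (hF : 1 - δ ≤ Pr (qp m lam p) (Full m (u * L))) :
    1 - (1 - cS ^ L * (u / (2 * s))) ^ M - δ ≤
      Pr (qp m lam p) {ω | SB m ω ∈ Ev (Box (B - u * L - s) B C' D') {p | p.1 = B - u * L - s} {p | p.1 = B}} := by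
  have hq : Adm (qp m lam p) := qp_adm hl (by linarith) hp1
  refine (left_wall hl hp hp1 (A := m - 1 - B) hu h1 h2 hL hs (by omega) (by omega) hC hD hM hN hN1 hN2 hF).trans ?_
  rw [← SB_mirror]
  refine Pr_mono hq ?_
  rintro ω ⟨a, b, ha, hb, hc⟩
  simp only [mem_ofPred_eq] at ha hb
  refine ⟨(m - 1 - b.1, b.2), (m - 1 - a.1, a.2), by simp only [mem_ofPred_eq]; omega, by simp only [mem_ofPred_eq]; omega, ?_⟩
  refine (hc.symmK).map (f := fun z : Z2 => (m - 1 - z.1, z.2)) (fun p q h => ⟨?_, h.2⟩) fun p hp => ⟨hp.1, ?_⟩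
  · have := h.1
    simp only
    rw [abs_le] at *; omega
  · have := hp.2
    simp only [mem_box] at *; omega


/-- All the connections assemble into a crossing of the rectangle. -/
lemma assemble {A B C' D' Y u s : ℤ} {L : ℕ} (hu : 0 < u) (hs : u * L < s) (hA : 0 ≤ A) (hB : B ≤ m - 1)
    (hw : A + u * L + s ≤ B - u * L - s) (hC : u * L ≤ C') (hD : D' ≤ m - 1 - u * L) (hY : C' ≤ Y) (hY' : Y + s ≤ D')
    {ω : Idx m → Bool} (hF : ω ∈ Full m (u * L))
    (e1 : SB m ω ∈ Ev (Box A (A + u * L + s) C' D') {p | p.1 = A} {p | p.1 = A + u * L + s})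
    (e2 : SB m ω ∈ Ev (Box (B - u * L - s) B C' D') {p | p.1 = B - u * L - s} {p | p.1 = B})
    (v1 : blueL (u * L) ω ∈ EV (A + u * L) (A + u * L + s) C' D')
    (v2 : blueL (u * L) ω ∈ EV (B - u * L - s) (B - u * L) C' D')
    (h : blueL (u * L) ω ∈ EH (A + u * L) (B - u * L) Y (Y + s)) :
    SB m ω ∈ Ev (Box A B C' D') {p | p.1 = A} {p | p.1 = B} := by
  have hr : 0 ≤ u * (L:ℤ) := by positivity
  have conv : ∀ (x0 x1 y0 y1 : ℤ) (a b : Z2), u * L ≤ x0 → x1 ≤ m - 1 - u * L → u * L ≤ y0 → y1 ≤ m - 1 - u * L →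
      Conn king (blueL (u * L) ω ∩ Box x0 x1 y0 y1) a b → Conn king (SB m ω ∩ Box x0 x1 y0 y1) a b :=
    fun x0 x1 y0 y1 a b h0 h1 h2 h3 hc => hc.mono fun p hp => by
      have hp2 := hp.2
      rw [mem_box] at hp2
      exact ⟨full_blue hr hF (by rw [mem_box]; omega) hp.1, hp.2⟩
  obtain ⟨a1, a1', ha1, ha1', p1⟩ := e1
  obtain ⟨a2, a2', ha2, ha2', p2⟩ := e2
  obtain ⟨b1, b1', hb1, hb1', q1⟩ := v1
  obtain ⟨b2, b2', hb2, hb2', q2⟩ := v2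
  obtain ⟨c1, c1', hc1, hc1', q⟩ := h
  simp only [mem_ofPred_eq] at ha1 ha1' ha2 ha2' hb1 hb1' hb2 hb2' hc1 hc1'
  replace q1 := conv _ _ _ _ _ _ (by omega) (by omega) (by omega) (by omega) q1
  replace q2 := conv _ _ _ _ _ _ (by omega) (by omega) (by omega) (by omega) q2
  replace q := conv _ _ _ _ _ _ (by omega) (by omega) (by omega) (by omega) q
  have k1 : Box A (A + u * L + s) C' D' ⊆ Box A B C' D' := fun p hp => by rw [mem_box] at *; omega
  have k2 : Box (B - u * L - s) B C' D' ⊆ Box A B C' D' := fun p hp => by rw [mem_box] at *; omega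
  have k3 : Box (A + u * L) (A + u * L + s) C' D' ⊆ Box A B C' D' := fun p hp => by rw [mem_box] at *; omega
  have k4 : Box (B - u * L - s) (B - u * L) C' D' ⊆ Box A B C' D' := fun p hp => by rw [mem_box] at *; omega
  have k5 : Box (A + u * L) (B - u * L) Y (Y + s) ⊆ Box A B C' D' := fun p hp => by rw [mem_box] at *; omega
  have g1 := span_boxes p1 q1 (fun q hq => by rw [mem_box] at hq; omega) (fun q hq => by rw [mem_box] at hq; omega) k1 k3
  have g2 := span_boxes q q1 (fun q hq => by rw [mem_box] at hq; omega) (fun q hq => by rw [mem_box] at hq; omega) k5 k3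
  have g3 := span_boxes q q2 (fun q hq => by rw [mem_box] at hq; omega) (fun q hq => by rw [mem_box] at hq; omega) k5 k4
  have g4 := span_boxes p2 q2 (fun q hq => by rw [mem_box] at hq; omega) (fun q hq => by rw [mem_box] at hq; omega) k2 k4
  have g5 := p2.mono (inter_subset_inter_right (SB m ω) k2)
  exact ⟨a1, a2', ha1, ha2', g1.trans (g2.symmK.trans (g3.trans (g4.symmK.trans g5)))⟩

lemma Pr_inter_ge {ι : Type*} [Fintype ι] [DecidableEq ι] {q : ι → ℝ} (hq : Adm q) {E F : Set (ι → Bool)} {x y : ℝ}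
    (hE : 1 - x ≤ Pr q E) (hF : 1 - y ≤ Pr q F) : 1 - (x + y) ≤ Pr q (E ∩ F) := by
  have h1 := Pr_union_le hq (E := Eᶜ) (F := Fᶜ)
  rw [← compl_inter, Pr_compl, Pr_compl, Pr_compl] at h1
  linarith

/-- Crossing of a macroscopic rectangle. -/
lemma discrete_crossing [NeZero m] {lam p : ℝ} (hl : 0 ≤ lam) (hp : 1 / 2 ≤ p) (hp1 : p ≤ 1)
    {A B C' D' u s N : ℤ} {L M j : ℕ} {δ δ' : ℝ}
    (hu : 0 < u) (h1 : 1 / 4 ≤ lam * u ^ 2) (h2 : lam * u ^ 2 ≤ 1) (hL : 8 ≤ L) (hs : u * L < s)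
    (hA : 0 ≤ A) (hB : B ≤ m - 1) (hw : A + 2 * (u * L) + 2 * s ≤ B) (hC : u * L ≤ C') (hD : D' ≤ m - 1 - u * L)
    (hsD : s ≤ D' - C') (hj : m ≤ s + 3 * s * j)
    (hM : 7 * s * M ≤ D' - C') (hN : 2 * N + 2 * (u * L) < m) (hN1 : u * L + s ≤ 2 * N) (hN2 : D' - C' ≤ 2 * N)
    (hF : 1 - δ ≤ Pr (qp m lam p) (Full m (u * L)))
    (hH : 1 - Pr (qp m lam p) {ω | blueL (u * L) ω ∈ EH 0 (4 * s) 0 s} ≤ δ') :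
    1 - (2 * (1 - cS ^ L * (u / (2 * s))) ^ M + 3 * δ + 3 * ((2 * j + 1) * δ')) ≤
      Pr (qp m lam p) {ω | SB m ω ∈ Ev (Box A B C' D') {p | p.1 = A} {p | p.1 = B}} := by
  have hq : Adm (qp m lam p) := qp_adm hl (by linarith) hp1
  have hr : 0 < u * (L:ℤ) := by have : (0:ℤ) < L := by exact_mod_cast (by omega : 0 < L)
                                positivity
  let μ := modelPerc m hl (r := u * L) (N := 0) hr.le (by omega) hp hp1
  have hst : ∀ w, 0 < w → w ≤ s + 3 * s * j → 1 - (2 * j + 1) * δ' ≤ μ.hcr w s := fun w hw hw' =>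
    (μ.hcr_strip (by omega) hH j).trans (μ.hcr_anti hw hw')
  have f1 := left_wall hl hp hp1 hu h1 h2 hL hs hA (by omega) hC hD hM hN hN1 hN2 hF
  have f2 := right_wall hl hp hp1 hu h1 h2 hL hs hB (by omega) hC hD hM hN hN1 hN2 hF
  have f3 := (hst (D' - C') (by omega) (by omega)).trans (μ.hcr_EV (x0 := A + u * L) (x1 := A + u * L + s) (y0 := C') (y1 := D') rfl (by ring))
  have f4 := (hst (D' - C') (by omega) (by omega)).trans (μ.hcr_EV (x0 := B - u * L - s) (x1 := B - u * L) (y0 := C') (y1 := D') rfl (by ring))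
  have f5 := (hst (B - u * L - (A + u * L)) (by omega) (by omega)).trans
    (μ.hcr_EH (x0 := A + u * L) (x1 := B - u * L) (y0 := C') (y1 := C' + s) rfl (by ring))
  rw [sub_sub] at f1 f2
  have f := Pr_inter_ge hq hF (Pr_inter_ge hq f1 (Pr_inter_ge hq f2 (Pr_inter_ge hq f3 (Pr_inter_ge hq f4 f5))))
  refine le_trans (by linarith) (f.trans (Pr_mono hq ?_))
  rintro ω ⟨g0, g1, g2, g3, g4, g5⟩
  exact assemble hu hs hA hB (by omega) hC hD le_rfl (by omega) g0 g1 g2 g3 g4 g5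

/-- The lattice version of a crossing of `[a,b] × [c,d]`. -/
def LC (a b c d : ℝ) (m : ℕ) : Set (Set Z2) :=
  Ev (Box ⌊a * (m - 1 : ℝ)⌋ ⌊b * (m - 1 : ℝ)⌋ ⌊c * (m - 1 : ℝ)⌋ ⌊d * (m - 1 : ℝ)⌋)
    {p | p.1 = ⌊a * (m - 1 : ℝ)⌋} {p | p.1 = ⌊b * (m - 1 : ℝ)⌋}

lemma floor_bounds {a b : ℝ} (ha : 0 ≤ a) (hb : b ≤ 1) {m : ℕ} {s : ℤ} {κ : ℝ} (hκ : κ ≤ b - a)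
    (hm : 8 ≤ κ * m) (hs : (100 * s : ℝ) ≤ κ * m) :
    0 ≤ ⌊a * (m - 1 : ℝ)⌋ ∧ ⌊b * (m - 1 : ℝ)⌋ ≤ m - 1 ∧ 50 * s ≤ ⌊b * (m - 1 : ℝ)⌋ - ⌊a * (m - 1 : ℝ)⌋ ∧
      κ * m / 2 ≤ ((⌊b * (m - 1 : ℝ)⌋ - ⌊a * (m - 1 : ℝ)⌋ : ℤ) : ℝ) := by
  have hm1 : (8:ℝ) ≤ m := by nlinarith [(Nat.cast_nonneg m : (0:ℝ) ≤ m)]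
  have h1 := Int.floor_le (a * (m - 1 : ℝ))
  have h2 := Int.lt_floor_add_one (b * (m - 1 : ℝ))
  have h3 : κ * m / 2 ≤ ((⌊b * (m - 1 : ℝ)⌋ - ⌊a * (m - 1 : ℝ)⌋ : ℤ) : ℝ) := by
    push_cast
    have h5 : κ * (m - 1) ≤ (b - a) * (m - 1) := mul_le_mul_of_nonneg_right hκ (by linarith)
    nlinarith
  refine ⟨Int.floor_nonneg.2 (mul_nonneg ha (by linarith)), ?_, ?_, h3⟩
  · have h4 := Int.floor_le (b * (m - 1 : ℝ))
    have : ((⌊b * (m - 1 : ℝ)⌋ : ℤ) : ℝ) ≤ ((m - 1 : ℤ) : ℝ) := by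
      push_cast
      nlinarith
    exact_mod_cast this
  · have : ((50 * s : ℤ) : ℝ) ≤ ((⌊b * (m - 1 : ℝ)⌋ - ⌊a * (m - 1 : ℝ)⌋ : ℤ) : ℝ) := by
      refine le_trans ?_ h3
      push_cast
      linarith
    exact_mod_cast this

lemma full_rate {n m : ℕ} [NeZero m] (hn : 1 < n) (hm : 2 * √n ≤ m) (hl : 1 ≤ ell n) (hm2 : 4 * ell n * usz n m < m) {p : ℝ}
    (hp : 0 ≤ p) (hp1 : p ≤ 1) :
    1 - 9 / n ≤ Pr (qp m (n / m ^ 2) p) (Full m (8 * ell n * usz n m)) := by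
  obtain ⟨hu, h1, h2, h3, h4⟩ := usz_bounds (by omega) hm
  set u := usz n m
  set w := 4 * ell n * u
  have hw : u ≤ w := by nlinarith
  have hm0 : (0:ℤ) ≤ m := by positivity
  have hdiv := Int.ediv_nonneg hm0 (show 0 ≤ w by omega)
  have hJ : (m:ℤ) ≤ w * ((m / w).toNat + 1 : ℕ) := by
    have := Int.mul_ediv_add_emod (m:ℤ) w
    have h5 := Int.emod_lt_of_pos (m:ℤ) (show 0 < w by omega)
    push_cast
    rw [Int.toNat_of_nonneg hdiv]
    nlinarith
  have hf := full_prob (lam := n / m ^ 2) (by positivity) hp hp1 (by omega) hm2 hJ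
  have e : 2 * w = 8 * ell n * u := by simp only [w]; ring
  rw [e] at hf
  refine le_trans ?_ hf
  have hu' : (0:ℝ) < u := by exact_mod_cast hu
  have hl' : (1:ℝ) ≤ ell n := by exact_mod_cast hl
  have hn' : (1:ℝ) < n := by exact_mod_cast hn
  have hs1 : 1 < √(n:ℝ) := by rw [Real.lt_sqrt (by norm_num)]; simpa using hn'
  have hs2 : √(n:ℝ) ^ 2 = n := Real.sq_sqrt (by positivity)
  have hJ2 : (((m / w).toNat + 1 : ℕ) : ℝ) ≤ 3 * √n := by
    have h6 : w * (m / w) ≤ (m:ℤ) := Int.mul_ediv_self_le (by omega)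
    have h7 : u * (m / w) ≤ (m:ℤ) := le_trans (mul_le_mul_of_nonneg_right hw hdiv) h6
    have h8 : (((m / w).toNat : ℕ) : ℝ) = ((m / w : ℤ) : ℝ) := by exact_mod_cast Int.toNat_of_nonneg hdiv
    have h9 : (u:ℝ) * ((m / w : ℤ) : ℝ) ≤ 2 * u * √n := le_trans (by exact_mod_cast h7) h4
    have h10 : ((m / w : ℤ) : ℝ) ≤ 2 * √n := by
      have : (u:ℝ) * ((m / w : ℤ) : ℝ) ≤ u * (2 * √n) := by linarith
      exact le_of_mul_le_mul_left this hu'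
    rw [Nat.cast_add, h8]; push_cast at *; linarith
  have hlog := ell_sq n
  have hlog0 : 0 < Real.log n := Real.log_pos hn'
  have hexp : Real.exp (-((n:ℝ) / m ^ 2 * (w:ℝ) ^ 2)) ≤ 1 / (n:ℝ) ^ 2 := by
    have : (n:ℝ) / m ^ 2 * (w:ℝ) ^ 2 = 16 * (ell n:ℝ) ^ 2 * ((n:ℝ) / m ^ 2 * (u:ℝ) ^ 2) := by
      simp only [w]; push_cast; ring
    have h5 : 2 * Real.log n ≤ (n:ℝ) / m ^ 2 * (w:ℝ) ^ 2 := by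
      rw [this]; nlinarith
    calc _ ≤ Real.exp (-(2 * Real.log n)) := Real.exp_le_exp.2 (by linarith)
      _ = _ := by
        rw [Real.exp_neg, two_mul, Real.exp_add, Real.exp_log (by linarith)]; field_simp
  have : (((m / w).toNat + 1 : ℕ) : ℝ) ^ 2 * Real.exp (-((n:ℝ) / m ^ 2 * (w:ℝ) ^ 2)) ≤ 9 / n := by
    calc _ ≤ (3 * √(n:ℝ)) ^ 2 * (1 / (n:ℝ) ^ 2) := by gcongr
      _ = 9 / n := by rw [mul_pow, hs2]; field_simp; norm_num
  linarith

lemma wall_rate {n : ℕ} {u s : ℤ} {M L : ℕ} {κ : ℝ} (hn : 0 < n) (hκ : 0 < κ) (hu : 0 < u) (hus : u ≤ s) (hs : (s:ℝ) ≤ (n:ℝ) ^ (1 / 6 : ℝ) * u)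
    (hc : (n : ℝ) ^ (-(1 / 24 : ℝ)) ≤ cS ^ L) (hM : κ * (n:ℝ) ^ (1 / 3 : ℝ) / 100 ≤ M) :
    (1 - cS ^ L * (u / (2 * s))) ^ M ≤ Real.exp (-(κ / 200 * (n:ℝ) ^ (1 / 8 : ℝ))) := by
  have hu' : (0:ℝ) < u := by exact_mod_cast hu
  have hus' : (u:ℝ) ≤ s := by exact_mod_cast hus
  have hn' : (0:ℝ) < n := by exact_mod_cast hn
  have hs' : (0:ℝ) < s := hu'.trans_le hus'
  have h0 : (u / (2 * s) : ℝ) ≤ 1 := by rw [div_le_one (by linarith)]; linarith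
  have h1 : cS ^ L ≤ 1 := pow_le_one₀ cS_pos.le cS_lt.le
  have h1' : 0 < cS ^ L := pow_pos cS_pos _
  have h2 : (n:ℝ) ^ (-(1 / 6 : ℝ)) / 2 ≤ u / (2 * s) := by
    rw [div_le_div_iff₀ (by norm_num) (by linarith), Real.rpow_neg hn'.le]
    have h3 : 0 < (n:ℝ) ^ (1 / 6 : ℝ) := by positivity
    have : ((n:ℝ) ^ (1 / 6 : ℝ))⁻¹ * s ≤ u := by rw [inv_mul_le_iff₀ h3]; exact hs
    linarith
  set π := cS ^ L * (u / (2 * s))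
  have hπ1 : π ≤ 1 := mul_le_one₀ h1 (by positivity) h0
  have hπ2 : (n:ℝ) ^ (-(1 / 24 : ℝ)) * ((n:ℝ) ^ (-(1 / 6 : ℝ)) / 2) ≤ π := mul_le_mul hc h2 (by positivity) h1'.le
  have h5 : (1 - π) ^ M ≤ Real.exp (-(π * M)) := by
    calc (1 - π) ^ M ≤ Real.exp (-π) ^ M := pow_le_pow_left₀ (by linarith) (Real.one_sub_le_exp_neg π) M
      _ = _ := by rw [← Real.exp_nat_mul]; ring_nf
  refine h5.trans (Real.exp_le_exp.2 (neg_le_neg ?_))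
  calc κ / 200 * (n:ℝ) ^ (1 / 8 : ℝ) = (n:ℝ) ^ (-(1 / 24 : ℝ)) * ((n:ℝ) ^ (-(1 / 6 : ℝ)) / 2) * (κ * (n:ℝ) ^ (1 / 3 : ℝ) / 100) := by
        have : (1 / 8 : ℝ) = -(1/24) + (-(1/6) + 1/3) := by norm_num
        rw [this, Real.rpow_add hn', Real.rpow_add hn']; ring
    _ ≤ _ := mul_le_mul hπ2 hM (by positivity) (by positivity)

lemma rate_tendsto {κ κ' γ : ℝ} (hκ : 0 < κ) (hκ' : 0 < κ') (hγ : 0 < γ) :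
    Tendsto (fun n : ℕ => 2 * Real.exp (-(κ / 200 * (n:ℝ) ^ (1 / 8 : ℝ))) + 3 * (9 / n) +
      3 * ((4 * √n + 1) * Real.exp (-(κ' * (n:ℝ) ^ γ)))) atTop (nhds 0) := by
  have hp : ∀ t : ℝ, 0 < t → Tendsto (fun n : ℕ => (n:ℝ) ^ t) atTop atTop := fun t ht =>
    (tendsto_rpow_atTop ht).comp tendsto_natCast_atTop_atTop
  have h1 : Tendsto (fun n : ℕ => Real.exp (-(κ / 200 * (n:ℝ) ^ (1 / 8 : ℝ)))) atTop (nhds 0) :=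
    Real.tendsto_exp_neg_atTop_nhds_zero.comp ((hp _ (by norm_num)).const_mul_atTop (by positivity))
  have h2 : Tendsto (fun n : ℕ => (9:ℝ) / n) atTop (nhds 0) := tendsto_const_div_atTop_nhds_zero_nat 9
  have h3 : Tendsto (fun n : ℕ => Real.exp (-(κ' * (n:ℝ) ^ γ))) atTop (nhds 0) :=
    Real.tendsto_exp_neg_atTop_nhds_zero.comp ((hp _ hγ).const_mul_atTop hκ')
  have h4 : Tendsto (fun n : ℕ => √(n:ℝ) * Real.exp (-(κ' * (n:ℝ) ^ γ))) atTop (nhds 0) := by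
    have := (tendsto_rpow_mul_exp_neg_mul_atTop_nhds_zero (1 / (2 * γ)) κ' hκ').comp (hp γ hγ)
    refine this.congr fun n => ?_
    simp only [Function.comp]
    rw [← Real.rpow_mul (by positivity), Real.sqrt_eq_rpow, neg_mul]
    congr 2
    field_simp
  have := ((h1.const_mul 2).add (h2.const_mul 3)).add (((h4.const_mul 4).add h3).const_mul 3)
  simp only [mul_zero, add_zero] at this
  refine this.congr fun n => ?_
  ring

/-- Lattice crossings are very likely slightly above criticality. -/
theorem discrete_main : ∃ γ : ℝ, 0 < γ ∧ ∀ a b c d : ℝ, 0 ≤ a → a < b → b ≤ 1 → 0 ≤ c → c < d → d ≤ 1 →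
    ∃ ε : ℕ → ℝ, Tendsto ε atTop (nhds 0) ∧ ∀ᶠ n : ℕ in atTop, (n : ℝ) ^ (-γ) ≤ 1 / 2 ∧
      ∀ᶠ m : ℕ in atTop, ∀ [NeZero m],
        1 - ε n ≤ Pr (qp m (n / m ^ 2) (1 / 2 + (n : ℝ) ^ (-γ))) {ω | SB m ω ∈ LC a b c d m} := by
  obtain ⟨γ, κ', hγ, hκ', H⟩ := exists_strip_scale
  refine ⟨γ, hγ, fun a b c d ha hab hb hc hcd hd => ?_⟩
  set κ := min (b - a) (d - c)
  have hκ : 0 < κ := lt_min (by linarith) (by linarith)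
  have hκ1 : κ ≤ b - a := min_le_left _ _
  have hκ2 : κ ≤ d - c := min_le_right _ _
  refine ⟨_, rate_tendsto hκ hκ' hγ, ?_⟩
  have hbig : ∀ᶠ n : ℕ in atTop, 100 / κ ≤ (n:ℝ) ^ (1 / 3 : ℝ) :=
    ((tendsto_rpow_atTop (by norm_num)).comp tendsto_natCast_atTop_atTop).eventually_ge_atTop _
  filter_upwards [H, hbig, eventually_gt_atTop 1, pow_ell_ge cS_pos cS_lt (show (0:ℝ) < 1 / 24 by norm_num) 8]
    with n hn hn2 hn3 hn4
  obtain ⟨hn0, hl, hs⟩ := hn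
  refine ⟨hn0, ?_⟩
  have hm1 : ∀ᶠ m : ℕ in atTop, 2 * √n ≤ m := tendsto_natCast_atTop_atTop.eventually_ge_atTop _
  have hm2 : ∀ᶠ m : ℕ in atTop, 8 / κ ≤ (m:ℝ) := tendsto_natCast_atTop_atTop.eventually_ge_atTop _
  filter_upwards [hm1, hm2] with m hm1 hm2 _
  obtain ⟨s, hs1, hs2, hs3⟩ := hs m hm1
  obtain ⟨hu, h1, h2, h3, h4⟩ := usz_bounds (by omega) hm1
  set u := usz n m
  have hn' : (1:ℝ) < n := by exact_mod_cast hn3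
  have hu' : (0:ℝ) < u := by exact_mod_cast hu
  have hlu : u ≤ ell n * u := by nlinarith
  have hs4 : 4 * ell n * u ≤ 8 * ell n * u := by nlinarith
  have hs8 : 8 * u ≤ 8 * ell n * u := by nlinarith
  have hs0 : (0:ℝ) < s := by exact_mod_cast (by omega : 0 < s)
  have hsm : s * (n:ℝ) ^ (1 / 3 : ℝ) ≤ m := by
    calc s * (n:ℝ) ^ (1 / 3 : ℝ) ≤ (n:ℝ) ^ (1 / 6 : ℝ) * u * (n:ℝ) ^ (1 / 3 : ℝ) := by gcongr
      _ = u * √n := by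
        rw [Real.sqrt_eq_rpow, show (1/2:ℝ) = 1/6 + 1/3 by norm_num, Real.rpow_add (by linarith)]; ring
      _ ≤ m := h3
  have hsκ : (100 * s : ℝ) ≤ κ * m := by
    rw [div_le_iff₀ hκ] at hn2
    have : (s:ℝ) * 100 ≤ s * ((n:ℝ) ^ (1 / 3 : ℝ) * κ) := mul_le_mul_of_nonneg_left hn2 hs0.le
    nlinarith
  have hκm : 8 ≤ κ * m := by rw [div_le_iff₀ hκ] at hm2; linarith
  obtain ⟨a1, a2, a3, -⟩ := floor_bounds ha hb hκ1 hκm hsκ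
  obtain ⟨b1, b2, b3, b4⟩ := floor_bounds hc hd hκ2 hκm hsκ
  unfold LC
  set A := ⌊a * (m - 1 : ℝ)⌋
  set B := ⌊b * (m - 1 : ℝ)⌋
  set C := ⌊c * (m - 1 : ℝ)⌋
  set D := ⌊d * (m - 1 : ℝ)⌋
  set L := 8 * (ell n).toNat
  have hL : u * (L:ℤ) = 8 * ell n * u := by
    simp only [L]; push_cast; rw [Int.toNat_of_nonneg (by omega)]; ring
  set h := (D - C) / 4
  set M := ((D - C - 2 * h) / (7 * s)).toNat
  have hdiv := Int.ediv_nonneg (show 0 ≤ D - C - 2 * h by omega) (show 0 ≤ 7 * s by omega)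
  have hM0 : (M:ℤ) = (D - C - 2 * h) / (7 * s) := Int.toNat_of_nonneg hdiv
  have hM : 7 * s * (M:ℤ) ≤ D - h - (C + h) := by
    rw [hM0]
    have := Int.mul_ediv_self_le (x := D - C - 2 * h) (k := 7 * s) (by omega)
    omega
  have hM2 : κ * (n:ℝ) ^ (1 / 3 : ℝ) / 100 ≤ M := by
    have h5 : D - C - 2 * h ≤ 7 * s * (M + 1) := by
      have := Int.mul_ediv_add_emod (D - C - 2 * h) (7 * s)
      have := Int.emod_lt_of_pos (D - C - 2 * h) (show 0 < 7 * s by omega)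
      rw [hM0]; rw [mul_add]; omega
    have h6 : ((D - C : ℤ):ℝ) ≤ 14 * s * (M + 1) := by
      have : D - C ≤ 14 * s * (M + 1) := by
        have : 14 * s * ((M:ℤ) + 1) = 2 * (7 * s * (M + 1)) := by ring
        omega
      exact_mod_cast this
    have h7 : κ * (s * (n:ℝ) ^ (1 / 3 : ℝ)) ≤ 28 * s * (M + 1) := by
      have := mul_le_mul_of_nonneg_left hsm hκ.le
      linarith
    have h8 : κ * (n:ℝ) ^ (1 / 3 : ℝ) ≤ 28 * (M + 1) := by
      have : s * (κ * (n:ℝ) ^ (1 / 3 : ℝ)) ≤ s * (28 * (M + 1)) := by linarith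
      exact le_of_mul_le_mul_left this hs0
    rw [div_le_iff₀ hκ] at hn2
    linarith
  set j := ((m:ℤ) / s).toNat
  have hdiv' := Int.ediv_nonneg (show (0:ℤ) ≤ m by positivity) (show 0 ≤ s by omega)
  have hj0 : (j:ℤ) = m / s := Int.toNat_of_nonneg hdiv'
  have hj1 : s * (j:ℤ) ≤ m := by rw [hj0]; exact Int.mul_ediv_self_le (by omega)
  have hj2 : (m:ℤ) ≤ s + 3 * s * j := by
    have := Int.mul_ediv_add_emod (m:ℤ) s
    have := Int.emod_lt_of_pos (m:ℤ) (show 0 < s by omega)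
    have h9 : 0 ≤ s * (j:ℤ) := by rw [hj0]; exact mul_nonneg (by omega) hdiv'
    have : 3 * s * (j:ℤ) = 3 * (s * j) := by ring
    rw [← hj0] at *
    omega
  have hj3 : (j:ℝ) ≤ 2 * √n := by
    have h5 : u * (j:ℤ) ≤ m := le_trans (mul_le_mul_of_nonneg_right (by omega) (by positivity)) hj1
    have h6 : (u:ℝ) * j ≤ u * (2 * √n) := by
      have : (u:ℝ) * j ≤ m := by exact_mod_cast h5
      linarith
    exact le_of_mul_le_mul_left h6 hu'
  have hpn : 0 ≤ (n:ℝ) ^ (-γ) := by positivity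
  have key := discrete_crossing (m := m) (lam := n / m ^ 2) (p := 1 / 2 + (n:ℝ) ^ (-γ)) (by positivity) (by linarith) (by linarith)
    (A := A) (B := B) (C' := C + h) (D' := D - h) (u := u) (s := s) (N := m / 4 + 3) (L := L) (M := M) (j := j) (δ := 9 / n)
    (δ' := Real.exp (-(κ' * (n:ℝ) ^ γ)))
    hu h1 h2 (by omega) (by omega) a1 a2 (by omega) (by omega) (by omega) (by omega) hj2 hM (by omega) (by omega) (by omega)
    (by rw [hL]; exact full_rate hn3 hm1 hl (show 4 * ell n * u < m by omega) (by linarith) (by linarith)) (by rw [hL]; exact hs3)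
  refine le_trans ?_ (key.trans (Pr_mono (qp_adm (by positivity) (by linarith) (by linarith)) fun ω hω => Ev_mono ?_ subset_rfl subset_rfl hω))
  · have h5 := wall_rate (M := M) (L := L) (u := u) (s := s) (by omega) hκ hu (by omega) hs2 hn4 hM2
    have h6 : (2 * (j:ℝ) + 1) * Real.exp (-(κ' * (n:ℝ) ^ γ)) ≤ (4 * √n + 1) * Real.exp (-(κ' * (n:ℝ) ^ γ)) := by
      exact mul_le_mul_of_nonneg_right (by linarith) (Real.exp_pos _).le
    linarith
  · intro p hp
    rw [mem_box] at *; omega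

/-! ### Poissonisation -/

section poisson
variable {A : Type*} [Fintype A] [DecidableEq A] {E : Type*} [MeasurableSpace E]

/-- The indicator that no coordinate in `B` agrees with `s`. -/
def avoid (s : A → Bool) (B : Finset A) (ω : A → Bool) : ℝ := ∏ i ∈ B, if ω i = s i then 0 else 1

lemma Ex_avoid (q : A → ℝ) (s : A → Bool) (B : Finset A) :
    Ex q (avoid s B) = ∏ i ∈ B, w1 (q i) (!s i) := by
  have := Finset.prod_univ_sum (fun _ : A => (Finset.univ : Finset Bool))
    (fun i b => w1 (q i) b * if i ∈ B then (if b = s i then 0 else 1) else 1)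
  rw [Fintype.piFinset_univ] at this
  rw [← Finset.prod_ite_mem_eq B]
  refine Eq.trans ?_ (this.symm.trans (Finset.prod_congr rfl fun i _ => ?_))
  · refine Finset.sum_congr rfl fun ω _ => ?_
    rw [Finset.prod_mul_distrib, Finset.prod_ite_mem_eq B]; rfl
  · by_cases hi : i ∈ B
    · cases h : s i <;> simp [hi, w1, h]
    · simp [hi, w1]

lemma avoid_point (s τ ω : A → Bool) :
    (if ω = τ then (1:ℝ) else 0) = ∑ t ∈ (Finset.univ.filter fun i => τ i = s i).powerset,
      (-1) ^ t.card * avoid s (t ∪ Finset.univ.filter fun i => ¬ τ i = s i) ω := by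
  have h := Finset.prod_sub (fun _ : A => (1:ℝ)) (fun i => if ω i = s i then 0 else 1)
    (Finset.univ.filter fun i => τ i = s i)
  have e : ∀ t ∈ (Finset.univ.filter fun i => τ i = s i).powerset,
      avoid s (t ∪ Finset.univ.filter fun i => ¬ τ i = s i) ω
        = avoid s t ω * avoid s (Finset.univ.filter fun i => ¬ τ i = s i) ω := fun t ht => by
    refine Finset.prod_union (Finset.disjoint_left.2 fun i hi hi' => ?_)
    have := Finset.mem_powerset.1 ht hi
    simp only [Finset.mem_filter] at this hi'
    exact hi'.2 this.2
  rw [Finset.sum_congr rfl fun t ht => by rw [e t ht, ← mul_assoc], ← Finset.sum_mul]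
  simp only [Finset.prod_const_one, mul_one] at h
  change _ = (∑ t ∈ _, (-1:ℝ) ^ t.card * ∏ i ∈ t, _) * _
  rw [← h]
  split_ifs with hω
  · subst hω
    rw [Finset.prod_eq_one fun i hi => by simp [(Finset.mem_filter.1 hi).2], avoid,
      Finset.prod_eq_one fun i hi => by simp [(Finset.mem_filter.1 hi).2], one_mul]
  · obtain ⟨i, hi⟩ := Function.ne_iff.1 hω
    by_cases hs : τ i = s i
    · rw [Finset.prod_eq_zero (Finset.mem_filter.2 ⟨Finset.mem_univ i, hs⟩), zero_mul]
      rw [if_neg (fun h' => hi (h'.trans hs.symm)), sub_self]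
    · have : avoid s (Finset.univ.filter fun i => ¬ τ i = s i) ω = 0 := by
        refine Finset.prod_eq_zero (Finset.mem_filter.2 ⟨Finset.mem_univ i, hs⟩) ?_
        rw [if_pos]
        cases h1 : ω i <;> cases h2 : τ i <;> cases h3 : s i <;> simp_all
      rw [this, mul_zero]

/-- Which atoms are occupied by a sample; coordinate `i` equals `s i` when atom `i` is occupied. -/
def occ (s : A → Bool) (g : E → A) {N : ℕ} (x : Fin N → E) (i : A) : Bool :=
  open Classical in if ∃ k, g (x k) = i then s i else !s i

lemma occ_eq_iff (s : A → Bool) (g : E → A) {N : ℕ} (x : Fin N → E) (i : A) :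
    occ s g x i = s i ↔ ∃ k, g (x k) = i := by
  unfold occ; split_ifs with h <;> simp [h]

lemma avoid_occ (s : A → Bool) (g : E → A) {N : ℕ} (x : Fin N → E) (B : Finset A) :
    avoid s B (occ s g x) = ∏ k, (g ⁻¹' (B : Set A))ᶜ.indicator (fun _ => (1:ℝ)) (x k) := by
  unfold avoid
  simp only [occ_eq_iff]
  by_cases h : ∃ k, g (x k) ∈ B
  · obtain ⟨k, hk⟩ := h
    trans (0:ℝ)
    · exact Finset.prod_eq_zero hk (if_pos ⟨k, rfl⟩)
    · exact (Finset.prod_eq_zero (Finset.mem_univ k) (by simp [hk])).symm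
  · push Not at h
    rw [Finset.prod_eq_one, Finset.prod_eq_one]
    · intro k _; simp [h k]
    · intro i hi; rw [if_neg]; rintro ⟨k, rfl⟩; exact h k hi

lemma measurable_occ (s : A → Bool) {g : E → A} (hg : ∀ i, MeasurableSet (g ⁻¹' {i})) (N : ℕ) :
    Measurable fun x : Fin N → E => occ s g x := by
  refine measurable_pi_lambda _ fun i => ?_
  unfold occ
  refine Measurable.ite ?_ measurable_const measurable_const
  have : {x : Fin N → E | ∃ k, g (x k) = i} = ⋃ k, (fun x => x k) ⁻¹' (g ⁻¹' {i}) := by ext; simp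
  rw [this]
  exact MeasurableSet.iUnion fun k => (measurable_pi_apply k) (hg i)

lemma pois_pow (n r : ℝ) : HasSum (fun N => pois n N * r ^ N) (Real.exp (-(n * (1 - r)))) := by
  have := (NormedSpace.expSeries_div_hasSum_exp (n * r)).mul_left (Real.exp (-n))
  rw [← Real.exp_eq_exp_ℝ, ← Real.exp_add] at this
  convert! this using 2
  · rw [pois, mul_pow]; ring
  · ring

/-- Occupation of atoms by a Poisson number of independent points is independent. -/
lemma poisson_occ (μ : Measure E) [IsProbabilityMeasure μ] (s : A → Bool) {g : E → A}
    (hg : ∀ i, MeasurableSet (g ⁻¹' {i})) {n : ℝ} {q : A → ℝ}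
    (hq : ∀ i, w1 (q i) (!s i) = Real.exp (-(n * μ.real (g ⁻¹' {i})))) (F : (A → Bool) → ℝ) :
    HasSum (fun N => pois n N * ∫ x : Fin N → E, F (occ s g x) ∂Measure.pi fun _ => μ) (Ex q F) := by
  have hsum : ∀ (F : (A → Bool) → ℝ) (N : ℕ),
      Integrable (fun x : Fin N → E => F (occ s g x)) (Measure.pi fun _ => μ) := fun F N => by
    obtain ⟨C, hC⟩ := (Set.finite_range F).isBounded.exists_norm_le
    exact Integrable.of_bound ((measurable_of_finite F).comp (measurable_occ s hg N)).aestronglyMeasurable C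
      (Eventually.of_forall fun x => hC _ ⟨_, rfl⟩)
  have hlin : ∀ {κ : Type _} (T : Finset κ) (c : κ → ℝ) (f : κ → (A → Bool) → ℝ),
      (∀ k ∈ T, HasSum (fun N => pois n N * ∫ x : Fin N → E, f k (occ s g x) ∂Measure.pi fun _ => μ) (Ex q (f k))) →
      HasSum (fun N => pois n N * ∫ x : Fin N → E, (∑ k ∈ T, c k * f k (occ s g x)) ∂Measure.pi fun _ => μ)
        (Ex q fun ω => ∑ k ∈ T, c k * f k ω) := fun T c f h => by
    rw [Ex_sum, Finset.sum_congr rfl fun k _ => Ex_smul q (c k) (f k)]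
    convert! hasSum_sum fun k hk => (h k hk).mul_left (c k) using 2 with N
    rw [integral_finsetSum T fun k _ => (hsum (f k) N).const_mul (c k), Finset.mul_sum]
    refine Finset.sum_congr rfl fun k _ => ?_
    rw [integral_const_mul]; ring
  have h1 : ∀ B : Finset A, HasSum (fun N => pois n N *
      ∫ x : Fin N → E, avoid s B (occ s g x) ∂Measure.pi fun _ => μ) (Ex q (avoid s B)) := fun B => by
    have hB : MeasurableSet (g ⁻¹' (B : Set A)) := by
      have : g ⁻¹' (B : Set A) = ⋃ i ∈ B, g ⁻¹' {i} := by ext; simp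
      rw [this]; exact B.measurableSet_biUnion fun i _ => hg i
    have hr : μ.real (g ⁻¹' (B : Set A)) = ∑ i ∈ B, μ.real (g ⁻¹' {i}) := by
      have : g ⁻¹' (B : Set A) = ⋃ i ∈ B, g ⁻¹' {i} := by ext; simp
      rw [this, measureReal_biUnion_finset _ fun i _ => hg i]
      intro i _ j _ hij
      exact Disjoint.preimage _ (by simpa using hij)
    rw [Ex_avoid, Finset.prod_congr rfl fun i _ => hq i, ← Real.exp_sum, Finset.sum_neg_distrib, ← Finset.mul_sum, ← hr]
    convert! pois_pow n (μ.real (g ⁻¹' (B : Set A))ᶜ) using 2 with N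
    · simp only [avoid_occ]
      rw [integral_fintype_prod_eq_pow, Fintype.card_fin, integral_indicator_const _ hB.compl, smul_eq_mul, mul_one]
    · rw [probReal_compl_eq_one_sub hB]; ring
  have h2 : ∀ τ : A → Bool, HasSum (fun N => pois n N *
      ∫ x : Fin N → E, (if occ s g x = τ then (1:ℝ) else 0) ∂Measure.pi fun _ => μ)
        (Ex q fun ω => if ω = τ then 1 else 0) := fun τ => by
    simp only [avoid_point s τ]
    exact hlin _ _ _ fun t _ => h1 _
  have h3 := hlin Finset.univ F (fun τ ω => if ω = τ then 1 else 0) fun τ _ => h2 τ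
  simpa using h3

end poisson

lemma volume_plane_prod {I J : Set ℝ} (hI : MeasurableSet I) (hJ : MeasurableSet J) :
    volume {x : Plane | x 0 ∈ I ∧ x 1 ∈ J} = volume I * volume J := by
  have h := (PiLp.volume_preserving_ofLp (Fin 2)).measure_preimage
    (s := Set.univ.pi ![I, J]) (MeasurableSet.univ_pi fun i => by fin_cases i <;> simpa).nullMeasurableSet
  rw [volume_pi_pi] at h
  simp only [Fin.prod_univ_two, Matrix.cons_val_zero, Matrix.cons_val_one] at h
  rw [← h]
  congr 1
  ext x
  simp [Set.mem_pi, Fin.forall_fin_two]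

lemma isClosed_Sq : IsClosed Sq := by
  have h0 : Continuous fun x : Plane => x 0 := by fun_prop
  have h1 : Continuous fun x : Plane => x 1 := by fun_prop
  exact (isClosed_Icc.preimage h0).inter (isClosed_Icc.preimage h1)

lemma volume_Sq : volume Sq = 1 := by
  have := volume_plane_prod (measurableSet_Icc (a := (0:ℝ)) (b := 1)) (measurableSet_Icc (a := (0:ℝ)) (b := 1))
  simpa [Sq] using this

lemma markLaw_true {p : ℝ} : markLaw p {true} = ENNReal.ofReal p := by
  simp [markLaw, ENNReal.ofReal]

lemma markLaw_false {p : ℝ} : markLaw p {false} = ENNReal.ofReal (1 - p) := by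
  simp [markLaw, ENNReal.ofReal]

lemma markLaw_prob {p : ℝ} (h0 : 0 ≤ p) (h1 : p ≤ 1) : IsProbabilityMeasure (markLaw p) := by
  constructor
  have : (Set.univ : Set Bool) = {true} ∪ {false} := by ext b; cases b <;> simp
  rw [this, measure_union (by simp) (measurableSet_singleton _), markLaw_true, markLaw_false,
    ← ENNReal.ofReal_add h0 (by linarith)]
  simp

lemma unif_prob : IsProbabilityMeasure (volume.restrict Sq) := ⟨by simp [volume_Sq]⟩

lemma ptLaw_prob {p : ℝ} (h0 : 0 ≤ p) (h1 : p ≤ 1) : IsProbabilityMeasure (ptLaw p) := by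
  have := markLaw_prob h0 h1
  have := unif_prob
  unfold ptLaw; infer_instance

/-- The lattice cell containing a point, at mesh `1 / m`. -/
def cellZ (m : ℕ) (x : Plane) : Z2 := (⌊m * x 0⌋, ⌊m * x 1⌋)

/-- The marked cell containing a marked point. -/
def cellOf (m : ℕ) (x : Pt) : Idx m := (cs m (cellZ m x.1), x.2)

/-- The discretised configuration. -/
def occ' (m : ℕ) {N : ℕ} (x : Fin N → Pt) : Idx m → Bool := occ (fun i => i.2) (cellOf m) x

lemma measurableSet_floor_cast (m : ℕ) (v : ZMod m) : MeasurableSet {t : ℝ | ((⌊m * t⌋ : ℤ) : ZMod m) = v} := by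
  have : Measurable fun t : ℝ => ⌊(m:ℝ) * t⌋ := Int.measurable_floor.comp (by fun_prop)
  exact this (MeasurableSet.of_discrete (s := {k : ℤ | (k : ZMod m) = v}))

lemma volume_floor_cast (m : ℕ) [NeZero m] (v : ZMod m) :
    volume ({t : ℝ | ((⌊m * t⌋ : ℤ) : ZMod m) = v} ∩ Icc 0 1) = ENNReal.ofReal (1 / m) := by
  have hm : (0:ℝ) < m := by exact_mod_cast Nat.pos_of_ne_zero (NeZero.ne m)
  have h : ({t : ℝ | ((⌊m * t⌋ : ℤ) : ZMod m) = v} ∩ Icc 0 1 : Set ℝ) =ᵐ[volume] Ico (v.val / m : ℝ) ((v.val + 1) / m) := by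
    have : ∀ᵐ t : ℝ, t ≠ 1 := by simp [ae_iff]
    filter_upwards [this] with t ht
    apply propext
    change (((⌊m * t⌋ : ℤ) : ZMod m) = v ∧ 0 ≤ t ∧ t ≤ 1) ↔ ((v.val / m : ℝ) ≤ t ∧ t < (v.val + 1) / m)
    rw [div_le_iff₀ hm, lt_div_iff₀ hm]
    constructor
    · rintro ⟨h1, h2, h3⟩
      have h4 : 0 ≤ ⌊m * t⌋ := Int.floor_nonneg.2 (by positivity)
      have h5 : ⌊m * t⌋ < m := by
        rw [Int.floor_lt]
        have : t < 1 := lt_of_le_of_ne h3 ht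
        push_cast
        nlinarith
      have h6 : (v.val : ℤ) = ⌊m * t⌋ := by
        lift ⌊m * t⌋ to ℕ using h4 with k hk
        rw [← h1]; simp
        exact Int.emod_eq_of_lt (by positivity) h5
      have h7 := Int.floor_le (m * t)
      have h8 := Int.lt_floor_add_one (m * t)
      rw [← h6] at h7 h8
      push_cast at h7 h8
      constructor <;> linarith
    · rintro ⟨h1, h2⟩
      have h3 : ⌊m * t⌋ = v.val := by
        rw [Int.floor_eq_iff]; push_cast; constructor <;> linarith
      refine ⟨by rw [h3]; simp, ?_, ?_⟩
      · have : (0:ℝ) ≤ v.val := by positivity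
        by_contra hc; push Not at hc; nlinarith
      · have : (v.val : ℝ) + 1 ≤ m := by exact_mod_cast ZMod.val_lt v
        by_contra hc; push Not at hc; nlinarith
  rw [measure_congr h, Real.volume_Ico]
  congr 1; ring

lemma cellOf_preimage (m : ℕ) (i : Idx m) : cellOf m ⁻¹' {i} =
    {x : Plane | x 0 ∈ {t : ℝ | ((⌊m * t⌋ : ℤ) : ZMod m) = i.1.1} ∧ x 1 ∈ {t : ℝ | ((⌊m * t⌋ : ℤ) : ZMod m) = i.1.2}} ×ˢ {i.2} := by
  ext x
  obtain ⟨⟨i1, i2⟩, b⟩ := i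
  simp [cellOf, cellZ, cs, Prod.ext_iff]

lemma measurableSet_coord {I J : Set ℝ} (hI : MeasurableSet I) (hJ : MeasurableSet J) :
    MeasurableSet {x : Plane | x 0 ∈ I ∧ x 1 ∈ J} := by
  have h0 : Measurable fun x : Plane => x 0 := by fun_prop
  have h1 : Measurable fun x : Plane => x 1 := by fun_prop
  exact (h0 hI).inter (h1 hJ)

lemma measurableSet_cellOf (m : ℕ) (i : Idx m) : MeasurableSet (cellOf m ⁻¹' {i}) := by
  rw [cellOf_preimage]
  exact (measurableSet_coord (measurableSet_floor_cast m _) (measurableSet_floor_cast m _)).prod (measurableSet_singleton _)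

lemma ptLaw_cellOf (m : ℕ) [NeZero m] {p : ℝ} (h0 : 0 ≤ p) (h1 : p ≤ 1) (i : Idx m) :
    (ptLaw p).real (cellOf m ⁻¹' {i}) = 1 / m ^ 2 * if i.2 then p else 1 - p := by
  have := markLaw_prob h0 h1
  rw [cellOf_preimage, measureReal_def, ptLaw, Measure.prod_prod, Measure.restrict_apply
    (measurableSet_coord (measurableSet_floor_cast m _) (measurableSet_floor_cast m _))]
  have e : ({x : Plane | x 0 ∈ {t : ℝ | ((⌊m * t⌋ : ℤ) : ZMod m) = i.1.1} ∧ x 1 ∈ {t : ℝ | ((⌊m * t⌋ : ℤ) : ZMod m) = i.1.2}} ∩ Sq : Set Plane)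
      = {x : Plane | x 0 ∈ {t : ℝ | ((⌊m * t⌋ : ℤ) : ZMod m) = i.1.1} ∩ Icc 0 1 ∧ x 1 ∈ {t : ℝ | ((⌊m * t⌋ : ℤ) : ZMod m) = i.1.2} ∩ Icc 0 1} := by
    ext x; simp only [Sq, mem_inter_iff, mem_ofPred_eq]; tauto
  rw [e, volume_plane_prod ((measurableSet_floor_cast m _).inter measurableSet_Icc) ((measurableSet_floor_cast m _).inter measurableSet_Icc),
    volume_floor_cast, volume_floor_cast]
  have hm : (0:ℝ) ≤ 1 / m := by positivity
  rw [ENNReal.toReal_mul, ENNReal.toReal_mul, ENNReal.toReal_ofReal hm]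
  rcases i with ⟨v, b⟩
  cases b
  · rw [markLaw_false, ENNReal.toReal_ofReal (by linarith)]; simp only [Bool.false_eq_true, if_false]; ring
  · rw [markLaw_true, ENNReal.toReal_ofReal h0]; simp only [if_true]; ring

/-- The discretised Poisson process is the Bernoulli model. -/
lemma poisson_cells (m : ℕ) [NeZero m] {p : ℝ} (h0 : 0 ≤ p) (h1 : p ≤ 1) (n : ℝ) (F : (Idx m → Bool) → ℝ) :
    HasSum (fun N => pois n N * ∫ x : Fin N → Pt, F (occ' m x) ∂Measure.pi fun _ => ptLaw p)
      (Ex (qp m (n / m ^ 2) p) F) := by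
  have := ptLaw_prob h0 h1
  refine poisson_occ (ptLaw p) _ (measurableSet_cellOf m) (fun i => ?_) F
  rw [ptLaw_cellOf m h0 h1]
  rcases i with ⟨v, b⟩
  cases b <;> simp [w1, qp] <;> ring_nf

lemma measurable_occ' (m : ℕ) [NeZero m] (N : ℕ) : Measurable fun x : Fin N → Pt => occ' m x :=
  measurable_occ _ (measurableSet_cellOf m) N

/-! ### Crossings and chains of cells -/

lemma dist_le_dist_iff {y p q : Plane} : dist y p ≤ dist y q ↔
    (y 0 - p 0) ^ 2 + (y 1 - p 1) ^ 2 ≤ (y 0 - q 0) ^ 2 + (y 1 - q 1) ^ 2 := by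
  rw [EuclideanSpace.dist_eq, EuclideanSpace.dist_eq, Real.sqrt_le_sqrt_iff (by positivity)]
  simp [Fin.sum_univ_two, Real.dist_eq]

lemma dist_lt_dist_iff {y p q : Plane} : dist y p < dist y q ↔
    (y 0 - p 0) ^ 2 + (y 1 - p 1) ^ 2 < (y 0 - q 0) ^ 2 + (y 1 - q 1) ^ 2 := by
  rw [← not_le, dist_le_dist_iff, not_le]

lemma dist_eq_dist_iff {y p q : Plane} : dist y p = dist y q ↔
    (y 0 - p 0) ^ 2 + (y 1 - p 1) ^ 2 = (y 0 - q 0) ^ 2 + (y 1 - q 1) ^ 2 := by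
  rw [le_antisymm_iff, dist_le_dist_iff, dist_le_dist_iff, ← le_antisymm_iff]

lemma abs_coord_le_dist (x y : Plane) (i : Fin 2) : |x i - y i| ≤ dist x y := by
  rw [EuclideanSpace.dist_eq]
  refine Real.le_sqrt_of_sq_le ?_
  have := Finset.single_le_sum (f := fun i => dist (x i) (y i) ^ 2) (fun _ _ => by positivity) (Finset.mem_univ i)
  simpa [Real.dist_eq] using this

lemma dist_le_coord (x y : Plane) : dist x y ≤ |x 0 - y 0| + |x 1 - y 1| := by
  rw [EuclideanSpace.dist_eq, Fin.sum_univ_two]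
  refine Real.sqrt_le_iff.2 ⟨by positivity, ?_⟩
  simp only [Real.dist_eq]
  nlinarith [abs_nonneg (x 0 - y 0), abs_nonneg (x 1 - y 1)]

lemma isClosed_rect (a b c d : ℝ) : IsClosed (rect a b c d) := by
  have h0 : Continuous fun x : Plane => x 0 := by fun_prop
  have h1 : Continuous fun x : Plane => x 1 := by fun_prop
  exact (isClosed_Icc.preimage h0).inter (isClosed_Icc.preimage h1)

lemma isCompact_rect (a b c d : ℝ) : IsCompact (rect a b c d) := by
  refine Metric.isCompact_of_isClosed_isBounded (isClosed_rect a b c d) (Metric.isBounded_iff.2 ⟨(b - a) + (d - c), ?_⟩)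
  rintro x ⟨⟨h1, h2⟩, h3, h4⟩ y ⟨⟨h5, h6⟩, h7, h8⟩
  refine (dist_le_coord x y).trans (add_le_add ?_ ?_) <;> rw [abs_le] <;> constructor <;> linarith

lemma convex_rect (a b c d : ℝ) : Convex ℝ (rect a b c d) := by
  rintro x ⟨⟨h1, h2⟩, h3, h4⟩ y ⟨⟨h5, h6⟩, h7, h8⟩ s t hs ht hst
  obtain rfl : t = 1 - s := by linarith
  refine ⟨⟨?_, ?_⟩, ?_, ?_⟩ <;> simp <;> nlinarith

/-- The points nearer to `p` than to `q` form a convex set. -/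
lemma convex_nearer (p q : Plane) : Convex ℝ {y : Plane | dist y p ≤ dist y q} := by
  intro x hx y hy s t hs ht hst
  obtain rfl : t = 1 - s := by linarith
  simp only [mem_ofPred_eq, dist_le_dist_iff] at *
  simp only [PiLp.add_apply, PiLp.smul_apply, smul_eq_mul]
  nlinarith

lemma convex_strictly_nearer (p q : Plane) : Convex ℝ {y : Plane | dist y p < dist y q} := by
  intro x hx y hy s t hs ht hst
  obtain rfl : t = 1 - s := by linarith
  simp only [mem_ofPred_eq, dist_lt_dist_iff] at *
  simp only [PiLp.add_apply, PiLp.smul_apply, smul_eq_mul]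
  have := (convex_Ioi (0:ℝ)) (show (x 0 - q 0) ^ 2 + (x 1 - q 1) ^ 2 - ((x 0 - p 0) ^ 2 + (x 1 - p 1) ^ 2) ∈ Ioi 0 by simp only [mem_Ioi]; linarith)
    (show (y 0 - q 0) ^ 2 + (y 1 - q 1) ^ 2 - ((y 0 - p 0) ^ 2 + (y 1 - p 1) ^ 2) ∈ Ioi 0 by simp only [mem_Ioi]; linarith) hs ht hst
  simp only [mem_Ioi, smul_eq_mul] at this
  linarith

section chain
variable {N : ℕ}

/-- The blue indices `i`, `j` have cells meeting in the rectangle, up to an error `ε`. -/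
def Meet (a b c d ε : ℝ) (x : Fin N → Pt) (i j : Fin N) : Prop :=
  (x i).2 = true ∧ (x j).2 = true ∧ ∃ y ∈ rect (a - ε) (b + ε) (c - ε) (d + ε), ∀ k, (x k).2 = false →
    dist y (x i).1 ≤ dist y (x k).1 + ε ∧ dist y (x j).1 ≤ dist y (x k).1 + ε

/-- A chain of meeting blue cells joins the two vertical sides. -/
def Chain (a b c d ε : ℝ) (x : Fin N → Pt) : Prop :=
  ∃ i j, Meet a a c d ε x i i ∧ Meet b b c d ε x j j ∧ Relation.ReflTransGen (Meet a b c d ε x) i j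

/-- The cell of an index relative to the red points, within the rectangle. -/
def vcell (a b c d : ℝ) (x : Fin N → Pt) (i : Fin N) : Set Plane :=
  {y | y ∈ rect a b c d ∧ ∀ k, (x k).2 = false → dist y (x i).1 ≤ dist y (x k).1}

lemma meet_zero {a b c d : ℝ} {x : Fin N → Pt} {i j : Fin N} : Meet a b c d 0 x i j ↔
    (x i).2 = true ∧ (x j).2 = true ∧ (vcell a b c d x i ∩ vcell a b c d x j).Nonempty := by
  unfold Meet vcell
  simp only [sub_zero, add_zero]
  refine and_congr_right fun _ => and_congr_right fun _ => ⟨?_, ?_⟩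
  · rintro ⟨y, hy, h⟩
    exact ⟨y, ⟨hy, fun k hk => (h k hk).1⟩, hy, fun k hk => (h k hk).2⟩
  · rintro ⟨y, ⟨hy, h1⟩, -, h2⟩
    exact ⟨y, hy, fun k hk => ⟨h1 k hk, h2 k hk⟩⟩

lemma isClosed_vcell (a b c d : ℝ) (x : Fin N → Pt) (i : Fin N) : IsClosed (vcell a b c d x i) := by
  have : vcell a b c d x i = rect a b c d ∩ ⋂ k, {y | (x k).2 = false → dist y (x i).1 ≤ dist y (x k).1} := by
    ext; simp [vcell]
  rw [this]
  refine (isClosed_rect a b c d).inter (isClosed_iInter fun k => ?_)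
  by_cases hk : (x k).2 = false
  · simp only [hk, forall_const]; exact isClosed_le (by fun_prop) (by fun_prop)
  · simp [hk]

lemma convex_vcell (a b c d : ℝ) (x : Fin N → Pt) (i : Fin N) : Convex ℝ (vcell a b c d x i) := by
  intro y hy z hz s t hs ht hst
  exact ⟨convex_rect a b c d hy.1 hz.1 hs ht hst, fun k hk => convex_nearer _ _ (hy.2 k hk) (hz.2 k hk) hs ht hst⟩

lemma blue_iff {a b c d : ℝ} {x : Fin N → Pt} {y : Plane} : (y ∈ rect a b c d ∧ isBlue (cfgOf x) y) ↔
    ∃ i, (x i).2 = true ∧ y ∈ vcell a b c d x i := by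
  constructor
  · rintro ⟨hy, _, ⟨i, rfl⟩, hi, h⟩
    exact ⟨i, hi, hy, fun k _ => h _ ⟨k, rfl⟩⟩
  · rintro ⟨i, hi, hy, h⟩
    refine ⟨hy, ?_⟩
    obtain ⟨j, hj, hmin⟩ := (Finset.univ.filter fun j => (x j).2 = true).exists_min_image (fun j => dist y (x j).1)
      ⟨i, by simp [hi]⟩
    simp only [Finset.mem_filter, Finset.mem_univ, true_and] at hj hmin
    refine ⟨x j, ⟨j, rfl⟩, hj, ?_⟩
    rintro _ ⟨k, rfl⟩
    cases hk : (x k).2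
    · exact (hmin i hi).trans (h k hk)
    · exact hmin k hk

lemma crossing_iff_chain {a b c d : ℝ} (hab : a ≤ b) {x : Fin N → Pt} :
    Crossing a b c d (cfgOf x) ↔ Chain a b c d 0 x := by
  have hl : ∀ {i}, vcell a a c d x i ⊆ vcell a b c d x i := @fun _ y hy => ⟨⟨⟨hy.1.1.1, hy.1.1.2.trans hab⟩, hy.1.2⟩, hy.2⟩
  have hr : ∀ {i}, vcell b b c d x i ⊆ vcell a b c d x i := @fun _ y hy => ⟨⟨⟨hab.trans hy.1.1.1, hy.1.1.2⟩, hy.1.2⟩, hy.2⟩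
  constructor
  · rintro ⟨K, hK, hc, ⟨y, hy, hya⟩, z, hz, hzb⟩
    have hK' : ∀ y ∈ K, ∃ i, (x i).2 = true ∧ y ∈ vcell a b c d x i := fun y hy => blue_iff.1 (hK hy)
    obtain ⟨i, hi, hyi⟩ := hK' y hy
    have key : ∃ j, (x j).2 = true ∧ Relation.ReflTransGen (Meet a b c d 0 x) i j ∧ z ∈ vcell a b c d x j := by
      by_contra hcon
      push Not at hcon
      set U := ⋃ j ∈ {j | (x j).2 = true ∧ Relation.ReflTransGen (Meet a b c d 0 x) i j}, vcell a b c d x j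
      set V := ⋃ j ∈ {j | (x j).2 = true ∧ ¬ Relation.ReflTransGen (Meet a b c d 0 x) i j}, vcell a b c d x j
      have hU : IsClosed U := (Set.toFinite _).isClosed_biUnion fun j _ => isClosed_vcell a b c d x j
      have hV : IsClosed V := (Set.toFinite _).isClosed_biUnion fun j _ => isClosed_vcell a b c d x j
      obtain ⟨w, -, hwU, hwV⟩ := isPreconnected_closed_iff.1 hc.isPreconnected U V hU hV (fun w hw => by
        obtain ⟨j, hj, hwj⟩ := hK' w hw
        by_cases h : Relation.ReflTransGen (Meet a b c d 0 x) i j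
        · exact Or.inl (mem_biUnion (show j ∈ {j | _} from ⟨hj, h⟩) hwj)
        · exact Or.inr (mem_biUnion (show j ∈ {j | _} from ⟨hj, h⟩) hwj))
        ⟨y, hy, mem_biUnion (show i ∈ {j | _} from ⟨hi, .refl⟩) hyi⟩
        (by
          obtain ⟨j, hj, hzj⟩ := hK' z hz
          exact ⟨z, hz, mem_biUnion (show j ∈ {j | _} from ⟨hj, fun h => hcon j hj h hzj⟩) hzj⟩)
      simp only [U, V, mem_iUnion, mem_ofPred_eq, exists_prop] at hwU hwV
      obtain ⟨j, ⟨hj, hij⟩, hwj⟩ := hwU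
      obtain ⟨k, ⟨hk, hik⟩, hwk⟩ := hwV
      exact hik (hij.tail (meet_zero.2 ⟨hj, hk, w, hwj, hwk⟩))
    obtain ⟨j, hj, hij, hzj⟩ := key
    refine ⟨i, j, meet_zero.2 ⟨hi, hi, y, ?_⟩, meet_zero.2 ⟨hj, hj, z, ?_⟩, hij⟩
    · rw [inter_self]; exact ⟨⟨⟨hya.ge, hya.le⟩, hyi.1.2⟩, hyi.2⟩
    · rw [inter_self]; exact ⟨⟨⟨hzb.ge, hzb.le⟩, hzj.1.2⟩, hzj.2⟩
  · rintro ⟨i, j, hi, hj, hij⟩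
    obtain ⟨hib, -, y, hy, -⟩ := meet_zero.1 hi
    obtain ⟨hjb, -, z, hz, -⟩ := meet_zero.1 hj
    have key : ∃ K : Set Plane, K ⊆ {y | y ∈ rect a b c d ∧ isBlue (cfgOf x) y} ∧ IsConnected K ∧ y ∈ K ∧
        vcell a b c d x j ⊆ K := by
      clear hj hz hjb
      induction hij with
      | refl => exact ⟨vcell a b c d x i, fun w hw => blue_iff.2 ⟨i, hib, hw⟩,
          ⟨⟨y, hl hy⟩, (convex_vcell a b c d x i).isPreconnected⟩, hl hy, subset_rfl⟩
      | @tail j k _ hjk ih =>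
        obtain ⟨K, hK, hc, hyK, hjK⟩ := ih
        obtain ⟨-, hkb, w, hwj, hwk⟩ := meet_zero.1 hjk
        exact ⟨K ∪ vcell a b c d x k, union_subset hK fun w hw => blue_iff.2 ⟨k, hkb, hw⟩,
          hc.union ⟨w, hjK hwj, hwk⟩ ⟨⟨w, hwk⟩, (convex_vcell a b c d x k).isPreconnected⟩, Or.inl hyK, subset_union_right⟩
    obtain ⟨K, hK, hc, hyK, hjK⟩ := key
    exact ⟨K, hK, hc, ⟨y, hyK, le_antisymm hy.1.1.2 hy.1.1.1⟩, z, hjK (hr hz), le_antisymm hz.1.1.2 hz.1.1.1⟩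

/-- Existential quantification over a compact set preserves closedness. -/
lemma isClosed_exists_compact {α : Type*} [TopologicalSpace α] {K : Set Plane} (hK : IsCompact K) {P : α → Plane → Prop}
    (hP : IsClosed {q : α × Plane | P q.1 q.2}) : IsClosed {x | ∃ y ∈ K, P x y} := by
  have := isCompact_iff_compactSpace.1 hK
  have h := isClosedMap_snd_of_compactSpace (X := K) (Y := α) _
    (hP.preimage (show Continuous fun q : K × α => (q.2, (q.1 : Plane)) by fun_prop))
  convert! h
  ext x; simp

lemma isClosed_meet (a b c d : ℝ) (i j : Fin N) :
    IsClosed {q : (Fin N → Pt) × ℝ | q.2 ≤ 1 ∧ Meet a b c d q.2 q.1 i j} := by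
  have hb : ∀ (k : Fin N) (v : Bool), IsClopen {q : (Fin N → Pt) × ℝ | (q.1 k).2 = v} := fun k v =>
    (isClopen_discrete {v}).preimage (show Continuous fun q : (Fin N → Pt) × ℝ => (q.1 k).2 by fun_prop)
  have h := isClosed_exists_compact (isCompact_rect (a - 1) (b + 1) (c - 1) (d + 1))
    (P := fun (q : (Fin N → Pt) × ℝ) y => y ∈ rect (a - q.2) (b + q.2) (c - q.2) (d + q.2) ∧ ∀ k, (q.1 k).2 = false →
      dist y (q.1 i).1 ≤ dist y (q.1 k).1 + q.2 ∧ dist y (q.1 j).1 ≤ dist y (q.1 k).1 + q.2) (by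
    have h1 : IsClosed {q : ((Fin N → Pt) × ℝ) × Plane | q.2 ∈ rect (a - q.1.2) (b + q.1.2) (c - q.1.2) (d + q.1.2)} := by
      simp only [rect, mem_ofPred_eq, mem_Icc, ofPred_and]
      refine IsClosed.inter (IsClosed.inter ?_ ?_) (IsClosed.inter ?_ ?_) <;> exact isClosed_le (by fun_prop) (by fun_prop)
    refine h1.inter ?_
    · change IsClosed {q : ((Fin N → Pt) × ℝ) × Plane | ∀ k, (q.1.1 k).2 = false →
        dist q.2 (q.1.1 i).1 ≤ dist q.2 (q.1.1 k).1 + q.1.2 ∧ dist q.2 (q.1.1 j).1 ≤ dist q.2 (q.1.1 k).1 + q.1.2}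
      simp only [ofPred_forall]
      refine isClosed_iInter fun k => ?_
      have : {q : ((Fin N → Pt) × ℝ) × Plane | (q.1.1 k).2 = false →
          dist q.2 (q.1.1 i).1 ≤ dist q.2 (q.1.1 k).1 + q.1.2 ∧ dist q.2 (q.1.1 j).1 ≤ dist q.2 (q.1.1 k).1 + q.1.2}
          = Prod.fst ⁻¹' {q : (Fin N → Pt) × ℝ | (q.1 k).2 = true} ∪
            ({q | dist q.2 (q.1.1 i).1 ≤ dist q.2 (q.1.1 k).1 + q.1.2} ∩ {q | dist q.2 (q.1.1 j).1 ≤ dist q.2 (q.1.1 k).1 + q.1.2}) := by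
        ext q
        simp only [mem_ofPred_eq, mem_union, mem_preimage, mem_inter_iff]
        cases (q.1.1 k).2 <;> simp
      rw [this]
      refine ((hb k true).1.preimage continuous_fst).union (IsClosed.inter ?_ ?_) <;>
        exact isClosed_le (by fun_prop) (by fun_prop))
  convert! (((hb i true).1.inter (hb j true).1).inter h).inter
    (isClosed_le continuous_snd continuous_const : IsClosed {q : (Fin N → Pt) × ℝ | q.2 ≤ 1}) using 1
  ext q
  simp only [Meet, mem_ofPred_eq, mem_inter_iff]
  constructor
  · rintro ⟨h1, hi, hj, y, hy, h⟩
    exact ⟨⟨⟨hi, hj⟩, y, ⟨⟨by linarith [hy.1.1], by linarith [hy.1.2]⟩, by linarith [hy.2.1], by linarith [hy.2.2]⟩, hy, h⟩, h1⟩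
  · rintro ⟨⟨⟨hi, hj⟩, y, -, hy, h⟩, h1⟩
    exact ⟨h1, hi, hj, y, hy, h⟩

lemma isClosed_meet_zero (a b c d : ℝ) (i j : Fin N) : IsClosed {x : Fin N → Pt | Meet a b c d 0 x i j} := by
  convert! (isClosed_meet a b c d i j).preimage (show Continuous fun x : Fin N → Pt => (x, (0:ℝ)) by fun_prop) using 1
  ext x; simp

lemma eventually_meet (a b c d : ℝ) (x : Fin N → Pt) (i j : Fin N) :
    ∀ᶠ ε in nhdsWithin (0:ℝ) (Ioi 0), Meet a b c d ε x i j → Meet a b c d 0 x i j := by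
  by_cases h : Meet a b c d 0 x i j
  · exact Eventually.of_forall fun _ _ => h
  have h1 : IsClosed {ε : ℝ | ε ≤ 1 ∧ Meet a b c d ε x i j} :=
    (isClosed_meet a b c d i j).preimage (show Continuous fun ε : ℝ => (x, ε) by fun_prop)
  have h2 : ∀ᶠ ε in nhds (0:ℝ), ε ∉ {ε : ℝ | ε ≤ 1 ∧ Meet a b c d ε x i j} :=
    h1.isOpen_compl.mem_nhds fun h' => h h'.2
  filter_upwards [nhdsWithin_le_nhds h2, nhdsWithin_le_nhds (Iio_mem_nhds (zero_lt_one (α := ℝ)))] with ε h3 h4 h5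
  exact absurd ⟨le_of_lt h4, h5⟩ h3

/-- Approximate chains of small error are chains. -/
lemma eventually_chain (a b c d : ℝ) (x : Fin N → Pt) :
    ∀ᶠ ε in nhdsWithin (0:ℝ) (Ioi 0), Chain a b c d ε x → Chain a b c d 0 x := by
  filter_upwards [eventually_all.2 fun i => eventually_meet a a c d x i i, eventually_all.2 fun i => eventually_meet b b c d x i i,
    eventually_all.2 fun i => eventually_all.2 fun j => eventually_meet a b c d x i j] with ε h1 h2 h3
  rintro ⟨i, j, hi, hj, hij⟩
  exact ⟨i, j, h1 i hi, h2 j hj, Relation.ReflTransGen.mono (fun i j h => h3 i j h) _ _ hij⟩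

lemma measurableSet_chain (a b c d : ℝ) : MeasurableSet {x : Fin N → Pt | Chain a b c d 0 x} := by
  have hm : ∀ a b i j, Measurable fun x : Fin N → Pt => Meet a b c d 0 x i j := fun a b i j =>
    measurableSet_setOfPred.1 (isClosed_meet_zero a b c d i j).measurableSet
  have h : Measurable fun x : Fin N → Pt => ((fun i => Meet a a c d 0 x i i, fun i => Meet b b c d 0 x i i),
      fun i j => Meet a b c d 0 x i j) := by
    refine Measurable.prodMk (Measurable.prodMk ?_ ?_) ?_
    · exact measurable_pi_lambda _ fun i => hm _ _ _ _
    · exact measurable_pi_lambda _ fun i => hm _ _ _ _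
    · exact measurable_pi_lambda _ fun i => measurable_pi_lambda _ fun j => hm _ _ _ _
  exact h (Set.toFinite {q : ((Fin N → Prop) × (Fin N → Prop)) × (Fin N → Fin N → Prop) | ∃ i j, q.1.1 i ∧ q.1.2 j ∧ Relation.ReflTransGen q.2 i j}).measurableSet

lemma fR_eq_indicator {a b c d : ℝ} (hab : a ≤ b) :
    (fun x : Fin N → Pt => fR a b c d (cfgOf x)) = {x : Fin N → Pt | Chain a b c d 0 x}.indicator fun _ => 1 := by
  ext x
  by_cases h : Chain a b c d 0 x
  · rw [fR, if_pos ((crossing_iff_chain hab).2 h), indicator_of_mem (by exact h)]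
  · rw [fR, if_neg (fun h' => h ((crossing_iff_chain hab).1 h')), indicator_of_notMem (by exact h)]

lemma measurable_fR {a b c d : ℝ} (hab : a ≤ b) : Measurable fun x : Fin N → Pt => fR a b c d (cfgOf x) := by
  rw [fR_eq_indicator hab]
  exact measurable_const.indicator (measurableSet_chain a b c d)

end chain

/-! ### Lattice crossings give continuum crossings -/

/-- The lattice point `v` at mesh `1 / m`. -/
def latPt (m : ℕ) (v : Z2) : Plane := !₂[(v.1 : ℝ) / m, (v.2 : ℝ) / m]

section limit
variable {m N : ℕ}

lemma d2_le_iff (hm : 0 < m) (z z' v : Z2) :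
    d2 z v ≤ d2 z' v ↔ dist (latPt m v) (latPt m z) ≤ dist (latPt m v) (latPt m z') := by
  have hm' : (0:ℝ) < m := by exact_mod_cast hm
  rw [dist_le_dist_iff]
  simp only [latPt, PiLp.toLp_apply, Matrix.cons_val_zero, Matrix.cons_val_one]
  have e : ∀ w : Z2, ((v.1:ℝ) / m - w.1 / m) ^ 2 + ((v.2:ℝ) / m - w.2 / m) ^ 2 = ((d2 w v : ℤ) : ℝ) / m ^ 2 := fun w => by
    simp only [d2]; push_cast; field_simp; ring
  rw [e, e, div_le_div_iff_of_pos_right (by positivity)]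
  exact_mod_cast Iff.rfl

lemma dist_cellZ (hm : 0 < m) (p : Plane) : dist (latPt m (cellZ m p)) p ≤ 2 / m := by
  have hm' : (0:ℝ) < m := by exact_mod_cast hm
  have h : ∀ t : ℝ, |(⌊m * t⌋ : ℝ) / m - t| ≤ 1 / m := fun t => by
    have h1 := Int.floor_le (m * t)
    have h2 := Int.lt_floor_add_one (m * t)
    have e : (⌊m * t⌋ : ℝ) / m - t = (⌊m * t⌋ - m * t) / m := by field_simp
    rw [e, abs_div, abs_of_pos hm', div_le_div_iff_of_pos_right hm', abs_le]
    constructor <;> linarith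
  refine (dist_le_coord _ _).trans ?_
  simp only [latPt, cellZ, PiLp.toLp_apply, Matrix.cons_val_zero, Matrix.cons_val_one]
  have e : (2:ℝ) / m = 1 / m + 1 / m := by ring
  linarith [h (p 0), h (p 1)]

lemma dist_king (hm : 0 < m) {v w : Z2} (h : king v w) : dist (latPt m v) (latPt m w) ≤ 2 / m := by
  have hm' : (0:ℝ) < m := by exact_mod_cast hm
  have h1 : ∀ s t : ℤ, |s - t| ≤ 1 → |(s:ℝ) / m - t / m| ≤ 1 / m := fun s t hst => by
    rw [← sub_div, abs_div, abs_of_pos hm', div_le_div_iff_of_pos_right hm']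
    exact_mod_cast hst
  refine (dist_le_coord _ _).trans ?_
  simp only [latPt, PiLp.toLp_apply, Matrix.cons_val_zero, Matrix.cons_val_one]
  have e : (2:ℝ) / m = 1 / m + 1 / m := by ring
  linarith [h1 _ _ h.1, h1 _ _ h.2]

/-- The half-open unit square. -/
def SqO : Set Plane := {x | x 0 ∈ Ico (0:ℝ) 1 ∧ x 1 ∈ Ico (0:ℝ) 1}

lemma cellZ_mem (hm : 0 < m) {p : Plane} (hp : p ∈ SqO) : cellZ m p ∈ SqZ m := by
  have hm' : (0:ℝ) < m := by exact_mod_cast hm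
  have h : ∀ t : ℝ, t ∈ Ico (0:ℝ) 1 → 0 ≤ ⌊m * t⌋ ∧ ⌊m * t⌋ ≤ m - 1 := fun t ht => by
    refine ⟨Int.floor_nonneg.2 (mul_nonneg hm'.le ht.1), ?_⟩
    have : ⌊m * t⌋ < m := by rw [Int.floor_lt]; push_cast; nlinarith [ht.2]
    omega
  exact ⟨(h _ hp.1).1, (h _ hp.1).2, (h _ hp.2).1, (h _ hp.2).2⟩

/-- The blue index `i` is nearest to the lattice site `v` at lattice resolution. -/
def Near (m : ℕ) (x : Fin N → Pt) (v : Z2) (i : Fin N) : Prop :=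
  (x i).2 = true ∧ ∀ k, (x k).2 = false → d2 (cellZ m (x i).1) v ≤ d2 (cellZ m (x k).1) v

lemma exists_near [NeZero m] {x : Fin N → Pt} (hx : ∀ i, (x i).1 ∈ SqO) {v : Z2} (hv : v ∈ SB m (occ' m x)) :
    ∃ i, Near m x v i := by
  have hm : 0 < m := Nat.pos_of_ne_zero (NeZero.ne m)
  obtain ⟨z, hz, hb, h⟩ := hv
  obtain ⟨i, hi⟩ := (occ_eq_iff (fun i : Idx m => i.2) (cellOf m) x _).1 hb
  rw [cellOf, Prod.mk.injEq] at hi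
  have hzi := cellZ_mem hm (hx i)
  have e : cellZ m (x i).1 = z := by
    simp only [SqZ, mem_box] at hz hzi
    refine cs_inj hi.1 ?_ ?_ <;> rw [abs_lt] <;> omega
  refine ⟨i, hi.2, fun k hk => ?_⟩
  rw [e]
  refine h _ (cellZ_mem hm (hx k)) ((occ_eq_iff (fun i : Idx m => i.2) (cellOf m) x _).2 ⟨k, ?_⟩)
  rw [cellOf, hk]

lemma Near.dist_le (hm : 0 < m) {x : Fin N → Pt} {v : Z2} {i : Fin N} (h : Near m x v i) {k : Fin N}
    (hk : (x k).2 = false) : dist (latPt m v) (x i).1 ≤ dist (latPt m v) (x k).1 + 4 / m := by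
  have h1 := (d2_le_iff hm _ _ _).1 (h.2 k hk)
  have h2 := dist_cellZ hm (x i).1
  have h3 := dist_cellZ hm (x k).1
  have h4 := dist_triangle (latPt m v) (latPt m (cellZ m (x i).1)) (x i).1
  have h5 := dist_triangle_right (latPt m v) (latPt m (cellZ m (x k).1)) (x k).1
  have e : (4:ℝ) / m = 2 / m + 2 / m := by ring
  linarith

lemma Near.meet (hm : 0 < m) {a b c d : ℝ} {x : Fin N → Pt} {v w : Z2} {i j : Fin N} (hi : Near m x v i)
    (hj : Near m x w j) (hvw : dist (latPt m v) (latPt m w) ≤ 2 / m)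
    (hv : latPt m v ∈ rect (a - 8 / m) (b + 8 / m) (c - 8 / m) (d + 8 / m)) : Meet a b c d (8 / m) x i j := by
  refine ⟨hi.1, hj.1, latPt m v, hv, fun k hk => ?_⟩
  have h1 := hi.dist_le hm hk
  have h2 := hj.dist_le hm hk
  have h3 := dist_triangle (latPt m v) (latPt m w) (x j).1
  have h4 := dist_triangle_left (latPt m w) (x k).1 (latPt m v)
  have e : (8:ℝ) / m = 4 / m + 2 / m + 2 / m := by ring
  have e' : (0:ℝ) ≤ 2 / m := by positivity
  constructor <;> linarith

lemma floor_scaled (hm : 0 < m) {a : ℝ} (h0 : 0 ≤ a) (h1 : a ≤ 1) :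
    a - 8 / m ≤ (⌊a * (m - 1 : ℝ)⌋ : ℝ) / m ∧ (⌊a * (m - 1 : ℝ)⌋ : ℝ) / m ≤ a := by
  have hm' : (0:ℝ) < m := by exact_mod_cast hm
  have h2 := Int.floor_le (a * (m - 1 : ℝ))
  have h3 := Int.lt_floor_add_one (a * (m - 1 : ℝ))
  have e : a - 8 / m = (a * m - 8) / m := by field_simp
  rw [e, div_le_div_iff_of_pos_right hm', div_le_iff₀ hm']
  constructor <;> nlinarith

lemma chain_of_LC [NeZero m] {a b c d : ℝ} (ha : 0 ≤ a) (hab : a < b) (hb : b ≤ 1) (hc : 0 ≤ c) (hcd : c < d) (hd : d ≤ 1)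
    {x : Fin N → Pt} (hx : ∀ i, (x i).1 ∈ SqO) (h : SB m (occ' m x) ∈ LC a b c d m) : Chain a b c d (8 / m) x := by
  have hm : 0 < m := Nat.pos_of_ne_zero (NeZero.ne m)
  have hm' : (0:ℝ) < m := by exact_mod_cast hm
  obtain ⟨p, q, hp, hq, h⟩ := h
  have hs : ∀ {s t : ℤ}, s ≤ t → (s:ℝ) / m ≤ t / m := fun h => by
    rw [div_le_div_iff_of_pos_right hm']; exact_mod_cast h
  have h8 : (0:ℝ) ≤ 8 / m := by positivity
  have hbox : ∀ v ∈ Box ⌊a * (m - 1 : ℝ)⌋ ⌊b * (m - 1 : ℝ)⌋ ⌊c * (m - 1 : ℝ)⌋ ⌊d * (m - 1 : ℝ)⌋,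
      latPt m v ∈ rect (a - 8 / m) (b + 8 / m) (c - 8 / m) (d + 8 / m) := fun v hv => by
    rw [mem_box] at hv
    have ea := floor_scaled hm ha (hab.le.trans hb)
    have eb := floor_scaled hm (ha.trans hab.le) hb
    have ec := floor_scaled hm hc (hcd.le.trans hd)
    have ed := floor_scaled hm (hc.trans hcd.le) hd
    refine ⟨⟨?_, ?_⟩, ?_, ?_⟩ <;> simp only [latPt, PiLp.toLp_apply, Matrix.cons_val_zero, Matrix.cons_val_one]
    · exact ea.1.trans (hs hv.1)
    · linarith [hs hv.2.1]
    · exact ec.1.trans (hs hv.2.2.1)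
    · linarith [hs hv.2.2.2]
  have hend : ∀ {t : ℝ} {v : Z2}, 0 ≤ t → t ≤ 1 → v.1 = ⌊t * (m - 1 : ℝ)⌋ →
      latPt m v ∈ rect (a - 8 / m) (b + 8 / m) (c - 8 / m) (d + 8 / m) →
      latPt m v ∈ rect (t - 8 / m) (t + 8 / m) (c - 8 / m) (d + 8 / m) := fun {t v} h0 h1 hv hr => by
    refine ⟨?_, hr.2⟩
    simp only [latPt, PiLp.toLp_apply, Matrix.cons_val_zero, hv]
    have := floor_scaled hm h0 h1
    constructor <;> linarith
  have hself : ∀ v, dist (latPt m v) (latPt m v) ≤ 2 / m := fun v => by rw [dist_self]; positivity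
  obtain ⟨i, hi⟩ := exists_near hx h.left_mem.1
  have key : ∀ j, Near m x q j → Relation.ReflTransGen (Meet a b c d (8 / m) x) i j := by
    refine h.induct (P := fun v => ∀ j, Near m x v j → Relation.ReflTransGen (Meet a b c d (8 / m) x) i j)
      (fun j hj => .single (hi.meet hm hj (hself p) (hbox p h.left_mem.2))) fun v w hv ih hvw hw j hj => ?_
    obtain ⟨k, hk⟩ := exists_near hx hv.right_mem.1
    exact (ih k hk).tail (hk.meet hm hj (dist_king hm hvw) (hbox v hv.right_mem.2))
  obtain ⟨j, hj⟩ := exists_near hx h.right_mem.1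
  exact ⟨i, j, hi.meet hm hi (hself p) (hend ha (hab.le.trans hb) hp (hbox p h.left_mem.2)),
    hj.meet hm hj (hself q) (hend (ha.trans hab.le) hb hq (hbox q h.right_mem.2)), key j hj⟩

/-- For a fixed configuration, fine lattice crossings are genuine crossings. -/
lemma eventually_crossing {a b c d : ℝ} (ha : 0 ≤ a) (hab : a < b) (hb : b ≤ 1) (hc : 0 ≤ c) (hcd : c < d) (hd : d ≤ 1)
    {x : Fin N → Pt} (hx : ∀ i, (x i).1 ∈ SqO) : ∀ᶠ m : ℕ in atTop,
    SB (m + 1) (occ' (m + 1) x) ∈ LC a b c d (m + 1) → Crossing a b c d (cfgOf x) := by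
  have ht : Tendsto (fun m : ℕ => (8:ℝ) / ((m + 1 : ℕ) : ℝ)) atTop (nhdsWithin 0 (Ioi 0)) := by
    refine tendsto_nhdsWithin_iff.2 ⟨?_, Eventually.of_forall fun m => ?_⟩
    · exact (tendsto_const_div_atTop_nhds_zero_nat 8).comp (tendsto_add_atTop_nat 1)
    · have : (0:ℝ) < ((m + 1 : ℕ) : ℝ) := by positivity
      exact div_pos (by norm_num) this
  filter_upwards [ht.eventually (eventually_chain a b c d x)] with m hm h
  exact (crossing_iff_chain hab.le).2 (hm (chain_of_LC ha hab hb hc hcd hd hx h))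

end limit

/-! ### The continuum lower bound -/

lemma pois_nonneg {n : ℝ} (hn : 0 ≤ n) (N : ℕ) : 0 ≤ pois n N := by unfold pois; positivity

lemma pois_hasSum (n : ℝ) : HasSum (pois n) 1 := by simpa using pois_pow n 1

lemma ptLaw_prod_univ (p : ℝ) {S : Set Plane} (h : volume S = 0) : ptLaw p (S ×ˢ Set.univ) = 0 := by
  have : SigmaFinite (markLaw p) := by unfold markLaw; infer_instance
  rw [ptLaw, Measure.prod_prod, le_antisymm ((Measure.restrict_apply_le _ _).trans_eq h) zero_le, zero_mul]

lemma volume_coord_eq (i : Fin 2) (t : ℝ) : volume {x : Plane | x i = t} = 0 := by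
  fin_cases i
  · have := volume_plane_prod (measurableSet_singleton t) MeasurableSet.univ
    simpa using this
  · have := volume_plane_prod MeasurableSet.univ (measurableSet_singleton t)
    simpa using this

lemma fR_mem (a b c d : ℝ) (η : Config) : 0 ≤ fR a b c d η ∧ fR a b c d η ≤ 1 := by
  unfold fR; split_ifs <;> simp

section lower
variable {p : ℝ} (h0 : 0 ≤ p) (h1 : p ≤ 1)
include h0 h1

lemma ae_SqO (N : ℕ) : ∀ᵐ x : Fin N → Pt ∂Measure.pi fun _ => ptLaw p, ∀ i, (x i).1 ∈ SqO := by
  have := ptLaw_prob h0 h1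
  have h : ∀ᵐ q ∂ptLaw p, q.1 ∈ SqO := by
    have := markLaw_prob h0 h1
    have e1 : ∀ᵐ q ∂ptLaw p, q.1 ∈ Sq := by
      have : ptLaw p (Sqᶜ ×ˢ Set.univ) = 0 := by
        rw [ptLaw, Measure.prod_prod, Measure.restrict_apply isClosed_Sq.measurableSet.compl]; simp
      rw [ae_iff]; convert! this using 2; ext; simp
    have e2 : ∀ i, ∀ᵐ q ∂ptLaw p, q.1 i ≠ 1 := fun i => by
      rw [ae_iff]; convert! ptLaw_prod_univ p (volume_coord_eq i 1) using 2; ext; simp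
    filter_upwards [e1, e2 0, e2 1] with q h1 h2 h3
    exact ⟨⟨h1.1.1, lt_of_le_of_ne h1.1.2 h2⟩, h1.2.1, lt_of_le_of_ne h1.2.2 h3⟩
  exact eventually_all.2 fun i => (Measure.tendsto_eval_ae_ae (μ := fun _ : Fin N => ptLaw p) (i := i)).eventually h

lemma PE_ge {a b c d : ℝ} (ha : 0 ≤ a) (hab : a < b) (hb : b ≤ 1) (hc : 0 ≤ c) (hcd : c < d) (hd : d ≤ 1)
    {n : ℝ} (hn : 0 ≤ n) {ε : ℝ} (h : ∀ᶠ m : ℕ in atTop, ∀ [NeZero m],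
      1 - ε ≤ Pr (qp m (n / m ^ 2) p) {ω | SB m ω ∈ LC a b c d m}) : 1 - ε ≤ PE n p (fR a b c d) := by
  have := ptLaw_prob h0 h1
  set F : (m : ℕ) → (Idx m → Bool) → ℝ := fun m => {ω | SB m ω ∈ LC a b c d m}.indicator fun _ => 1
  have hF : ∀ m ω, 0 ≤ F m ω ∧ F m ω ≤ 1 := fun m ω => by
    exact ⟨indicator_nonneg (fun _ _ => zero_le_one) _, indicator_le_self' (fun _ _ => zero_le_one) _⟩
  set G : (m : ℕ) → (N : ℕ) → (Fin N → Pt) → ℝ := fun m N x => max (F (m + 1) (occ' (m + 1) x)) (fR a b c d (cfgOf x))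
  have hFm : ∀ m N, Measurable fun x : Fin N → Pt => F (m + 1) (occ' (m + 1) x) := fun m N =>
    (measurable_of_finite (F (m + 1))).comp (measurable_occ' (m + 1) N)
  have hGm : ∀ m N, Measurable (G m N) := fun m N => (hFm m N).max (measurable_fR hab.le)
  have hGb : ∀ m N x, 0 ≤ G m N x ∧ G m N x ≤ 1 := fun m N x =>
    ⟨le_max_of_le_left (hF _ _).1, max_le (hF _ _).2 (fR_mem _ _ _ _ _).2⟩
  have hGn : ∀ m N x, ‖G m N x‖ ≤ 1 := fun m N x => by
    rw [Real.norm_eq_abs, abs_of_nonneg (hGb m N x).1]; exact (hGb m N x).2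
  have hlim : ∀ N, Tendsto (fun m => ∫ x, G m N x ∂Measure.pi fun _ => ptLaw p) atTop
      (nhds (∫ x : Fin N → Pt, fR a b c d (cfgOf x) ∂Measure.pi fun _ => ptLaw p)) := fun N => by
    refine tendsto_integral_of_dominated_convergence (fun _ => 1) (fun m => (hGm m N).aestronglyMeasurable)
      (integrable_const 1) (fun m => Eventually.of_forall (hGn m N)) ?_
    filter_upwards [ae_SqO h0 h1 N] with x hx
    refine tendsto_const_nhds.congr' ?_
    filter_upwards [eventually_crossing ha hab hb hc hcd hd hx] with m hm
    by_cases hs : SB (m + 1) (occ' (m + 1) x) ∈ LC a b c d (m + 1)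
    · have e1 : fR a b c d (cfgOf x) = 1 := if_pos (hm hs)
      simp only [G]; rw [e1, max_eq_right (hF _ _).2]
    · have e1 : F (m + 1) (occ' (m + 1) x) = 0 := indicator_of_notMem (by exact hs) _
      simp only [G]; rw [e1, max_eq_right (fR_mem _ _ _ _ _).1]
  have hlim2 : Tendsto (fun m => ∑' N, pois n N * ∫ x, G m N x ∂Measure.pi fun _ => ptLaw p) atTop
      (nhds (PE n p (fR a b c d))) := by
    refine tendsto_tsum_of_dominated_convergence (pois_hasSum n).summable (fun N => (hlim N).const_mul _)
      (Eventually.of_forall fun m N => ?_)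
    rw [norm_mul, Real.norm_eq_abs, abs_of_nonneg (pois_nonneg hn N)]
    refine mul_le_of_le_one_right (pois_nonneg hn N) ?_
    refine (norm_integral_le_of_norm_le_const (C := 1) (Eventually.of_forall (hGn m N))).trans ?_
    simp
  refine ge_of_tendsto hlim2 ?_
  filter_upwards [(tendsto_add_atTop_nat 1).eventually h] with m hm
  have hs := poisson_cells (m + 1) h0 h1 n (F (m + 1))
  refine (hm.trans (le_of_eq hs.tsum_eq.symm)).trans (Summable.tsum_le_tsum (fun N => ?_) hs.summable ?_)
  · refine mul_le_mul_of_nonneg_left (integral_mono ?_ ?_ fun x => le_max_left _ _) (pois_nonneg hn N)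
    · exact Integrable.of_bound (hFm m N).aestronglyMeasurable 1 (Eventually.of_forall fun x => by
        rw [Real.norm_eq_abs, abs_of_nonneg (hF _ _).1]; exact (hF _ _).2)
    · exact Integrable.of_bound (hGm m N).aestronglyMeasurable 1 (Eventually.of_forall (hGn m N))
  · refine Summable.of_norm_bounded (pois_hasSum n).summable fun N => ?_
    rw [norm_mul, Real.norm_eq_abs, abs_of_nonneg (pois_nonneg hn N)]
    refine mul_le_of_le_one_right (pois_nonneg hn N) ?_
    refine (norm_integral_le_of_norm_le_const (C := 1) (Eventually.of_forall (hGn m N))).trans ?_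
    simp

end lower

/-! ### Connected sets that must meet -/

/-- Two points of a preconnected set are joined by a sequence of points of the set with small steps. -/
lemma exists_steps {K : Set Plane} (hK : IsPreconnected K) {p q : Plane} (hp : p ∈ K) (hq : q ∈ K) {ε : ℝ} (hε : 0 < ε) :
    ∃ (k : ℕ) (f : ℕ → Plane), f 0 = p ∧ f k = q ∧ (∀ i ≤ k, f i ∈ K) ∧ ∀ i < k, dist (f (i + 1)) (f i) ≤ ε := by
  have h : Relation.ReflTransGen (fun u v : Plane => v ∈ K ∧ dist v u ≤ ε) p q := by
    by_contra hcon
    have hsymm : Std.Symm (fun u v : Plane => u ∈ K ∧ v ∈ K ∧ dist v u ≤ ε) :=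
      ⟨fun u v h => ⟨h.2.1, h.1, by rw [dist_comm]; exact h.2.2⟩⟩
    refine hcon (Relation.ReflTransGen.mono (fun u v (h : u ∈ K ∧ v ∈ K ∧ dist v u ≤ ε) => h.2) _ _ ?_)
    refine hK.induction₂ (Relation.ReflTransGen fun u v : Plane => u ∈ K ∧ v ∈ K ∧ dist v u ≤ ε) (fun x hx => ?_)
      (fun x y z _ _ _ h1 h2 => h1.trans h2) (fun x y _ _ h => ?_) hp hq
    · filter_upwards [self_mem_nhdsWithin, mem_nhdsWithin_of_mem_nhds (Metric.ball_mem_nhds x hε)] with y hy hxy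
      exact .single ⟨hx, hy, (Metric.mem_ball.1 hxy).le⟩
    · exact Relation.ReflTransGen.stdSymm.symm _ _ h
  clear hq
  induction h with
  | refl => exact ⟨0, fun _ => p, rfl, rfl, fun _ _ => hp, fun i hi => by omega⟩
  | @tail u v _ huv ih =>
    obtain ⟨k, f, h0, hk, hf, hs⟩ := ih
    refine ⟨k + 1, fun i => if i ≤ k then f i else v, by simp [h0], by simp, fun i hi => ?_, fun i hi => ?_⟩
    · dsimp only; split_ifs with h
      · exact hf i h
      · exact huv.1
    · rcases Nat.lt_succ_iff_lt_or_eq.1 hi with h | rfl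
      · simp only [h.le, if_true, Nat.succ_le_of_lt h]; exact hs i h
      · simp only [le_refl, if_true, Nat.not_succ_le_self, if_false, hk]; exact huv.2

/-- A compact set spanning a rectangle horizontally meets every closed set spanning it vertically. -/
lemma spanning_meet {a b c d : ℝ} {P Q K : Set Plane} (hP : IsCompact P) (hPc : IsPreconnected P) (hQ : IsClosed Q)
    (hKQ : K ⊆ Q) (hK : IsPreconnected K) (hPs : ∀ y ∈ P, c ≤ y 1 ∧ y 1 ≤ d) (hKs : ∀ y ∈ K, a ≤ y 0 ∧ y 0 ≤ b)
    (hl : ∃ y ∈ P, y 0 ≤ a) (hr : ∃ y ∈ P, b ≤ y 0) (hb : ∃ y ∈ K, y 1 = c) (ht : ∃ y ∈ K, y 1 = d) :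
    (P ∩ Q).Nonempty := by
  by_contra hne
  obtain ⟨r, hr0, hrd⟩ := Metric.exists_pos_forall_lt_edist hP hQ (disjoint_iff_inter_eq_empty.2 (not_nonempty_iff_eq_empty.1 hne))
  have hr0' : (0:ℝ) < r := hr0
  have hrd' : ∀ x ∈ P, ∀ y ∈ Q, (r:ℝ) < dist x y := fun x hx y hy => by
    have := hrd x hx y hy
    rw [edist_nndist] at this
    exact_mod_cast this
  obtain ⟨p, hp, hpa⟩ := hl
  obtain ⟨q, hq, hqb⟩ := hr
  obtain ⟨u, hu, huc⟩ := hb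
  obtain ⟨v, hv, hvd⟩ := ht
  obtain ⟨k, f, f0, fk, hf, hfs⟩ := exists_steps hPc hp hq (ε := (r:ℝ) / 4) (by positivity)
  obtain ⟨l, g, g0, gl, hg, hgs⟩ := exists_steps hK hu hv (ε := (r:ℝ) / 4) (by positivity)
  refine real_span (ε := (r:ℝ) / 4) (k := k) (l := l) (Ax := fun i => f i 0) (Ay := fun i => f i 1) (Bx := fun j => g j 0)
    (By := fun j => g j 1) (by positivity) (fun i hi => ⟨?_, ?_⟩) (fun i hi => ⟨?_, ?_⟩) (fun i hi j hj => ?_)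
    (fun j hj => ?_) (fun j hj => ?_) (fun i hi => ?_) (fun i hi => ?_)
  · exact (abs_coord_le_dist _ _ _).trans (hfs i hi)
  · exact (abs_coord_le_dist _ _ _).trans (hfs i hi)
  · exact (abs_coord_le_dist _ _ _).trans (hgs i hi)
  · exact (abs_coord_le_dist _ _ _).trans (hgs i hi)
  · by_contra! h
    linarith [hrd' _ (hf i hi) _ (hKQ (hg j hj)), dist_le_coord (f i) (g j)]
  · dsimp only; rw [f0]; exact hpa.trans (hKs _ (hg j hj)).1
  · dsimp only; rw [fk]; exact (hKs _ (hg j hj)).2.trans hqb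
  · dsimp only; rw [g0, huc]; exact (hPs _ (hf i hi)).1
  · dsimp only; rw [gl, hvd]; exact (hPs _ (hf i hi)).2

/-! ### Perturbing closed crossings of generic configurations -/

section perturb
variable {N : ℕ} {a b c d : ℝ} {x : Fin N → Pt}

/-- The points of a horizontal strip strictly nearer to the point `i` than to every red point. -/
def scell (c d : ℝ) (x : Fin N → Pt) (i : Fin N) : Set Plane :=
  {y | (c ≤ y 1 ∧ y 1 ≤ d) ∧ ∀ k, (x k).2 = false → dist y (x i).1 < dist y (x k).1}

/-- Coordinates are distinct, no three points are equidistant from a point of a horizontal side, and no four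
are equidistant from a point of the rectangle. -/
structure Generic (a b c d : ℝ) (x : Fin N → Pt) : Prop where
  coord : ∀ i j, i ≠ j → ∀ e, (x i).1 e ≠ (x j).1 e
  side : ∀ i j k, i ≠ j → i ≠ k → j ≠ k → ∀ y ∈ rect a b c d, y 1 = c ∨ y 1 = d →
    ¬ (dist y (x i).1 = dist y (x j).1 ∧ dist y (x i).1 = dist y (x k).1)
  inner : ∀ i j k l, i ≠ j → i ≠ k → i ≠ l → j ≠ k → j ≠ l → k ≠ l → ∀ y ∈ rect a b c d,
    ¬ (dist y (x i).1 = dist y (x j).1 ∧ dist y (x i).1 = dist y (x k).1 ∧ dist y (x i).1 = dist y (x l).1)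

lemma convex_scell (c d : ℝ) (x : Fin N → Pt) (i : Fin N) : Convex ℝ (scell c d x i) := by
  intro y hy z hz s t hs ht hst
  refine ⟨?_, fun k hk => convex_strictly_nearer _ _ (hy.2 k hk) (hz.2 k hk) hs ht hst⟩
  obtain ⟨⟨h1, h2⟩, -⟩ := hy
  obtain ⟨⟨h3, h4⟩, -⟩ := hz
  obtain rfl : t = 1 - s := by linarith
  constructor <;> simp <;> nlinarith

lemma eventually_nearer {y v p q : Plane} (h : dist y p ≤ dist y q)
    (hv : dist y p = dist y q → 0 < (p 0 - q 0) * v 0 + (p 1 - q 1) * v 1) :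
    ∀ᶠ t in nhdsWithin (0:ℝ) (Ioi 0), dist (y + t • v) p < dist (y + t • v) q := by
  rcases h.lt_or_eq with h | h
  · refine nhdsWithin_le_nhds (ContinuousAt.eventually_lt (by fun_prop) (by fun_prop) ?_)
    simpa using h
  · filter_upwards [self_mem_nhdsWithin] with t ht
    rw [dist_lt_dist_iff]
    have := mul_pos (show 0 < t from ht) (hv h)
    rw [dist_eq_dist_iff] at h
    simp only [PiLp.add_apply, PiLp.smul_apply, smul_eq_mul]
    nlinarith

lemma eventually_scell {i : Fin N} {y v : Plane} (hy : y ∈ vcell a b c d x i) (hs : v 1 = 0 ∨ c < y 1 ∧ y 1 < d)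
    (hv : ∀ k, (x k).2 = false → dist y (x i).1 = dist y (x k).1 →
      0 < ((x i).1 0 - (x k).1 0) * v 0 + ((x i).1 1 - (x k).1 1) * v 1) :
    ∀ᶠ t in nhdsWithin (0:ℝ) (Ioi 0), y + t • v ∈ scell c d x i := by
  have h1 : ∀ᶠ t in nhdsWithin (0:ℝ) (Ioi 0), c ≤ (y + t • v) 1 ∧ (y + t • v) 1 ≤ d := by
    rcases hs with h | h
    · refine Eventually.of_forall fun t => ?_
      simpa [h] using hy.1.2
    · have e1 : ∀ᶠ t in nhds (0:ℝ), c < (y + t • v) 1 :=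
        ContinuousAt.eventually_lt (by fun_prop) (by fun_prop) (by simpa using h.1)
      have e2 : ∀ᶠ t in nhds (0:ℝ), (y + t • v) 1 < d :=
        ContinuousAt.eventually_lt (by fun_prop) (by fun_prop) (by simpa using h.2)
      filter_upwards [nhdsWithin_le_nhds e1, nhdsWithin_le_nhds e2] with t h1 h2
      exact ⟨h1.le, h2.le⟩
  have h2 : ∀ᶠ t in nhdsWithin (0:ℝ) (Ioi 0), ∀ k, (x k).2 = false → dist (y + t • v) (x i).1 < dist (y + t • v) (x k).1 := by
    refine eventually_all.2 fun k => ?_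
    by_cases hk : (x k).2 = false
    · filter_upwards [eventually_nearer (hy.2 k hk) (hv k hk)] with t ht _ using ht
    · exact Eventually.of_forall fun t h => absurd h hk
  filter_upwards [h1, h2] with t h1 h2 using ⟨h1, h2⟩

/-- Moving towards `p` brings one nearer to `p` than to any other equidistant point. -/
lemma toward_pos {y p q : Plane} (h : dist y p = dist y q) (hpq : p 0 ≠ q 0) :
    0 < (p 0 - q 0) * (p - y) 0 + (p 1 - q 1) * (p - y) 1 := by
  rw [dist_eq_dist_iff] at h
  have := sq_pos_of_ne_zero (sub_ne_zero.2 hpq)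
  simp only [PiLp.sub_apply]
  nlinarith [sq_nonneg (p 1 - q 1)]

/-- Moving away from `q` brings one nearer to any other equidistant point than to `q`. -/
lemma away_pos {y p q : Plane} (h : dist y p = dist y q) (hpq : p 0 ≠ q 0) :
    0 < (p 0 - q 0) * (y - q) 0 + (p 1 - q 1) * (y - q) 1 := by
  rw [dist_eq_dist_iff] at h
  have := sq_pos_of_ne_zero (sub_ne_zero.2 hpq)
  simp only [PiLp.sub_apply]
  nlinarith [sq_nonneg (p 1 - q 1)]

lemma exists_direction (hg : Generic a b c d x) {i j : Fin N} (hi : (x i).2 = true) (hj : (x j).2 = true) {y : Plane}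
    (hyi : y ∈ vcell a b c d x i) (hyj : y ∈ vcell a b c d x j) (hij : dist y (x i).1 ≤ dist y (x j).1) :
    ∃ v : Plane, (v 1 = 0 ∨ c < y 1 ∧ y 1 < d) ∧
      (∀ k, (x k).2 = false → dist y (x i).1 = dist y (x k).1 →
        0 < ((x i).1 0 - (x k).1 0) * v 0 + ((x i).1 1 - (x k).1 1) * v 1) ∧
      ∀ k, (x k).2 = false → dist y (x j).1 = dist y (x k).1 →
        0 < ((x j).1 0 - (x k).1 0) * v 0 + ((x j).1 1 - (x k).1 1) * v 1 := by
  have hne : ∀ {i k}, (x i).2 = true → (x k).2 = false → i ≠ k := by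
    rintro i _ h1 h2 rfl; rw [h1] at h2; cases h2
  have hlt : dist y (x i).1 < dist y (x j).1 → ∀ k, (x k).2 = false → dist y (x i).1 ≠ dist y (x k).1 := fun h k hk =>
    (h.trans_le (hyj.2 k hk)).ne
  by_cases hside : y 1 = c ∨ y 1 = d
  · by_cases he : i ≠ j ∧ dist y (x i).1 = dist y (x j).1
    · refine ⟨0, Or.inl rfl, fun k hk h => ?_, fun k hk h => ?_⟩
      · exact (hg.side i j k he.1 (hne hi hk) (hne hj hk) y hyi.1 hside ⟨he.2, h⟩).elim
      · exact (hg.side i j k he.1 (hne hi hk) (hne hj hk) y hyi.1 hside ⟨he.2, he.2.trans h⟩).elim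
    · obtain ⟨v, hv1, hv⟩ : ∃ v : Plane, v 1 = 0 ∧ ∀ k, (x k).2 = false → dist y (x j).1 = dist y (x k).1 →
          0 < ((x j).1 0 - (x k).1 0) * v 0 + ((x j).1 1 - (x k).1 1) * v 1 := by
        by_cases hk : ∃ k, (x k).2 = false ∧ dist y (x j).1 = dist y (x k).1
        · obtain ⟨k, hk, hd⟩ := hk
          refine ⟨!₂[(x j).1 0 - (x k).1 0, 0], by simp, fun l hl hdl => ?_⟩
          obtain rfl : l = k := by
            by_contra hlk
            exact hg.side j k l (hne hj hk) (hne hj hl) (Ne.symm hlk) y hyi.1 hside ⟨hd, hdl⟩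
          have := sq_pos_of_ne_zero (sub_ne_zero.2 (hg.coord j l (hne hj hk) 0))
          simp only [PiLp.toLp_apply, Matrix.cons_val_zero, Matrix.cons_val_one, mul_zero, add_zero]
          nlinarith
        · exact ⟨0, rfl, fun k hk' h => (hk ⟨k, hk', h⟩).elim⟩
      refine ⟨v, Or.inl hv1, fun k hk h => ?_, hv⟩
      by_cases hij' : i = j
      · subst hij'; exact hv k hk h
      · exact (hlt (hij.lt_of_ne fun h => he ⟨hij', h⟩) k hk h).elim
  · have hin : c < y 1 ∧ y 1 < d := by
      push Not at hside
      exact ⟨lt_of_le_of_ne hyi.1.2.1 (Ne.symm hside.1), lt_of_le_of_ne hyi.1.2.2 hside.2⟩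
    by_cases he : i ≠ j ∧ dist y (x i).1 = dist y (x j).1
    · by_cases hk : ∃ k, (x k).2 = false ∧ dist y (x j).1 = dist y (x k).1
      · obtain ⟨k, hk, hd⟩ := hk
        have key : ∀ l, (x l).2 = false → dist y (x j).1 = dist y (x l).1 → l = k := fun l hl hdl => by
          by_contra hlk
          exact hg.inner i j k l he.1 (hne hi hk) (hne hi hl) (hne hj hk) (hne hj hl) (Ne.symm hlk) y hyi.1
            ⟨he.2, he.2.trans hd, he.2.trans hdl⟩
        refine ⟨y - (x k).1, Or.inr hin, fun l hl h => ?_, fun l hl h => ?_⟩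
        · obtain rfl := key l hl (he.2.symm.trans h)
          exact away_pos h (hg.coord _ _ (hne hi hl) 0)
        · obtain rfl := key l hl h
          exact away_pos h (hg.coord _ _ (hne hj hl) 0)
      · exact ⟨0, Or.inl rfl, fun k hk' h => (hk ⟨k, hk', he.2.symm.trans h⟩).elim, fun k hk' h => (hk ⟨k, hk', h⟩).elim⟩
    · refine ⟨(x j).1 - y, Or.inr hin, fun k hk h => ?_, fun k hk h => toward_pos h (hg.coord _ _ (hne hj hk) 0)⟩
      by_cases hij' : i = j
      · subst hij'; exact toward_pos h (hg.coord _ _ (hne hi hk) 0)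
      · exact (hlt (hij.lt_of_ne fun h => he ⟨hij', h⟩) k hk h).elim

lemma eventually_scell_inter (hg : Generic a b c d x) {i j : Fin N} (hi : (x i).2 = true) (hj : (x j).2 = true) {y : Plane}
    (hyi : y ∈ vcell a b c d x i) (hyj : y ∈ vcell a b c d x j) :
    ∃ v : Plane, ∀ᶠ t in nhdsWithin (0:ℝ) (Ioi 0), y + t • v ∈ scell c d x i ∩ scell c d x j := by
  rcases le_total (dist y (x i).1) (dist y (x j).1) with h | h
  · obtain ⟨v, h1, h2, h3⟩ := exists_direction hg hi hj hyi hyj h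
    exact ⟨v, (eventually_scell hyi h1 h2).and (eventually_scell hyj h1 h3)⟩
  · obtain ⟨v, h1, h2, h3⟩ := exists_direction hg hj hi hyj hyi h
    exact ⟨v, (eventually_scell hyi h1 h3).and (eventually_scell hyj h1 h2)⟩

/-- The region of a strip strictly nearer to some blue point than to all red points. -/
def strictBlue (c d : ℝ) (x : Fin N → Pt) : Set Plane := {y | ∃ i, (x i).2 = true ∧ y ∈ scell c d x i}

lemma joinedIn_scell {i : Fin N} (hi : (x i).2 = true) {p q : Plane} (hp : p ∈ scell c d x i) (hq : q ∈ scell c d x i) :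
    JoinedIn (strictBlue c d x) p q :=
  ((convex_scell c d x i).isPathConnected ⟨p, hp⟩ |>.joinedIn p hp q hq).mono fun _ hy => ⟨i, hi, hy⟩

/-- A closed crossing of a generic configuration yields a strictly blue path, slightly displaced. -/
lemma exists_strict_path (hg : Generic a b c d x) (hab : a ≤ b) (h : Crossing a b c d (cfgOf x)) {a' b' : ℝ}
    (ha : a < a') (hb : b' < b) : ∃ p q : Plane, p 0 ≤ a' ∧ b' ≤ q 0 ∧ JoinedIn (strictBlue c d x) p q := by
  obtain ⟨i, j, hi, hj, hij⟩ := (crossing_iff_chain hab).1 h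
  obtain ⟨hib, -, y, hy, -⟩ := meet_zero.1 hi
  obtain ⟨hjb, -, z, hz, -⟩ := meet_zero.1 hj
  have hy' : y ∈ vcell a b c d x i := ⟨⟨⟨hy.1.1.1, hy.1.1.2.trans hab⟩, hy.1.2⟩, hy.2⟩
  have hz' : z ∈ vcell a b c d x j := ⟨⟨⟨hab.trans hz.1.1.1, hz.1.1.2⟩, hz.1.2⟩, hz.2⟩
  obtain ⟨p, hpa, hp⟩ : ∃ p : Plane, p 0 ≤ a' ∧ p ∈ scell c d x i := by
    obtain ⟨v, hv⟩ := eventually_scell_inter hg hib hib hy' hy'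
    have e : ∀ᶠ t in nhds (0:ℝ), (y + t • v) 0 < a' :=
      ContinuousAt.eventually_lt (by fun_prop) (by fun_prop) (by simpa using hy.1.1.2.trans_lt ha)
    obtain ⟨t, h1, h2⟩ := (hv.and (nhdsWithin_le_nhds e)).exists
    exact ⟨_, h2.le, h1.1⟩
  obtain ⟨q, hqb, hq⟩ : ∃ q : Plane, b' ≤ q 0 ∧ q ∈ scell c d x j := by
    obtain ⟨v, hv⟩ := eventually_scell_inter hg hjb hjb hz' hz'
    have e : ∀ᶠ t in nhds (0:ℝ), b' < (z + t • v) 0 :=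
      ContinuousAt.eventually_lt (by fun_prop) (by fun_prop) (by simpa using hb.trans_le hz.1.1.1)
    obtain ⟨t, h1, h2⟩ := (hv.and (nhdsWithin_le_nhds e)).exists
    exact ⟨_, h2.le, h1.1⟩
  have key : ∀ q ∈ scell c d x j, JoinedIn (strictBlue c d x) p q := by
    clear hz hz' hq hj hjb
    induction hij with
    | refl => exact fun q hq => joinedIn_scell hib hp hq
    | @tail j k _ hjk ih =>
      obtain ⟨hjb, hkb, w, hwj, hwk⟩ := meet_zero.1 hjk
      obtain ⟨v, hv⟩ := eventually_scell_inter hg hjb hkb hwj hwk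
      obtain ⟨t, ht⟩ := hv.exists
      exact fun q hq => (ih _ ht.1).trans (joinedIn_scell hkb ht.2 hq)
  exact ⟨p, q, hpa, hqb, key q hq⟩

/-- Exchange the coordinates and the colours. -/
def flipPt (q : Pt) : Pt := (!₂[q.1 1, q.1 0], !q.2)

lemma dist_swap (y p : Plane) : dist (!₂[y 1, y 0] : Plane) !₂[p 1, p 0] = dist y p := by
  simp only [EuclideanSpace.dist_eq, Fin.sum_univ_two, PiLp.toLp_apply, Matrix.cons_val_zero, Matrix.cons_val_one]
  rw [add_comm]

/-- Generic configurations have no blue horizontal crossing of a rectangle along with a red vertical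
crossing of a narrower one. -/
lemma not_both (hg : Generic a b c d x) {a' b' : ℝ} (ha : a < a') (hab : a' ≤ b') (hb : b' < b)
    (h : Crossing a b c d (cfgOf x)) : ¬ Crossing c d a' b' (cfgOf fun i => flipPt (x i)) := by
  rintro ⟨K, hK, hc, ⟨u, hu, huc⟩, v, hv, hvd⟩
  obtain ⟨p, q, hpa, hqb, γ, hγ⟩ := exists_strict_path hg (by linarith) h ha hb
  set Q : Set Plane := ⋃ i ∈ {i | (flipPt (x i)).2 = true}, vcell c d a' b' (fun i => flipPt (x i)) i with hQ
  have hQc : IsClosed Q := (Set.toFinite _).isClosed_biUnion fun j _ => isClosed_vcell _ _ _ _ _ _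
  have hKQ : K ⊆ Q := fun y hy => by
    obtain ⟨i, hi, hyi⟩ := blue_iff.1 (hK hy)
    exact mem_biUnion (show i ∈ {i | _} from hi) hyi
  have hsw : Continuous fun y : Plane => (!₂[y 1, y 0] : Plane) := by fun_prop
  obtain ⟨w, ⟨t, rfl⟩, hw⟩ := spanning_meet (a := a') (b := b') (c := c) (d := d) (P := range γ)
    (Q := (fun y : Plane => (!₂[y 1, y 0] : Plane)) ⁻¹' Q) (K := (fun y : Plane => (!₂[y 1, y 0] : Plane)) '' K)
    (isCompact_range γ.continuous) (isPreconnected_range γ.continuous) (hQc.preimage hsw)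
    (by
      rintro _ ⟨y, hy, rfl⟩
      rw [mem_preimage]
      convert! hKQ hy using 1
      ext e; fin_cases e <;> simp) (hc.isPreconnected.image _ hsw.continuousOn)
    (by rintro _ ⟨t, rfl⟩; obtain ⟨i, -, h, -⟩ := hγ t; exact h)
    (by rintro _ ⟨y, hy, rfl⟩; simpa using (hK hy).1.2)
    ⟨p, ⟨0, γ.source⟩, hpa⟩ ⟨q, ⟨1, γ.target⟩, hqb⟩ ⟨_, ⟨u, hu, rfl⟩, by simpa using huc⟩ ⟨_, ⟨v, hv, rfl⟩, by simpa using hvd⟩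
  obtain ⟨i, hi, -, hs⟩ := hγ t
  simp only [hQ, mem_preimage, mem_iUnion, exists_prop] at hw
  obtain ⟨k, hk, -, hw⟩ := hw
  have h1 := hs k (by simpa [flipPt] using hk)
  have h2 := hw i (by simpa [flipPt] using hi)
  simp only [flipPt, dist_swap] at h2
  linarith

end perturb

/-! ### Almost sure genericity -/

section generic
variable {p : ℝ} (h0 : 0 ≤ p) (h1 : p ≤ 1) {N : ℕ}
include h0 h1

lemma pi_null {B : Set (Fin N → Pt)} (hB : MeasurableSet B) (i : Fin N)
    (h : ∀ x, ptLaw p {q | Function.update x i q ∈ B} = 0) : Measure.pi (fun _ : Fin N => ptLaw p) B = 0 := by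
  have := ptLaw_prob h0 h1
  rw [← lintegral_indicator_one hB]
  rw [lintegral_eq_of_lmarginal_eq (μ := fun _ : Fin N => ptLaw p) {i} (f := B.indicator 1) (g := fun _ => 0)
    (measurable_one.indicator hB) measurable_const, lintegral_zero]
  rw [lmarginal_singleton, lmarginal_singleton]
  ext x
  simp only [lintegral_zero]
  rw [← h x, ← lintegral_indicator_one (show MeasurableSet {q | Function.update x i q ∈ B} from
    hB.preimage (measurable_update x))]
  rfl

lemma ae_coord_ne {i j : Fin N} (hij : i ≠ j) (e : Fin 2) :
    ∀ᵐ x : Fin N → Pt ∂Measure.pi fun _ => ptLaw p, (x i).1 e ≠ (x j).1 e := by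
  rw [ae_iff]
  simp only [ne_eq, not_not]
  refine pi_null h0 h1 (isClosed_eq (by fun_prop) (by fun_prop)).measurableSet i fun x => ?_
  convert! ptLaw_prod_univ p (volume_coord_eq e ((x j).1 e)) using 2
  ext q
  simp [Function.update_of_ne hij.symm]

/-- The point `i` does not lie on a circle determined by the other points. -/
lemma ae_not_on_circle {C : Set Plane} (hC : IsCompact C) {P : (Fin N → Pt) → Plane → Prop}
    (hP : IsClosed {q : (Fin N → Pt) × Plane | P q.1 q.2}) {D : Set (Fin N → Pt)} (hD : MeasurableSet D) {i j : Fin N} (hij : i ≠ j)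
    (hPi : ∀ x q y, P (Function.update x i q) y ↔ P x y) (hDi : ∀ x q, Function.update x i q ∈ D ↔ x ∈ D)
    (hu : ∀ x ∈ D, ∀ y ∈ C, ∀ z ∈ C, P x y → P x z → y = z) :
    ∀ᵐ x : Fin N → Pt ∂Measure.pi fun _ => ptLaw p, x ∈ D → ∀ y ∈ C, P x y → dist y (x i).1 ≠ dist y (x j).1 := by
  rw [ae_iff]
  have hm : MeasurableSet {x : Fin N → Pt | ∃ y ∈ C, P x y ∧ dist y (x i).1 = dist y (x j).1} :=
    (isClosed_exists_compact hC (P := fun x y => P x y ∧ dist y (x i).1 = dist y (x j).1)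
      (hP.inter (isClosed_eq (by fun_prop) (by fun_prop)))).measurableSet
  convert! pi_null h0 h1 (hD.inter hm) i fun x => ?_ using 2
  · ext x
    simp only [mem_ofPred_eq, mem_inter_iff]
    push Not
    rfl
  by_cases hx : x ∈ D ∧ ∃ y ∈ C, P x y
  · obtain ⟨hxD, y, hy, hPy⟩ := hx
    refine measure_mono_null (fun q hq => ?_)
      (ptLaw_prod_univ p (Measure.addHaar_sphere volume y (dist y (x j).1)))
    obtain ⟨-, z, hz, hPz, hd⟩ := hq
    obtain rfl := hu x hxD y hy z hz hPy ((hPi _ _ _).1 hPz)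
    rw [Function.update_self, Function.update_of_ne hij.symm] at hd
    exact ⟨by rw [Metric.mem_sphere, dist_comm]; exact hd, mem_univ _⟩
  · convert! measure_empty (μ := ptLaw p) using 2
    refine eq_empty_of_forall_notMem fun q hq => hx ?_
    obtain ⟨hqD, z, hz, hPz, -⟩ := hq
    exact ⟨(hDi _ _).1 hqD, z, hz, (hPi _ _ _).1 hPz⟩

omit h0 h1 in
/-- Two points with distinct abscissas are equidistant from one point of a horizontal line only. -/
lemma eq_of_equidistant_side {p q y z : Plane} (hpq : p 0 ≠ q 0) (hyz : y 1 = z 1) (hy : dist y p = dist y q)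
    (hz : dist z p = dist z q) : y = z := by
  rw [dist_eq_dist_iff] at hy hz
  have : (p 0 - q 0) * (y 0 - z 0) = 0 := by rw [hyz] at hy; linarith
  ext e
  fin_cases e
  · exact sub_eq_zero.1 ((mul_eq_zero.1 this).resolve_left (sub_ne_zero.2 hpq))
  · exact hyz

omit h0 h1 in
/-- Three points with distinct coordinates are equidistant from one point only. -/
lemma eq_of_equidistant {p q r y z : Plane} (hpq : ∀ e, p e ≠ q e) (hqr : ∀ e, q e ≠ r e) (hpr : ∀ e, p e ≠ r e)
    (hy : dist y p = dist y q) (hy' : dist y p = dist y r) (hz : dist z p = dist z q) (hz' : dist z p = dist z r) : y = z := by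
  rw [dist_eq_dist_iff] at hy hy' hz hz'
  have e1 : (p 0 - q 0) * (y 0 - z 0) + (p 1 - q 1) * (y 1 - z 1) = 0 := by linarith
  have e2 : (q 0 - r 0) * (y 0 - z 0) + (q 1 - r 1) * (y 1 - z 1) = 0 := by linarith
  by_contra hne
  have hw : y 0 - z 0 ≠ 0 := fun h => hne (by
    rw [h, mul_zero, zero_add] at e1
    ext e
    fin_cases e
    · exact sub_eq_zero.1 h
    · exact sub_eq_zero.1 ((mul_eq_zero.1 e1).resolve_left (sub_ne_zero.2 (hpq 1))))
  set κ := (y 1 - z 1) / (y 0 - z 0) with hκ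
  have hκ' : y 1 - z 1 = κ * (y 0 - z 0) := by rw [hκ]; field_simp
  have f1 : p 0 - q 0 = -κ * (p 1 - q 1) := mul_right_cancel₀ hw (by rw [hκ'] at e1; linarith)
  have f2 : q 0 - r 0 = -κ * (q 1 - r 1) := mul_right_cancel₀ hw (by rw [hκ'] at e2; linarith)
  have g1 : -κ * (2 * y 0 - p 0 - q 0) + (2 * y 1 - p 1 - q 1) = 0 :=
    mul_left_cancel₀ (sub_ne_zero.2 (hpq 1)) (by linear_combination (-(2 * y 0 - p 0 - q 0)) * f1 - hy)
  have g2 : -κ * (2 * y 0 - q 0 - r 0) + (2 * y 1 - q 1 - r 1) = 0 :=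
    mul_left_cancel₀ (sub_ne_zero.2 (hqr 1)) (by linear_combination (-(2 * y 0 - q 0 - r 0)) * f2 - (hy' - hy))
  have g3 : (κ ^ 2 + 1) * (p 1 - r 1) = 0 := by
    have : p 0 - r 0 = -κ * (p 1 - r 1) := by linear_combination f1 + f2
    linear_combination κ * this - (g1 - g2)
  have g4 : p 1 - r 1 = 0 := (mul_eq_zero.1 g3).resolve_left (by positivity)
  exact hpr 1 (sub_eq_zero.1 g4)

lemma ae_generic (a b c d : ℝ) : ∀ᵐ x : Fin N → Pt ∂Measure.pi fun _ => ptLaw p, Generic a b c d x := by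
  have hc : ∀ᵐ x : Fin N → Pt ∂Measure.pi fun _ => ptLaw p, ∀ i j, i ≠ j → ∀ e, (x i).1 e ≠ (x j).1 e :=
    eventually_all.2 fun i => eventually_all.2 fun j => eventually_imp_distrib_left.2 fun hij =>
      eventually_all.2 fun e => ae_coord_ne h0 h1 hij e
  have hs : ∀ s, ∀ᵐ x : Fin N → Pt ∂Measure.pi fun _ => ptLaw p, ∀ i j k, i ≠ j → i ≠ k → j ≠ k →
      (x j).1 0 ≠ (x k).1 0 → ∀ y ∈ rect a b c d ∩ {y | y 1 = s}, dist y (x j).1 = dist y (x k).1 →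
        dist y (x i).1 ≠ dist y (x j).1 := fun s => by
    refine eventually_all.2 fun i => eventually_all.2 fun j => eventually_all.2 fun k =>
      eventually_imp_distrib_left.2 fun hij => eventually_imp_distrib_left.2 fun hik => eventually_imp_distrib_left.2 fun hjk => ?_
    refine ae_not_on_circle h0 h1 ((isCompact_rect a b c d).inter_right (isClosed_eq (by fun_prop) (by fun_prop)))
      (P := fun x y => dist y (x j).1 = dist y (x k).1) (isClosed_eq (by fun_prop) (by fun_prop))
      (D := {x | (x j).1 0 ≠ (x k).1 0}) (isOpen_ne_fun (by fun_prop) (by fun_prop)).measurableSet hij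
      (fun x q y => ?_) (fun x q => ?_) (fun x hx y hy z hz h h' => eq_of_equidistant_side hx (hy.2.trans hz.2.symm) h h')
    · simp only [Function.update_of_ne hij.symm, Function.update_of_ne hik.symm]
    · simp only [mem_ofPred_eq, Function.update_of_ne hij.symm, Function.update_of_ne hik.symm]
  have hi : ∀ᵐ x : Fin N → Pt ∂Measure.pi fun _ => ptLaw p, ∀ i j k l, i ≠ j → i ≠ k → i ≠ l → 
      x ∈ {x : Fin N → Pt | (∀ e, (x j).1 e ≠ (x k).1 e) ∧ (∀ e, (x k).1 e ≠ (x l).1 e) ∧ ∀ e, (x j).1 e ≠ (x l).1 e} →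
        ∀ y ∈ rect a b c d, dist y (x j).1 = dist y (x k).1 ∧ dist y (x j).1 = dist y (x l).1 →
          dist y (x i).1 ≠ dist y (x j).1 := by
    refine eventually_all.2 fun i => eventually_all.2 fun j => eventually_all.2 fun k => eventually_all.2 fun l =>
      eventually_imp_distrib_left.2 fun hij => eventually_imp_distrib_left.2 fun hik => eventually_imp_distrib_left.2 fun hil => ?_
    have ho : ∀ j k : Fin N, IsOpen {x : Fin N → Pt | ∀ e, (x j).1 e ≠ (x k).1 e} := fun j k => by
      simp only [ofPred_forall]
      exact isOpen_iInter_of_finite fun e => isOpen_ne_fun (by fun_prop) (by fun_prop)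
    refine ae_not_on_circle h0 h1 (isCompact_rect a b c d)
      (P := fun x y => dist y (x j).1 = dist y (x k).1 ∧ dist y (x j).1 = dist y (x l).1)
      ((isClosed_eq (by fun_prop) (by fun_prop)).inter (isClosed_eq (by fun_prop) (by fun_prop)))
      ((ho j k).inter ((ho k l).inter (ho j l))).measurableSet hij
      (fun x q y => ?_) (fun x q => ?_) (fun x hx y hy z hz h h' => eq_of_equidistant hx.1 hx.2.1 hx.2.2 h.1 h.2 h'.1 h'.2)
    · simp only [Function.update_of_ne hij.symm, Function.update_of_ne hik.symm, Function.update_of_ne hil.symm]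
    · simp only [mem_inter_iff, mem_ofPred_eq, Function.update_of_ne hij.symm, Function.update_of_ne hik.symm, Function.update_of_ne hil.symm]
  filter_upwards [hc, hs c, hs d, hi] with x hc hsc hsd hi
  refine ⟨hc, fun i j k hij hik hjk y hy hside h => ?_, fun i j k l hij hik hil hjk hjl hkl y hy h => ?_⟩
  · rcases hside with hs | hs
    · exact hsc i j k hij hik hjk (hc j k hjk 0) y ⟨hy, hs⟩ (h.1.symm.trans h.2) h.1
    · exact hsd i j k hij hik hjk (hc j k hjk 0) y ⟨hy, hs⟩ (h.1.symm.trans h.2) h.1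
  · exact hi i j k l hij hik hil ⟨hc j k hjk, hc k l hkl, hc j l hjl⟩ y hy ⟨h.1.symm.trans h.2.1, h.1.symm.trans h.2.2⟩ h.1

end generic

/-! ### Colour symmetry and the threshold -/

lemma measurePreserving_flipPt (p : ℝ) (h0 : 0 ≤ p) (h1 : p ≤ 1) : MeasurePreserving flipPt (ptLaw p) (ptLaw (1 - p)) := by
  have := markLaw_prob h0 h1
  have := markLaw_prob (p := 1 - p) (by linarith) (by linarith)
  have e : MeasurePreserving (fun y : Plane => (!₂[y 1, y 0] : Plane)) volume volume := by
    convert! (LinearIsometryEquiv.piLpCongrLeft 2 ℝ ℝ (Equiv.swap (0 : Fin 2) 1)).measurePreserving using 1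
    ext y e
    fin_cases e <;> simp [LinearIsometryEquiv.piLpCongrLeft_apply, Equiv.piCongrLeft'_apply]
  have e1 := e.restrict_preimage isClosed_Sq.measurableSet
  have e2 : (fun y : Plane => (!₂[y 1, y 0] : Plane)) ⁻¹' Sq = Sq := by
    ext y; simp [Sq, and_comm]
  rw [e2] at e1
  have e3 : MeasurePreserving (fun b : Bool => !b) (markLaw p) (markLaw (1 - p)) := by
    refine ⟨measurable_of_finite _, ?_⟩
    rw [markLaw, markLaw, Measure.map_add _ _ (measurable_of_finite _), Measure.map_smul, Measure.map_smul,
      Measure.map_dirac' (measurable_of_finite _), Measure.map_dirac' (measurable_of_finite _), add_comm]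
    simp
  exact e1.prod e3

section upper
variable {n p : ℝ} (hn : 0 ≤ n) (h0 : 0 ≤ p) (h1 : p ≤ 1)
include h0 h1

lemma integrable_fR {a b c d : ℝ} (hab : a ≤ b) (N : ℕ) :
    Integrable (fun x : Fin N → Pt => fR a b c d (cfgOf x)) (Measure.pi fun _ => ptLaw p) := by
  have := ptLaw_prob h0 h1
  refine Integrable.of_bound (measurable_fR hab).aestronglyMeasurable 1 (Eventually.of_forall fun x => ?_)
  rw [Real.norm_eq_abs, abs_of_nonneg (fR_mem _ _ _ _ _).1]
  exact (fR_mem _ _ _ _ _).2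

lemma integral_fR_mem {a b c d : ℝ} (hab : a ≤ b) (N : ℕ) :
    0 ≤ ∫ x : Fin N → Pt, fR a b c d (cfgOf x) ∂(Measure.pi fun _ => ptLaw p) ∧
      ∫ x : Fin N → Pt, fR a b c d (cfgOf x) ∂(Measure.pi fun _ => ptLaw p) ≤ 1 := by
  have := ptLaw_prob h0 h1
  refine ⟨integral_nonneg fun x => (fR_mem _ _ _ _ _).1, ?_⟩
  refine (integral_mono (integrable_fR h0 h1 hab N) (integrable_const 1) fun x => (fR_mem _ _ _ _ _).2).trans ?_
  simp

/-- A horizontal crossing is at most as likely as the absence of a vertical crossing of a narrower rectangle in the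
opposite colour. -/
lemma integral_fR_add_le {a b c d a' b' : ℝ} (ha : a < a') (hab : a' ≤ b') (hb : b' < b) (hcd : c ≤ d) (N : ℕ) :
    ∫ x : Fin N → Pt, fR a b c d (cfgOf x) ∂(Measure.pi fun _ => ptLaw (1 - p)) +
      ∫ x : Fin N → Pt, fR c d a' b' (cfgOf x) ∂(Measure.pi fun _ => ptLaw p) ≤ 1 := by
  have h0' : 0 ≤ 1 - p := by linarith
  have h1' : 1 - p ≤ 1 := by linarith
  have := ptLaw_prob h0 h1
  have := ptLaw_prob h0' h1'
  have hab' : a ≤ b := by linarith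
  have hmp : MeasurePreserving (fun (x : Fin N → Pt) i => flipPt (x i)) (Measure.pi fun _ => ptLaw (1 - p))
      (Measure.pi fun _ => ptLaw p) := by
    refine measurePreserving_pi _ _ fun i => ?_
    have := measurePreserving_flipPt (1 - p) h0' h1'
    rwa [sub_sub_cancel] at this
  have hi : Integrable (fun x : Fin N → Pt => fR c d a' b' (cfgOf fun i => flipPt (x i)))
      (Measure.pi fun _ => ptLaw (1 - p)) := hmp.integrable_comp_of_integrable (integrable_fR h0 h1 hcd N)
  have e : ∫ x : Fin N → Pt, fR c d a' b' (cfgOf x) ∂(Measure.pi fun _ => ptLaw p) =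
      ∫ x : Fin N → Pt, fR c d a' b' (cfgOf fun i => flipPt (x i)) ∂(Measure.pi fun _ => ptLaw (1 - p)) := by
    rw [← hmp.map_eq]
    exact integral_map hmp.aemeasurable (measurable_fR hcd).aestronglyMeasurable
  rw [e, ← integral_add (integrable_fR h0' h1' hab' N) hi]
  refine (integral_mono_ae ((integrable_fR h0' h1' hab' N).add hi) (integrable_const 1) ?_).trans (by simp)
  filter_upwards [ae_generic h0' h1' a b c d] with x hx
  by_cases hC : Crossing a b c d (cfgOf x)
  · have e : fR c d a' b' (cfgOf fun i => flipPt (x i)) = 0 := if_neg (not_both hx ha hab hb hC)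
    dsimp only [Pi.add_apply]
    rw [e, add_zero]
    exact (fR_mem _ _ _ _ _).2
  · have e : fR a b c d (cfgOf x) = 0 := if_neg hC
    dsimp only [Pi.add_apply]
    rw [e, zero_add]
    exact (fR_mem _ _ _ _ _).2

include hn

lemma summable_PE {a b c d : ℝ} (hab : a ≤ b) :
    Summable fun N => pois n N * ∫ x : Fin N → Pt, fR a b c d (cfgOf x) ∂(Measure.pi fun _ => ptLaw p) :=
  Summable.of_nonneg_of_le (fun N => mul_nonneg (pois_nonneg hn N) (integral_fR_mem h0 h1 hab N).1)
    (fun N => mul_le_of_le_one_right (pois_nonneg hn N) (integral_fR_mem h0 h1 hab N).2) (pois_hasSum n).summable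

lemma PE_nonneg {a b c d : ℝ} (hab : a ≤ b) : 0 ≤ PE n p (fR a b c d) :=
  tsum_nonneg fun N => mul_nonneg (pois_nonneg hn N) (integral_fR_mem h0 h1 hab N).1

lemma PE_le_one {a b c d : ℝ} (hab : a ≤ b) : PE n p (fR a b c d) ≤ 1 := by
  rw [← (pois_hasSum n).tsum_eq]
  exact Summable.tsum_le_tsum (fun N => mul_le_of_le_one_right (pois_nonneg hn N) (integral_fR_mem h0 h1 hab N).2)
    (summable_PE hn h0 h1 hab) (pois_hasSum n).summable

lemma PE_add_le {a b c d a' b' : ℝ} (ha : a < a') (hab : a' ≤ b') (hb : b' < b) (hcd : c ≤ d) :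
    PE n (1 - p) (fR a b c d) + PE n p (fR c d a' b') ≤ 1 := by
  have h0' : 0 ≤ 1 - p := by linarith
  have h1' : 1 - p ≤ 1 := by linarith
  have hs1 := summable_PE hn h0' h1' (a := a) (b := b) (c := c) (d := d) (by linarith)
  have hs2 := summable_PE hn h0 h1 (c := a') (d := b') hcd
  refine (hs1.tsum_add hs2).symm.trans_le ((Summable.tsum_le_tsum (fun N => ?_) (hs1.add hs2)
    (pois_hasSum n).summable).trans_eq (pois_hasSum n).tsum_eq)
  rw [← mul_add]
  exact mul_le_of_le_one_right (pois_nonneg hn N) (integral_fR_add_le h0 h1 ha hab hb hcd N)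

end upper

end VP

/-- **Theorem 2.** The threshold window of the crossing event around `p = 1/2` has polynomial
width: for some `γ > 0`, the crossing probability tends to `0` at `p = 1/2 - n^{-γ}` and to `1`
at `p = 1/2 + n^{-γ}`. -/
theorem voronoi_polynomial_threshold_window
    (a b c d : ℝ) (ha : 0 ≤ a) (hab : a < b) (hb : b ≤ 1)
    (hc : 0 ≤ c) (hcd : c < d) (hd : d ≤ 1) :
    ∃ γ : ℝ, 0 < γ ∧
      Tendsto (fun n : ℕ => PE n (1/2 - (n : ℝ) ^ (-γ)) (fR a b c d)) atTop (nhds 0) ∧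
      Tendsto (fun n : ℕ => PE n (1/2 + (n : ℝ) ^ (-γ)) (fR a b c d)) atTop (nhds 1) := by
  obtain ⟨γ, hγ, h⟩ := VP.discrete_main
  obtain ⟨ε, hε, hε'⟩ := h a b c d ha hab hb hc hcd hd
  obtain ⟨ε₂, hε₂, hε₂'⟩ := h c d ((2 * a + b) / 3) ((a + 2 * b) / 3) hc hcd hd (by linarith) (by linarith) (by linarith)
  have hpos : ∀ n : ℕ, 0 ≤ (n : ℝ) ^ (-γ) := fun n => by positivity
  refine ⟨γ, hγ, ?_, ?_⟩
  · refine tendsto_of_tendsto_of_tendsto_of_le_of_le' tendsto_const_nhds hε₂ ?_ ?_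
    · filter_upwards [hε₂'] with n hn
      have := hpos n
      exact VP.PE_nonneg n.cast_nonneg (by linarith [hn.1]) (by linarith) hab.le
    · filter_upwards [hε₂'] with n hn
      have := hpos n
      have h1 := VP.PE_ge (p := 1/2 + (n : ℝ) ^ (-γ)) (by linarith) (by linarith [hn.1]) hc hcd hd (by linarith) (by linarith)
        (by linarith) n.cast_nonneg hn.2
      have h2 := VP.PE_add_le (n := n) (p := 1/2 + (n : ℝ) ^ (-γ)) (a := a) (b := b) (c := c) (d := d) (a' := (2 * a + b) / 3)
        (b' := (a + 2 * b) / 3) n.cast_nonneg (by linarith) (by linarith [hn.1]) (by linarith) (by linarith) (by linarith) hcd.le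
      rw [show 1 - (1/2 + (n : ℝ) ^ (-γ)) = 1/2 - (n : ℝ) ^ (-γ) by ring] at h2
      linarith
  · refine tendsto_of_tendsto_of_tendsto_of_le_of_le' (by simpa using hε.const_sub 1) tendsto_const_nhds ?_ ?_
    · filter_upwards [hε'] with n hn
      have := hpos n
      exact VP.PE_ge (by linarith) (by linarith [hn.1]) ha hab hb hc hcd hd n.cast_nonneg hn.2
    · filter_upwards [hε'] with n hn
      have := hpos n
      exact VP.PE_le_one n.cast_nonneg (by linarith) (by linarith [hn.1]) hab.le
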